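/- For every cubic form F in five variables over ℂ defining a smooth cubic threefold V = V(F) ⊂ ℙ⁴, there exist a line l on V, two distinct 2-planes π₁ ≠ π₂ of ℙ⁴ containing l, and two distinct lines r₁ ≠ r₂ on V with rᵢ contained in πᵢ, such that V·π₁ = l + 2r₁ and V·π₂ = l + 2r₂. In other words, every smooth cubic threefold admits a configuration consisting of a line l together with two distinct residual double lines. -/

import Mathlib

noncomputable section
open MvPolynomial

/-- `F` defines a smooth cubic threefold: the only common zero of the five partial
derivatives of `F` is the origin. -/
def IsSmoothCubic (F : MvPolynomial (Fin 5) ℂ) : Prop :=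
  ∀ p : Fin 5 → ℂ, (∀ i : Fin 5, eval p (pderiv i F) = 0) → p = 0

/-- A line of `ℙ⁴`: a 2-dimensional linear subspace of `ℂ⁵`. -/
def IsLine (W : Submodule ℂ (Fin 5 → ℂ)) : Prop := Module.finrank ℂ W = 2

/-- A 2-plane of `ℙ⁴`: a 3-dimensional linear subspace of `ℂ⁵`. -/
def IsPlane (W : Submodule ℂ (Fin 5 → ℂ)) : Prop := Module.finrank ℂ W = 3

/-- The linear subspace `W` lies on the hypersurface defined by `F`. -/
def LiesOn (F : MvPolynomial (Fin 5) ℂ) (W : Submodule ℂ (Fin 5 → ℂ)) : Prop :=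
  ∀ p ∈ W, eval p F = 0

/-- The intersection cycle `V(F)·Pl` equals `l + 2r`: the restriction of `F` to the
2-plane `Pl` factors as `c·ℓ·ρ²` where `ℓ`, `ρ` are linear forms, nonzero on `Pl`,
whose kernels cut `l` and `r` respectively out of `Pl`. -/
def CycleLplus2R (F : MvPolynomial (Fin 5) ℂ) (l r Pl : Submodule ℂ (Fin 5 → ℂ)) : Prop :=
  IsLine l ∧ IsLine r ∧ IsPlane Pl ∧ l ≤ Pl ∧ r ≤ Pl ∧ r ≠ l ∧
  ∃ (c : ℂ) (L R : (Fin 5 → ℂ) →ₗ[ℂ] ℂ), c ≠ 0 ∧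
    (∃ p ∈ Pl, L p ≠ 0) ∧ (∃ p ∈ Pl, R p ≠ 0) ∧
    Pl ⊓ LinearMap.ker L = l ∧ Pl ⊓ LinearMap.ker R = r ∧
    ∀ p ∈ Pl, eval p F = c * L p * (R p) ^ 2

end

set_option linter.all false
set_option maxHeartbeats 4000000

local notation "algMap" => algebraMap
local notation "LinIndep" => LinearIndependent
local notation "PolyC" => Polynomial.C
local notation "PolyX" => Polynomial.X
local notation "Vec" R:max => Fin 5 → R

/-! ### Transfer, Krull -/
section Transfer

theorem exists_specialization {k K : Type} [Field k] [IsAlgClosed k] [Field K] [Algebra k K]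
    (s : Finset K) : ∃ (B : Subalgebra k K), (∀ x ∈ s, x ∈ B) ∧ Nonempty (B →ₐ[k] k) := by
  refine ⟨Algebra.adjoin k (s : Set K), fun x hx => Algebra.subset_adjoin hx, ?_⟩
  set B := Algebra.adjoin k (s : Set K) with hB
  have : Algebra.FiniteType k B := (Subalgebra.fg_iff_finiteType _).1 ⟨s, rfl⟩
  obtain ⟨m, hm⟩ := Ideal.exists_maximal B
  let := Ideal.Quotient.field m
  have := finite_of_finite_type_of_isJacobsonRing k (B ⧸ m)
  have hbij : Function.Bijective (algMap k (B ⧸ m)) :=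
    IsAlgClosed.algebraMap_bijective_of_isIntegral
  exact ⟨((AlgEquiv.ofBijective (Algebra.ofId k (B ⧸ m)) hbij).symm.toAlgHom).comp
    (Ideal.Quotient.mkₐ k m)⟩

open MvPolynomial in
theorem height_point {k : Type} [Field k] {N : ℕ} (c : Fin N → k) :
    (N : ℕ∞) ≤ (RingHom.ker (aeval c : MvPolynomial (Fin N) k →ₐ[k] k)).height := by
  let φ : ℕ → (MvPolynomial (Fin N) k →ₐ[k] MvPolynomial (Fin N) k) := fun j =>
    aeval (fun i => if i.1 < j then C (c i) else X i)
  have hpr : ∀ j, (RingHom.ker (φ j)).IsPrime := fun j => RingHom.ker_isPrime _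
  have hcomp : ∀ j, (φ (j+1)).comp (φ j) = φ (j+1) := by
    intro j
    ext i
    simp only [φ, AlgHom.comp_apply, aeval_X]
    by_cases h : i.1 < j
    · simp [h, Nat.lt_succ_of_lt h]
    · simp [h]
  have hle : ∀ j, RingHom.ker (φ j) ≤ RingHom.ker (φ (j+1)) := by
    intro j x hx
    rw [RingHom.mem_ker] at hx ⊢
    rw [← hcomp j, AlgHom.comp_apply, hx, map_zero]
  have hlt : ∀ j, j < N → RingHom.ker (φ j) < RingHom.ker (φ (j+1)) := by
    intro j hj
    refine lt_of_le_of_ne (hle j) ?_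
    intro h
    have h1 : (X ⟨j, hj⟩ - C (c ⟨j, hj⟩) : MvPolynomial (Fin N) k) ∈ RingHom.ker (φ (j+1)) := by
      rw [RingHom.mem_ker]; simp [φ]
    rw [← h, RingHom.mem_ker] at h1
    have h2 : (X ⟨j, hj⟩ - C (c ⟨j, hj⟩) : MvPolynomial (Fin N) k) = 0 := by simpa [φ] using h1
    have := congrArg (eval (fun _ => c ⟨j, hj⟩ + 1)) h2
    simp at this
  have hh : ∀ j, j ≤ N → (j : ℕ∞) ≤ (RingHom.ker (φ j)).height := by
    intro j
    induction j with
    | zero => intro _; simp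
    | succ j ih =>
      intro hj
      have := Ideal.height_add_one_le_of_lt_of_isPrime (hlt j (by omega))
      refine le_trans ?_ this
      push_cast
      gcongr
      exact ih (by omega)
  refine (hh N le_rfl).trans (Ideal.height_mono ?_)
  intro x hx
  rw [RingHom.mem_ker] at hx ⊢
  have : (aeval c : MvPolynomial (Fin N) k →ₐ[k] k).comp (φ N) = aeval c := by ext i; simp [φ]
  rw [← this, AlgHom.comp_apply, hx, map_zero]

open MvPolynomial in
theorem krull_point {k : Type} [Field k] [IsAlgClosed k] {m N : ℕ} (hmN : m < N)
    (f : Fin m → MvPolynomial (Fin N) k) (x0 : Fin N → k) (h0 : ∀ j, aeval x0 (f j) = 0) :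
    ∃ (K : Type) (_ : Field K) (_ : IsAlgClosed K) (_ : Algebra k K) (x : Fin N → K),
      (∀ j, aeval x (f j) = 0) ∧ ∃ i, x i ∉ Set.range (algMap k K) := by
  let M := RingHom.ker (aeval x0 : MvPolynomial (Fin N) k →ₐ[k] k)
  have : M.IsPrime := RingHom.ker_isPrime _
  have hI : Ideal.span (Set.range f) ≤ M := by rw [Ideal.span_le]; rintro _ ⟨j, rfl⟩; exact h0 j
  obtain ⟨p, hp, hpM⟩ := Ideal.exists_minimalPrimes_le hI
  have hpp : p.IsPrime := hp.1.1
  have hht := Ideal.height_le_card_of_mem_minimalPrimes_span (Set.finite_range f) hp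
  have hht2 : p.height < N := by
    refine lt_of_le_of_lt hht ?_
    have : (Set.range f).ncard ≤ m := by
      rw [← Set.image_univ]
      refine (Set.ncard_image_le (Set.toFinite _)).trans ?_
      simp [Set.ncard_univ]
    exact_mod_cast lt_of_le_of_lt this hmN
  let K := AlgebraicClosure (FractionRing (MvPolynomial (Fin N) k ⧸ p))
  let g : MvPolynomial (Fin N) k →ₐ[k] K :=
    (IsScalarTower.toAlgHom k (MvPolynomial (Fin N) k ⧸ p) K).comp (Ideal.Quotient.mkₐ k p)
  have hinj : Function.Injective (algMap (MvPolynomial (Fin N) k ⧸ p) K) := by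
    rw [IsScalarTower.algebraMap_eq _ (FractionRing (MvPolynomial (Fin N) k ⧸ p)), RingHom.coe_comp]
    exact (algMap (FractionRing (MvPolynomial (Fin N) k ⧸ p)) K).injective.comp
      (IsFractionRing.injective _ _)
  have hg : ∀ q, g q = 0 ↔ q ∈ p := by
    intro q
    have : g q = algMap (MvPolynomial (Fin N) k ⧸ p) K (Ideal.Quotient.mk p q) := rfl
    rw [this, ← Ideal.Quotient.eq_zero_iff_mem]
    exact map_eq_zero_iff _ hinj
  have hgae : g = aeval (fun i => g (X i)) := by ext i; simp
  refine ⟨K, inferInstance, inferInstance, inferInstance, fun i => g (X i), ?_, ?_⟩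
  · intro j
    rw [← hgae, hg]
    exact hp.1.2 (Ideal.subset_span ⟨j, rfl⟩)
  · by_contra hcon
    push Not at hcon
    choose c hc using hcon
    have hpc : RingHom.ker (aeval c : MvPolynomial (Fin N) k →ₐ[k] k) ≤ p := by
      intro q hq
      rw [RingHom.mem_ker] at hq
      rw [← hg, hgae]
      have : (aeval (fun i => g (X i)) : MvPolynomial (Fin N) k →ₐ[k] K)
          = (Algebra.ofId k K).comp (aeval c) := by
        ext i; simp [← hc i, Algebra.ofId_apply]
      rw [this, AlgHom.comp_apply, hq, map_zero]
    have := (height_point c).trans (Ideal.height_mono hpc)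
    exact absurd hht2 (not_lt.mpr this)

open MvPolynomial in
theorem proj_zero {k : Type} [Field k] [IsAlgClosed k] {m N : ℕ} (hmN : m < N)
    (f : Fin m → MvPolynomial (Fin N) k) (h0 : ∀ j, aeval (0 : Fin N → k) (f j) = 0) :
    ∃ x : Fin N → k, x ≠ 0 ∧ ∀ j, aeval x (f j) = 0 := by
  obtain ⟨K, _, _, _, x, hx, i, hi⟩ := krull_point hmN f 0 h0
  classical
  have hxi : x i ≠ 0 := fun h => hi ⟨0, by simp [h]⟩
  obtain ⟨B, hB, ⟨φ⟩⟩ := exists_specialization (k := k)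
    (insert (x i)⁻¹ (Finset.univ.image x))
  let xb : Fin N → B := fun j => ⟨x j, hB _ (by simp)⟩
  let y : B := ⟨(x i)⁻¹, hB _ (by simp)⟩
  have h1 : xb i * y = 1 := by ext; simp [xb, y, hxi]
  refine ⟨fun j => φ (xb j), ?_, ?_⟩
  · intro h
    have := congrArg φ h1
    have h2 := congrFun h i
    simp only [Pi.zero_apply] at h2
    simp [h2] at this
  · intro j
    have h2 : aeval xb (f j) = 0 := by
      have : B.val (aeval xb (f j)) = aeval x (f j) := by
        rw [← AlgHom.comp_apply]
        congr 1
        ext i; simp [xb]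
      apply Subtype.ext
      have h3 := hx j
      rw [← this] at h3
      simpa using h3
    have : aeval (fun j => φ (xb j)) (f j) = φ (aeval xb (f j)) := by
      rw [← AlgHom.comp_apply]; congr 1; ext i; simp
    rw [this, h2, map_zero]

end Transfer

/-! ### Cubic forms as symmetric trilinear forms -/

/-- symmetric arrays, i.e. cubic forms in five variables -/
structure Cub (k : Type) where
  τ : Fin 5 → Fin 5 → Vec k
  s12 : ∀ i j l, τ i j l = τ j i l
  s23 : ∀ i j l, τ i j l = τ i l j

namespace Cub

section basics
variable {k R S : Type} [Field k] [CommRing R] [Algebra k R] [CommRing S] [Algebra k S]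

/-- the trilinear form with values in an algebra -/
def T (C : Cub k) (x y z : Vec R) : R :=
  ∑ i, ∑ j, ∑ l, algMap k R (C.τ i j l) * (x i * y j * z l)

variable (C : Cub k)

theorem T_swap12 (x y z : Vec R) : C.T x y z = C.T y x z := by
  unfold T
  rw [Finset.sum_comm]
  refine Finset.sum_congr rfl fun i _ => Finset.sum_congr rfl fun j _ =>
    Finset.sum_congr rfl fun l _ => ?_
  rw [C.s12]; ring

theorem T_swap23 (x y z : Vec R) : C.T x y z = C.T x z y := by
  unfold T
  refine Finset.sum_congr rfl fun i _ => ?_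
  rw [Finset.sum_comm]
  refine Finset.sum_congr rfl fun j _ => Finset.sum_congr rfl fun l _ => ?_
  rw [C.s23]; ring

theorem T_add1 (x x' y z : Vec R) : C.T (x + x') y z = C.T x y z + C.T x' y z := by
  simp only [T, ← Finset.sum_add_distrib, Pi.add_apply]
  refine Finset.sum_congr rfl fun i _ => Finset.sum_congr rfl fun j _ =>
    Finset.sum_congr rfl fun l _ => ?_
  ring

theorem T_smul1 (c : R) (x y z : Vec R) : C.T (c • x) y z = c * C.T x y z := by
  simp only [T, Finset.mul_sum, Pi.smul_apply, smul_eq_mul]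
  refine Finset.sum_congr rfl fun i _ => Finset.sum_congr rfl fun j _ =>
    Finset.sum_congr rfl fun l _ => ?_
  ring

theorem T_add2 (x y y' z : Vec R) : C.T x (y + y') z = C.T x y z + C.T x y' z := by
  rw [T_swap12, T_add1, T_swap12, T_swap12 C y']

theorem T_add3 (x y z z' : Vec R) : C.T x y (z + z') = C.T x y z + C.T x y z' := by
  rw [T_swap23, T_add2, T_swap23, T_swap23 C _ z']

theorem T_smul2 (c : R) (x y z : Vec R) : C.T x (c • y) z = c * C.T x y z := by
  rw [T_swap12, T_smul1, T_swap12]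

theorem T_smul3 (c : R) (x y z : Vec R) : C.T x y (c • z) = c * C.T x y z := by
  rw [T_swap23, T_smul2, T_swap23]

theorem T_lin : (∀ x x' y z : Vec R, C.T (x + x') y z = C.T x y z + C.T x' y z) ∧
    (∀ x y y' z : Vec R, C.T x (y + y') z = C.T x y z + C.T x y' z) ∧
    (∀ x y z z' : Vec R, C.T x y (z + z') = C.T x y z + C.T x y z') ∧
    (∀ (c : R) (x y z : Vec R), C.T (c • x) y z = c * C.T x y z) ∧
    (∀ (c : R) (x y z : Vec R), C.T x (c • y) z = c * C.T x y z) ∧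
    ∀ (c : R) (x y z : Vec R), C.T x y (c • z) = c * C.T x y z :=
  ⟨C.T_add1, C.T_add2, C.T_add3, C.T_smul1, C.T_smul2, C.T_smul3⟩

theorem T_swap : (∀ x y z : Vec R, C.T x y z = C.T y x z) ∧
    ∀ x y z : Vec R, C.T x y z = C.T x z y :=
  ⟨C.T_swap12, C.T_swap23⟩

theorem T_perm (R : Type) [CommRing R] [Algebra k R] :
    (∀ p q : Vec R, C.T q p p = C.T p p q) ∧ (∀ p q : Vec R, C.T p q p = C.T p p q) ∧
    (∀ p q r : Vec R, C.T p r q = C.T p q r) ∧ (∀ p q r : Vec R, C.T q p r = C.T p q r) ∧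
    (∀ p q r : Vec R, C.T q r p = C.T p q r) ∧ (∀ p q r : Vec R, C.T r p q = C.T p q r) ∧
    ∀ p q r : Vec R, C.T r q p = C.T p q r := by
  refine ⟨?_, ?_, ?_, ?_, ?_, ?_, ?_⟩ <;> intros <;> simp only [C.T_swap]

theorem T_neg1 (x y z : Vec R) : C.T (-x) y z = - C.T x y z := by
  have := C.T_smul1 (-1) x y z; simpa using this
theorem T_neg2 (x y z : Vec R) : C.T x (-y) z = - C.T x y z := by
  have := C.T_smul2 (-1) x y z; simpa using this
theorem T_neg3 (x y z : Vec R) : C.T x y (-z) = - C.T x y z := by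
  have := C.T_smul3 (-1) x y z; simpa using this
theorem T_sub1 (x x' y z : Vec R) : C.T (x - x') y z = C.T x y z - C.T x' y z := by
  rw [sub_eq_add_neg, T_add1, T_neg1, sub_eq_add_neg]
theorem T_sub2 (x y y' z : Vec R) : C.T x (y - y') z = C.T x y z - C.T x y' z := by
  rw [sub_eq_add_neg, T_add2, T_neg2, sub_eq_add_neg]
theorem T_sub3 (x y z z' : Vec R) : C.T x y (z - z') = C.T x y z - C.T x y z' := by
  rw [sub_eq_add_neg, T_add3, T_neg3, sub_eq_add_neg]
theorem T_zero3 (x y : Vec R) : C.T x y 0 = 0 := by have := C.T_smul3 0 x y 0; simpa using this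

theorem T_map (φ : R →ₐ[k] S) (x y z : Vec R) :
    C.T (φ ∘ x) (φ ∘ y) (φ ∘ z) = φ (C.T x y z) := by
  simp [T, map_sum]

/-- base change to a larger field -/
def base (K : Type) [Field K] [Algebra k K] : Cub K where
  τ i j l := algMap k K (C.τ i j l)
  s12 i j l := by rw [C.s12]
  s23 i j l := by rw [C.s23]

theorem T_base (K : Type) [Field K] [Algebra k K] [Algebra K R] [IsScalarTower k K R]
    (x y z : Vec R) : (C.base K).T x y z = C.T x y z := by
  simp [T, base, ← IsScalarTower.algebraMap_apply]

/-- smoothness -/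
def SM : Prop := ∀ p : Vec k, (∀ w : Vec k, C.T p p w = 0) → p = 0

/-- equations of a residual double line -/
def DblE (p q e : Vec R) (α β γ : R) : Prop :=
  3 * C.T p p e = α ^ 2 ∧ 3 * C.T p q e = α * β ∧ 3 * C.T q q e = β ^ 2 ∧
  3 * C.T p e e = 2 * α * γ ∧ 3 * C.T q e e = 2 * β * γ ∧ C.T e e e = γ ^ 2

theorem DblE.map {p q e : Vec R} {α β γ : R} (h : C.DblE p q e α β γ) (φ : R →ₐ[k] S) :
    C.DblE (φ ∘ p) (φ ∘ q) (φ ∘ e) (φ α) (φ β) (φ γ) := by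
  obtain ⟨a1, a2, a3, a4, a5, a6⟩ := h
  have h3 : φ 3 = 3 := map_ofNat φ 3
  have h2 : φ 2 = 2 := map_ofNat φ 2
  refine ⟨?_, ?_, ?_, ?_, ?_, ?_⟩ <;> simp only [T_map] <;>
    (try rw [← h3]) <;> (try rw [← h2]) <;> simp only [← map_mul, ← map_pow] <;> congr 1

theorem DblE.of_map {p q e : Vec R} {α β γ : R} (φ : R →ₐ[k] S) (hφ : Function.Injective φ)
    (h : C.DblE (φ ∘ p) (φ ∘ q) (φ ∘ e) (φ α) (φ β) (φ γ)) : C.DblE p q e α β γ := by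
  obtain ⟨a1, a2, a3, a4, a5, a6⟩ := h
  have h3 : φ 3 = 3 := map_ofNat φ 3
  have h2 : φ 2 = 2 := map_ofNat φ 2
  simp only [T_map, ← h3, ← h2, ← map_mul, ← map_pow] at a1 a2 a3 a4 a5 a6
  exact ⟨hφ a1, hφ a2, hφ a3, hφ a4, hφ a5, hφ a6⟩

/-- the plane `p,q,e` cuts out `l + 2 r`, where `l` is the line `p,q` -/
def Dbl (p q e : Vec R) : Prop := ∃ α β γ : R, (α ≠ 0 ∨ β ≠ 0) ∧ C.DblE p q e α β γ

/-- the configuration we look for -/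
def Config : Prop := ∃ p q e f : Vec k, LinIndep k ![p, q, e, f] ∧
  C.T p p p = 0 ∧ C.T p p q = 0 ∧ C.T p q q = 0 ∧ C.T q q q = 0 ∧
  C.Dbl p q e ∧ C.Dbl p q f

theorem T_eq_zero_of_single {x y : Vec R}
    (h : ∀ i, C.T x y (Pi.single i 1) = 0) (w : Vec R) : C.T x y w = 0 := by
  have : w = ∑ i, w i • (Pi.single i 1 : Vec R) := by
    ext j; simp [Finset.sum_apply, Pi.single_apply]
  rw [this, Fin.sum_univ_five]
  simp only [T_add3, T_smul3, h]; ring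

end basics

section transfer
variable {k K : Type} [Field k] [IsAlgClosed k] [Field K] [Algebra k K] (C : Cub k)

theorem li_dual {n : ℕ} (v : Fin n → Vec K) (h : LinIndep K v) :
    ∃ G : Fin n → Vec K, ∀ i j, ∑ l, G i l * v j l = if i = j then 1 else 0 := by
  have hinj : LinearMap.ker (Fintype.linearCombination K v) = ⊥ := by
    rw [LinearMap.ker_eq_bot']
    intro m hm
    rw [Fintype.linearIndependent_iff] at h
    ext i
    exact h m (by simpa [Fintype.linearCombination_apply] using hm) i
  obtain ⟨g, hg⟩ := LinearMap.exists_leftInverse_of_injective _ hinj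
  refine ⟨fun i l => g (Pi.single l 1) i, fun i j => ?_⟩
  have h1 := congrArg (fun f => f (Pi.single j 1) i) hg
  simp only [LinearMap.comp_apply, LinearMap.id_apply, Pi.single_apply] at h1
  rw [← h1]
  have h2 : Fintype.linearCombination K v (Pi.single j 1) = v j := by
    simp [Fintype.linearCombination_apply, Pi.single_apply]
  rw [h2]
  have h3 : v j = ∑ l, v j l • (Pi.single l 1 : Vec K) := by
    ext m; simp [Finset.sum_apply, Pi.single_apply]
  conv_rhs => rw [h3]
  rw [map_sum, Finset.sum_apply]
  refine Finset.sum_congr rfl fun l _ => ?_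
  simp [mul_comm]

theorem li_of_dual {n : ℕ} (v : Fin n → Vec K) (G : Fin n → Vec K)
    (h : ∀ i j, ∑ l, G i l * v j l = if i = j then 1 else 0) : LinIndep K v := by
  rw [Fintype.linearIndependent_iff]
  intro c hc i
  have h1 : ∑ l, G i l * (∑ j, c j • v j) l = 0 := by rw [hc]; simp
  have h2 : ∑ l, G i l * (∑ j, c j • v j) l = c i := by
    simp only [Finset.sum_apply, Pi.smul_apply, smul_eq_mul, Finset.mul_sum]
    rw [Finset.sum_comm]
    have : ∀ j, ∑ l, G i l * (c j * v j l) = c j * if i = j then 1 else 0 := by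
      intro j
      rw [← h, Finset.mul_sum]
      exact Finset.sum_congr rfl fun l _ => by ring
    simp [this]
  rw [← h2, h1]

theorem SM_base (h : C.SM) : (C.base K).SM := by
  intro p hp
  by_contra hne
  obtain ⟨i, hi⟩ : ∃ i, p i ≠ 0 := by by_contra hcon; push Not at hcon; exact hne (funext hcon)
  classical
  obtain ⟨B, hB, ⟨φ⟩⟩ := exists_specialization (k := k)
    (insert (p i)⁻¹ (Finset.univ.image p))
  let xb : Fin 5 → B := fun j => ⟨p j, hB _ (by simp)⟩
  let y : B := ⟨(p i)⁻¹, hB _ (by simp)⟩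
  have h1 : xb i * y = 1 := by ext; simp [xb, y, hi]
  have h0 : φ ∘ xb = 0 := by
    apply h
    apply T_eq_zero_of_single
    intro j
    have e1 : (Pi.single j 1 : Vec k) = φ ∘ (Pi.single j 1 : Fin 5 → B) := by
      ext m; by_cases hm : m = j
      · subst hm; simp
      · simp [hm]
    rw [e1, T_map]
    have h2 : C.T xb xb (Pi.single j 1) = 0 := by
      have h3 := hp (Pi.single j 1)
      rw [T_base] at h3
      have e2 : (Pi.single j 1 : Vec K) = B.val ∘ (Pi.single j 1 : Fin 5 → B) := by
        ext m; by_cases hm : m = j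
        · subst hm; simp
        · simp [hm]
      have e3 : p = B.val ∘ xb := rfl
      rw [e2, e3, T_map] at h3
      exact Subtype.ext h3
    rw [h2, map_zero]
  have h2 : φ (xb i) = 0 := congrFun h0 i
  have := congrArg φ h1
  simp [h2] at this

theorem Config_base (h : (C.base K).Config) : C.Config := by
  obtain ⟨p, q, e, f, hli, h1, h2, h3, h4, ⟨α, β, γ, hab, a1, a2, a3, a4, a5, a6⟩,
    α', β', γ', hab', b1, b2, b3, b4, b5, b6⟩ := h
  obtain ⟨G, hG⟩ := li_dual _ hli
  simp only [T_base] at a1 a2 a3 a4 a5 a6 b1 b2 b3 b4 b5 b6 h1 h2 h3 h4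
  classical
  obtain ⟨B, hB, ⟨φ⟩⟩ := exists_specialization (k := k)
    (Finset.univ.image p ∪ Finset.univ.image q ∪ Finset.univ.image e ∪ Finset.univ.image f ∪
      Finset.univ.image (fun x : Fin 4 × Fin 5 => G x.1 x.2) ∪
      {α, β, γ, α', β', γ', α⁻¹, β⁻¹, α'⁻¹, β'⁻¹})
  have lift1 : ∀ x : K, x ∈ ({α, β, γ, α', β', γ', α⁻¹, β⁻¹, α'⁻¹, β'⁻¹} : Finset K) →
      ∃ y : B, B.val y = x := fun x hx =>
    ⟨⟨x, hB x (Finset.mem_union_right _ hx)⟩, rfl⟩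
  have liftp : ∃ y : Fin 5 → B, p = B.val ∘ y := ⟨fun i => ⟨p i, hB _ (by simp)⟩, rfl⟩
  have liftq : ∃ y : Fin 5 → B, q = B.val ∘ y := ⟨fun i => ⟨q i, hB _ (by simp)⟩, rfl⟩
  have lifte : ∃ y : Fin 5 → B, e = B.val ∘ y := ⟨fun i => ⟨e i, hB _ (by simp)⟩, rfl⟩
  have liftf : ∃ y : Fin 5 → B, f = B.val ∘ y := ⟨fun i => ⟨f i, hB _ (by simp)⟩, rfl⟩
  have liftG : ∃ y : Fin 4 → Fin 5 → B, G = fun i j => B.val (y i j) :=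
    ⟨fun i j => ⟨G i j, hB _ (by
      refine Finset.mem_union_left _ (Finset.mem_union_right _ ?_)
      exact Finset.mem_image.2 ⟨(i, j), Finset.mem_univ _, rfl⟩)⟩, rfl⟩
  obtain ⟨p, rfl⟩ := liftp
  obtain ⟨q, rfl⟩ := liftq
  obtain ⟨e, rfl⟩ := lifte
  obtain ⟨f, rfl⟩ := liftf
  obtain ⟨G, rfl⟩ := liftG
  have hne : ∀ x y : B, (x ≠ 0 ∨ y ≠ 0) → (∃ z, x ≠ 0 → x * z = 1) → (∃ z, y ≠ 0 → y * z = 1) →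
      (φ x ≠ 0 ∨ φ y ≠ 0) := by
    rintro x y (hx | hx) ⟨z, hz⟩ ⟨w, hw⟩
    · left; intro h; have := congrArg φ (hz hx); simp [h] at this
    · right; intro h; have := congrArg φ (hw hx); simp [h] at this
  have hinv : ∀ x : B, (∃ z : B, B.val z = (B.val x)⁻¹) → ∃ z, x ≠ 0 → x * z = 1 := by
    rintro x ⟨z, hz⟩
    refine ⟨z, fun hx => Subtype.ext ?_⟩
    have : B.val x ≠ 0 := fun h => hx (Subtype.ext h)
    have h2 : B.val x * B.val z = 1 := by rw [hz]; exact mul_inv_cancel₀ this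
    exact h2
  obtain ⟨iα, hiα⟩ := lift1 α⁻¹ (by simp)
  obtain ⟨iβ, hiβ⟩ := lift1 β⁻¹ (by simp)
  obtain ⟨iα', hiα'⟩ := lift1 α'⁻¹ (by simp)
  obtain ⟨iβ', hiβ'⟩ := lift1 β'⁻¹ (by simp)
  obtain ⟨α, rfl⟩ := lift1 α (by simp)
  obtain ⟨β, rfl⟩ := lift1 β (by simp)
  obtain ⟨γ, rfl⟩ := lift1 γ (by simp)
  obtain ⟨α', rfl⟩ := lift1 α' (by simp)
  obtain ⟨β', rfl⟩ := lift1 β' (by simp)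
  obtain ⟨γ', rfl⟩ := lift1 γ' (by simp)
  have hBinj : Function.Injective B.val := Subtype.val_injective
  have hd1 := DblE.of_map C B.val hBinj ⟨a1, a2, a3, a4, a5, a6⟩
  have hd2 := DblE.of_map C B.val hBinj ⟨b1, b2, b3, b4, b5, b6⟩
  simp only [T_map, map_eq_zero_iff _ hBinj] at h1 h2 h3 h4
  simp only [ne_eq, map_eq_zero_iff _ hBinj] at hab hab'
  refine ⟨φ ∘ p, φ ∘ q, φ ∘ e, φ ∘ f, ?_, by rw [T_map, h1, map_zero], by rw [T_map, h2, map_zero],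
    by rw [T_map, h3, map_zero], by rw [T_map, h4, map_zero],
    ⟨φ α, φ β, φ γ, ?_, hd1.map C φ⟩, ⟨φ α', φ β', φ γ', ?_, hd2.map C φ⟩⟩
  · apply li_of_dual _ (fun i j => φ (G i j))
    intro i j
    have h5 := hG i j
    have h6 : ∑ l, G i l * (![p, q, e, f] j) l = if i = j then 1 else 0 := by
      apply hBinj
      rw [map_sum]
      have : B.val (if i = j then 1 else 0) = if i = j then 1 else 0 := by split_ifs <;> simp
      rw [this, ← h5]
      refine Finset.sum_congr rfl fun l _ => ?_
      rw [map_mul]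
      congr 1
      fin_cases j <;> rfl
    have h7 := congrArg φ h6
    rw [map_sum] at h7
    have : φ (if i = j then 1 else 0) = if i = j then 1 else 0 := by split_ifs <;> simp
    rw [this] at h7
    rw [← h7]
    refine Finset.sum_congr rfl fun l _ => ?_
    rw [map_mul]
    congr 1
    fin_cases j <;> rfl
  · exact hne _ _ hab (hinv _ ⟨_, hiα⟩) (hinv _ ⟨_, hiβ⟩)
  · exact hne _ _ hab' (hinv _ ⟨_, hiα'⟩) (hinv _ ⟨_, hiβ'⟩)

end transfer
end Cub

/-! ### Constants and places -/

section Places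

/-- a place of `K` over `k`: a valuation ring with residue field `k` -/
structure IsPlace {k R : Type} [Field k] [CommRing R] [Algebra k R] (ρ : R →ₐ[k] k) : Prop where
  unit : ∀ a, ρ a ≠ 0 → IsUnit a
  total : ∀ a b : R, a ∣ b ∨ b ∣ a

/-- there are enough places -/
def HasPlaces (k K : Type) [Field k] [Field K] [Algebra k K] : Prop :=
  ∀ x : K, x ∉ Set.range (algMap k K) →
    ∃ (R : Type) (_ : CommRing R) (_ : IsDomain R) (_ : Algebra k R) (_ : Algebra R K)
      (_ : IsScalarTower k R K) (ρ : R →ₐ[k] k), IsPlace ρ ∧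
      Function.Injective (algMap R K) ∧
      (∀ z : K, z ∈ Set.range (algMap R K) ∨ z⁻¹ ∈ Set.range (algMap R K)) ∧
      x ∉ Set.range (algMap R K)

theorem hasPlaces_of_trdeg {k K : Type} [Field k] [IsAlgClosed k] [Field K] [Algebra k K]
    (H : ∀ a x : K, a ∉ Set.range (algMap k K) → IsAlgebraic (Algebra.adjoin k {a}) x) :
    HasPlaces k K := by
  intro x hx
  have hcl : ∀ z : K, IsIntegral k z → z ∈ Set.range (algMap k K) := by
    intro z hz
    have : Algebra.IsIntegral k (IntermediateField.adjoin k {z}) := by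
      have := IntermediateField.adjoin.finiteDimensional hz
      infer_instance
    obtain ⟨c, hc⟩ := (IsAlgClosed.algebraMap_bijective_of_isIntegral (k := k)
      (K := IntermediateField.adjoin k {z})).2 ⟨z, IntermediateField.mem_adjoin_simple_self k z⟩
    exact ⟨c, congrArg Subtype.val hc⟩
  have hic' : IsIntegrallyClosedIn (⊥ : Subalgebra k K).toSubring K := by
    rw [isIntegrallyClosedIn_iff]
    refine ⟨Subtype.val_injective, ?_⟩
    intro z hz
    have hz' : IsIntegral (⊥ : Subalgebra k K) z := hz
    have h2 : IsIntegral k z := isIntegral_trans z hz'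
    exact ⟨⟨z, Algebra.mem_bot.2 (hcl z h2)⟩, rfl⟩
  obtain ⟨V, hV, hxV⟩ := Subring.exists_le_valuationSubring_of_isIntegrallyClosedIn
    (x := x) (R := (⊥ : Subalgebra k K).toSubring) (fun h => hx (Algebra.mem_bot.1 h))
  have hkV : ∀ c : k, algMap k K c ∈ V := fun c => hV (Algebra.mem_bot.2 ⟨c, rfl⟩)
  let f : k →+* V := (algMap k K).codRestrict V.toSubring hkV
  let _ : Algebra k V := f.toAlgebra
  have : IsScalarTower k V K := IsScalarTower.of_algebraMap_eq fun c => rfl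
  have hres : ∀ a : V, ∃ c : k, ¬ IsUnit (a - algMap k V c) := by
    intro a
    by_contra hcon
    push Not at hcon
    have haK : (a : K) ∉ Set.range (algMap k K) := by
      rintro ⟨c, hc⟩
      have h1 : a - algMap k V c = 0 := by
        apply Subtype.ext
        show (a : K) - algMap k K c = 0
        rw [hc, sub_self]
      have h2 := hcon c
      rw [h1] at h2
      exact not_isUnit_zero h2
    have hunit : ∀ P : Polynomial k, P ≠ 0 → IsUnit (Polynomial.aeval a P) := by
      intro P hP
      have hs := IsAlgClosed.splits P
      rw [hs.eq_prod_roots, map_mul, Polynomial.aeval_C]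
      refine IsUnit.mul ?_ ?_
      · exact (IsUnit.mk0 _ (Polynomial.leadingCoeff_ne_zero.2 hP)).map (algMap k V)
      · rw [map_multiset_prod]
        refine Multiset.prod_induction IsUnit _ (fun _ _ h1 h2 => h1.mul h2) isUnit_one ?_
        intro u hu
        simp only [Multiset.map_map, Multiset.mem_map, Function.comp_apply] at hu
        obtain ⟨c, _, rfl⟩ := hu
        simpa using hcon c
    obtain ⟨p, hp0, hp⟩ := H a x haK
    have hS : ∀ s : Algebra.adjoin k {(a : K)}, ∃ P : Polynomial k,
        ((Polynomial.aeval a P : V) : K) = s := by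
      rintro ⟨s, hs⟩
      have hs2 := hs
      rw [Algebra.adjoin_singleton_eq_range_aeval] at hs2
      obtain ⟨P, hP⟩ := hs2
      refine ⟨P, ?_⟩
      show _ = s
      rw [← hP]
      have := Polynomial.aeval_algebraMap_apply K a P
      exact this.symm
    let g : Algebra.adjoin k {(a : K)} →+* V :=
      (Algebra.adjoin k {(a : K)}).val.toRingHom.codRestrict V.toSubring (by
        intro s; obtain ⟨P, hP⟩ := hS s
        show (s : K) ∈ V
        rw [← hP]; exact Subtype.property _)
    have hg : Function.Injective g := by
      intro s t h
      exact Subtype.ext (congrArg (fun z : V => (z : K)) h)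
    have hq0 : p.map g ≠ 0 := (Polynomial.map_ne_zero_iff hg).2 hp0
    have hlu : IsUnit (p.map g).leadingCoeff := by
      rw [Polynomial.leadingCoeff_map_of_injective hg]
      obtain ⟨P, hP⟩ := hS p.leadingCoeff
      have h1 : g p.leadingCoeff = Polynomial.aeval a P := Subtype.ext hP.symm
      rw [h1]
      apply hunit
      rintro rfl
      simp at hP
      exact hp0 (by simpa using hP.symm)
    have hIntg : IsIntegral V x := by
      obtain ⟨u, hu⟩ := hlu
      refine ⟨PolyC (↑u⁻¹ : V) * p.map g, ?_, ?_⟩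
      · apply Polynomial.monic_C_mul_of_mul_leadingCoeff_eq_one
        rw [← hu]; simp
      · rw [Polynomial.eval₂_mul, Polynomial.eval₂_map]
        have : (algMap V K).comp g = algMap (Algebra.adjoin k {(a : K)}) K := rfl
        rw [this]
        rw [Polynomial.aeval_def] at hp
        rw [hp, mul_zero]
    obtain ⟨y, hy⟩ := (IsIntegrallyClosed.isIntegral_iff (R := V) (K := K)).1 hIntg
    exact hxV (hy ▸ y.2)
  have hsurj : Function.Surjective (algMap k (IsLocalRing.ResidueField V)) := by
    intro z
    obtain ⟨a, rfl⟩ := IsLocalRing.residue_surjective z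
    obtain ⟨c, hc⟩ := hres a
    refine ⟨c, ?_⟩
    have h1 : IsLocalRing.residue V (a - algMap k V c) = 0 := by
      rw [IsLocalRing.residue_eq_zero_iff]; exact hc
    rw [map_sub, sub_eq_zero] at h1
    rw [h1]; rfl
  have hbij : Function.Bijective (algMap k (IsLocalRing.ResidueField V)) :=
    ⟨RingHom.injective _, hsurj⟩
  let ρ : V →ₐ[k] k :=
    ((AlgEquiv.ofBijective (Algebra.ofId k (IsLocalRing.ResidueField V)) hbij).symm.toAlgHom).comp
      (IsScalarTower.toAlgHom k V (IsLocalRing.ResidueField V))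
  refine ⟨V, inferInstance, inferInstance, inferInstance, inferInstance, inferInstance, ρ,
    ⟨?_, ?_⟩, Subtype.val_injective, ?_, ?_⟩
  · intro a ha
    by_contra hcon
    apply ha
    have : IsLocalRing.residue V a = 0 := by rw [IsLocalRing.residue_eq_zero_iff]; exact hcon
    show (AlgEquiv.ofBijective (Algebra.ofId k (IsLocalRing.ResidueField V)) hbij).symm
      (IsLocalRing.residue V a) = 0
    rw [this, map_zero]
  · intro a b; exact ValuationRing.dvd_total a b
  · intro z
    rcases V.mem_or_inv_mem z with h | h
    · exact Or.inl ⟨⟨z, h⟩, rfl⟩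
    · exact Or.inr ⟨⟨_, h⟩, rfl⟩
  · rintro ⟨y, rfl⟩; exact hxV y.2

theorem mem_range_of_isAlgebraic {k K : Type} [Field k] [IsAlgClosed k] [Field K] [Algebra k K]
    (y : K) (h : IsAlgebraic k y) : y ∈ Set.range (algMap k K) := by
  have hz := h.isIntegral
  have : Algebra.IsIntegral k (IntermediateField.adjoin k {y}) := by
    have := IntermediateField.adjoin.finiteDimensional hz
    infer_instance
  obtain ⟨c, hc⟩ := (IsAlgClosed.algebraMap_bijective_of_isIntegral (k := k)
    (K := IntermediateField.adjoin k {y})).2 ⟨y, IntermediateField.mem_adjoin_simple_self k y⟩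
  exact ⟨c, congrArg Subtype.val hc⟩

theorem hasPlaces_of_algebraic {k0 K : Type} [Field k0] [IsAlgClosed k0] [Field K]
    [Algebra k0 K] (y : K) (halg : Algebra.IsAlgebraic (Algebra.adjoin k0 {y}) K) :
    HasPlaces k0 K := by
  apply hasPlaces_of_trdeg
  have htd : Algebra.trdeg k0 K ≤ 1 := by
    have := Algebra.IsAlgebraic.trdeg_le_cardinalMk k0 ({y} : Set K)
    simpa using this
  intro a x ha
  have hatr : Transcendental k0 a := fun h => ha (mem_range_of_isAlgebraic a h)
  have hi : AlgebraicIndependent k0 (fun _ : Unit => a) := by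
    rw [algebraicIndependent_unique_type_iff]; exact hatr
  have hb := hi.isTranscendenceBasis_of_trdeg_le_of_finite (by simpa using htd)
  have h1 := hb.isAlgebraic.isAlgebraic x
  rw [Set.range_const] at h1
  exact h1

theorem exists_constants_aux0 {k k0 L K : Type} [Field k] [Field k0] [IsAlgClosed k0] [Field L]
    [Field K] [Algebra L K] [Algebra k k0] [Algebra k0 K] [Algebra k K]
    [IsScalarTower k k0 K] (y : K)
    (i3 : ∀ c : L, ∃ d : k0, algMap k0 K d = algMap L K c)
    (B : Set K) (hBL : ∀ b ∈ B, b = y ∨ ∃ c : L, algMap L K c = b)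
    (hB : Algebra.IsAlgebraic (Algebra.adjoin k B) K) : HasPlaces k0 K := by
  apply hasPlaces_of_algebraic y
  have hle : Algebra.adjoin k B ≤ (Algebra.adjoin k0 {y}).restrictScalars k := by
    rw [Algebra.adjoin_le_iff]
    intro b hb
    rcases hBL b hb with h | ⟨c, hc⟩
    · subst h; exact Algebra.self_mem_adjoin_singleton k0 b
    · obtain ⟨d, hd⟩ := i3 c
      rw [← hc, ← hd]
      exact Subalgebra.algebraMap_mem (Algebra.adjoin k0 {y}) d
  constructor
  intro z
  have h1 := hB.isAlgebraic z
  have := h1.ringHom_of_comp_eq (S := Algebra.adjoin k0 {y}) (B := K)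
    (Subalgebra.inclusion hle).toRingHom (RingHom.id K)
    (Subalgebra.inclusion_injective hle) rfl
  exact this

theorem exists_constants_aux {k L K : Type} [Field k] [Field L] [Field K] [IsAlgClosed K]
    [Algebra k L] [Algebra L K] [Algebra k K] [IsScalarTower k L K] (y : K)
    (htrL : Transcendental L y) (B : Set K) (hBL : ∀ b ∈ B, b = y ∨ ∃ c : L, algMap L K c = b)
    (hB : Algebra.IsAlgebraic (Algebra.adjoin k B) K) :
    ∃ (k0 : Type) (_ : Field k0) (_ : IsAlgClosed k0) (_ : Algebra k k0) (_ : Algebra k0 K)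
      (_ : IsScalarTower k k0 K), y ∉ Set.range (algMap k0 K) ∧ HasPlaces k0 K := by
  have htr0 : Transcendental (algebraicClosure L K) y := htrL.algebraicClosure
  have hac : IsAlgClosed (algebraicClosure L K) := IsAlgClosure.isAlgClosed L
  let i1 : Algebra k (algebraicClosure L K) :=
    ((algMap L (algebraicClosure L K)).comp (algMap k L)).toAlgebra
  have i2 : IsScalarTower k (algebraicClosure L K) K := IsScalarTower.of_algebraMap_eq fun c => by
    rw [IsScalarTower.algebraMap_apply k L K]; rfl
  have i3 : ∀ c : L, ∃ d : algebraicClosure L K, algMap _ K d = algMap L K c :=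
    fun c => ⟨algMap L _ c, rfl⟩
  refine ⟨algebraicClosure L K, inferInstance, hac, i1, inferInstance, i2, ?_,
    exists_constants_aux0 y i3 B hBL hB⟩
  rintro ⟨c, rfl⟩; exact htr0 (isAlgebraic_algebraMap c)

open scoped IntermediateField.algebraAdjoinAdjoin in
theorem exists_constants {k K : Type} [Field k] [IsAlgClosed k] [Field K] [IsAlgClosed K]
    [Algebra k K] (y : K) (hy : y ∉ Set.range (algMap k K)) :
    ∃ (k0 : Type) (_ : Field k0) (_ : IsAlgClosed k0) (_ : Algebra k k0) (_ : Algebra k0 K)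
      (_ : IsScalarTower k k0 K), y ∉ Set.range (algMap k0 K) ∧ HasPlaces k0 K := by
  have htr : Transcendental k y := fun h => hy (mem_range_of_isAlgebraic y h)
  have hind : AlgebraicIndepOn k id ({y} : Set K) := by
    rw [AlgebraicIndepOn]
    rw [algebraicIndependent_unique_type_iff]
    exact htr
  obtain ⟨B, hyB, hB⟩ := exists_isTranscendenceBasis_superset hind
  have hyB : y ∈ B := hyB rfl
  have h1 := hB.1.transcendental_adjoin (s := {⟨y, hyB⟩}ᶜ) (i := ⟨y, hyB⟩) (by simp)
  have h2 : ((↑) : B → K) '' ({⟨y, hyB⟩}ᶜ) = B \ {y} := by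
    ext z; simp only [Set.mem_image, Set.mem_compl_iff, Set.mem_singleton_iff, Set.mem_sdiff]
    constructor
    · rintro ⟨w, hw, rfl⟩; exact ⟨w.2, fun h => hw (Subtype.ext h)⟩
    · rintro ⟨h, h'⟩; exact ⟨⟨z, h⟩, fun h2 => h' (congrArg Subtype.val h2), rfl⟩
  rw [h2] at h1
  refine exists_constants_aux (k := k) (L := IntermediateField.adjoin k (B \ {y})) y ?_ B ?_ ?_
  · intro h
    exact h1 ((IsFractionRing.isAlgebraic_iff (Algebra.adjoin k (B \ {y})) _ _).2 h)
  · intro b hb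
    by_cases h : b = y
    · exact Or.inl h
    · exact Or.inr ⟨⟨b, IntermediateField.subset_adjoin _ _ ⟨hb, h⟩⟩, rfl⟩
  · have h1 := hB.isAlgebraic
    rw [Subtype.range_coe] at h1
    exact h1

end Places

/-! ### Algebra of the two degenerate cases -/

section Bad
variable {k R : Type} [Field k] [CharZero k] [CommRing R] [IsDomain R] [Algebra k R]
  {ρ : R →ₐ[k] k}

theorem rho2 : ρ 2 = 2 := map_ofNat ρ 2
theorem rho3 : ρ 3 = 3 := map_ofNat ρ 3
theorem rho4 : ρ 4 = 4 := map_ofNat ρ 4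

theorem IsPlace.inv (hρ : IsPlace ρ) {a : R} (h : ρ a ≠ 0) : ∃ v, a * v = 1 := by
  obtain ⟨u, rfl⟩ := hρ.unit a h
  exact ⟨_, u.mul_inv⟩

theorem IsPlace.nak (hρ : IsPlace ρ) {g y A m : R} (h : g = y * A + g * m) (hm : ρ m = 0) :
    y ∣ g := by
  obtain ⟨v, hv⟩ := hρ.inv (a := 1 - m) (by simp [hm])
  exact ⟨A * v, by linear_combination (-g) * hv + v * h⟩

theorem IsPlace.inv_one (hρ : IsPlace ρ) {a : R} (h : ρ a = 1) : ∃ v, a * v = 1 ∧ ρ v = 1 := by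
  obtain ⟨v, hv⟩ := hρ.inv (a := a) (by simp [h])
  refine ⟨v, hv, ?_⟩
  have := congrArg ρ hv
  simpa [h] using this

theorem bad1_Em (hρ : IsPlace ρ) {p q z K y0 y1 x x2 ω s0 s1 s2 a a' a1 A B3 B4 B5 B6 B7 B8 B9 : R}
    (hp : ρ p = 0) (hq : ρ q = 0) (hz : ρ z = 0) (hx : ρ x = 0) (hx2 : ρ x2 = 0)
    (hy0 : ρ y0 = 0) (hy1 : ρ y1 = 0) (hω : ρ ω = 0) (ha : ρ a ≠ 0) (ha' : ρ a' ≠ 0)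
    (ha1 : ρ a1 ≠ 0) (hs : ρ s0 ≠ 0 ∨ ρ s1 ≠ 0 ∨ ρ s2 ≠ 0)
    (E1 : -p ^ 3 + ω * s0 * a = K * y0 * x ^ 2)
    (E2 : -3 * p ^ 2 * q + ω * (s0 * A + s1 * a') = K * (y1 * x ^ 2 + 2 * y0 * x))
    (E3 : -3 * p * q ^ 2 + ω * B3 = K * (2 * y1 * x + y0))
    (E4 : -q ^ 3 + ω * B4 = K * y1)
    (E5 : -p - 3 * p ^ 2 * z + ω * B5 = K * (x ^ 2 + 2 * y0 * x * x2))
    (E6 : -q - 6 * p * q * z + ω * B6 = K * (2 * x + 2 * y1 * x * x2 + 2 * y0 * x2))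
    (E7 : 1 - 3 * q ^ 2 * z + ω * B7 = K * (1 + 2 * y1 * x2))
    (E8 : -z - 3 * p * z ^ 2 + ω * B8 = K * (2 * x * x2 + y0 * x2 ^ 2))
    (E9 : -3 * q * z ^ 2 + ω * B9 = K * (2 * x2 + y1 * x2 ^ 2))
    (E10 : -z ^ 3 + ω * s2 * a1 = K * x2 ^ 2) :
    ∃ W p' q' z', ω = x ^ 5 * W ∧ p = x ^ 2 * p' ∧ ρ p' = -1 ∧ q = x * q' ∧ ρ q' = -2 ∧
      z = x ^ 5 * z' := by
  have hK : ρ K = 1 := by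
    have := congrArg ρ E7
    simpa [hq, hz, hω, hy1, hx2] using this.symm
  obtain ⟨v9, hv9⟩ := hρ.inv (a := K * (2 + y1 * x2)) (by simp [hK, hy1, rho2])
  obtain ⟨v8, hv8, hv8'⟩ := hρ.inv_one (a := 1 + 3 * p * z) (by simp [hp])
  obtain ⟨v6, hv6, hv6'⟩ := hρ.inv_one (a := 1 + 6 * p * z) (by simp [hp])
  obtain ⟨v, hv, hv'⟩ := hρ.inv_one (a := K) hK
  have e9 : x2 = v9 * (-3 * q * z ^ 2 + ω * B9) := by linear_combination (-x2) * hv9 - v9 * E9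
  obtain ⟨κ, hκ⟩ : ∃ κ, κ = v8 * K * (2 * x + y0 * x2) * v9 := ⟨_, rfl⟩
  obtain ⟨w, hw⟩ := hρ.inv (a := 1 - 3 * κ * q * z) (by simp [hq])
  obtain ⟨Z, hZ⟩ : ∃ Z, z = ω * Z := by
    refine ⟨w * (v8 * B8 - κ * B9), ?_⟩
    have e8 : z = v8 * (ω * B8 - K * x2 * (2 * x + y0 * x2)) := by
      linear_combination (-z) * hv8 - v8 * E8
    have e8' : z * (1 - 3 * κ * q * z) = ω * (v8 * B8 - κ * B9) := by
      subst hκ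
      linear_combination e8 - v8 * K * (2 * x + y0 * x2) * e9
    linear_combination (-z) * hw + w * e8'
  obtain ⟨X2, hX2⟩ : ∃ X2, x2 = ω * X2 := by
    refine ⟨v9 * (-3 * q * z * Z + B9), ?_⟩
    linear_combination e9 - 3 * v9 * q * z * hZ
  obtain ⟨Q1, Q2, hQ, hQ1⟩ : ∃ Q1 Q2, q = x * Q1 + ω * Q2 ∧ ρ Q1 = -2 := by
    refine ⟨-2 * v6 * K * (1 + y1 * x2), v6 * (B6 - 2 * K * y0 * X2), ?_, ?_⟩
    · linear_combination (-q) * hv6 - v6 * E6 - 2 * v6 * K * y0 * hX2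
    · simp [hv6', hK, hx2, rho2]
  obtain ⟨P1, P2, hP, hP1⟩ : ∃ P1 P2, p = x ^ 2 * P1 + ω * P2 ∧ ρ P1 = -1 := by
    refine ⟨-v8 * K, v8 * (B5 - 2 * K * y0 * x * X2), ?_, ?_⟩
    · linear_combination (-p) * hv8 - v8 * E5 - 2 * v8 * K * y0 * x * hX2
    · simp [hv8', hK]
  obtain ⟨Y1, Y2, hY⟩ : ∃ Y1 Y2, y1 = x ^ 3 * Y1 + ω * Y2 := by
    refine ⟨-v * Q1 ^ 3, v * (B4 - (3 * x ^ 2 * Q1 ^ 2 * Q2 + 3 * x * Q1 * ω * Q2 ^ 2 +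
      ω ^ 2 * Q2 ^ 3)), ?_⟩
    have : y1 = v * (-q ^ 3 + ω * B4) := by linear_combination (-y1) * hv - v * E4
    rw [this, hQ]; ring
  obtain ⟨Y3, Y4, hY0⟩ : ∃ Y3 Y4, y0 = x ^ 4 * Y3 + ω * Y4 := by
    refine ⟨-3 * v * P1 * Q1 ^ 2 - 2 * Y1, v * (B3 - 3 * P2 * q ^ 2 - 3 * x ^ 2 * P1 *
      (2 * x * Q1 * Q2 + ω * Q2 ^ 2)) - 2 * x * Y2, ?_⟩
    have : y0 = v * (-3 * p * q ^ 2 + ω * B3) - 2 * y1 * x := by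
      linear_combination (-(y0 + 2 * y1 * x)) * hv - v * E3
    rw [this, hY, hP]
    linear_combination (-3 * v * x ^ 2 * P1) * (q + x * Q1 + ω * Q2) * hQ
  have F1 : ω * s0 * a = x ^ 5 * (x * (K * Y3 + P1 ^ 3)) + ω * (K * x ^ 2 * Y4 +
      3 * x ^ 4 * P1 ^ 2 * P2 + 3 * x ^ 2 * P1 * ω * P2 ^ 2 + ω ^ 2 * P2 ^ 3) := by
    have : ω * s0 * a = K * y0 * x ^ 2 + p ^ 3 := by linear_combination E1
    rw [this, hY0, hP]; ring
  have F2 : ω * (s0 * A + s1 * a') = x ^ 5 * (3 * P1 ^ 2 * Q1 + K * (Y1 + 2 * Y3)) +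
      ω * (3 * q * (2 * x ^ 2 * P1 * P2 + ω * P2 ^ 2) + 3 * x ^ 4 * P1 ^ 2 * Q2 +
        K * (Y2 * x ^ 2 + 2 * Y4 * x)) := by
    have : ω * (s0 * A + s1 * a') = 3 * p ^ 2 * q + K * (y1 * x ^ 2 + 2 * y0 * x) := by
      linear_combination E2
    rw [this, hY0, hY, hP]
    linear_combination (3 * x ^ 4 * P1 ^ 2) * hQ
  have F3 : ω * s2 * a1 = x ^ 5 * 0 + ω * (z ^ 2 * Z + K * x2 * X2) := by
    linear_combination E10 + z ^ 2 * hZ + K * x2 * hX2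
  have key : x ^ 5 ∣ ω := by
    by_cases h0 : ρ s0 = 0
    · by_cases h1 : ρ s1 = 0
      · have h2 : ρ s2 ≠ 0 := by tauto
        obtain ⟨t, ht⟩ := hρ.inv (a := s2 * a1) (by simp [h2, ha1])
        exact hρ.nak (g := ω) (y := x ^ 5) (A := 0) (m := t * (z ^ 2 * Z + K * x2 * X2))
          (by linear_combination (-ω) * ht + t * F3) (by simp [hz, hx2])
      · obtain ⟨t, ht⟩ := hρ.inv (a := s1 * a') (by simp [h1, ha'])
        exact hρ.nak (g := ω) (y := x ^ 5) (A := t * (3 * P1 ^ 2 * Q1 + K * (Y1 + 2 * Y3)))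
          (m := t * (3 * q * (2 * x ^ 2 * P1 * P2 + ω * P2 ^ 2) + 3 * x ^ 4 * P1 ^ 2 * Q2 +
            K * (Y2 * x ^ 2 + 2 * Y4 * x) - s0 * A))
          (by linear_combination (-ω) * ht + t * F2) (by simp [hq, hx, h0])
    · obtain ⟨t, ht⟩ := hρ.inv (a := s0 * a) (by simp [h0, ha])
      exact hρ.nak (g := ω) (y := x ^ 5) (A := t * (x * (K * Y3 + P1 ^ 3)))
        (m := t * (K * x ^ 2 * Y4 +
          3 * x ^ 4 * P1 ^ 2 * P2 + 3 * x ^ 2 * P1 * ω * P2 ^ 2 + ω ^ 2 * P2 ^ 3))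
        (by linear_combination (-ω) * ht + t * F1) (by simp [hω, hx])
  obtain ⟨W, hW⟩ := key
  refine ⟨W, P1 + x ^ 3 * W * P2, Q1 + x ^ 4 * W * Q2, W * Z, hW, ?_, ?_, ?_, ?_, ?_⟩
  · rw [hP]; linear_combination P2 * hW
  · simp [hP1, hx]
  · rw [hQ]; linear_combination Q2 * hW
  · simp [hQ1, hx]
  · rw [hZ]; linear_combination Z * hW

theorem bad1_En (hρ : IsPlace ρ) {x X y ξ Ξ φ ψ f1 g1 c0 c1 c3 muu muo mub moo mob mbb u g
      s0 s1 s3 a a4 a8 A4 A8 A9 B1 B2 B3 B4 B5 B6 B9 B10 BV BW : R}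
    (hy0 : y ≠ 0) (hy : ρ y = 0) (hx : x = y * ξ) (hX : X = y * Ξ) (hξ : ρ ξ ≠ 0 ∨ ρ Ξ ≠ 0)
    (hf1 : f1 = x ^ 2 * φ) (hφ : ρ φ = 1) (hg1 : g1 = x * ψ) (hψ : ρ ψ = 2) (hg : ρ g = 0)
    (hu : ρ u = 0) (ha : ρ a ≠ 0) (ha4 : ρ a4 ≠ 0) (ha8 : ρ a8 ≠ 0)
    (hs : ρ s0 ≠ 0 ∨ ρ s1 ≠ 0 ∨ ρ s3 ≠ 0)
    (U1 : 1 + g * B1 = muu)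
    (U2 : -c3 + g * B2 = muo - f1 * muu)
    (U3 : g * B3 = mub - g1 * muu)
    (U4 : -c0 + g * (s0 * A4 + s1 * B4 + s3 * a4) = moo - f1 * muo)
    (U5 : -c1 + g * B5 = mob - f1 * mub - g1 * muo)
    (U6 : -c3 + g * B6 = mbb - g1 * mub)
    (U7 : g * s0 * a = - f1 * moo)
    (U8 : g * (s0 * A8 + s1 * a8) = - f1 * mob - g1 * moo)
    (U9 : -c0 + g * (s0 * A9 + s1 * B9) = - f1 * mbb - g1 * mob)
    (U10 : -c1 + g * B10 = - g1 * mbb)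
    (K1 : 2 * moo + mob * X + muo * u = 0)
    (K2 : mob + 2 * mbb * X + mub * u = 0)
    (K3 : muo + mub * X + 2 * muu * u = 0)
    (V : X ^ 2 + u = g * BV + x ^ 5 * BW) :
    (4 * mbb * muu - mub ^ 2) ∣ y ^ 2 ∧ y ^ 2 ∣ u := by
  have key : y ^ 4 ∣ g := by
    obtain ⟨u1, u2, hu12⟩ : ∃ u1 u2, u = y ^ 2 * u1 + g * u2 :=
      ⟨-Ξ ^ 2 + y ^ 3 * ξ ^ 5 * BW, BV, by subst hx hX; linear_combination V⟩
    obtain ⟨b1, hb⟩ : ∃ b1, mub = y * b1 + g * B3 :=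
      ⟨ξ * ψ * muu, by subst hg1 hx; linear_combination -U3⟩
    obtain ⟨o1, o2, ho⟩ : ∃ o1 o2, muo = y ^ 2 * o1 + g * o2 :=
      ⟨-b1 * Ξ - 2 * muu * u1, -B3 * X - 2 * muu * u2, by
        subst hX; linear_combination K3 - y * Ξ * hb - 2 * muu * hu12⟩
    obtain ⟨w1, w2, hw⟩ : ∃ w1 w2, mbb = y ^ 2 * w1 + g * w2 := by
      refine ⟨ξ * ψ * b1 - ξ ^ 2 * φ * muu + o1, g1 * B3 + o2 - B2 + B6, ?_⟩
      subst hf1 hg1 hx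
      linear_combination ho + (y * ξ * ψ) * hb - U6 + U2
    obtain ⟨h1, h2, hh, hh2⟩ : ∃ h1 h2, mob = y ^ 3 * h1 + g * h2 ∧ ρ h2 = 0 := by
      refine ⟨-2 * w1 * Ξ - b1 * u1, -2 * w2 * X - b1 * y * u2 - B3 * u, ?_, ?_⟩
      · subst hX; linear_combination K2 - 2 * y * Ξ * hw - u * hb - y * b1 * hu12
      · simp [hX, hy, hu]
    obtain ⟨n1, n2, hn, hn2⟩ : ∃ n1 n2, 2 * moo = y ^ 4 * n1 + g * n2 ∧ ρ n2 = 0 := by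
      refine ⟨-h1 * Ξ - o1 * u1, -(h2 * X + y ^ 2 * o1 * u2 + o2 * u), ?_, ?_⟩
      · subst hX; linear_combination K1 - y * Ξ * hh - u * ho - y ^ 2 * o1 * hu12
      · simp [hX, hy, hu]
    have hxr : ρ x = 0 := by simp [hx, hy]
    have F7 : g * (s0 * (2 * a)) = y ^ 4 * (- f1 * n1) + g * (-f1 * n2) := by
      linear_combination 2 * U7 - f1 * hn
    have F8 : g * (2 * s0 * A8 + s1 * (2 * a8)) =
        y ^ 4 * (-2 * ξ ^ 2 * φ * y * h1 - g1 * n1) + g * (-2 * f1 * h2 - g1 * n2) := by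
      linear_combination 2 * U8 - 2 * f1 * hh - g1 * hn - 2 * y ^ 3 * h1 * hf1 -
        2 * y ^ 3 * h1 * φ * (x + y * ξ) * hx
    have F4 : g * (2 * s0 * (A4 - A9) + 2 * s1 * (B4 - B9) + s3 * (2 * a4)) =
        y ^ 4 * (n1 - 2 * ξ ^ 2 * φ * o1 + 2 * ξ ^ 2 * φ * w1 + 2 * ξ * ψ * h1) +
        g * (n2 - 2 * f1 * o2 + 2 * f1 * w2 + 2 * g1 * h2) := by
      subst hf1 hg1 hx
      linear_combination 2 * U4 - 2 * U9 + hn - 2 * (y * ξ) ^ 2 * φ * ho +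
        2 * (y * ξ) ^ 2 * φ * hw + 2 * (y * ξ * ψ) * hh
    by_cases h0 : ρ s0 = 0
    · by_cases h1' : ρ s1 = 0
      · have h3 : ρ s3 ≠ 0 := by tauto
        obtain ⟨t, ht⟩ := hρ.inv (a := s3 * (2 * a4)) (by simp [h3, ha4, rho2])
        refine hρ.nak (g := g) (y := y ^ 4)
          (A := t * (n1 - 2 * ξ ^ 2 * φ * o1 + 2 * ξ ^ 2 * φ * w1 + 2 * ξ * ψ * h1))
          (m := t * (n2 - 2 * f1 * o2 + 2 * f1 * w2 + 2 * g1 * h2 - 2 * s0 * (A4 - A9) -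
            2 * s1 * (B4 - B9)))
          (by linear_combination (-g) * ht + t * F4) (by simp [hn2, hf1, hg1, hxr, h0, h1'])
      · obtain ⟨t, ht⟩ := hρ.inv (a := s1 * (2 * a8)) (by simp [h1', ha8, rho2])
        refine hρ.nak (g := g) (y := y ^ 4)
          (A := t * (-2 * ξ ^ 2 * φ * y * h1 - g1 * n1))
          (m := t * (-2 * f1 * h2 - g1 * n2 - 2 * s0 * A8))
          (by linear_combination (-g) * ht + t * F8) (by simp [hf1, hg1, hxr, h0])
    · obtain ⟨t, ht⟩ := hρ.inv (a := s0 * (2 * a)) (by simp [h0, ha, rho2])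
      refine hρ.nak (g := g) (y := y ^ 4) (A := t * (- f1 * n1)) (m := t * (-f1 * n2))
        (by linear_combination (-g) * ht + t * F7) (by simp [hf1, hxr])
  obtain ⟨G, hG⟩ := key
  obtain ⟨b, hb, hb'⟩ : ∃ b, mub = y * b ∧ ρ b = 2 * ρ ξ := by
    refine ⟨ξ * ψ * muu + y ^ 3 * G * B3, ?_, ?_⟩
    · subst hg1 hx; linear_combination -U3 + B3 * hG
    · simp [← U1, hg, hy, hψ]; ring
  have hmuu : ρ muu = 1 := by simp [← U1, hg]
  obtain ⟨u', hu', hu''⟩ : ∃ u', u = y ^ 2 * u' ∧ ρ u' = - ρ Ξ ^ 2 := by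
    refine ⟨-Ξ ^ 2 + y ^ 2 * G * BV + y ^ 3 * ξ ^ 5 * BW, ?_, ?_⟩
    · subst hx hX; linear_combination V + BV * hG
    · simp [hy]
  obtain ⟨o', ho', ho''⟩ : ∃ o', muo = y ^ 2 * o' ∧ ρ o' = -2 * ρ ξ * ρ Ξ + 2 * ρ Ξ ^ 2 := by
    refine ⟨-b * Ξ - 2 * muu * u', ?_, ?_⟩
    · subst hX; linear_combination K3 - y * Ξ * hb - 2 * muu * hu'
    · simp [hb', hmuu, hu'', rho2]
  obtain ⟨w', hw', hw''⟩ : ∃ w', mbb = y ^ 2 * w' ∧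
      ρ w' = 3 * ρ ξ ^ 2 - 2 * ρ ξ * ρ Ξ + 2 * ρ Ξ ^ 2 := by
    refine ⟨ξ * ψ * b - ξ ^ 2 * φ * muu + o' - y ^ 2 * G * B2 + y ^ 2 * G * B6, ?_, ?_⟩
    · subst hf1 hg1 hx
      linear_combination ho' + (y * ξ * ψ) * hb - U6 + U2 + (B6 - B2) * hG
    · simp [hψ, hb', hφ, hmuu, ho'', hy]; ring
  have h1 : mob = y ^ 3 * (-2 * w' * Ξ - b * u') := by
    subst hX; linear_combination K2 - 2 * y * Ξ * hw' - u * hb - y * b * hu'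
  have h2 : mob = y ^ 3 * (ξ ^ 2 * φ * b + ξ * ψ * o' - ξ * ψ * w' + y * G * (B5 - B10)) := by
    subst hf1 hg1 hx
    linear_combination -U5 + U10 + (y * ξ) ^ 2 * φ * hb + y * ξ * ψ * ho' - y * ξ * ψ * hw' +
      (B5 - B10) * hG
  have h3 : -2 * w' * Ξ - b * u' = ξ ^ 2 * φ * b + ξ * ψ * o' - ξ * ψ * w' + y * G * (B5 - B10) :=
    mul_left_cancel₀ (pow_ne_zero 3 hy0) (h1.symm.trans h2)
  have h4 := congrArg ρ h3
  simp only [map_sub, map_add, map_mul, map_neg, map_pow, rho2, hw'', hb', hu'', hφ, hψ, ho'',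
    hy] at h4
  refine ⟨?_, ⟨u', hu'⟩⟩
  have he : 4 * mbb * muu - mub ^ 2 = y ^ 2 * (4 * w' * muu - b ^ 2) := by rw [hw', hb]; ring
  have hr : ρ (4 * w' * muu - b ^ 2) ≠ 0 := by
    simp only [map_sub, map_mul, map_pow, rho4, hw'', hmuu, hb']
    intro h5
    have hξ0 : ρ ξ ^ 3 = 0 := by linear_combination (1 / 8) * (2 * ρ Ξ - ρ ξ) * h5 + (1/2) * h4
    have hξ1 : ρ ξ = 0 := by simpa using hξ0
    have hΞ0 : ρ Ξ = 0 := by rw [hξ1] at h5; simpa using h5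
    tauto
  obtain ⟨v, hv⟩ := hρ.inv hr
  exact ⟨v, by rw [he]; linear_combination (-y ^ 2) * hv⟩


theorem bad2_En (hρ : IsPlace ρ) {ι X Y K f1 f2 g1 g2 c0 c1 c3 g
      s0 s1 s3 a a4 a8 A4 A8 A9 B1 B2 B3 B4 B5 B6 B9 B10 : R}
    (hι0 : ι ≠ 0) (hι : ρ ι = 0) (hf2 : f2 = ι * X) (hg2 : g2 ^ 2 = ι * Y)
    (hg : ρ g = 0) (hg2' : ρ g2 = 0) (ha : ρ a ≠ 0) (ha4 : ρ a4 ≠ 0) (ha8 : ρ a8 ≠ 0)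
    (hs : ρ s0 ≠ 0 ∨ ρ s1 ≠ 0 ∨ ρ s3 ≠ 0)
    (U1 : 1 + g * B1 = K)
    (U2 : -c3 + g * B2 = -K * (2 * f2 + f1))
    (U3 : g * B3 = -K * (2 * g2 + g1))
    (U4 : -c0 + g * (s0 * A4 + s1 * B4 + s3 * a4) = K * (f2 ^ 2 + 2 * f1 * f2))
    (U5 : -c1 + g * B5 = K * (2 * f2 * g2 + 2 * f1 * g2 + 2 * g1 * f2))
    (U6 : -c3 + g * B6 = K * (g2 ^ 2 + 2 * g1 * g2))
    (U7 : g * s0 * a = - K * (f1 * f2 ^ 2))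
    (U8 : g * (s0 * A8 + s1 * a8) = - K * (2 * f1 * f2 * g2 + g1 * f2 ^ 2))
    (U9 : -c0 + g * (s0 * A9 + s1 * B9) = - K * (f1 * g2 ^ 2 + 2 * g1 * f2 * g2))
    (U10 : -c1 + g * B10 = - K * (g1 * g2 ^ 2)) :
    ∃ G F1 G1 C0 C1 C3, g = ι ^ 2 * G ∧ f1 = 3 * g2 ^ 2 - 2 * f2 + ι ^ 2 * F1 ∧
      g1 = -2 * g2 + ι ^ 2 * G1 ∧ c0 = ι ^ 2 * C0 ∧ c1 = -2 * g2 ^ 3 + ι ^ 2 * C1 ∧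
      c3 = 3 * g2 ^ 2 + ι ^ 2 * C3 ∧ ρ Y * (2 * ρ Y - 3 * ρ X) = 0 := by
  have hK : ρ K = 1 := by simp [← U1, hg]
  have hf2' : ρ f2 = 0 := by simp [hf2, hι]
  obtain ⟨v, hv, hv'⟩ := hρ.inv_one (a := K) hK
  obtain ⟨Sg, hSg⟩ : ∃ Sg, g1 = -2 * g2 + g * Sg :=
    ⟨-v * B3, by linear_combination (-(2 * g2 + g1)) * hv + v * U3⟩
  obtain ⟨Sc, hSc⟩ : ∃ Sc, c3 = 3 * g2 ^ 2 + g * Sc :=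
    ⟨B6 + 3 * B1 * g2 ^ 2 - 2 * K * g2 * Sg, by
      linear_combination -U6 - 2 * K * g2 * hSg - 3 * g2 ^ 2 * U1⟩
  obtain ⟨Sf, hSf⟩ : ∃ Sf, f1 = 3 * g2 ^ 2 - 2 * f2 + g * Sf :=
    ⟨v * (Sc - B2) - 3 * v * B1 * g2 ^ 2, by
      linear_combination (-(2 * f2 + f1) + 3 * g2 ^ 2) * hv + v * U2 + v * hSc + 3 * v * g2 ^ 2 * U1⟩
  have key : ι ^ 2 ∣ g := by
    have F7 : g * (s0 * a) = ι ^ 2 * (-K * f1 * X ^ 2) + g * 0 := by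
      subst hf2; linear_combination U7
    have F8 : g * (s0 * A8 + s1 * a8) =
        ι ^ 2 * (-K * (2 * (3 * Y - 2 * X) * X * g2 + g1 * X ^ 2)) + g * (-2 * K * Sf * f2 * g2) := by
      have : f1 = ι * (3 * Y - 2 * X) + g * Sf := by subst hf2; linear_combination hSf + 3 * hg2
      rw [U8, this, hf2]; ring
    have F4 : g * (s0 * (A4 - A9) + s1 * (B4 - B9) + s3 * a4) =
        ι ^ 2 * (K * (X ^ 2 + 2 * (3 * Y - 2 * X) * X + (3 * Y - 2 * X) * Y - 4 * X * Y)) +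
          g * (K * (2 * Sf * f2 + Sf * g2 ^ 2 + 2 * Sg * f2 * g2)) := by
      have : f1 = ι * (3 * Y - 2 * X) + g * Sf := by subst hf2; linear_combination hSf + 3 * hg2
      have h1 : g * (s0 * (A4 - A9) + s1 * (B4 - B9) + s3 * a4) =
        K * (f2 ^ 2 + 2 * f1 * f2 + f1 * g2 ^ 2 + 2 * g1 * f2 * g2) := by
        linear_combination U4 - U9
      rw [h1, this, hSg, hf2]
      linear_combination (K * ι * (3 * Y - 2 * X) - 4 * K * ι * X) * hg2
    by_cases h0 : ρ s0 = 0
    · by_cases h1' : ρ s1 = 0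
      · have h3 : ρ s3 ≠ 0 := by tauto
        obtain ⟨t, ht⟩ := hρ.inv (a := s3 * a4) (by simp [h3, ha4])
        exact hρ.nak (g := g) (y := ι ^ 2)
          (A := t * (K * (X ^ 2 + 2 * (3 * Y - 2 * X) * X + (3 * Y - 2 * X) * Y - 4 * X * Y)))
          (m := t * (K * (2 * Sf * f2 + Sf * g2 ^ 2 + 2 * Sg * f2 * g2) - s0 * (A4 - A9) -
            s1 * (B4 - B9)))
          (by linear_combination (-g) * ht + t * F4) (by simp [h0, h1', hf2', hg2'])
      · obtain ⟨t, ht⟩ := hρ.inv (a := s1 * a8) (by simp [h1', ha8])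
        exact hρ.nak (g := g) (y := ι ^ 2)
          (A := t * (-K * (2 * (3 * Y - 2 * X) * X * g2 + g1 * X ^ 2)))
          (m := t * (-2 * K * Sf * f2 * g2 - s0 * A8))
          (by linear_combination (-g) * ht + t * F8) (by simp [h0, hf2'])
    · obtain ⟨t, ht⟩ := hρ.inv (a := s0 * a) (by simp [h0, ha])
      exact hρ.nak (g := g) (y := ι ^ 2) (A := t * (-K * f1 * X ^ 2)) (m := 0)
        (by linear_combination (-g) * ht + t * F7) (by simp)
  obtain ⟨G, hG⟩ := key
  have hf1 : f1 = ι * (3 * Y - 2 * X) + ι ^ 2 * (G * Sf) := by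
    subst hf2; linear_combination hSf + 3 * hg2 + Sf * hG
  have hc1 : c1 = -2 * g2 ^ 3 + ι ^ 2 * (G * B10 + K * G * Sg * g2 ^ 2 - 2 * G * B1 * g2 ^ 3) := by
    linear_combination -U10 + K * g2 ^ 2 * hSg + (B10 + K * Sg * g2 ^ 2 - 2 * B1 * g2 ^ 3) * hG +
      2 * g2 ^ 3 * U1
  refine ⟨G, G * Sf, G * Sg, G * (s0 * A9 + s1 * B9) + K * ((3 * Y - 2 * X) * Y + ι * G * Sf * Y +
    2 * (-2 * X * Y + X * ι * G * Sg * g2)), _, G * Sc, hG, ?_, ?_, ?_, hc1, ?_, ?_⟩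
  · linear_combination hSf + Sf * hG
  · linear_combination hSg + Sg * hG
  · have : c0 = g * (s0 * A9 + s1 * B9) + K * (f1 * g2 ^ 2 + 2 * g1 * f2 * g2) := by
      linear_combination -U9
    rw [this, hf1, hSg, hf2, hG]
    linear_combination (K * ι * (3 * Y - 2 * X) + K * ι ^ 2 * (G * Sf) - 4 * K * ι * X) * hg2
  · linear_combination hSc + Sc * hG
  · obtain ⟨C1, hC1⟩ : ∃ C1, c1 = -2 * g2 ^ 3 + ι ^ 2 * C1 := ⟨_, hc1⟩
    obtain ⟨W, hW⟩ : ∃ W, 2 * (g2 * (2 * Y - 3 * X)) = ι * W := by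
      refine ⟨G * B5 - C1 - G * B1 * (2 * f2 * g2 + 2 * f1 * g2 + 2 * g1 * f2) - 2 * G * Sf * g2 -
        2 * G * Sg * f2, mul_left_cancel₀ hι0 ?_⟩
      linear_combination -U5 - hC1 + (2 * f2 * g2 + 2 * f1 * g2 + 2 * g1 * f2) * U1 -
        2 * g2 * hSf - 2 * f2 * hSg + (B5 - B1 * (2 * f2 * g2 + 2 * f1 * g2 + 2 * g1 * f2) -
          2 * Sf * g2 - 2 * Sg * f2) * hG - 4 * g2 * hg2 + 6 * g2 * hf2
    have h1 : 4 * (Y * (2 * Y - 3 * X) ^ 2) = ι * W ^ 2 := by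
      have : ι * (4 * (Y * (2 * Y - 3 * X) ^ 2)) = ι * (ι * W ^ 2) := by
        linear_combination (-4 * (2 * Y - 3 * X) ^ 2) * hg2 + (2 * g2 * (2 * Y - 3 * X) + ι * W) * hW
      exact mul_left_cancel₀ hι0 this
    have h2 := congrArg ρ h1
    simp only [map_mul, map_pow, map_sub, rho2, rho3, rho4, hι] at h2
    simp at h2
    rcases h2 with h2 | h2 <;> simp [h2]

theorem bad2_Em (hρ : IsPlace ρ) {ι X Y Tt f1 f2 g1 g2 c0 c1 c3 g G F1 G1 C0 C1 C3 s0 s1 s3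
      p q z y0 y1 τo tb tw tu t0 t1 t2 noo nob nbb now nbw nww
      moo mob mbb mwo mwb mww e co cb cw : R}
    (hι : ρ ι = 0) (hf2 : f2 = ι * X) (hg2 : g2 ^ 2 = ι * Y) (htw : tw = ι * Tt)
    (hprim : ρ X ≠ 0 ∨ ρ Y ≠ 0 ∨ ρ Tt ≠ 0) (hg2' : ρ g2 = 0) (hz : ρ z = 0)
    (hG : g = ι ^ 2 * G) (hf1 : f1 = 3 * g2 ^ 2 - 2 * f2 + ι ^ 2 * F1)
    (hg1 : g1 = -2 * g2 + ι ^ 2 * G1) (hc0 : c0 = ι ^ 2 * C0)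
    (hc1 : c1 = -2 * g2 ^ 3 + ι ^ 2 * C1) (hc3 : c3 = 3 * g2 ^ 2 + ι ^ 2 * C3)
    (hXY : ρ Y * (2 * ρ Y - 3 * ρ X) = 0)
    (hto : τo = g * s0 + c0 * tw) (htb : tb = g * s1 + c1 * tw) (htu : tu = g * s3 + c3 * tw)
    (hy0 : y0 = c0 + c3 * f1) (hy1 : y1 = c1 + c3 * g1) (hp : p = -f1 + z * y0)
    (hq : q = -g1 + z * y1) (ht0 : t0 = τo - p * tu) (ht1 : t1 = tb - q * tu)
    (ht2 : t2 = tw - z * tu) (hnoo : ρ noo ≠ 0) (hnww : ρ nww ≠ 0)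
    (E5 : -p - 3 * p ^ 2 * z + (t0 * now + t2 * noo) = moo + y0 * mwo)
    (E6 : -q - 6 * p * q * z + (t0 * nbw + t1 * now + t2 * nob) = mob + y0 * mwb + y1 * mwo)
    (E7 : 1 - 3 * q ^ 2 * z + (t1 * nbw + t2 * nbb) = mbb + y1 * mwb)
    (E8 : -z - 3 * p * z ^ 2 + (t0 * nww + t2 * now) = mwo + y0 * mww)
    (E9 : -3 * q * z ^ 2 + (t1 * nww + t2 * nbw) = mwb + y1 * mww)
    (E10 : -z ^ 3 + t2 * nww = mww)
    (K1 : 2 * mww * cw + mwo * co + mwb * cb = 0)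
    (K2 : mwo * cw + 2 * moo * co + mob * cb = 0)
    (K3 : mwb * cw + mob * co + 2 * mbb * cb = 0)
    (Aw : 4 * moo * mbb - mob ^ 2 = e * cw ^ 2)
    (Ao : 4 * mbb * mww - mwb ^ 2 = e * co ^ 2)
    (hc : ρ co ≠ 0 ∨ ρ cw ≠ 0) :
    e ∣ ι := by
  -- everything modulo `ι`
  obtain ⟨Y0, hY0, hY0'⟩ : ∃ Y0, y0 = ι * Y0 ∧ ρ Y0 = 0 := by
    refine ⟨ι * C0 + 3 * Y * f1 + ι * C3 * f1, ?_, ?_⟩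
    · rw [hy0, hc0, hc3]; linear_combination 3 * f1 * hg2
    · simp [hι, hf1, hg2', hf2]
  obtain ⟨Y1, hY1, hY1'⟩ : ∃ Y1, y1 = ι * Y1 ∧ ρ Y1 = 0 := by
    refine ⟨-2 * g2 * Y + ι * C1 + 3 * Y * g1 + ι * C3 * g1, ?_, ?_⟩
    · rw [hy1, hc1, hc3]; linear_combination (3 * g1 - 2 * g2) * hg2
    · simp [hι, hg1, hg2']
  obtain ⟨P, hP, hP'⟩ : ∃ P, p = ι * P ∧ ρ P = 2 * ρ X - 3 * ρ Y := by
    refine ⟨2 * X - 3 * Y - ι * F1 + z * Y0, ?_, ?_⟩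
    · rw [hp, hf1, hY0]; linear_combination 2 * hf2 - 3 * hg2
    · simp [hι, hz, rho2, rho3]
  obtain ⟨Q, hQ, hQ'⟩ : ∃ Q, q = 2 * g2 + ι * Q ∧ ρ Q = 0 := by
    refine ⟨- ι * G1 + z * Y1, ?_, ?_⟩
    · rw [hq, hg1, hY1]; ring
    · simp [hι, hz]
  have hq0 : ρ q = 0 := by simp [hQ, hg2', hι]
  obtain ⟨TU, hTU⟩ : ∃ TU, tu = ι ^ 2 * TU := by
    refine ⟨G * s3 + (3 * Y + ι * C3) * Tt, ?_⟩
    rw [htu, hc3, htw, hG]; linear_combination 3 * ι * Tt * hg2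
  obtain ⟨T0, hT0⟩ : ∃ T0, t0 = ι ^ 2 * T0 := by
    refine ⟨G * s0 + C0 * tw - p * TU, ?_⟩
    rw [ht0, hto, hTU, hG, hc0]; ring
  obtain ⟨T1, hT1⟩ : ∃ T1, t1 = ι ^ 2 * T1 := by
    refine ⟨G * s1 - 2 * g2 * Y * Tt + C1 * tw - q * TU, ?_⟩
    rw [ht1, htb, hTU, hG, hc1, htw]; linear_combination (-2 * g2 * ι * Tt) * hg2
  obtain ⟨T2, hT2, hT2'⟩ : ∃ T2, t2 = ι * T2 ∧ ρ T2 = ρ Tt := by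
    refine ⟨Tt - z * ι * TU, ?_, ?_⟩
    · rw [ht2, hTU, htw]; ring
    · simp [hι]
  obtain ⟨Moo, hMoo, hMoo'⟩ : ∃ M, moo = ι * M ∧
      ρ M = 3 * ρ Y - 2 * ρ X + ρ noo * ρ Tt := by
    refine ⟨-P - 3 * p * P * z + (ι * T0 * now + T2 * noo) - Y0 * mwo, ?_,
      by simp [hz, hι, hP', hT2', hY0']; ring⟩
    linear_combination -E5 + now * hT0 + noo * hT2 - mwo * hY0 - (1 + 3 * p * z) * hP
  obtain ⟨Mob, hMob⟩ : ∃ M, mob = -2 * g2 + ι * M := by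
    refine ⟨-Q - 6 * P * q * z + (ι * T0 * nbw + ι * T1 * now + T2 * nob) - Y0 * mwb - Y1 * mwo, ?_⟩
    linear_combination -E6 + nbw * hT0 + now * hT1 + nob * hT2 - mwb * hY0 - mwo * hY1 -
      hQ - 6 * q * z * hP
  have hmbb : ρ mbb = 1 := by
    have := congrArg ρ E7
    simp [hz, hT1, hT2, hι, hY1] at this
    exact this.symm
  obtain ⟨Mwo, hMwo⟩ : ∃ M, mwo = -z + ι * M := by
    refine ⟨-3 * P * z ^ 2 + (ι * T0 * nww + T2 * now) - Y0 * mww, ?_⟩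
    linear_combination -E8 + nww * hT0 + now * hT2 - mww * hY0 - 3 * z ^ 2 * hP
  obtain ⟨Mwb, hMwb⟩ : ∃ M, mwb = -3 * q * z ^ 2 + ι * M := by
    refine ⟨(ι * T1 * nww + T2 * nbw) - Y1 * mww, ?_⟩
    linear_combination -E9 + nww * hT1 + nbw * hT2 - mww * hY1
  obtain ⟨Mb2, hMb2⟩ : ∃ M, mob ^ 2 = ι * M :=
    ⟨4 * Y - 4 * g2 * Mob + ι * Mob ^ 2, by rw [hMob]; linear_combination 4 * hg2⟩
  have hzι : ι ∣ z := by
    rcases hc with hc | hc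
    · obtain ⟨t, ht⟩ := hρ.inv hc
      refine hρ.nak (g := z) (y := ι) (A := t * (2 * T2 * nww * cw + Mwo * co + Mwb * cb))
        (m := t * (-2 * z ^ 2 * cw - 3 * q * z * cb)) ?_ (by simp [hz])
      rw [← E10, hMwo, hMwb, hT2] at K1
      linear_combination (-z) * ht - t * K1
    · obtain ⟨t, ht⟩ := hρ.inv (a := 2 * cw * mbb) (by simp [hc, hmbb, rho2])
      refine hρ.nak (g := z) (y := ι)
        (A := t * (2 * mbb * Mwo * cw + 4 * mbb * Moo * co - mob * Mwb * cw - Mb2 * co))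
        (m := t * (3 * mob * q * z * cw)) ?_ (by simp [hz])
      have h1 : 2 * mbb * (mwo * cw + 2 * moo * co) - mob * (mwb * cw) - mob ^ 2 * co = 0 := by
        linear_combination 2 * mbb * K2 - mob * K3
      rw [hMoo, hMb2, hMwb, hMwo] at h1
      linear_combination (-z) * ht - t * h1
  obtain ⟨Z, hZ⟩ := hzι
  obtain ⟨Mww, hMww, hMww'⟩ : ∃ M, mww = ι * M ∧ ρ M = ρ Tt * ρ nww := by
    refine ⟨-z ^ 2 * Z + T2 * nww, ?_, ?_⟩
    · rw [← E10, hT2]; linear_combination (-z ^ 2) * hZ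
    · simp [hz, hT2']
  obtain ⟨Mwb', hMwb'⟩ : ∃ M, mwb = ι * M :=
    ⟨-3 * q * z * Z + Mwb, by rw [hMwb]; linear_combination (-3 * q * z) * hZ⟩
  have hMwo0 : ρ mwo = 0 := by simp [hMwo, hz, hι]
  obtain ⟨Aw', hAw, hAw'⟩ : ∃ A, e * cw ^ 2 = ι * A ∧
      ρ A = 4 * (2 * ρ Y - 2 * ρ X + ρ noo * ρ Tt) := by
    refine ⟨4 * mbb * Moo - (4 * Y - 4 * g2 * Mob + ι * Mob ^ 2), ?_, ?_⟩
    · rw [← Aw, hMoo, hMob]; linear_combination (-4) * hg2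
    · simp [hmbb, hMoo', hg2', hι, rho4]; ring
  obtain ⟨Ao', hAo, hAo'⟩ : ∃ A, e * co ^ 2 = ι * A ∧ ρ A = 4 * (ρ nww * ρ Tt) := by
    refine ⟨4 * mbb * Mww - ι * Mwb' ^ 2, ?_, ?_⟩
    · rw [← Ao, hMww, hMwb']; ring
    · simp [hmbb, hι, hMww', rho4]; ring
  have fin : ∀ E, e = ι * E → ι ≠ 0 → e ∣ ι := by
    intro E hE hι0
    have hw : E * cw ^ 2 = Aw' := mul_left_cancel₀ hι0 (by linear_combination hAw - cw ^ 2 * hE)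
    have ho : E * co ^ 2 = Ao' := mul_left_cancel₀ hι0 (by linear_combination hAo - co ^ 2 * hE)
    have hE0 : ρ E ≠ 0 := by
      intro h0
      have h1 : ρ Tt = 0 := by rw [← ho] at hAo'; simpa [h0, hnww] using hAo'
      have h2 : ρ Y = ρ X := by
        rw [← hw] at hAw'
        simp only [map_mul, map_pow, h0, h1] at hAw'
        linear_combination (-1 / 8) * hAw'
      have h3 : ρ X = 0 := by
        rw [h2] at hXY
        have : ρ X ^ 2 = 0 := by linear_combination -hXY
        simpa using this
      simp [h1, h2, h3] at hprim
    obtain ⟨v, hv⟩ := hρ.inv hE0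
    exact ⟨v, by rw [hE]; linear_combination (-ι) * hv⟩
  by_cases hι0 : ι = 0
  · simp [hι0]
  rcases hc with hc | hc
  · obtain ⟨t, ht⟩ := hρ.inv (a := co ^ 2) (by simpa using hc)
    exact fin (Ao' * t) (by linear_combination (-e) * ht + t * hAo) hι0
  · obtain ⟨t, ht⟩ := hρ.inv (a := cw ^ 2) (by simpa using hc)
    exact fin (Aw' * t) (by linear_combination (-e) * ht + t * hAw) hι0
end Bad

/-! ### Reduction at a place -/

section LI
variable {k : Type} [Field k]

theorem li1_iff {a : Vec k} : LinIndep k ![a] ↔ a ≠ 0 := by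
  rw [Fintype.linearIndependent_iff]
  constructor
  · rintro h rfl
    simpa using h (fun _ => 1) (by simp) 0
  · intro h g hg i
    fin_cases i
    simpa [h] using hg

theorem li2_iff {a b : Vec k} : LinIndep k ![a, b] ↔
    ∀ x y : k, x • a + y • b = 0 → x = 0 ∧ y = 0 := LinearIndependent.pair_iff

theorem li3_iff {a b c : Vec k} : LinIndep k ![a, b, c] ↔
    ∀ x y z : k, x • a + y • b + z • c = 0 → x = 0 ∧ y = 0 ∧ z = 0 := by
  rw [Fintype.linearIndependent_iff]
  constructor
  · intro h x y z hx
    have := h ![x, y, z] (by simpa [Fin.sum_univ_succ, add_assoc] using hx)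
    exact ⟨this 0, this 1, this 2⟩
  · intro h g hg i
    have := h (g 0) (g 1) (g 2) (by simpa [Fin.sum_univ_succ, add_assoc] using hg)
    fin_cases i
    exacts [this.1, this.2.1, this.2.2]

theorem li4_iff {a b c d : Vec k} : LinIndep k ![a, b, c, d] ↔
    ∀ x y z w : k, x • a + y • b + z • c + w • d = 0 → x = 0 ∧ y = 0 ∧ z = 0 ∧ w = 0 := by
  rw [Fintype.linearIndependent_iff]
  constructor
  · intro h x y z w hx
    have := h ![x, y, z, w] (by simpa [Fin.sum_univ_succ, add_assoc] using hx)
    exact ⟨this 0, this 1, this 2, this 3⟩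
  · intro h g hg i
    have := h (g 0) (g 1) (g 2) (g 3) (by simpa [Fin.sum_univ_succ, add_assoc] using hg)
    fin_cases i
    exacts [this.1, this.2.1, this.2.2.1, this.2.2.2]

theorem li5_iff {a b c d e : Vec k} : LinIndep k ![a, b, c, d, e] ↔
    ∀ x y z w u : k, x • a + y • b + z • c + w • d + u • e = 0 →
      x = 0 ∧ y = 0 ∧ z = 0 ∧ w = 0 ∧ u = 0 := by
  rw [Fintype.linearIndependent_iff]
  constructor
  · intro h x y z w u hx
    have := h ![x, y, z, w, u] (by simpa [Fin.sum_univ_succ, add_assoc] using hx)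
    exact ⟨this 0, this 1, this 2, this 3, this 4⟩
  · intro h g hg i
    have := h (g 0) (g 1) (g 2) (g 3) (g 4) (by simpa [Fin.sum_univ_succ, add_assoc] using hg)
    fin_cases i
    exacts [this.1, this.2.1, this.2.2.1, this.2.2.2.1, this.2.2.2.2]

/-- four independent vectors and a fifth one completing the basis -/
theorem exists_ext {n : ℕ} (e : Fin n → Vec k) (he : LinIndep k e) (hn : n < 5) :
    ∃ v, ∀ (a : k) (b : Fin n → k), a • v + ∑ i, b i • e i = 0 → a = 0 ∧ b = 0 := by
  have h1 : Submodule.span k (Set.range e) ≠ ⊤ := by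
    intro h
    have h2 := finrank_span_eq_card he
    rw [h, finrank_top] at h2
    simp at h2; omega
  obtain ⟨v, hv⟩ : ∃ v, v ∉ Submodule.span k (Set.range e) := by
    by_contra hcon; push Not at hcon
    exact h1 (eq_top_iff.2 fun v _ => hcon v)
  refine ⟨v, fun a b hab => ?_⟩
  have ha : a = 0 := by
    by_contra ha
    apply hv
    have h3 : v = ∑ i, (-(a⁻¹ * b i)) • e i := by
      have h4 : a • v = - ∑ i, b i • e i := eq_neg_of_add_eq_zero_left hab
      have h5 : v = a⁻¹ • (a • v) := by rw [smul_smul, inv_mul_cancel₀ ha, one_smul]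
      rw [h5, h4, smul_neg, Finset.smul_sum, ← Finset.sum_neg_distrib]
      refine Finset.sum_congr rfl fun i _ => ?_
      rw [smul_smul, neg_smul]
    rw [h3]
    exact Submodule.sum_mem _ fun i _ => Submodule.smul_mem _ _ (Submodule.subset_span ⟨i, rfl⟩)
  refine ⟨ha, ?_⟩
  subst ha
  ext i
  exact Fintype.linearIndependent_iff.1 he b (by simpa using hab) i

theorem exists_ext2 {a b : Vec k} (h : LinIndep k ![a, b]) :
    ∃ c, LinIndep k ![a, b, c] := by
  obtain ⟨v, hv⟩ := exists_ext _ h (by norm_num)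
  refine ⟨v, li3_iff.2 fun x y z hx => ?_⟩
  have := hv z ![x, y] (by rw [← hx]; simp [Fin.sum_univ_succ]; abel)
  exact ⟨congrFun this.2 0, congrFun this.2 1, this.1⟩

theorem exists_ext3 {a b c : Vec k} (h : LinIndep k ![a, b, c]) :
    ∃ d, LinIndep k ![a, b, c, d] := by
  obtain ⟨v, hv⟩ := exists_ext _ h (by norm_num)
  refine ⟨v, li4_iff.2 fun x y z w hx => ?_⟩
  have := hv w ![x, y, z] (by rw [← hx]; simp [Fin.sum_univ_succ]; abel)
  exact ⟨congrFun this.2 0, congrFun this.2 1, congrFun this.2 2, this.1⟩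

theorem exists_ext4 {a b c d : Vec k} (h : LinIndep k ![a, b, c, d]) :
    ∃ e, LinIndep k ![a, b, c, d, e] := by
  obtain ⟨v, hv⟩ := exists_ext _ h (by norm_num)
  refine ⟨v, li5_iff.2 fun x y z w u hx => ?_⟩
  have := hv u ![x, y, z, w] (by rw [← hx]; simp [Fin.sum_univ_succ]; abel)
  exact ⟨congrFun this.2 0, congrFun this.2 1, congrFun this.2 2, congrFun this.2 3, this.1⟩

/-- coordinates with respect to a basis -/
theorem exists_coord {a b c d e : Vec k} (h : LinIndep k ![a, b, c, d, e])
    (v : Vec k) : ∃ x y z w u : k, v = x • a + y • b + z • c + w • d + u • e := by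
  have h1 : Submodule.span k (Set.range ![a, b, c, d, e]) = ⊤ := by
    apply Submodule.eq_top_of_finrank_eq
    rw [finrank_span_eq_card h]; simp
  have h2 : v ∈ Submodule.span k (Set.range ![a, b, c, d, e]) := by rw [h1]; trivial
  rw [Submodule.mem_span_range_iff_exists_fun] at h2
  obtain ⟨x, hx⟩ := h2
  exact ⟨x 0, x 1, x 2, x 3, x 4, by rw [← hx]; simp [Fin.sum_univ_succ, add_assoc]⟩

end LI

section Flag
variable {k R K : Type} [Field k] [CommRing R] [IsDomain R] [Field K] [Algebra k R] [Algebra k K]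
  [Algebra R K] [IsScalarTower k R K] {ρ : R →ₐ[k] k}

/-- a place of `K` over `k` -/
structure PlaceIn (K : Type) [Field K] [Algebra R K] (ρ : R →ₐ[k] k) : Prop extends IsPlace ρ where
  inj : Function.Injective (algMap R K)
  val : ∀ z : K, z ∈ Set.range (algMap R K) ∨ z⁻¹ ∈ Set.range (algMap R K)

/-- extension of vectors to the field -/
def up (K : Type) [Field K] [Algebra R K] (v : Vec R) : Vec K := fun i => algMap R K (v i)
/-- residue of a vector -/
def rs (ρ : R →ₐ[k] k) (v : Vec R) : Vec k := fun i => ρ (v i)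
/-- constant vectors -/
def cst (k R : Type) [Field k] [CommRing R] [Algebra k R] (v : Vec k) : Vec R :=
  fun i => algMap k R (v i)

@[simp] theorem up_add (v w : Vec R) : up K (v + w) = up K v + up K w := by ext; simp [up]
@[simp] theorem up_sub (v w : Vec R) : up K (v - w) = up K v - up K w := by ext; simp [up]
@[simp] theorem up_neg (v : Vec R) : up K (-v) = - up K v := by ext; simp [up]
@[simp] theorem up_smul (a : R) (v : Vec R) : up K (a • v) = algMap R K a • up K v := by
  ext; simp [up]
@[simp] theorem rs_add (v w : Vec R) : rs ρ (v + w) = rs ρ v + rs ρ w := by ext; simp [rs]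
@[simp] theorem rs_sub (v w : Vec R) : rs ρ (v - w) = rs ρ v - rs ρ w := by ext; simp [rs]
@[simp] theorem rs_neg (v : Vec R) : rs ρ (-v) = - rs ρ v := by ext; simp [rs]
@[simp] theorem rs_smul (a : R) (v : Vec R) : rs ρ (a • v) = ρ a • rs ρ v := by ext; simp [rs]
@[simp] theorem rs_cst (v : Vec k) : rs ρ (cst k R v) = v := by ext; simp [rs, cst]
@[simp] theorem up_cst (v : Vec k) : up K (cst k R v) = cst k K v := by
  ext; simp [up, cst, ← IsScalarTower.algebraMap_apply]
@[simp] theorem cst_add (v w : Vec k) : cst k R (v + w) = cst k R v + cst k R w := by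
  ext; simp [cst]
@[simp] theorem cst_smul (a : k) (v : Vec k) : cst k R (a • v) = algMap k R a • cst k R v := by
  ext; simp [cst]

theorem T_up (C : Cub k) (x y z : Vec R) :
    C.T (up K x) (up K y) (up K z) = algMap R K (C.T x y z) :=
  C.T_map (IsScalarTower.toAlgHom k R K) x y z
theorem T_rs (C : Cub k) (x y z : Vec R) :
    C.T (rs ρ x) (rs ρ y) (rs ρ z) = ρ (C.T x y z) := C.T_map ρ x y z
theorem T_cst (C : Cub k) (x y z : Vec k) :
    C.T (cst k R x) (cst k R y) (cst k R z) = algMap k R (C.T x y z) :=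
  C.T_map (Algebra.ofId k R) x y z

namespace PlaceIn

theorem up_inj (hP : PlaceIn K ρ) {v w : Vec R} (h : up K v = up K w) : v = w := by
  ext i; exact hP.inj (congrFun h i)

theorem T_eq_zero (hP : PlaceIn K ρ) (C : Cub k) {x y z : Vec R} (h : C.T (up K x) (up K y) (up K z) = 0) :
    C.T x y z = 0 := by
  rw [T_up] at h; exact hP.inj (by simpa using h)

/-- among finitely many elements one divides all the others -/
theorem exists_max (hP : PlaceIn K ρ) {n : ℕ} (v : Fin (n + 1) → K) (hv : v ≠ 0) :
    ∃ i, v i ≠ 0 ∧ ∀ j, v j / v i ∈ Set.range (algMap R K) := by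
  induction n with
  | zero =>
    refine ⟨0, ?_, ?_⟩
    · intro h; apply hv; ext i; fin_cases i; exact h
    · have h0 : v 0 ≠ 0 := by
        intro h; apply hv; ext i; fin_cases i; exact h
      intro j; fin_cases j; exact ⟨1, by simp [h0]⟩
  | succ n ih =>
    by_cases h0 : Fin.tail v = 0
    · have hz : ∀ j : Fin (n + 1), v j.succ = 0 := fun j => congrFun h0 j
      have h1 : v 0 ≠ 0 := by intro h; apply hv; ext i; refine Fin.cases h (fun j => hz j) i
      refine ⟨0, h1, fun j => ?_⟩
      refine Fin.cases ⟨1, by simp [h1]⟩ (fun j => ⟨0, by simp [hz j]⟩) j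
    · obtain ⟨i, hi, hj⟩ := ih (Fin.tail v) h0
      change v i.succ ≠ 0 at hi
      change ∀ j : Fin (n + 1), v j.succ / v i.succ ∈ _ at hj
      rcases hP.val (v 0 / v i.succ) with h | h
      · exact ⟨i.succ, hi, fun j => Fin.cases h hj j⟩
      · by_cases h1 : v 0 = 0
        · exact ⟨i.succ, hi, fun j => Fin.cases ⟨0, by simp [h1]⟩ hj j⟩
        · refine ⟨0, h1, fun j => Fin.cases ⟨1, by simp [h1]⟩ (fun j => ?_) j⟩
          obtain ⟨a, ha⟩ := hj j
          obtain ⟨b, hb⟩ := h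
          refine ⟨a * b, ?_⟩
          rw [map_mul, ha, hb]; field_simp

theorem exists_prim (hP : PlaceIn K ρ) (v : Vec K) (hv : v ≠ 0) :
    ∃ (y : K) (w : Vec R), y ≠ 0 ∧ up K w = y • v ∧ ∃ i, w i = 1 := by
  obtain ⟨i, hi, hj⟩ := hP.exists_max v hv
  choose w hw using hj
  refine ⟨(v i)⁻¹, w, inv_ne_zero hi, ?_, i, ?_⟩
  · ext j; simp [up, hw, div_eq_inv_mul]
  · apply hP.inj; rw [hw, div_self hi, map_one]

/-- if the residues are independent the coordinates are integral -/
theorem coord_int (hP : PlaceIn K ρ) {n : ℕ} (e : Fin n → Vec R) (he : LinIndep k (fun i => rs ρ (e i)))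
    (x : Fin n → K) (w : Vec R) (h : ∑ i, x i • up K (e i) = up K w) :
    ∀ i, x i ∈ Set.range (algMap R K) := by
  cases n with
  | zero => intro i; exact i.elim0
  | succ n =>
  by_cases hx : x = 0
  · intro i; exact ⟨0, by simp [hx]⟩
  obtain ⟨i, hi, hj⟩ := hP.exists_max x hx
  rcases hP.val (x i) with hv | ⟨b, hb⟩
  · intro j
    obtain ⟨a, ha⟩ := hj j
    obtain ⟨c, hc⟩ := hv
    exact ⟨a * c, by rw [map_mul, ha, hc]; field_simp⟩
  · choose y hy using hj
    have h1 : ∑ j, y j • e j = b • w := by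
      apply hP.up_inj
      have : up K (∑ j, y j • e j) = ∑ j, algMap R K (y j) • up K (e j) := by
        ext l; simp [up, Finset.sum_apply, Algebra.smul_def]
      rw [this, up_smul, hb, ← h, Finset.smul_sum]
      refine Finset.sum_congr rfl fun j _ => ?_
      rw [hy, smul_smul, div_eq_inv_mul]
    have hyi : y i = 1 := by apply hP.inj; rw [hy, div_self hi, map_one]
    by_cases hbu : ρ b = 0
    · exfalso
      have h2 : ∑ j, ρ (y j) • rs ρ (e j) = 0 := by
        have := congrArg (rs ρ) h1
        rw [rs_smul, hbu, zero_smul] at this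
        rw [← this]; ext l; simp [rs, Finset.sum_apply]
      have := Fintype.linearIndependent_iff.1 he (fun j => ρ (y j)) h2 i
      simp [hyi] at this
    · obtain ⟨c, hc⟩ := hP.toIsPlace.unit b hbu
      intro j
      have hbc : algMap R K b * algMap R K ↑(c⁻¹) = 1 := by
        rw [← map_mul, ← hc, Units.mul_inv, map_one]
      have hxi : x i = algMap R K ↑(c⁻¹) := by
        rw [hb] at hbc
        field_simp at hbc; exact hbc.symm
      refine ⟨y j * ↑(c⁻¹), ?_⟩
      rw [map_mul, hy, ← hxi]; field_simp

theorem ext_flag (hP : PlaceIn K ρ) {n : ℕ} (e : Fin n → Vec R) (he : LinIndep k (fun i => rs ρ (e i)))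
    (v : Vec K) (hv : ∀ x : Fin n → K, v + ∑ i, x i • up K (e i) ≠ 0) :
    ∃ (e' : Vec R) (y : K) (x : Fin n → K), y ≠ 0 ∧ up K e' = y • v + ∑ i, x i • up K (e i) ∧
      ∀ (a : k) (b : Fin n → k), a • rs ρ e' + ∑ i, b i • rs ρ (e i) = 0 → a = 0 ∧ b = 0 := by
  obtain ⟨G, hG⟩ := Cub.li_dual _ he
  obtain ⟨N, hN⟩ : ∃ N : Matrix (Fin n) (Fin n) R, ∀ i j, N i j = ∑ l, algMap k R (G i l) * e j l :=
    ⟨Matrix.of fun i j => ∑ l, algMap k R (G i l) * e j l, fun i j => rfl⟩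
  have hN1 : ρ.mapMatrix N = 1 := by
    ext i j
    rw [Matrix.one_apply, ← hG i j]
    simp [hN, rs, map_sum]
  have hdet : ρ N.det ≠ 0 := by rw [AlgHom.map_det, hN1]; simp
  have hdet' : IsUnit ((algMap R K).mapMatrix N).det := by
    rw [← RingHom.map_det, isUnit_iff_ne_zero]
    intro h
    have : N.det = 0 := hP.inj (by simpa using h)
    simp [this] at hdet
  set NK := (algMap R K).mapMatrix N with hNK
  have hNKa : ∀ i j, NK i j = ∑ l, algMap k K (G i l) * up K (e j) l := by
    intro i j
    simp [hNK, hN, map_sum, up, ← IsScalarTower.algebraMap_apply]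
  set g : Fin n → K := fun i => ∑ l, algMap k K (G i l) * v l with hg
  set x := NK⁻¹.mulVec (-g) with hx
  have hx1 : NK.mulVec x = -g := by
    rw [hx, Matrix.mulVec_mulVec, Matrix.mul_nonsing_inv _ hdet', Matrix.one_mulVec]
  set v' := v + ∑ i, x i • up K (e i) with hv'
  have hGv : ∀ i, ∑ l, algMap k K (G i l) * v' l = 0 := by
    intro i
    have h1 := congrFun hx1 i
    simp only [Matrix.mulVec, dotProduct, Pi.neg_apply, hNKa, hg] at h1
    simp only [hv', Pi.add_apply, Finset.sum_apply, Pi.smul_apply, smul_eq_mul, mul_add,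
      Finset.sum_add_distrib, Finset.mul_sum]
    rw [Finset.sum_comm (γ := Fin 5), ← sub_eq_zero.2 h1]
    simp only [Finset.sum_mul]
    rw [sub_neg_eq_add, add_comm]
    congr 1
    refine Finset.sum_congr rfl fun j _ => Finset.sum_congr rfl fun l _ => ?_
    ring
  obtain ⟨y, w, hy, hw, i0, hi0⟩ := hP.exists_prim v' (hv x)
  have hGw : ∀ i, ∑ l, G i l * rs ρ w l = 0 := by
    intro i
    have : ∑ l, algMap k R (G i l) * w l = 0 := by
      apply hP.inj
      have h2 : algMap R K (∑ l, algMap k R (G i l) * w l) =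
          ∑ l, algMap k K (G i l) * up K w l := by
        simp [up, map_sum, ← IsScalarTower.algebraMap_apply]
      rw [h2, hw, map_zero, ← mul_zero y, ← hGv i, Finset.mul_sum]
      refine Finset.sum_congr rfl fun l _ => ?_
      simp only [Pi.smul_apply, smul_eq_mul]; ring
    have h3 := congrArg ρ this
    simpa [map_sum, rs] using h3
  refine ⟨w, y, fun i => y * x i, hy, ?_, ?_⟩
  · rw [hw, hv', smul_add, Finset.smul_sum]
    simp only [smul_smul]
  · intro a b hab
    have hb : b = 0 := by
      ext i
      have h1 : ∑ l, G i l * (a • rs ρ w + ∑ j, b j • rs ρ (e j)) l = 0 := by rw [hab]; simp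
      have h2 : ∑ l, G i l * (a • rs ρ w + ∑ j, b j • rs ρ (e j)) l = b i := by
        simp only [Pi.add_apply, Finset.sum_apply, Pi.smul_apply, smul_eq_mul, mul_add,
          Finset.sum_add_distrib, Finset.mul_sum]
        rw [Finset.sum_comm]
        have h3 : ∀ j, ∑ l, G i l * (b j * rs ρ (e j) l) = b j * if i = j then 1 else 0 := by
          intro j; rw [← hG i j, Finset.mul_sum]
          exact Finset.sum_congr rfl fun l _ => by ring
        simp only [h3]
        have h4 : ∑ l, G i l * (a * rs ρ w l) = 0 := by
          rw [← mul_zero a, ← hGw i, Finset.mul_sum]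
          exact Finset.sum_congr rfl fun l _ => by ring
        rw [h4]; simp
      rw [← h2, h1]; rfl
    refine ⟨?_, hb⟩
    subst hb
    have := congrFun hab i0
    simpa [rs, hi0] using this

theorem flag1 (hP : PlaceIn K ρ) {v1 : Vec K} (h1 : v1 ≠ 0) :
    ∃ (e1 : Vec R) (a11 : K), a11 ≠ 0 ∧ up K e1 = a11 • v1 ∧ LinIndep k ![rs ρ e1] := by
  obtain ⟨y, w, hy, hw, i, hi⟩ := hP.exists_prim v1 h1
  refine ⟨w, y, hy, hw, li1_iff.2 fun h => ?_⟩
  have := congrFun h i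
  simp [rs, hi] at this

theorem flag2 (hP : PlaceIn K ρ) {v1 v2 : Vec K} (h : LinIndep K ![v1, v2]) :
    ∃ (e1 e2 : Vec R) (a11 a21 a22 : K), a11 ≠ 0 ∧ a22 ≠ 0 ∧ up K e1 = a11 • v1 ∧
      up K e2 = a21 • v1 + a22 • v2 ∧ LinIndep k ![rs ρ e1, rs ρ e2] := by
  rw [li2_iff] at h
  have h1 : v1 ≠ 0 := by rintro rfl; simpa using (h 1 0 (by simp)).1
  obtain ⟨e1, a11, ha11, he1, hl⟩ := hP.flag1 h1
  obtain ⟨e2, y, x, hy, he2, hl2⟩ := hP.ext_flag ![e1] (by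
    convert hl using 1; ext i; fin_cases i; rfl) v2 (by
    intro x hx
    simp [he1, smul_smul] at hx
    have := h (x 0 * a11) 1 (by rw [← hx]; module)
    simp at this)
  refine ⟨e1, e2, a11, x 0 * a11, y, ha11, hy, he1, ?_, ?_⟩
  · rw [he2]; simp [he1, smul_smul]; module
  · rw [li2_iff]
    intro s t hst
    have := hl2 t ![s] (by rw [← hst]; simp; module)
    exact ⟨congrFun this.2 0, this.1⟩

theorem flag3 (hP : PlaceIn K ρ) {v1 v2 v3 : Vec K} (h : LinIndep K ![v1, v2, v3]) :
    ∃ (e1 e2 e3 : Vec R) (a11 a21 a22 a31 a32 a33 : K), a11 ≠ 0 ∧ a22 ≠ 0 ∧ a33 ≠ 0 ∧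
      up K e1 = a11 • v1 ∧ up K e2 = a21 • v1 + a22 • v2 ∧
      up K e3 = a31 • v1 + a32 • v2 + a33 • v3 ∧
      LinIndep k ![rs ρ e1, rs ρ e2, rs ρ e3] := by
  rw [li3_iff] at h
  obtain ⟨e1, e2, a11, a21, a22, ha11, ha22, he1, he2, hl⟩ := hP.flag2 (v1 := v1) (v2 := v2) (by
    rw [li2_iff]; intro x y hx
    have := h x y 0 (by rw [← hx]; module)
    exact ⟨this.1, this.2.1⟩)
  obtain ⟨e3, y, x, hy, he3, hl3⟩ := hP.ext_flag ![e1, e2] (by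
    convert hl using 1; ext i; fin_cases i <;> rfl) v3 (by
    intro x hx
    simp [Fin.sum_univ_succ, he1, he2] at hx
    have := h (x 0 * a11 + x 1 * a21) (x 1 * a22) 1 (by rw [← hx]; module)
    simp at this)
  refine ⟨e1, e2, e3, a11, a21, a22, x 0 * a11 + x 1 * a21, x 1 * a22, y, ha11, ha22, hy, he1, he2,
    ?_, ?_⟩
  · rw [he3]; simp [Fin.sum_univ_succ, he1, he2]; module
  · rw [li3_iff]
    intro s t r hst
    have := hl3 r ![s, t] (by rw [← hst]; simp [Fin.sum_univ_succ]; module)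
    exact ⟨congrFun this.2 0, congrFun this.2 1, this.1⟩

theorem flag4 (hP : PlaceIn K ρ) {v1 v2 v3 v4 : Vec K} (h : LinIndep K ![v1, v2, v3, v4]) :
    ∃ (e1 e2 e3 e4 : Vec R) (a11 a21 a22 a31 a32 a33 a41 a42 a43 a44 : K),
      a11 ≠ 0 ∧ a22 ≠ 0 ∧ a33 ≠ 0 ∧ a44 ≠ 0 ∧
      up K e1 = a11 • v1 ∧ up K e2 = a21 • v1 + a22 • v2 ∧
      up K e3 = a31 • v1 + a32 • v2 + a33 • v3 ∧
      up K e4 = a41 • v1 + a42 • v2 + a43 • v3 + a44 • v4 ∧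
      LinIndep k ![rs ρ e1, rs ρ e2, rs ρ e3, rs ρ e4] := by
  rw [li4_iff] at h
  obtain ⟨e1, e2, e3, a11, a21, a22, a31, a32, a33, ha11, ha22, ha33, he1, he2, he3, hl⟩ :=
    hP.flag3 (v1 := v1) (v2 := v2) (v3 := v3) (by
    rw [li3_iff]; intro x y z hx
    have := h x y z 0 (by rw [← hx]; module)
    exact ⟨this.1, this.2.1, this.2.2.1⟩)
  obtain ⟨e4, y, x, hy, he4, hl4⟩ := hP.ext_flag ![e1, e2, e3] (by
    convert hl using 1; ext i; fin_cases i <;> rfl) v4 (by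
    intro x hx
    simp [Fin.sum_univ_succ, he1, he2, he3] at hx
    have := h (x 0 * a11 + x 1 * a21 + x 2 * a31) (x 1 * a22 + x 2 * a32) (x 2 * a33) 1
      (by rw [← hx]; module)
    simp at this)
  refine ⟨e1, e2, e3, e4, a11, a21, a22, a31, a32, a33, x 0 * a11 + x 1 * a21 + x 2 * a31,
    x 1 * a22 + x 2 * a32, x 2 * a33, y, ha11, ha22, ha33, hy, he1, he2, he3, ?_, ?_⟩
  · rw [he4]; simp [Fin.sum_univ_succ, he1, he2, he3]; module
  · rw [li4_iff]
    intro s t r q hst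
    have := hl4 q ![s, t, r] (by rw [← hst]; simp [Fin.sum_univ_succ]; module)
    exact ⟨congrFun this.2 0, congrFun this.2 1, congrFun this.2 2, this.1⟩

end PlaceIn
end Flag

/-! ### Elementary facts on smooth cubics -/

namespace Cub

/-- homogeneous conditions on a vector -/
inductive Cond (k : Type)
  | lin (a b : Vec k)
  | quad (a : Vec k)
  | cub

section pz
variable {k : Type} [Field k] (C : Cub k)

/-- value of a condition -/
def Cond.ev {R : Type} [CommRing R] [Algebra k R] : Cond k → (Vec R) → R
  | .lin a b, w => C.T (cst k R a) (cst k R b) w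
  | .quad a, w => C.T (cst k R a) w w
  | .cub, w => C.T w w w

theorem cst_self (v : Vec k) : cst k k v = v := rfl

theorem pz [IsAlgClosed k] {m n : ℕ} (hmn : m < n) (v : Fin n → Vec k) (c : Fin m → Cond k) :
    ∃ x : Fin n → k, x ≠ 0 ∧ ∀ j, (c j).ev C (∑ i, x i • v i) = 0 := by
  let W : Fin 5 → MvPolynomial (Fin n) k := ∑ i, (MvPolynomial.X i : MvPolynomial (Fin n) k) • cst k (MvPolynomial (Fin n) k) (v i)
  have key : ∀ (x : Fin n → k) j, MvPolynomial.aeval x ((c j).ev C W) =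
      (c j).ev C (∑ i, x i • v i) := by
    intro x j
    have h1 : (MvPolynomial.aeval x : MvPolynomial (Fin n) k →ₐ[k] k) ∘ W = ∑ i, x i • v i := by
      ext l; simp [W, Finset.sum_apply, cst]
    have h2 : ∀ a : Vec k, (MvPolynomial.aeval x : MvPolynomial (Fin n) k →ₐ[k] k) ∘ (cst k (MvPolynomial (Fin n) k) a) = a := by
      intro a; ext l; simp [cst]
    cases c j <;> simp only [Cond.ev, ← T_map, h1, h2, cst_self]
  obtain ⟨x, hx, hj⟩ := proj_zero hmn (fun j => (c j).ev C W) (by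
    intro j
    rw [key]
    have : ∑ i, (0 : Fin n → k) i • v i = 0 := by simp
    rw [this]
    cases c j <;> simp [Cond.ev, T_zero3])
  exact ⟨x, hx, fun j => by rw [← key]; exact hj j⟩

variable {C}

/-- a smooth cubic contains no plane -/
theorem SM.no_plane [IsAlgClosed k] (hC : C.SM) {a b c : Vec k}
    (h : LinIndep k ![a, b, c])
    (haaa : C.T a a a = 0) (haab : C.T a a b = 0) (haac : C.T a a c = 0) (habb : C.T a b b = 0)
    (habc : C.T a b c = 0) (hacc : C.T a c c = 0) (hbbb : C.T b b b = 0) (hbbc : C.T b b c = 0)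
    (hbcc : C.T b c c = 0) (hccc : C.T c c c = 0) : False := by
  obtain ⟨d, hd⟩ := exists_ext3 h
  obtain ⟨e, he⟩ := exists_ext4 hd
  obtain ⟨x, hx, hj⟩ := C.pz (m := 1) (n := 3) (by norm_num) ![a, b, c] ![.cub]
  obtain ⟨x, hx, hj⟩ : ∃ x : Fin 3 → k, x ≠ 0 ∧
      ∀ j : Fin 2, C.T (∑ i, x i • ![a, b, c] i) (∑ i, x i • ![a, b, c] i) (![d, e] j) = 0 := by
    obtain ⟨x, hx, hj⟩ := C.pz (m := 2) (n := 3) (by norm_num) ![a, b, c] ![.quad d, .quad e]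
    refine ⟨x, hx, fun j => ?_⟩
    have := hj j
    fin_cases j <;>
    · simp [Cond.ev, cst_self] at this
      rw [C.T_swap23, C.T_swap12]; simpa using this
  set w := ∑ i, x i • ![a, b, c] i with hw
  have hw' : w = x 0 • a + x 1 • b + x 2 • c := by rw [hw]; simp [Fin.sum_univ_succ, add_assoc]
  have hw0 : w = 0 := by
    apply hC
    intro v
    obtain ⟨y0, y1, y2, y3, y4, rfl⟩ := exists_coord he v
    have h3 := hj 0
    have h4 := hj 1
    simp only [Matrix.cons_val_zero, Matrix.cons_val_one] at h3 h4
    have hA : C.T w w a = 0 := by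
      rw [hw']; simp only [T_add1, T_add2, T_smul1, T_smul2]
      simp only [C.T_swap] at *
      simp [*]
    have hB : C.T w w b = 0 := by
      rw [hw']; simp only [T_add1, T_add2, T_smul1, T_smul2]
      simp only [C.T_swap] at *
      simp [*]
    have hCc : C.T w w c = 0 := by
      rw [hw']; simp only [T_add1, T_add2, T_smul1, T_smul2]
      simp only [C.T_swap] at *
      simp [*]
    simp only [T_add3, T_smul3, hA, hB, hCc, h3, h4]; ring
  have := li3_iff.1 h _ _ _ (hw'.symm.trans hw0)
  apply hx; ext i; fin_cases i
  exacts [this.1, this.2.1, this.2.2]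

/-- the planes tangent along a line do not fill a hyperplane -/
theorem SM.no_tangent_hyperplane [IsAlgClosed k] (hC : C.SM) {a b c d : Vec k}
    (h : LinIndep k ![a, b, c, d])
    (haaa : C.T a a a = 0) (haab : C.T a a b = 0) (habb : C.T a b b = 0) (hbbb : C.T b b b = 0)
    (haac : C.T a a c = 0) (habc : C.T a b c = 0) (hbbc : C.T b b c = 0)
    (haad : C.T a a d = 0) (habd : C.T a b d = 0) (hbbd : C.T b b d = 0) : False := by
  obtain ⟨e, he⟩ := exists_ext4 h
  obtain ⟨x, hx, hj⟩ := C.pz (m := 1) (n := 2) (by norm_num) ![a, b] ![.quad e]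
  set w := ∑ i, x i • ![a, b] i with hw
  have hw' : w = x 0 • a + x 1 • b := by rw [hw]; simp [Fin.sum_univ_succ, add_assoc]
  have h3 : C.T e w w = 0 := by simpa [Cond.ev, cst_self] using hj 0
  rw [C.T_swap12, C.T_swap23] at h3
  have hw0 : w = 0 := by
    apply hC
    intro v
    obtain ⟨y0, y1, y2, y3, y4, rfl⟩ := exists_coord he v
    have hh : ∀ v', C.T a a v' = 0 → C.T a b v' = 0 → C.T b b v' = 0 → C.T w w v' = 0 := by
      intro v' h1 h2 h3
      rw [hw']; simp only [T_add1, T_add2, T_smul1, T_smul2]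
      rw [C.T_swap12 b a, h1, h2, h3]; ring
    have h5 : C.T b b a = 0 := by rw [C.T_swap23, C.T_swap12]; exact habb
    have h6 : C.T a b a = 0 := by rw [C.T_swap23]; exact haab
    simp only [T_add3, T_smul3, hh a haaa h6 h5, hh b haab habb hbbb, hh c haac habc hbbc,
      hh d haad habd hbbd, h3]; ring
  have := li4_iff.1 h (x 0) (x 1) 0 0 (by rw [← hw0, hw']; module)
  apply hx; ext i; fin_cases i
  exacts [this.1, this.2.1]

end pz
end Cub

section Ech
variable {k R K : Type} [Field k] [CharZero k] [CommRing R] [IsDomain R] [Field K] [Algebra k R] [Algebra k K]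
  [Algebra R K] [IsScalarTower k R K] {ρ : R →ₐ[k] k}

theorem exists_coordR {f1 f2 f3 f4 f5 : Vec k} (h : LinIndep k ![f1, f2, f3, f4, f5])
    (v : Vec R) : ∃ x1 x2 x3 x4 x5 : R, v = x1 • cst k R f1 + x2 • cst k R f2 +
      x3 • cst k R f3 + x4 • cst k R f4 + x5 • cst k R f5 := by
  have h1 : ∀ i : Fin 5, ∃ x : Vec k, Pi.single i 1 = x 0 • f1 + x 1 • f2 + x 2 • f3 + x 3 • f4 + x 4 • f5 := by
    intro i
    obtain ⟨x0, x1, x2, x3, x4, hx⟩ := exists_coord h (Pi.single i 1)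
    exact ⟨![x0, x1, x2, x3, x4], by simpa using hx⟩
  choose x hx using h1
  have h2 : v = ∑ i, v i • cst k R (Pi.single i 1) := by
    ext l; simp [cst, Pi.single_apply, Finset.sum_apply]
  refine ⟨∑ i, v i * algMap k R (x i 0), ∑ i, v i * algMap k R (x i 1),
    ∑ i, v i * algMap k R (x i 2), ∑ i, v i * algMap k R (x i 3),
    ∑ i, v i * algMap k R (x i 4), ?_⟩
  conv_lhs => rw [h2]
  simp only [hx, cst_add, cst_smul, smul_add, Finset.sum_add_distrib, Finset.sum_smul, smul_smul]

theorem cst_li (K : Type) [Field K] [Algebra k K] {n : ℕ} (f : Fin n → Vec k) (h : LinIndep k f) :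
    LinIndep K (fun i => cst k K (f i)) := by
  obtain ⟨G, hG⟩ := Cub.li_dual f h
  refine Cub.li_of_dual (fun i => cst k K (f i)) (fun i => cst k K (G i)) ?_
  intro i j
  have := congrArg (algMap k K) (hG i j)
  simpa [cst, map_sum, apply_ite] using this

theorem cst_li2 (K : Type) [Field K] [Algebra k K] {a b : Vec k}
    (h : LinIndep k ![a, b]) : LinIndep K ![cst k K a, cst k K b] := by
  convert cst_li K _ h using 1; ext i; fin_cases i <;> rfl

theorem cst_li5 (K : Type) [Field K] [Algebra k K] {a b c d e : Vec k}
    (h : LinIndep k ![a, b, c, d, e]) :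
    LinIndep K ![cst k K a, cst k K b, cst k K c, cst k K d, cst k K e] := by
  convert cst_li K _ h using 1; ext i; fin_cases i <;> rfl

theorem residues5 {f1 f2 f3 f4 f5 : Vec k} (h : LinIndep k ![f1, f2, f3, f4, f5])
    {x1 x2 x3 x4 x5 : R} {y1 y2 y3 y4 y5 : k}
    (hv : rs ρ (x1 • cst k R f1 + x2 • cst k R f2 +
      x3 • cst k R f3 + x4 • cst k R f4 + x5 • cst k R f5) =
      y1 • f1 + y2 • f2 + y3 • f3 + y4 • f4 + y5 • f5) :
    ρ x1 = y1 ∧ ρ x2 = y2 ∧ ρ x3 = y3 ∧ ρ x4 = y4 ∧ ρ x5 = y5 := by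
  simp only [rs_add, rs_smul, rs_cst] at hv
  have := li5_iff.1 h (ρ x1 - y1) (ρ x2 - y2) (ρ x3 - y3) (ρ x4 - y4) (ρ x5 - y5)
    (by rw [← sub_eq_zero.2 hv]; module)
  simpa only [sub_eq_zero] using this

/-- echelon form of several vectors -/
theorem ech (hP : IsPlace ρ) {m n : ℕ} (f : Fin m → Vec k) (g : Fin n → Vec k)
    (e : Fin m → Vec R) (A : Matrix (Fin m) (Fin m) R) (B : Matrix (Fin m) (Fin n) R)
    (he : ∀ j, e j = ∑ i, A j i • cst k R (f i) + ∑ i, B j i • cst k R (g i))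
    (hA : ∀ i j, ρ (A i j) = if i = j then 1 else 0) (hB : ∀ i j, ρ (B i j) = 0) :
    ∃ (N : Matrix (Fin m) (Fin m) R) (c : Matrix (Fin m) (Fin n) R), (∀ i j, ρ (c i j) = 0) ∧
      (∀ i j, ρ (N i j) = if i = j then 1 else 0) ∧
      ∀ j, ∑ i, N j i • e i = cst k R (f j) + ∑ i, c j i • cst k R (g i) := by
  have hA1 : ρ.mapMatrix A = 1 := by ext i j; rw [Matrix.one_apply]; exact hA i j
  have hdet : IsUnit A.det := hP.unit _ (by rw [AlgHom.map_det, hA1]; simp)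
  have hN : A⁻¹ * A = 1 := Matrix.nonsing_inv_mul _ hdet
  refine ⟨A⁻¹, A⁻¹ * B, ?_, ?_, ?_⟩
  · intro i j; simp [Matrix.mul_apply, map_sum, hB]
  · intro i j
    have h1 : ρ.mapMatrix A⁻¹ = 1 := by
      have := congrArg ρ.mapMatrix hN
      rwa [map_mul, hA1, mul_one, map_one] at this
    have := congrFun (congrFun h1 i) j
    rwa [Matrix.one_apply] at this
  · intro j
    have h3 : ∑ i, A⁻¹ j i • ∑ l, A i l • cst k R (f l) = cst k R (f j) := by
      simp only [Finset.smul_sum, smul_smul]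
      rw [Finset.sum_comm]
      simp only [← Finset.sum_smul]
      have : ∀ l, ∑ i, A⁻¹ j i * A i l = if j = l then 1 else 0 := by
        intro l; rw [← Matrix.mul_apply, hN, Matrix.one_apply]
      simp [this, ite_smul]
    have h4 : ∑ i, A⁻¹ j i • ∑ l, B i l • cst k R (g l) = ∑ l, (A⁻¹ * B) j l • cst k R (g l) := by
      simp only [Finset.smul_sum, smul_smul, Matrix.mul_apply, Finset.sum_smul]
      rw [Finset.sum_comm]
    simp only [he, smul_add, Finset.sum_add_distrib, h3, h4]

/-- echelon form of two vectors -/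
theorem ech2 (hP : IsPlace ρ) {f1 f2 f3 f4 f5 : Vec k}
    (h : LinIndep k ![f1, f2, f3, f4, f5]) {e1 e2 : Vec R} (h1 : rs ρ e1 = f1)
    (h2 : rs ρ e2 = f2) :
    ∃ n11 n12 n21 n22 c3 c4 c5 d3 d4 d5 : R, ρ c3 = 0 ∧ ρ c4 = 0 ∧ ρ c5 = 0 ∧
      ρ d3 = 0 ∧ ρ d4 = 0 ∧ ρ d5 = 0 ∧ ρ n11 = 1 ∧ ρ n12 = 0 ∧ ρ n21 = 0 ∧ ρ n22 = 1 ∧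
      n11 • e1 + n12 • e2 = cst k R f1 + c3 • cst k R f3 + c4 • cst k R f4 + c5 • cst k R f5 ∧
      n21 • e1 + n22 • e2 = cst k R f2 + d3 • cst k R f3 + d4 • cst k R f4 + d5 • cst k R f5 := by
  obtain ⟨x1, x2, x3, x4, x5, hx⟩ := exists_coordR (R := R) h e1
  obtain ⟨y1, y2, y3, y4, y5, hy⟩ := exists_coordR (R := R) h e2
  obtain ⟨r1, r2, r3, r4, r5⟩ := residues5 (y1 := 1) (y2 := 0) (y3 := 0) (y4 := 0) (y5 := 0) h
    (by rw [← hx, h1]; module)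
  obtain ⟨s1, s2, s3, s4, s5⟩ := residues5 (y1 := 0) (y2 := 1) (y3 := 0) (y4 := 0) (y5 := 0) h
    (by rw [← hy, h2]; module)
  obtain ⟨N, c, hc, hN, hj⟩ := ech hP ![f1, f2] ![f3, f4, f5] ![e1, e2] !![x1, x2; y1, y2]
    !![x3, x4, x5; y3, y4, y5]
    (by intro j; fin_cases j
        · simp [Fin.sum_univ_succ]; rw [hx]; module
        · simp [Fin.sum_univ_succ]; rw [hy]; module)
    (by intro i j; fin_cases i <;> fin_cases j <;> simp [*])
    (by intro i j; fin_cases i <;> fin_cases j <;> simp [*])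
  refine ⟨N 0 0, N 0 1, N 1 0, N 1 1, c 0 0, c 0 1, c 0 2, c 1 0, c 1 1, c 1 2, hc 0 0, hc 0 1,
    hc 0 2, hc 1 0, hc 1 1, hc 1 2, by simp [hN], by simp [hN], by simp [hN], by simp [hN], ?_, ?_⟩
  · simpa [Fin.sum_univ_succ, add_assoc] using hj 0
  · simpa [Fin.sum_univ_succ, add_assoc] using hj 1

/-- echelon form of three vectors -/
theorem ech3 (hP : IsPlace ρ) {f1 f2 f3 f4 f5 : Vec k}
    (h : LinIndep k ![f1, f2, f3, f4, f5]) {e1 e2 e3 : Vec R} (h1 : rs ρ e1 = f1)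
    (h2 : rs ρ e2 = f2) (h3 : rs ρ e3 = f3) :
    ∃ (N : Matrix (Fin 3) (Fin 3) R) (b4 b5 c4 c5 d4 d5 : R), ρ b4 = 0 ∧ ρ b5 = 0 ∧
      ρ c4 = 0 ∧ ρ c5 = 0 ∧ ρ d4 = 0 ∧ ρ d5 = 0 ∧ (∀ i j, ρ (N i j) = if i = j then 1 else 0) ∧
      N 0 0 • e1 + N 0 1 • e2 + N 0 2 • e3 = cst k R f1 + b4 • cst k R f4 + b5 • cst k R f5 ∧
      N 1 0 • e1 + N 1 1 • e2 + N 1 2 • e3 = cst k R f2 + c4 • cst k R f4 + c5 • cst k R f5 ∧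
      N 2 0 • e1 + N 2 1 • e2 + N 2 2 • e3 = cst k R f3 + d4 • cst k R f4 + d5 • cst k R f5 := by
  obtain ⟨x1, x2, x3, x4, x5, hx⟩ := exists_coordR (R := R) h e1
  obtain ⟨y1, y2, y3, y4, y5, hy⟩ := exists_coordR (R := R) h e2
  obtain ⟨z1, z2, z3, z4, z5, hz⟩ := exists_coordR (R := R) h e3
  obtain ⟨r1, r2, r3, r4, r5⟩ := residues5 (y1 := 1) (y2 := 0) (y3 := 0) (y4 := 0) (y5 := 0) h
    (by rw [← hx, h1]; module)
  obtain ⟨s1, s2, s3, s4, s5⟩ := residues5 (y1 := 0) (y2 := 1) (y3 := 0) (y4 := 0) (y5 := 0) h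
    (by rw [← hy, h2]; module)
  obtain ⟨t1, t2, t3, t4, t5⟩ := residues5 (y1 := 0) (y2 := 0) (y3 := 1) (y4 := 0) (y5 := 0) h
    (by rw [← hz, h3]; module)
  obtain ⟨N, c, hc, hN, hj⟩ := ech hP ![f1, f2, f3] ![f4, f5] ![e1, e2, e3]
    !![x1, x2, x3; y1, y2, y3; z1, z2, z3]
    !![x4, x5; y4, y5; z4, z5]
    (by intro j; fin_cases j
        · simp [Fin.sum_univ_succ]; rw [hx]; module
        · simp [Fin.sum_univ_succ]; rw [hy]; module
        · simp [Fin.sum_univ_succ]; rw [hz]; module)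
    (by intro i j; fin_cases i <;> fin_cases j <;> simp [*])
    (by intro i j; fin_cases i <;> fin_cases j <;> simp [*])
  refine ⟨N, c 0 0, c 0 1, c 1 0, c 1 1, c 2 0, c 2 1, hc 0 0, hc 0 1,
    hc 1 0, hc 1 1, hc 2 0, hc 2 1, hN, ?_, ?_, ?_⟩
  · simpa [Fin.sum_univ_succ, add_assoc] using hj 0
  · simpa [Fin.sum_univ_succ, add_assoc] using hj 1
  · simpa [Fin.sum_univ_succ, add_assoc] using hj 2

end Ech

/-! ### Lines of the second type -/

namespace Cub

section defs
variable {k R S : Type} [Field k] [CommRing R] [Algebra k R] [CommRing S] [Algebra k S] (C : Cub k)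

/-- the span of `a`, `b` lies on the cubic -/
def OnLine (a b : Vec R) : Prop :=
  C.T a a a = 0 ∧ C.T a a b = 0 ∧ C.T a b b = 0 ∧ C.T b b b = 0

/-- the plane spanned by `a`, `b`, `e` is tangent along the line `a`, `b` -/
def Tan (a b e : Vec R) : Prop :=
  C.T a a e = 0 ∧ C.T a b e = 0 ∧ C.T b b e = 0

/-- discriminant of the tangency -/
def G3 (a b u v w : Vec R) : R :=
  C.T a a u * (C.T a b v * C.T b b w - C.T a b w * C.T b b v)
  - C.T a a v * (C.T a b u * C.T b b w - C.T a b w * C.T b b u)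
  + C.T a a w * (C.T a b u * C.T b b v - C.T a b v * C.T b b u)

theorem G3_map (φ : R →ₐ[k] S) (a b u v w : Vec R) :
    C.G3 (φ ∘ a) (φ ∘ b) (φ ∘ u) (φ ∘ v) (φ ∘ w) = φ (C.G3 a b u v w) := by
  simp only [G3, T_map, map_add, map_sub, map_mul]

variable {C}

theorem OnLine.comb {a b : Vec R} (h : C.OnLine a b) (x y z w : R) :
    C.OnLine (x • a + y • b) (z • a + w • b) := by
  obtain ⟨h1, h2, h3, h4⟩ := h
  refine ⟨?_, ?_, ?_, ?_⟩ <;>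
  · simp only [T_lin]
    simp only [C.T_swap] at h1 h2 h3 h4 ⊢
    simp [h1, h2, h3, h4]

theorem OnLine.map {a b : Vec R} (h : C.OnLine a b) (φ : R →ₐ[k] S) :
    C.OnLine (φ ∘ a) (φ ∘ b) := by
  obtain ⟨h1, h2, h3, h4⟩ := h
  refine ⟨?_, ?_, ?_, ?_⟩ <;> rw [T_map] <;> simp [h1, h2, h3, h4]

theorem Tan.map {a b e : Vec R} (h : C.Tan a b e) (φ : R →ₐ[k] S) :
    C.Tan (φ ∘ a) (φ ∘ b) (φ ∘ e) := by
  obtain ⟨h1, h2, h3⟩ := h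
  refine ⟨?_, ?_, ?_⟩ <;> rw [T_map] <;> simp [h1, h2, h3]

end defs

section ex
variable {k : Type} [Field k] [IsAlgClosed k] (C : Cub k)

theorem exists_line : ∃ a b : Vec k, LinIndep k ![a, b] ∧ C.OnLine a b := by
  obtain ⟨p, hp, hp3⟩ : ∃ p : Vec k, p ≠ 0 ∧ C.T p p p = 0 := by
    obtain ⟨x, hx, hj⟩ := C.pz (m := 1) (n := 5) (by norm_num) (fun i => Pi.single i 1) ![.cub]
    refine ⟨x, hx, ?_⟩
    have h1 : ∑ i, x i • (Pi.single i 1 : Vec k) = x := by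
      ext l; simp [Finset.sum_apply, Pi.single_apply]
    have := hj 0
    rw [h1] at this
    simpa [Cond.ev] using this
  obtain ⟨v1, h1⟩ : ∃ v, LinIndep k ![p, v] := by
    obtain ⟨v, hv⟩ := exists_ext _ (li1_iff.2 hp) (by norm_num)
    refine ⟨v, li2_iff.2 fun x y hx => ?_⟩
    have := hv y ![x] (by rw [← hx]; simp [Fin.sum_univ_succ]; abel)
    exact ⟨congrFun this.2 0, this.1⟩
  obtain ⟨v2, h2⟩ := exists_ext2 h1
  obtain ⟨v3, h3⟩ := exists_ext3 h2
  obtain ⟨v4, h4⟩ := exists_ext4 h3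
  obtain ⟨x, hx, hj⟩ := C.pz (m := 3) (n := 4) (by norm_num) ![v1, v2, v3, v4]
    ![.lin p p, .quad p, .cub]
  set w := ∑ i, x i • ![v1, v2, v3, v4] i with hw
  have hw' : w = x 0 • v1 + x 1 • v2 + x 2 • v3 + x 3 • v4 := by
    rw [hw]; simp [Fin.sum_univ_succ, add_assoc]
  refine ⟨p, w, ?_, hp3, ?_, ?_, ?_⟩
  · rw [li2_iff]
    intro s t hst
    have := li5_iff.1 h4 s (t * x 0) (t * x 1) (t * x 2) (t * x 3) (by rw [← hst, hw']; module)
    refine ⟨this.1, ?_⟩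
    by_contra ht
    apply hx
    ext i
    fin_cases i <;> simp_all
  · simpa [Cond.ev, cst_self] using hj 0
  · simpa [Cond.ev, cst_self] using hj 1
  · simpa [Cond.ev, cst_self] using hj 2

/-- a point of the chart -/
def chA (K : Type) [CommRing K] [Algebra k K] (v : Fin 5 → Vec k) (x : Fin 6 → K) : Vec K :=
  cst k K (v 0) + x 0 • cst k K (v 2) + x 1 • cst k K (v 3) + x 2 • cst k K (v 4)
/-- a point of the chart -/
def chB (K : Type) [CommRing K] [Algebra k K] (v : Fin 5 → Vec k) (x : Fin 6 → K) : Vec K :=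
  cst k K (v 1) + x 3 • cst k K (v 2) + x 4 • cst k K (v 3) + x 5 • cst k K (v 4)

theorem chA_map {K L : Type} [CommRing K] [Algebra k K] [CommRing L] [Algebra k L] (φ : K →ₐ[k] L)
    (v : Fin 5 → Vec k) (x : Fin 6 → K) : φ ∘ chA K v x = chA L v (φ ∘ x) := by
  ext l; simp [chA, cst]
theorem chB_map {K L : Type} [CommRing K] [Algebra k K] [CommRing L] [Algebra k L] (φ : K →ₐ[k] L)
    (v : Fin 5 → Vec k) (x : Fin 6 → K) : φ ∘ chB K v x = chB L v (φ ∘ x) := by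
  ext l; simp [chB, cst]
theorem cst_map {K L : Type} [CommRing K] [Algebra k K] [CommRing L] [Algebra k L] (φ : K →ₐ[k] L)
    (v : Vec k) : φ ∘ cst k K v = cst k L v := by
  ext l; simp [cst]

theorem chart_curve (v : Fin 5 → Vec k) (h : C.OnLine (v 0) (v 1)) :
    ∃ (K : Type) (_ : Field K) (_ : IsAlgClosed K) (_ : Algebra k K) (x : Fin 6 → K),
      C.OnLine (chA K v x) (chB K v x) ∧ ∃ i, x i ∉ Set.range (algMap k K) := by
  let X : Fin 6 → MvPolynomial (Fin 6) k := MvPolynomial.X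
  let A := chA _ v X
  let B := chB _ v X
  have hA : ∀ {K : Type} [Field K] [Algebra k K] (x : Fin 6 → K),
      (MvPolynomial.aeval x : MvPolynomial (Fin 6) k →ₐ[k] K) ∘ A = chA K v x := by
    intro K _ _ x; rw [chA_map]; congr 1; ext l; simp [X]
  have hB : ∀ {K : Type} [Field K] [Algebra k K] (x : Fin 6 → K),
      (MvPolynomial.aeval x : MvPolynomial (Fin 6) k →ₐ[k] K) ∘ B = chB K v x := by
    intro K _ _ x; rw [chB_map]; congr 1; ext l; simp [X]
  have hA0 : chA k v 0 = v 0 := by simp [chA, cst_self]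
  have hB0 : chB k v 0 = v 1 := by simp [chB, cst_self]
  obtain ⟨h1, h2, h3, h4⟩ := h
  obtain ⟨K, _, _, _, x, hx, hi⟩ := krull_point (m := 4) (N := 6) (by norm_num)
    ![C.T A A A, C.T A A B, C.T A B B, C.T B B B] (0 : Fin 6 → k) (by
      intro j
      fin_cases j <;> simp only [Fin.zero_eta, Fin.mk_one, Fin.reduceFinMk, Matrix.cons_val, ← T_map, hA, hB, hA0, hB0, h1, h2, h3, h4])
  refine ⟨K, _, ‹_›, _, x, ⟨?_, ?_, ?_, ?_⟩, hi⟩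
  · simpa only [Matrix.cons_val, ← T_map, hA, hB] using hx 0
  · simpa only [Matrix.cons_val, ← T_map, hA, hB] using hx 1
  · simpa only [Matrix.cons_val, ← T_map, hA, hB] using hx 2
  · simpa only [Matrix.cons_val, ← T_map, hA, hB] using hx 3

theorem chart_curve2 (v : Fin 5 → Vec k) (h : C.OnLine (v 0) (v 1))
    (hG : C.G3 (v 0) (v 1) (v 2) (v 3) (v 4) = 0) :
    ∃ (K : Type) (_ : Field K) (_ : IsAlgClosed K) (_ : Algebra k K) (x : Fin 6 → K),
      C.OnLine (chA K v x) (chB K v x) ∧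
      C.G3 (chA K v x) (chB K v x) (cst k K (v 2)) (cst k K (v 3)) (cst k K (v 4)) = 0 ∧
      ∃ i, x i ∉ Set.range (algMap k K) := by
  let X : Fin 6 → MvPolynomial (Fin 6) k := MvPolynomial.X
  let A := chA _ v X
  let B := chB _ v X
  have hA : ∀ {K : Type} [Field K] [Algebra k K] (x : Fin 6 → K),
      (MvPolynomial.aeval x : MvPolynomial (Fin 6) k →ₐ[k] K) ∘ A = chA K v x := by
    intro K _ _ x; rw [chA_map]; congr 1; ext l; simp [X]
  have hB : ∀ {K : Type} [Field K] [Algebra k K] (x : Fin 6 → K),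
      (MvPolynomial.aeval x : MvPolynomial (Fin 6) k →ₐ[k] K) ∘ B = chB K v x := by
    intro K _ _ x; rw [chB_map]; congr 1; ext l; simp [X]
  have hA0 : chA k v 0 = v 0 := by simp [chA, cst_self]
  have hB0 : chB k v 0 = v 1 := by simp [chB, cst_self]
  obtain ⟨h1, h2, h3, h4⟩ := h
  obtain ⟨K, _, _, _, x, hx, hi⟩ := krull_point (m := 5) (N := 6) (by norm_num)
    ![C.T A A A, C.T A A B, C.T A B B, C.T B B B, C.G3 A B (cst k _ (v 2)) (cst k _ (v 3)) (cst k _ (v 4))]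
    (0 : Fin 6 → k) (by
      intro j
      fin_cases j <;> simp only [Fin.zero_eta, Fin.mk_one, Fin.reduceFinMk, Matrix.cons_val, ← T_map, ← G3_map, cst_map, cst_self, hA, hB, hA0, hB0, h1, h2, h3, h4, hG])
  refine ⟨K, _, ‹_›, _, x, ⟨?_, ?_, ?_, ?_⟩, ?_, hi⟩
  · simpa only [Matrix.cons_val, ← T_map, hA, hB] using hx 0
  · simpa only [Matrix.cons_val, ← T_map, hA, hB] using hx 1
  · simpa only [Matrix.cons_val, ← T_map, hA, hB] using hx 2
  · simpa only [Matrix.cons_val, ← T_map, hA, hB] using hx 3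
  · simpa only [Matrix.cons_val, ← G3_map, cst_map, hA, hB] using hx 4

end ex

theorem det5 {R : Type} [CommRing R] (a b c d s t u s' t' u' g1 g2 g3 h1 h2 h3 i1 i2 i3 : R) :
    (!![a, b, s, t, u; c, d, s', t', u'; 0, 0, g1, g2, g3; 0, 0, h1, h2, h3; 0, 0, i1, i2, i3] :
      Matrix (Fin 5) (Fin 5) R).det = (a * d - b * c) * (g1 * (h2 * i3 - h3 * i2)
        - g2 * (h1 * i3 - h3 * i1) + g3 * (h1 * i2 - h2 * i1)) := by
  simp [Matrix.det_succ_row_zero, Fin.sum_univ_succ, Fin.succAbove]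
  ring

theorem det5' {R : Type} [CommRing R] (p0 p2 p3 p4 q0 q1 q2 q3 q4 : R) :
    (!![p0, q0, 0, 0, 0; 0, q1, 0, 0, 0; p2, q2, 1, 0, 0; p3, q3, 0, 1, 0; p4, q4, 0, 0, 1] :
      Matrix (Fin 5) (Fin 5) R).det = p0 * q1 := by
  simp [Matrix.det_succ_row_zero, Fin.sum_univ_succ, Fin.succAbove]

section ample
variable {k R K : Type} [Field k] [CharZero k] [CommRing R] [IsDomain R] [Field K] [Algebra k R]
  [Algebra k K] [Algebra R K] [IsScalarTower k R K] {ρ : R →ₐ[k] k} {C : Cub k}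

theorem OnLine.of_up (hP : PlaceIn K ρ) {a b : Vec R} (h : C.OnLine (up K a) (up K b)) :
    C.OnLine a b :=
  ⟨hP.T_eq_zero C h.1, hP.T_eq_zero C h.2.1, hP.T_eq_zero C h.2.2.1, hP.T_eq_zero C h.2.2.2⟩

theorem OnLine.rs {a b : Vec R} (h : C.OnLine a b) : C.OnLine (rs ρ a) (rs ρ b) := h.map ρ

theorem Tan.of_up (hP : PlaceIn K ρ) {a b c : Vec R} (h : C.Tan (up K a) (up K b) (up K c)) :
    C.Tan a b c :=
  ⟨hP.T_eq_zero C h.1, hP.T_eq_zero C h.2.1, hP.T_eq_zero C h.2.2⟩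

theorem Tan.rs {a b c : Vec R} (h : C.Tan a b c) : C.Tan (rs ρ a) (rs ρ b) (rs ρ c) := h.map ρ

theorem G3_up (a b u v w : Vec R) :
    C.G3 (up K a) (up K b) (up K u) (up K v) (up K w) = algMap R K (C.G3 a b u v w) :=
  C.G3_map (IsScalarTower.toAlgHom k R K) a b u v w

theorem G3_comb (a b u v w : Vec K) (s t r : K) (h1 : C.T a a a = 0) :
    C.G3 (s • a) (t • a + r • b) u v w = (s * r) ^ 3 * C.G3 a b u v w := by
  simp only [G3, T_add1, T_add2, T_smul1, T_smul2, C.T_swap12 b a]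
  ring

theorem place_ample (hP : PlaceIn K ρ) (v : Fin 5 → Vec k)
    (hv : LinIndep k ![v 0, v 1, v 2, v 3, v 4]) (x : Fin 6 → K)
    (hl : C.OnLine (chA K v x) (chB K v x))
    (hno : ∀ a b c : Vec k, LinIndep k ![a, b, c] → C.OnLine a b → ¬ C.Tan a b c) :
    ∃ m r : R, (algMap R K m) ^ 2 *
      C.G3 (chA K v x) (chB K v x) (cst k K (v 2)) (cst k K (v 3)) (cst k K (v 4)) * algMap R K r = 1 ∧
      ∀ i, ∃ s : R, algMap R K s = algMap R K m * x i := by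
  have hvK := cst_li5 K hv
  rw [li5_iff] at hvK
  have hab : LinIndep K ![chA K v x, chB K v x] := by
    rw [li2_iff]; intro s t hst
    have := hvK s t (s * x 0 + t * x 3) (s * x 1 + t * x 4) (s * x 2 + t * x 5) (by
      rw [← hst, chA, chB]; module)
    exact ⟨this.1, this.2.1⟩
  obtain ⟨e1, e2, a11, a21, a22, h11, h22, he1, he2, hli⟩ := hP.flag2 hab
  obtain ⟨p0, p1, p2, p3, p4, hp⟩ := exists_coordR (R := R) hv e1
  obtain ⟨q0, q1, q2, q3, q4, hq⟩ := exists_coordR (R := R) hv e2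
  let φ := algMap R K
  have hp' : φ p0 = a11 ∧ φ p1 = 0 ∧ φ p2 = a11 * x 0 ∧ φ p3 = a11 * x 1 ∧ φ p4 = a11 * x 2 := by
    have := hvK (φ p0 - a11) (φ p1) (φ p2 - a11 * x 0) (φ p3 - a11 * x 1) (φ p4 - a11 * x 2) (by
      have h1 := he1
      rw [hp] at h1
      simp only [up_add, up_smul, up_cst, chA] at h1
      rw [← sub_eq_zero] at h1
      rw [← h1]; module)
    simpa only [sub_eq_zero] using this
  have hq' : φ q0 = a21 ∧ φ q1 = a22 ∧ φ q2 = a21 * x 0 + a22 * x 3 ∧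
      φ q3 = a21 * x 1 + a22 * x 4 ∧ φ q4 = a21 * x 2 + a22 * x 5 := by
    have := hvK (φ q0 - a21) (φ q1 - a22) (φ q2 - (a21 * x 0 + a22 * x 3))
      (φ q3 - (a21 * x 1 + a22 * x 4)) (φ q4 - (a21 * x 2 + a22 * x 5)) (by
      have h1 := he2
      rw [hq] at h1
      simp only [up_add, up_smul, up_cst, chA, chB] at h1
      rw [← sub_eq_zero] at h1
      rw [← h1]; module)
    simpa only [sub_eq_zero] using this
  obtain ⟨P0, P1, P2, P3, P4⟩ := hp'
  obtain ⟨Q0, Q1, Q2, Q3, Q4⟩ := hq'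
  have hp1 : p1 = 0 := hP.inj (by simpa using P1)
  have hlR : C.OnLine e1 e2 := by
    apply OnLine.of_up hP
    have := hl.comb a11 0 a21 a22
    rwa [zero_smul, add_zero, ← he1, ← he2] at this
  have hlk : C.OnLine (rs ρ e1) (rs ρ e2) := hlR.rs
  have hGe : C.G3 (up K e1) (up K e2) (cst k K (v 2)) (cst k K (v 3)) (cst k K (v 4)) =
      (φ (p0 * q1)) ^ 3 *
      C.G3 (chA K v x) (chB K v x) (cst k K (v 2)) (cst k K (v 3)) (cst k K (v 4)) := by
    rw [he1, he2, G3_comb _ _ _ _ _ _ _ _ hl.1, map_mul, P0, Q1]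
  -- the determinant argument
  obtain ⟨F, hF⟩ := Cub.li_dual _ hli
  have hF00 := hF 0 0
  have hF01 := hF 0 1
  have hF10 := hF 1 0
  have hF11 := hF 1 1
  simp only [Matrix.cons_val_zero, Matrix.cons_val_one, reduceIte, zero_ne_one, one_ne_zero] at hF00 hF01 hF10 hF11
  obtain ⟨ψ, hψ⟩ : ∃ ψ : Fin 2 → (Vec R) → R, ∀ i w, ψ i w = ∑ l, algMap k R (F i l) * w l :=
    ⟨_, fun i w => rfl⟩
  have ψadd : ∀ i a b, ψ i (a + b) = ψ i a + ψ i b := by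
    intro i a b; simp only [hψ, Pi.add_apply, mul_add, Finset.sum_add_distrib]
  have ψsmul : ∀ i c a, ψ i (c • a) = c * ψ i a := by
    intro i c a; simp only [hψ, Pi.smul_apply, smul_eq_mul, Finset.mul_sum]
    exact Finset.sum_congr rfl fun _ _ => by ring
  have ψρ : ∀ i w, ρ (ψ i w) = ∑ l, F i l * rs ρ w l := by intro i w; simp [hψ, map_sum, rs]
  let V : Fin 5 → Vec R := fun i => cst k R (v i)
  let S : Matrix (Fin 5) (Fin 5) R := Matrix.of ![fun i => ψ 0 (V i), fun i => ψ 1 (V i),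
    fun i => C.T e1 e1 (V i), fun i => C.T e1 e2 (V i), fun i => C.T e2 e2 (V i)]
  let Q : Matrix (Fin 5) (Fin 5) R :=
    !![p0, q0, 0, 0, 0; 0, q1, 0, 0, 0; p2, q2, 1, 0, 0; p3, q3, 0, 1, 0; p4, q4, 0, 0, 1]
  have he1V : e1 = p0 • V 0 + p2 • V 2 + p3 • V 3 + p4 • V 4 := by
    rw [hp, hp1]; simp only [zero_smul, add_zero]; rfl
  have he2V : e2 = q0 • V 0 + q1 • V 1 + q2 • V 2 + q3 • V 3 + q4 • V 4 := hq
  obtain ⟨l1, l2, l3, l4⟩ := hlR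
  have l2' : C.T e1 e2 e1 = 0 := by rw [C.T_swap23]; exact l2
  have l3' : C.T e2 e2 e1 = 0 := by rw [C.T_swap23, C.T_swap12]; exact l3
  have hf1 : ∀ f : (Vec R) → R, (∀ a b, f (a + b) = f a + f b) → (∀ c a, f (c • a) = c * f a) →
      f e1 = p0 * f (V 0) + p2 * f (V 2) + p3 * f (V 3) + p4 * f (V 4) ∧
      f e2 = q0 * f (V 0) + q1 * f (V 1) + q2 * f (V 2) + q3 * f (V 3) + q4 * f (V 4) := by
    intro f h1 h2
    constructor
    · conv_lhs => rw [he1V]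
      simp only [h1, h2]
    · conv_lhs => rw [he2V]
      simp only [h1, h2]
  have hSQ : S * Q = !![ψ 0 e1, ψ 0 e2, ψ 0 (V 2), ψ 0 (V 3), ψ 0 (V 4);
      ψ 1 e1, ψ 1 e2, ψ 1 (V 2), ψ 1 (V 3), ψ 1 (V 4);
      0, 0, C.T e1 e1 (V 2), C.T e1 e1 (V 3), C.T e1 e1 (V 4);
      0, 0, C.T e1 e2 (V 2), C.T e1 e2 (V 3), C.T e1 e2 (V 4);
      0, 0, C.T e2 e2 (V 2), C.T e2 e2 (V 3), C.T e2 e2 (V 4)] := by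
    have A0 := hf1 (ψ 0) (ψadd 0) (ψsmul 0)
    have A1 := hf1 (ψ 1) (ψadd 1) (ψsmul 1)
    have A2 := hf1 (C.T e1 e1) (C.T_add3 _ _) (fun c a => C.T_smul3 c _ _ a)
    have A3 := hf1 (C.T e1 e2) (C.T_add3 _ _) (fun c a => C.T_smul3 c _ _ a)
    have A4 := hf1 (C.T e2 e2) (C.T_add3 _ _) (fun c a => C.T_smul3 c _ _ a)
    rw [l1, l2] at A2
    rw [l2', l3] at A3
    rw [l3', l4] at A4
    rw [A0.1, A0.2, A1.1, A1.2]
    ext i j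
    rw [Matrix.mul_apply]
    fin_cases i <;> fin_cases j <;> simp [S, Q, Fin.sum_univ_succ, -zero_eq_mul]
    · ring
    · ring
    · ring
    · ring
    · rw [A2.1]; ring
    · rw [A2.2]; ring
    · rw [A3.1]; ring
    · rw [A3.2]; ring
    · rw [A4.1]; ring
    · rw [A4.2]; ring
  have hdet := congrArg Matrix.det hSQ
  rw [Matrix.det_mul, det5, show Q.det = p0 * q1 from det5' _ _ _ _ _ _ _ _ _] at hdet
  have hS : ρ S.det ≠ 0 := by
    rw [AlgHom.map_det]
    intro h0
    obtain ⟨y, hy, hSy⟩ := Matrix.exists_mulVec_eq_zero_iff.2 h0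
    obtain ⟨w, hw⟩ : ∃ w, w = y 0 • v 0 + y 1 • v 1 + y 2 • v 2 + y 3 • v 3 + y 4 • v 4 := ⟨_, rfl⟩
    have hw0 : w ≠ 0 := by
      intro h; rw [hw] at h
      have := li5_iff.1 hv _ _ _ _ _ h
      apply hy; ext i; fin_cases i
      exacts [this.1, this.2.1, this.2.2.1, this.2.2.2.1, this.2.2.2.2]
    have hrow : ∀ (f : (Vec R) → R) (g : (Vec k) → k), (∀ w, ρ (f w) = g (rs ρ w)) →
        (∀ a b, g (a + b) = g a + g b) → (∀ c a, g (c • a) = c * g a) →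
        (∑ i, ρ (f (V i)) * y i = 0) → g w = 0 := by
      intro f g h1 h2 h3 h4
      rw [hw]; simp only [h2, h3]
      simp only [h1, V, rs_cst, Fin.sum_univ_succ] at h4
      simp at h4
      rw [← h4];
      ring
    have hrowi : ∀ i, ∑ j, ρ (S i j) * y j = 0 := fun i => congrFun hSy i
    have R0 : ∑ l, F 0 l * w l = 0 := hrow (ψ 0) (fun w => ∑ l, F 0 l * w l) (ψρ 0)
      (by intro a b; simp only [Pi.add_apply, mul_add, Finset.sum_add_distrib])
      (by intro c a; simp only [Pi.smul_apply, smul_eq_mul, Finset.mul_sum]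
          exact Finset.sum_congr rfl fun _ _ => by ring) (hrowi 0)
    have R1 : ∑ l, F 1 l * w l = 0 := hrow (ψ 1) (fun w => ∑ l, F 1 l * w l) (ψρ 1)
      (by intro a b; simp only [Pi.add_apply, mul_add, Finset.sum_add_distrib])
      (by intro c a; simp only [Pi.smul_apply, smul_eq_mul, Finset.mul_sum]
          exact Finset.sum_congr rfl fun _ _ => by ring) (hrowi 1)
    have R2 : C.T (rs ρ e1) (rs ρ e1) w = 0 := hrow (C.T e1 e1) _ (fun w => (T_rs C _ _ _).symm)
      (C.T_add3 _ _) (fun c a => C.T_smul3 c _ _ a) (hrowi 2)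
    have R3 : C.T (rs ρ e1) (rs ρ e2) w = 0 := hrow (C.T e1 e2) _ (fun w => (T_rs C _ _ _).symm)
      (C.T_add3 _ _) (fun c a => C.T_smul3 c _ _ a) (hrowi 3)
    have R4 : C.T (rs ρ e2) (rs ρ e2) w = 0 := hrow (C.T e2 e2) _ (fun w => (T_rs C _ _ _).symm)
      (C.T_add3 _ _) (fun c a => C.T_smul3 c _ _ a) (hrowi 4)
    refine hno (rs ρ e1) (rs ρ e2) w ?_ hlk ⟨R2, R3, R4⟩
    rw [li3_iff]
    intro a b c h
    have happ : ∀ i : Fin 2, a * (∑ l, F i l * rs ρ e1 l) + b * (∑ l, F i l * rs ρ e2 l) +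
        c * (∑ l, F i l * w l) = 0 := by
      intro i
      have : ∑ l, F i l * (a • rs ρ e1 + b • rs ρ e2 + c • w) l = 0 := by rw [h]; simp
      rw [← this]
      simp only [Finset.mul_sum, ← Finset.sum_add_distrib, Pi.add_apply, Pi.smul_apply, smul_eq_mul]
      exact Finset.sum_congr rfl fun _ _ => by ring
    have i0 := happ 0
    have i1 := happ 1
    rw [hF00, hF01, R0] at i0
    rw [hF10, hF11, R1] at i1
    have ha : a = 0 := by linear_combination i0
    have hb : b = 0 := by linear_combination i1
    refine ⟨ha, hb, ?_⟩
    rw [ha, hb] at h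
    simpa [hw0] using h
  obtain ⟨s, hs⟩ := hP.toIsPlace.inv hS
  have hGR : C.G3 (up K e1) (up K e2) (cst k K (v 2)) (cst k K (v 3)) (cst k K (v 4)) =
      φ (C.G3 e1 e2 (V 2) (V 3) (V 4)) := by
    rw [← up_cst (R := R), ← up_cst (R := R), ← up_cst (R := R), G3_up]
  have hmG : p0 * q1 = C.G3 e1 e2 (V 2) (V 3) (V 4) * (s * (ψ 0 e1 * ψ 1 e2 - ψ 0 e2 * ψ 1 e1)) := by
    rw [G3]
    linear_combination s * hdet - (p0 * q1) * hs
  refine ⟨p0 * q1, s * (ψ 0 e1 * ψ 1 e2 - ψ 0 e2 * ψ 1 e1), ?_, ?_⟩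
  · have h1 := congrArg φ hmG
    rw [map_mul φ (C.G3 _ _ _ _ _), ← hGR, hGe] at h1
    have h2 : φ (p0 * q1) ≠ 0 := by rw [map_mul, P0, Q1]; exact mul_ne_zero h11 h22
    apply mul_left_cancel₀ h2
    change φ (p0 * q1) * ((φ (p0 * q1)) ^ 2 * _ * φ _) = _
    linear_combination -h1
  · have e : algMap R K (p0 * q1) = a11 * a22 := by rw [map_mul]; exact congrArg₂ _ P0 Q1
    intro i
    rw [e]
    fin_cases i
    · exact ⟨q1 * p2, by rw [map_mul]; change φ q1 * φ p2 = _; rw [Q1, P2]; simp; ring⟩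
    · exact ⟨q1 * p3, by rw [map_mul]; change φ q1 * φ p3 = _; rw [Q1, P3]; simp; ring⟩
    · exact ⟨q1 * p4, by rw [map_mul]; change φ q1 * φ p4 = _; rw [Q1, P4]; simp; ring⟩
    · exact ⟨p0 * q2 - q0 * p2, by
        rw [map_sub, map_mul, map_mul]; change φ p0 * φ q2 - φ q0 * φ p2 = _
        rw [P0, Q2, Q0, P2]; simp; ring⟩
    · exact ⟨p0 * q3 - q0 * p3, by
        rw [map_sub, map_mul, map_mul]; change φ p0 * φ q3 - φ q0 * φ p3 = _
        rw [P0, Q3, Q0, P3]; simp; ring⟩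
    · exact ⟨p0 * q4 - q0 * p4, by
        rw [map_sub, map_mul, map_mul]; change φ p0 * φ q4 - φ q0 * φ p4 = _
        rw [P0, Q4, Q0, P4]; simp; ring⟩

end ample

theorem const_of_places {k K : Type} [Field k] [Field K] [Algebra k K] (hp : HasPlaces k K) (z : K)
    (h : ∀ (R : Type) [CommRing R] [IsDomain R] [Algebra k R] [Algebra R K] [IsScalarTower k R K]
      (ρ : R →ₐ[k] k), PlaceIn K ρ → z ∈ Set.range (algMap R K)) :
    z ∈ Set.range (algMap k K) := by
  by_contra hz
  obtain ⟨R, _, _, _, _, _, ρ, h1, h2, h3, h4⟩ := hp z hz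
  exact h4 (h R ρ ⟨h1, h2, h3⟩)

theorem ample {k K : Type} [Field k] [CharZero k] [Field K] [Algebra k K] (hp : HasPlaces k K)
    {C : Cub k} (v : Fin 5 → Vec k)
    (hv : LinIndep k ![v 0, v 1, v 2, v 3, v 4]) (x : Fin 6 → K)
    (hl : C.OnLine (chA K v x) (chB K v x)) (hx : ∃ i, x i ∉ Set.range (algMap k K)) :
    ∃ a b c : Vec k, LinIndep k ![a, b, c] ∧ C.OnLine a b ∧ C.Tan a b c := by
  by_contra hcon
  have hno : ∀ a b c : Vec k, LinIndep k ![a, b, c] → C.OnLine a b → ¬ C.Tan a b c :=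
    fun a b c h1 h2 h3 => hcon ⟨a, b, c, h1, h2, h3⟩
  set g := C.G3 (chA K v x) (chB K v x) (cst k K (v 2)) (cst k K (v 3)) (cst k K (v 4)) with hg
  obtain ⟨c, hc⟩ := const_of_places hp g⁻¹ (by
    intro R _ _ _ _ _ ρ hP
    obtain ⟨m, r, h1, -⟩ := place_ample hP v hv x hl hno
    refine ⟨m ^ 2 * r, ?_⟩
    rw [eq_comm, inv_eq_iff_eq_inv, eq_comm, inv_eq_iff_eq_inv, map_mul, map_pow]
    rw [← hg] at h1
    exact eq_inv_of_mul_eq_one_left (by linear_combination h1))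
  obtain ⟨i, hi⟩ := hx
  apply hi
  apply const_of_places hp
  intro R _ _ _ _ _ ρ hP
  obtain ⟨m, r, h1, h2⟩ := place_ample hP v hv x hl hno
  obtain ⟨s, hs⟩ := h2 i
  rw [← hg] at h1
  refine ⟨s * m * r * algMap k R c⁻¹, ?_⟩
  have hgc : algMap k K c⁻¹ = g := by rw [map_inv₀, hc, inv_inv]
  rw [map_mul, map_mul, map_mul, hs, ← IsScalarTower.algebraMap_apply, hgc]
  linear_combination x i * h1

end Cub

/-! ### Triple lines are constant -/

/-- resultant of two binary quadratic forms -/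
def res2 {R : Type} [CommRing R] (a0 a1 a2 b0 b1 b2 : R) : R :=
  (a0 * b2 - a2 * b0) ^ 2 - 4 * (a0 * b1 - a1 * b0) * (a1 * b2 - a2 * b1)

theorem exists_quad_root {k : Type} [Field k] [IsAlgClosed k] (a b c : k) (ha : a ≠ 0) :
    ∃ x, a * x ^ 2 + b * x + c = 0 := by
  have hd : (PolyC a * PolyX ^ 2 + PolyC b * PolyX + PolyC c).degree = 2 :=
    Polynomial.degree_quadratic ha
  obtain ⟨x, hx⟩ := IsAlgClosed.exists_root _ (by rw [hd]; norm_num)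
  exact ⟨x, by simpa [Polynomial.IsRoot] using hx⟩

theorem common_zero_aux {k : Type} [Field k] [IsAlgClosed k] {a0 a1 a2 b0 b1 b2 : k}
    (h : res2 a0 a1 a2 b0 b1 b2 = 0) (ha : a0 ≠ 0) : ∃ x,
      a0 * x ^ 2 + 2 * a1 * x + a2 = 0 ∧ b0 * x ^ 2 + 2 * b1 * x + b2 = 0 := by
  obtain ⟨r, hr⟩ := exists_quad_root a0 (2 * a1) a2 ha
  obtain ⟨s, hs⟩ : ∃ s, a0 * s = - (2 * a1) - a0 * r := ⟨(- (2 * a1) - a0 * r) / a0, by field_simp⟩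
  have hs2 : a0 * s ^ 2 + 2 * a1 * s + a2 = 0 := by linear_combination hr + (s - r) * hs
  have h1 : (b0 * r ^ 2 + 2 * b1 * r + b2) * (b0 * s ^ 2 + 2 * b1 * s + b2) * a0 ^ 2 = 0 := by
    have hrs : a0 * (r * s) = a2 := by linear_combination r * hs - hr
    have hrps : a0 * (r + s) = - 2 * a1 := by linear_combination hs
    have e : (b0 * r ^ 2 + 2 * b1 * r + b2) * (b0 * s ^ 2 + 2 * b1 * s + b2) * a0 ^ 2 =
        b0 ^ 2 * (a0 * (r * s)) ^ 2 + 2 * b0 * b1 * (a0 * (r * s)) * (a0 * (r + s))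
        + b0 * b2 * ((a0 * (r + s)) ^ 2 - 2 * a0 * (a0 * (r * s)))
        + 4 * b1 ^ 2 * a0 * (a0 * (r * s)) + 2 * b1 * b2 * a0 * (a0 * (r + s)) + b2 ^ 2 * a0 ^ 2 := by ring
    rw [e, hrs, hrps]
    rw [res2] at h
    linear_combination h
  rcases mul_eq_zero.1 h1 with h2 | h2
  · rcases mul_eq_zero.1 h2 with h3 | h3
    · exact ⟨r, hr, h3⟩
    · exact ⟨s, hs2, h3⟩
  · exact absurd h2 (pow_ne_zero 2 ha)

theorem common_zero {k : Type} [Field k] [IsAlgClosed k] {a0 a1 a2 b0 b1 b2 : k}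
    (h : res2 a0 a1 a2 b0 b1 b2 = 0) : ∃ x y, (x ≠ 0 ∨ y ≠ 0) ∧
      a0 * x ^ 2 + 2 * a1 * x * y + a2 * y ^ 2 = 0 ∧ b0 * x ^ 2 + 2 * b1 * x * y + b2 * y ^ 2 = 0 := by
  by_cases ha : a0 = 0
  · by_cases hb : b0 = 0
    · exact ⟨1, 0, Or.inl one_ne_zero, by simp [ha], by simp [hb]⟩
    · obtain ⟨x, h1, h2⟩ := common_zero_aux (a0 := b0) (a1 := b1) (a2 := b2) (b0 := a0) (b1 := a1)
        (b2 := a2) (by rw [← h]; simp only [res2]; ring) hb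
      exact ⟨x, 1, Or.inr one_ne_zero, by simpa using h2, by simpa using h1⟩
  · obtain ⟨x, h1, h2⟩ := common_zero_aux h ha
    exact ⟨x, 1, Or.inr one_ne_zero, by simpa using h1, by simpa using h2⟩

section syl
variable {k R : Type} [Field k] [CharZero k] [CommRing R] [IsDomain R] [Algebra k R] {ρ : R →ₐ[k] k}

theorem IsPlace.dvd_of_unit (hP : IsPlace ρ) {u y X A m : R} (hu : ρ u ≠ 0) (hm : ρ m = 0)
    (h : u * y = X * A + y * m) : X ∣ y := by
  obtain ⟨v, hv⟩ := hP.inv (a := u - m) (by rw [map_sub, hm, sub_zero]; exact hu)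
  exact ⟨A * v, by linear_combination v * h - y * hv⟩

theorem syl_div (hP : IsPlace ρ) {a0 a1 a2 b0 b1 b2 x1 x2 z1 z2 y X A0 A1 A2 A3 m0 m1 m2 m3 : R}
    (hr : ρ (res2 a0 a1 a2 b0 b1 b2) ≠ 0)
    (hm0 : ρ m0 = 0) (hm1 : ρ m1 = 0) (hm2 : ρ m2 = 0) (hm3 : ρ m3 = 0)
    (h0 : y * (x1 * a0 + z1 * b0) = X * A0 + y * m0)
    (h1 : y * (x2 * a0 + 2 * x1 * a1 + z2 * b0 + 2 * z1 * b1) = X * A1 + y * m1)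
    (h2 : y * (2 * x2 * a1 + x1 * a2 + 2 * z2 * b1 + z1 * b2) = X * A2 + y * m2)
    (h3 : y * (x2 * a2 + z2 * b2) = X * A3 + y * m3)
    (h : x1 = 1 ∨ x2 = 1 ∨ z1 = 1 ∨ z2 = 1) : X ∣ y := by
  have key : ∀ K0 K1 K2 K3 : R, res2 a0 a1 a2 b0 b1 b2 * y =
      K0 * (y * (x1 * a0 + z1 * b0)) + K1 * (y * (x2 * a0 + 2 * x1 * a1 + z2 * b0 + 2 * z1 * b1))
      + K2 * (y * (2 * x2 * a1 + x1 * a2 + 2 * z2 * b1 + z1 * b2)) + K3 * (y * (x2 * a2 + z2 * b2)) →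
      X ∣ y := by
    intro K0 K1 K2 K3 hK
    refine hP.dvd_of_unit hr (A := K0 * A0 + K1 * A1 + K2 * A2 + K3 * A3)
      (m := K0 * m0 + K1 * m1 + K2 * m2 + K3 * m3) (by simp [*]) ?_
    rw [hK, h0, h1, h2, h3]; ring
  rcases h with h | h | h | h <;> subst h
  · refine key (a0*b2*b2 +(2*b1)*(2*b1)*a2 -(2*b1)*(2*a1)*b2 -b0*b2*a2)
      (-(b0*(2*b1)*a2 -b0*(2*a1)*b2)) (b0*b0*a2 -b0*a0*b2) (-(b0*b0*(2*a1) -b0*a0*(2*b1))) ?_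
    rw [res2]; ring
  · refine key (-((2*a1)*b2*b2 -(2*b1)*a2*b2)) (a0*b2*b2 -b0*a2*b2) (-(a0*(2*b1)*b2 -b0*(2*a1)*b2))
      (a0*(2*b1)*(2*b1) +b0*b0*a2 -a0*b0*b2 -b0*(2*a1)*(2*b1)) ?_
    rw [res2]; ring
  · refine key ((2*a1)*(2*a1)*b2 +b0*a2*a2 -(2*a1)*(2*b1)*a2 -a0*a2*b2)
      (-(a0*(2*a1)*b2 -a0*(2*b1)*a2)) (a0*a0*b2 -a0*b0*a2) (-(a0*a0*(2*b1) -a0*b0*(2*a1))) ?_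
    rw [res2]; ring
  · refine key (-((2*b1)*a2*a2 -(2*a1)*b2*a2)) (b0*a2*a2 -a0*b2*a2) (-(b0*(2*a1)*a2 -a0*(2*b1)*a2))
      (a0*a0*b2 +b0*(2*a1)*(2*a1) -a0*(2*b1)*(2*a1) -b0*a0*a2) ?_
    rw [res2]; ring

theorem IsPlace.gcd2 (hP : IsPlace ρ) (a b : R) : ∃ g x y, a = g * x ∧ b = g * y ∧ (x = 1 ∨ y = 1) := by
  rcases hP.total a b with ⟨c, hc⟩ | ⟨c, hc⟩
  · exact ⟨a, 1, c, by ring, hc, Or.inl rfl⟩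
  · exact ⟨b, c, 1, hc, by ring, Or.inr rfl⟩

theorem IsPlace.gcd3 (hP : IsPlace ρ) (a b c : R) :
    ∃ g x y z, a = g * x ∧ b = g * y ∧ c = g * z ∧ (x = 1 ∨ y = 1 ∨ z = 1) := by
  obtain ⟨g, x, y, ha, hb, hxy⟩ := hP.gcd2 a b
  obtain ⟨g', x', y', hg, hc, hxy'⟩ := hP.gcd2 g c
  rcases hxy' with h | h
  · subst h
    exact ⟨g', x, y, y', by rw [ha, hg]; ring, by rw [hb, hg]; ring, hc, by tauto⟩
  · subst h
    exact ⟨g', x' * x, x' * y, 1, by rw [ha, hg]; ring, by rw [hb, hg]; ring, hc, by tauto⟩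

theorem IsPlace.gcd4 (hP : IsPlace ρ) (a b c d : R) :
    ∃ g x y z w, a = g * x ∧ b = g * y ∧ c = g * z ∧ d = g * w ∧ (x = 1 ∨ y = 1 ∨ z = 1 ∨ w = 1) := by
  obtain ⟨g, x, y, ha, hb, hxy⟩ := hP.gcd2 a b
  obtain ⟨g', x', y', z', hg, hc, hd, hxy'⟩ := hP.gcd3 g c d
  by_cases h : x' = 1
  · subst h
    exact ⟨g', x, y, y', z', by rw [ha, hg]; ring, by rw [hb, hg]; ring, hc, hd, by tauto⟩
  · exact ⟨g', x' * x, x' * y, y', z', by rw [ha, hg]; ring, by rw [hb, hg]; ring, hc, hd, by tauto⟩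

end syl

namespace Cub

/-- the line is defined over the constants -/
def ConstLine (k : Type) {K : Type} [Field k] [Field K] [Algebra k K] (a b : Vec K) : Prop :=
  ∃ a0 b0 : Vec k, LinIndep k ![a0, b0] ∧ ∃ s t s' t' : K,
    cst k K a0 = s • a + t • b ∧ cst k K b0 = s' • a + t' • b

/-- the line `a`, `b` is a triple line in the plane `a`, `b`, `c` -/
def Trip {k R : Type} [Field k] [CommRing R] [Algebra k R] (C : Cub k) (a b c : Vec R) : Prop :=
  C.OnLine a b ∧ C.Tan a b c ∧ C.T a c c = 0 ∧ C.T b c c = 0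

theorem Trip.comb {k R : Type} [Field k] [CommRing R] [Algebra k R] {C : Cub k} {a b c : Vec R}
    (h : C.Trip a b c) (x y z w u v r : R) :
    C.Trip (x • a + y • b) (z • a + w • b) (u • a + v • b + r • c) := by
  refine ⟨h.1.comb x y z w, ?_, ?_, ?_⟩
  · obtain ⟨⟨h1, h2, h3, h4⟩, ⟨h5, h6, h7⟩, h8, h9⟩ := h
    refine ⟨?_, ?_, ?_⟩ <;>
    · simp only [T_lin]
      simp only [C.T_swap] at h1 h2 h3 h4 h5 h6 h7 h8 h9 ⊢
      simp [h1, h2, h3, h4, h5, h6, h7, h8, h9]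
  all_goals
    obtain ⟨⟨h1, h2, h3, h4⟩, ⟨h5, h6, h7⟩, h8, h9⟩ := h
    simp only [T_lin]
    simp only [C.T_swap] at h1 h2 h3 h4 h5 h6 h7 h8 h9 ⊢
    simp [h1, h2, h3, h4, h5, h6, h7, h8, h9]

/-- no common zeros along a line with tangent plane -/
theorem SM.res_ne {k : Type} [Field k] [IsAlgClosed k] {C : Cub k} (hC : C.SM)
    {f1 f2 f3 f4 f5 : Vec k} (h : LinIndep k ![f1, f2, f3, f4, f5])
    (hl : C.OnLine f1 f2) (ht : C.Tan f1 f2 f3) :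
    res2 (C.T f1 f1 f4) (C.T f1 f2 f4) (C.T f2 f2 f4) (C.T f1 f1 f5) (C.T f1 f2 f5) (C.T f2 f2 f5) ≠ 0 := by
  intro h0
  obtain ⟨x, y, hxy, h4, h5⟩ := common_zero h0
  have : x • f1 + y • f2 = 0 := by
    apply hC
    intro v
    obtain ⟨y0, y1, y2, y3, y4, rfl⟩ := exists_coord h v
    obtain ⟨⟨h1, h2, h3, h6⟩, ⟨h7, h8, h9⟩⟩ := And.intro hl ht
    simp only [T_lin]
    simp only [C.T_swap] at h1 h2 h3 h4 h5 h6 h7 h8 h9 ⊢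
    simp only [h1, h2, h3, h6, h7, h8, h9]
    linear_combination y3 * h4 + y4 * h5
  have := li5_iff.1 h x y 0 0 0 (by rw [← this]; module)
  tauto

section exps
variable {k R : Type} [Field k] [CommRing R] [Algebra k R] {ρ : R →ₐ[k] k} {C : Cub k}

theorem trip_exp3 {P1 P2 P3 G Q1 Q2 Q3 : Vec R} {x1 x2 x3 y : R}
    (r1 : ρ x1 = 0) (r2 : ρ x2 = 0) (r3 : ρ x3 = 0) (ry : ρ y = 0)
    (h123 : C.T P1 P2 P3 = 0) (h12 : C.T P1 P2 G = 0) (h13 : C.T P1 P3 G = 0) (h23 : C.T P2 P3 G = 0)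
    (h1 : C.T P1 G G = 0) (h2 : C.T P2 G G = 0) (h3 : C.T P3 G G = 0)
    (h : C.T (P1 + x1 • G + y • Q1) (P2 + x2 • G + y • Q2) (P3 + x3 • G + y • Q3) = 0) :
    ∃ m, ρ m = 0 ∧ y * (C.T P1 P2 Q3 + C.T P1 P3 Q2 + C.T P2 P3 Q1) =
      x1 * x2 * x3 * (- C.T G G G) + y * m := by
  refine ⟨-(x1 * (C.T G P2 Q3 + C.T G P3 Q2) + x2 * (C.T G P1 Q3 + C.T G P3 Q1) +
    x3 * (C.T G P1 Q2 + C.T G P2 Q1) + x1 * x2 * C.T G G Q3 + x1 * x3 * C.T G G Q2 +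
    x2 * x3 * C.T G G Q1 + y * (C.T (P1 + x1 • G) Q2 Q3 + C.T (P2 + x2 • G) Q1 Q3 +
    C.T (P3 + x3 • G) Q1 Q2) + y ^ 2 * C.T Q1 Q2 Q3), by simp [*], ?_⟩
  simp only [T_lin] at h ⊢
  simp only [C.T_swap] at h123 h12 h13 h23 h1 h2 h3 h ⊢
  simp only [h123, h12, h13, h23, h1, h2, h3] at h
  linear_combination h

theorem trip_exp2 {P1 P2 G Q1 Q2 Q3 : Vec R} {x1 x2 y w : R}
    (r1 : ρ x1 = 0) (r2 : ρ x2 = 0) (ry : ρ y = 0) (rw' : ρ w = 0)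
    (h12 : C.T P1 P2 G = 0) (h1 : C.T P1 G G = 0) (h2 : C.T P2 G G = 0)
    (h : C.T (P1 + x1 • G + y • Q1) (P2 + x2 • G + y • Q2) (G + w • Q3) = 0) :
    ∃ m B, ρ m = 0 ∧ w * C.T P1 P2 Q3 = x1 * x2 * (- C.T G G G) + y * B + w * m := by
  refine ⟨-(x1 * C.T G P2 Q3 + x2 * C.T P1 G Q3 + x1 * x2 * C.T G G Q3),
    -(C.T (P1 + x1 • G) Q2 (G + w • Q3) + C.T Q1 (P2 + x2 • G) (G + w • Q3) +
      y * C.T Q1 Q2 (G + w • Q3)), by simp [*], ?_⟩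
  simp only [T_lin] at h ⊢
  simp only [C.T_swap] at h12 h1 h2 h ⊢
  simp only [h12, h1, h2] at h
  linear_combination h

theorem trip_exp1 {P1 G Q1 Q3 : Vec R} {x1 y w : R}
    (h1 : C.T P1 G G = 0)
    (h : C.T (P1 + x1 • G + y • Q1) (G + w • Q3) (G + w • Q3) = 0) :
    ∃ A B, x1 * C.T G G G = y * A + w * B := by
  refine ⟨-(C.T Q1 (G + w • Q3) (G + w • Q3)),
    -(2 * C.T (P1 + x1 • G) G Q3 + w * C.T (P1 + x1 • G) Q3 Q3), ?_⟩
  simp only [T_lin] at h ⊢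
  simp only [C.T_swap] at h1 h ⊢
  simp only [h1] at h
  linear_combination h

end exps

section L1
variable {k R K : Type} [Field k] [CharZero k] [IsAlgClosed k] [CommRing R] [IsDomain R] [Field K]
  [Algebra k R] [Algebra k K] [Algebra R K] [IsScalarTower k R K] {ρ : R →ₐ[k] k} {C : Cub k}

theorem triple_const (hP : PlaceIn K ρ) (hC : C.SM) {a b c : Vec K}
    (hli : LinIndep K ![a, b, c]) (ht : C.Trip a b c) : ConstLine k a b := by
  obtain ⟨e1, e2, e3, a11, a21, a22, a31, a32, a33, h11, h22, h33, he1, he2, he3, hl⟩ := hP.flag3 hli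
  have htu : C.Trip (up K e1) (up K e2) (up K e3) := by
    have := ht.comb a11 0 a21 a22 a31 a32 a33
    rwa [zero_smul, add_zero, ← he1, ← he2, ← he3] at this
  have htR : C.Trip e1 e2 e3 := ⟨OnLine.of_up hP htu.1, Tan.of_up hP htu.2.1,
    hP.T_eq_zero C htu.2.2.1, hP.T_eq_zero C htu.2.2.2⟩
  have htk : C.Trip (rs ρ e1) (rs ρ e2) (rs ρ e3) := ⟨htR.1.rs, htR.2.1.rs,
    by rw [T_rs, htR.2.2.1, map_zero], by rw [T_rs, htR.2.2.2, map_zero]⟩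
  obtain ⟨f4, hf4⟩ := exists_ext3 hl
  obtain ⟨f5, hf⟩ := exists_ext4 hf4
  obtain ⟨n11, n12, n21, n22, α1, β1, γ1, α2, β2, γ2, rα1, rβ1, rγ1, rα2, rβ2, rγ2, -, -, -, -, hE1, hE2⟩ :=
    ech2 hP.toIsPlace hf rfl rfl
  obtain ⟨N, b4, b5, c4, c5, β3, γ3, -, -, -, -, rβ3, rγ3, -, -, -, hE3⟩ :=
    ech3 hP.toIsPlace hf rfl rfl rfl
  have hT := htR.comb n11 n12 n21 n22 (N 2 0) (N 2 1) (N 2 2)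
  rw [hE1, hE2, hE3] at hT
  have hres := hC.res_ne hf htk.1 htk.2.1
  have hn : C.T (rs ρ e3) (rs ρ e3) (rs ρ e3) ≠ 0 := by
    intro h0
    obtain ⟨⟨h1, h2, h3, h4⟩, ⟨h5, h6, h7⟩, h8, h9⟩ := htk
    exact hC.no_plane hl h1 h2 h5 h3 h6 h8 h4 h7 h9 h0
  obtain ⟨x, a1, a2, hα1, hα2, hx1⟩ := hP.toIsPlace.gcd2 α1 α2
  obtain ⟨y, y1, y2, y3, y4, hβ1, hβ2, hγ1, hγ2, hy1⟩ := hP.toIsPlace.gcd4 β1 β2 γ1 γ2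
  obtain ⟨w, w1, w2, hβ3, hγ3, hw1⟩ := hP.toIsPlace.gcd2 β3 γ3
  have rx : ρ x = 0 := by
    rcases hx1 with h | h <;> subst h
    · rw [mul_one] at hα1; rw [← hα1]; exact rα1
    · rw [mul_one] at hα2; rw [← hα2]; exact rα2
  have ry : ρ y = 0 := by
    rcases hy1 with h | h | h | h <;> subst h
    · rw [mul_one] at hβ1; rw [← hβ1]; exact rβ1
    · rw [mul_one] at hβ2; rw [← hβ2]; exact rβ2
    · rw [mul_one] at hγ1; rw [← hγ1]; exact rγ1
    · rw [mul_one] at hγ2; rw [← hγ2]; exact rγ2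
  have rw' : ρ w = 0 := by
    rcases hw1 with h | h <;> subst h
    · rw [mul_one] at hβ3; rw [← hβ3]; exact rβ3
    · rw [mul_one] at hγ3; rw [← hγ3]; exact rγ3
  -- constants
  set F1 := cst k R (rs ρ e1) with hF1
  set F2 := cst k R (rs ρ e2) with hF2
  set F3 := cst k R (rs ρ e3) with hF3
  set F4 := cst k R f4 with hF4
  set F5 := cst k R f5 with hF5
  have htF : C.Trip F1 F2 F3 := by
    refine ⟨⟨?_, ?_, ?_, ?_⟩, ⟨?_, ?_, ?_⟩, ?_, ?_⟩ <;> simp only [hF1, hF2, hF3, T_cst]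
    · rw [htk.1.1, map_zero]
    · rw [htk.1.2.1, map_zero]
    · rw [htk.1.2.2.1, map_zero]
    · rw [htk.1.2.2.2, map_zero]
    · rw [htk.2.1.1, map_zero]
    · rw [htk.2.1.2.1, map_zero]
    · rw [htk.2.1.2.2, map_zero]
    · rw [htk.2.2.1, map_zero]
    · rw [htk.2.2.2, map_zero]
  have hresF : ρ (res2 (C.T F1 F1 F4) (C.T F1 F2 F4) (C.T F2 F2 F4) (C.T F1 F1 F5) (C.T F1 F2 F5)
      (C.T F2 F2 F5)) ≠ 0 := by
    convert hres using 1
    simp only [hF1, hF2, hF4, hF5, T_cst, res2, map_sub, map_mul, map_pow, AlgHom.commutes,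
      map_ofNat, Algebra.algebraMap_self, RingHom.id_apply]
  have hnF : ρ (C.T F3 F3 F3) ≠ 0 := by
    convert hn using 1
    simp only [hF3, T_cst, AlgHom.commutes, Algebra.algebraMap_self, RingHom.id_apply]
  obtain ⟨Ω1, hΩ1⟩ : ∃ Ω, Ω = y1 • F4 + y3 • F5 := ⟨_, rfl⟩
  obtain ⟨Ω2, hΩ2⟩ : ∃ Ω, Ω = y2 • F4 + y4 • F5 := ⟨_, rfl⟩
  obtain ⟨Ω3, hΩ3⟩ : ∃ Ω, Ω = w1 • F4 + w2 • F5 := ⟨_, rfl⟩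
  have q1 : F1 + α1 • F3 + β1 • F4 + γ1 • F5 = F1 + (x * a1) • F3 + y • Ω1 := by
    rw [hα1, hβ1, hγ1, hΩ1]; module
  have q2 : F2 + α2 • F3 + β2 • F4 + γ2 • F5 = F2 + (x * a2) • F3 + y • Ω2 := by
    rw [hα2, hβ2, hγ2, hΩ2]; module
  have q3 : F3 + β3 • F4 + γ3 • F5 = F3 + w • Ω3 := by rw [hβ3, hγ3, hΩ3]; module
  rw [q1, q2, q3] at hT
  obtain ⟨⟨z1, z2, z3, z4⟩, ⟨z5, z6, z7⟩, z8, z9⟩ := htF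
  obtain ⟨⟨t1, t2, t3, t4⟩, ⟨t5, t6, t7⟩, t8, t9⟩ := hT
  clear_value F1 F2 F3 F4 F5
  have r1 : ρ (x * a1) = 0 := by rw [map_mul, rx, zero_mul]
  have r2 : ρ (x * a2) = 0 := by rw [map_mul, rx, zero_mul]
  obtain ⟨z2', z3', z6'⟩ : C.T F1 F2 F1 = 0 ∧ C.T F2 F2 F1 = 0 ∧ C.T F2 F1 F3 = 0 :=
    ⟨by rw [C.T_swap23]; exact z2, by rw [C.T_swap23, C.T_swap12]; exact z3, by rw [C.T_swap12]; exact z6⟩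
  obtain ⟨m0, rm0, g0⟩ := trip_exp3 (ρ := ρ) r1 r1 r1 ry z1 z5 z5 z5 z8 z8 z8 t1
  obtain ⟨m1, rm1, g1⟩ := trip_exp3 (ρ := ρ) r1 r1 r2 ry z2 z5 z6 z6 z8 z8 z9 t2
  obtain ⟨m2, rm2, g2⟩ := trip_exp3 (ρ := ρ) r1 r2 r2 ry z3 z6 z6 z7 z8 z9 z9 t3
  obtain ⟨m3, rm3, g3⟩ := trip_exp3 (ρ := ρ) r2 r2 r2 ry z4 z7 z7 z7 z9 z9 z9 t4
  obtain ⟨l5, B5, rl5, g5⟩ := trip_exp2 (ρ := ρ) r1 r1 ry rw' z5 z8 z8 t5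
  obtain ⟨l6, B6, rl6, g6⟩ := trip_exp2 (ρ := ρ) r1 r2 ry rw' z6 z8 z9 t6
  obtain ⟨l7, B7, rl7, g7⟩ := trip_exp2 (ρ := ρ) r2 r2 ry rw' z7 z9 z9 t7
  obtain ⟨A8, B8, g8⟩ := trip_exp1 z8 t8
  obtain ⟨A9, B9, g9⟩ := trip_exp1 z9 t9
  have res3 : ρ (res2 (3 * C.T F1 F1 F4) (3 * C.T F1 F2 F4) (3 * C.T F2 F2 F4) (3 * C.T F1 F1 F5)
      (3 * C.T F1 F2 F5) (3 * C.T F2 F2 F5)) ≠ 0 := by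
    have : res2 (3 * C.T F1 F1 F4) (3 * C.T F1 F2 F4) (3 * C.T F2 F2 F4) (3 * C.T F1 F1 F5)
      (3 * C.T F1 F2 F5) (3 * C.T F2 F2 F5) = 81 * res2 (C.T F1 F1 F4) (C.T F1 F2 F4) (C.T F2 F2 F4)
      (C.T F1 F1 F5) (C.T F1 F2 F5) (C.T F2 F2 F5) := by simp only [res2]; ring
    rw [this, map_mul, map_ofNat]
    exact mul_ne_zero (by norm_num) hresF
  have hxy : x ^ 3 ∣ y := by
    refine syl_div hP.toIsPlace (x1 := y1) (x2 := y2) (z1 := y3) (z2 := y4) res3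
      (m0 := m0) (m1 := 3 * m1) (m2 := 3 * m2) (m3 := m3)
      (A0 := a1 * a1 * a1 * (- C.T F3 F3 F3)) (A1 := 3 * (a1 * a1 * a2 * (- C.T F3 F3 F3)))
      (A2 := 3 * (a1 * a2 * a2 * (- C.T F3 F3 F3))) (A3 := a2 * a2 * a2 * (- C.T F3 F3 F3))
      rm0 (by simp [rm1]) (by simp [rm2]) rm3 ?_ ?_ ?_ ?_ hy1
    · simp only [hΩ1, hΩ2, T_add3, T_smul3] at g0 g1 g2 g3
      linear_combination g0
    · simp only [hΩ1, hΩ2, T_add3, T_smul3] at g0 g1 g2 g3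
      linear_combination 3 * g1
    · simp only [hΩ1, hΩ2, T_add3, T_smul3] at g0 g1 g2 g3
      linear_combination 3 * g2 - 3 * y * y1 * C.T_swap12 F2 F2 F4
    · simp only [hΩ1, hΩ2, T_add3, T_smul3] at g0 g1 g2 g3
      linear_combination g3
  obtain ⟨Y, hY⟩ := hxy
  have hxw : x ^ 2 ∣ w := by
    refine syl_div hP.toIsPlace (x1 := w1) (x2 := 0) (z1 := w2) (z2 := 0) hresF
      (m0 := l5) (m1 := 2 * l6) (m2 := l7) (m3 := 0)
      (A0 := a1 * a1 * (- C.T F3 F3 F3) + x * Y * B5) (A1 := 2 * (a1 * a2 * (- C.T F3 F3 F3) + x * Y * B6))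
      (A2 := (a2 * a2 * (- C.T F3 F3 F3)) + x * Y * B7) (A3 := 0)
      rl5 (by simp [rl6]) rl7 (map_zero _) ?_ ?_ ?_ ?_
      (hw1.elim Or.inl fun h => Or.inr (Or.inr (Or.inl h)))
    · simp only [hΩ3, T_add3, T_smul3] at g5 g6 g7
      rw [hY] at g5
      linear_combination g5
    · simp only [hΩ3, T_add3, T_smul3] at g5 g6 g7
      rw [hY] at g6
      linear_combination 2 * g6
    · simp only [hΩ3, T_add3, T_smul3] at g5 g6 g7
      rw [hY] at g7
      linear_combination g7
    · ring
  obtain ⟨W, hW⟩ := hxw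
  obtain ⟨vn, hvn⟩ := hP.toIsPlace.inv hnF
  have hx0 : ∃ c, x = x ^ 2 * c := by
    rw [hY, hW] at g8 g9
    rcases hx1 with h | h
    · exact ⟨vn * (x * Y * A8 + W * B8), by rw [h] at g8; linear_combination vn * g8 - x * hvn⟩
    · exact ⟨vn * (x * Y * A9 + W * B9), by rw [h] at g9; linear_combination vn * g9 - x * hvn⟩
  have hx : x = 0 := by
    obtain ⟨c, hc⟩ := hx0
    obtain ⟨u, hu⟩ := hP.toIsPlace.inv (a := 1 - x * c) (by simp [rx])
    linear_combination u * hc - x * hu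
  have hy : y = 0 := by rw [hY, hx]; ring
  replace hE1 := hE1.trans q1
  replace hE2 := hE2.trans q2
  rw [hx, hy] at hE1 hE2
  simp only [zero_mul, zero_smul, add_zero] at hE1 hE2
  refine ⟨rs ρ e1, rs ρ e2, ?_, ?_⟩
  · rw [li2_iff]
    intro s t h
    have := li3_iff.1 hl s t 0 (by rw [h]; simp)
    exact ⟨this.1, this.2.1⟩
  · have u1 := congrArg (up K) hE1
    have u2 := congrArg (up K) hE2
    rw [hF1] at u1
    rw [hF2] at u2
    simp only [up_add, up_smul, he1, he2, up_cst] at u1 u2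
    refine ⟨algMap R K n11 * a11 + algMap R K n12 * a21, algMap R K n12 * a22,
      algMap R K n21 * a11 + algMap R K n22 * a21, algMap R K n22 * a22, ?_, ?_⟩
    · rw [← u1]; module
    · rw [← u2]; module

end L1
end Cub

/-! ### Residual double lines of constant lines are constant -/

theorem PlaceIn.sq_int {k R K : Type} [Field k] [CommRing R] [Field K] [Algebra k R]
    [Algebra R K] {ρ : R →ₐ[k] k} (hP : PlaceIn K ρ) {z : K} {s : R} (h : algMap R K s = z ^ 2) :
    ∃ w, algMap R K w = z := by
  rcases hP.val z with ⟨w, hw⟩ | ⟨w, hw⟩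
  · exact ⟨w, hw⟩
  · by_cases hz : z = 0
    · exact ⟨0, by rw [hz, map_zero]⟩
    · refine ⟨s * w, ?_⟩
      rw [map_mul, h, hw]; field_simp

namespace Cub

section gen
variable {k R : Type} [Field k] [CommRing R] [Algebra k R] {C : Cub k}

theorem DblE.comb {p q e : Vec R} {α β γ : R} (hl : C.OnLine p q) (h : C.DblE p q e α β γ)
    (x y z w u v s : R) :
    C.DblE (x • p + y • q) (z • p + w • q) (u • p + v • q + s ^ 2 • e)
      (s * (α * x + β * y)) (s * (α * z + β * w)) (s * (α * u + β * v + γ * s ^ 2)) := by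
  obtain ⟨h1, h2, h3, h4, h5, h6⟩ := h
  obtain ⟨g1, g2, g3, g4⟩ := hl
  refine ⟨?_, ?_, ?_, ?_, ?_, ?_⟩ <;>
  simp only [T_lin] <;>
  simp only [C.T_swap] at h1 h2 h3 h4 h5 h6 g1 g2 g3 g4 ⊢ <;>
  simp only [g1, g2, g3, g4]
  · linear_combination s ^ 2 * (x ^ 2 * h1 + 2 * x * y * h2 + y ^ 2 * h3)
  · linear_combination s ^ 2 * (x * z * h1 + (x * w + y * z) * h2 + y * w * h3)
  · linear_combination s ^ 2 * (z ^ 2 * h1 + 2 * z * w * h2 + w ^ 2 * h3)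
  · linear_combination s ^ 2 * (2 * x * u * h1 + 2 * (x * v + y * u) * h2 + 2 * y * v * h3) +
      s ^ 4 * (x * h4 + y * h5)
  · linear_combination s ^ 2 * (2 * z * u * h1 + 2 * (z * v + w * u) * h2 + 2 * w * v * h3) +
      s ^ 4 * (z * h4 + w * h5)
  · linear_combination s ^ 2 * (u ^ 2 * h1 + 2 * u * v * h2 + v ^ 2 * h3) +
      s ^ 4 * (u * h4 + v * h5) + s ^ 6 * h6

/-- normal form of a line of second type `o`, `a` in its tangent plane -/
structure Nrm (C : Cub k) (o a b : Vec R) : Prop where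
  ooo : C.T o o o = 0
  ooa : C.T o o a = 0
  oob : C.T o o b = 0
  oaa : C.T o a a = 0
  oab : C.T o a b = 0
  obb : C.T o b b = 0
  aaa : C.T a a a = 0
  aab : C.T a a b = 0
  bbb : C.T b b b = 0
  abb : C.T a b b ≠ 0

end gen

section L2
variable {k R K : Type} [Field k] [CharZero k] [IsAlgClosed k] [CommRing R] [IsDomain R] [Field K]
  [Algebra k R] [Algebra k K] [Algebra R K] [IsScalarTower k R K] {ρ : R →ₐ[k] k} {C : Cub k}

theorem dvd_cancel {t A B : R} (ht : t ≠ 0) (rt : ρ t = 0) (h : t * A = t ^ 2 * B) : ρ A = 0 := by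
  have : A = t * B := mul_left_cancel₀ ht (by rw [h]; ring)
  rw [this, map_mul, rt, zero_mul]

theorem dbl_core (hP : IsPlace ρ) (hC : C.SM) {p q f3 f4 f5 : Vec k}
    (hf : LinIndep k ![p, q, f3, f4, f5]) (hl : C.OnLine p q) {x4 x5 α β γ : R}
    (r4 : ρ x4 = 0) (r5 : ρ x5 = 0)
    (hd : C.DblE (cst k R p) (cst k R q) (cst k R f3 + x4 • cst k R f4 + x5 • cst k R f5) α β γ)
    (h : (ρ α = 0 ∧ ρ β ≠ 0 ∧ ρ γ = 0) ∨ (ρ α = 0 ∧ ρ β = 0)) :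
    cst k R f3 + x4 • cst k R f4 + x5 • cst k R f5 = cst k R f3 := by
  obtain ⟨t, w4, w5, h4, h5, hw⟩ := hP.gcd2 x4 x5
  have rt : ρ t = 0 := by
    rcases hw with h | h <;> subst h
    · rw [mul_one] at h4; rw [← h4]; exact r4
    · rw [mul_one] at h5; rw [← h5]; exact r5
  by_cases ht : t = 0
  · rw [h4, h5, ht]; simp
  exfalso
  have h3 : (3 : k) ≠ 0 := by norm_num
  have hd0 : C.DblE p q f3 (ρ α) (ρ β) (ρ γ) := by
    have := DblE.map C hd ρ
    have e1 : ρ ∘ cst k R p = p := rs_cst (ρ := ρ) p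
    have e2 : ρ ∘ cst k R q = q := rs_cst (ρ := ρ) q
    have e3 : ρ ∘ (cst k R f3 + x4 • cst k R f4 + x5 • cst k R f5) = f3 := by
      have : rs ρ (cst k R f3 + x4 • cst k R f4 + x5 • cst k R f5) = f3 := by simp [r4, r5]
      exact this
    rwa [e1, e2, e3] at this
  obtain ⟨Ω, hΩ⟩ : ∃ Ω, Ω = w4 • cst k R f4 + w5 • cst k R f5 := ⟨_, rfl⟩
  have q3 : cst k R f3 + x4 • cst k R f4 + x5 • cst k R f5 = cst k R f3 + t • Ω := by
    rw [h4, h5, hΩ]; module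
  rw [q3] at hd
  have hΩ0 : rs ρ Ω = ρ w4 • f4 + ρ w5 • f5 := by rw [hΩ]; simp
  have hw0 : ρ w4 ≠ 0 ∨ ρ w5 ≠ 0 := by
    rcases hw with h | h
    · left; rw [h, map_one]; exact one_ne_zero
    · right; rw [h, map_one]; exact one_ne_zero
  have hli : LinIndep k ![p, q, f3, rs ρ Ω] := by
    rw [li4_iff, hΩ0]
    intro a b c d habc
    have := li5_iff.1 hf a b c (d * ρ w4) (d * ρ w5) (by rw [← habc]; module)
    refine ⟨this.1, this.2.1, this.2.2.1, ?_⟩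
    rcases hw0 with h | h
    · exact (mul_eq_zero.1 this.2.2.2.1).resolve_right h
    · exact (mul_eq_zero.1 this.2.2.2.2).resolve_right h
  have tr : ∀ x y z : Vec R, C.T (rs ρ x) (rs ρ y) (rs ρ z) = ρ (C.T x y z) := fun x y z => T_rs C x y z
  obtain ⟨g1, g2, g3, g4⟩ := hl
  obtain ⟨d1, d2, d3, d4, d5, d6⟩ := hd
  obtain ⟨c1, c2, c3, c4, c5, c6⟩ := hd0
  have s3 : ρ 3 = 3 := map_ofNat ρ 3
  rcases h with ⟨ra, rb, rg⟩ | ⟨ra, rb⟩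
  · -- the double line is different from the given line
    simp only [ra, rg, zero_mul, mul_zero, ne_eq, OfNat.ofNat_ne_zero, not_false_eq_true, zero_pow,
      mul_eq_zero, h3, false_or] at c1 c2 c4 c5 c6
    have z1 : C.T (cst k R p) (cst k R p) (cst k R f3) = 0 := by rw [T_cst, c1, map_zero]
    have z2 : C.T (cst k R p) (cst k R q) (cst k R f3) = 0 := by rw [T_cst, c2, map_zero]
    have z4 : C.T (cst k R p) (cst k R f3) (cst k R f3) = 0 := by rw [T_cst, c4, map_zero]
    have z5 : C.T (cst k R q) (cst k R f3) (cst k R f3) = 0 := by rw [T_cst, c5, map_zero]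
    have z6 : C.T (cst k R f3) (cst k R f3) (cst k R f3) = 0 := by rw [T_cst, c6, map_zero]
    obtain ⟨v, hv⟩ := hP.inv rb
    obtain ⟨v2, hv2⟩ := hP.inv (a := (2 : R)) (by rw [map_ofNat]; norm_num)
    have ha : ∃ A, α = t * A := by
      refine ⟨v * 3 * C.T (cst k R p) (cst k R q) Ω, ?_⟩
      simp only [T_add3, T_smul3, z2] at d2
      linear_combination -v * d2 - α * hv
    have hg : ∃ A, γ = t * A := by
      refine ⟨v2 * v * 3 * (2 * C.T (cst k R q) (cst k R f3) Ω + t * C.T (cst k R q) Ω Ω), ?_⟩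
      simp only [T_add2, T_smul2, T_add3, T_smul3, z5, C.T_swap23 _ Ω (cst k R f3)] at d5
      linear_combination -v2 * v * d5 - γ * hv - γ * β * v * hv2
    obtain ⟨A, rfl⟩ := ha
    obtain ⟨B, rfl⟩ := hg
    have y1 : C.T p p (rs ρ Ω) = 0 := by
      have := dvd_cancel (ρ := ρ) ht rt (A := 3 * C.T (cst k R p) (cst k R p) Ω) (B := A ^ 2) (by
        simp only [T_add3, T_smul3, z1] at d1
        linear_combination d1)
      rw [map_mul, s3, ← tr, rs_cst] at this
      exact (mul_eq_zero.1 this).resolve_left h3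
    have y2 : C.T p f3 (rs ρ Ω) = 0 := by
      have := dvd_cancel (ρ := ρ) ht rt (A := 6 * C.T (cst k R p) (cst k R f3) Ω)
        (B := 2 * A * B - 3 * C.T (cst k R p) Ω Ω) (by
        simp only [T_add2, T_smul2, T_add3, T_smul3, z4, C.T_swap23 _ Ω (cst k R f3)] at d4
        linear_combination d4)
      rw [map_mul, map_ofNat, ← tr, rs_cst, rs_cst] at this
      exact (mul_eq_zero.1 this).resolve_left (by norm_num)
    have y3 : C.T f3 f3 (rs ρ Ω) = 0 := by
      have := dvd_cancel (ρ := ρ) ht rt (A := 3 * C.T (cst k R f3) (cst k R f3) Ω)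
        (B := B ^ 2 - 3 * C.T (cst k R f3) Ω Ω - t * C.T Ω Ω Ω) (by
        simp only [T_lin] at d6
        simp only [C.T_swap] at d6 z6 ⊢
        simp only [z6] at d6
        linear_combination d6)
      rw [map_mul, s3, ← tr, rs_cst] at this
      exact (mul_eq_zero.1 this).resolve_left h3
    refine hC.no_tangent_hyperplane (a := p) (b := f3) (c := q) (d := rs ρ Ω) ?_ g1 c1 c4 c6 g2
      (by rw [C.T_swap23]; exact c2) (by rw [C.T_swap23, C.T_swap12]; exact c5) y1 y2 y3
    rw [li4_iff] at hli ⊢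
    intro a b c d habc
    have := hli a c b d (by rw [← habc]; module)
    exact ⟨this.1, this.2.2.1, this.2.1, this.2.2.2⟩
  · -- the double line specializes to the given line
    simp only [ra, rb, zero_mul, mul_zero, ne_eq, OfNat.ofNat_ne_zero, not_false_eq_true, zero_pow,
      mul_eq_zero, h3, false_or] at c1 c2 c3 c4 c5
    have rg : ρ γ ≠ 0 := by
      intro hg
      refine hC.no_plane (a := p) (b := q) (c := f3) ?_ g1 g2 c1 g3 c2 c4 g4 c3 c5 (by rw [c6, hg]; simp)
      rw [li3_iff]
      intro a b c habc
      have := li4_iff.1 hli a b c 0 (by rw [← habc]; module)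
      exact ⟨this.1, this.2.1, this.2.2.1⟩
    have z1 : C.T (cst k R p) (cst k R p) (cst k R f3) = 0 := by rw [T_cst, c1, map_zero]
    have z2 : C.T (cst k R p) (cst k R q) (cst k R f3) = 0 := by rw [T_cst, c2, map_zero]
    have z3 : C.T (cst k R q) (cst k R q) (cst k R f3) = 0 := by rw [T_cst, c3, map_zero]
    have z4 : C.T (cst k R p) (cst k R f3) (cst k R f3) = 0 := by rw [T_cst, c4, map_zero]
    have z5 : C.T (cst k R q) (cst k R f3) (cst k R f3) = 0 := by rw [T_cst, c5, map_zero]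
    obtain ⟨v, hv⟩ := hP.inv rg
    obtain ⟨v2, hv2⟩ := hP.inv (a := (2 : R)) (by rw [map_ofNat]; norm_num)
    have ha : ∃ A, α = t * A := by
      refine ⟨v2 * v * 3 * (2 * C.T (cst k R p) (cst k R f3) Ω + t * C.T (cst k R p) Ω Ω), ?_⟩
      simp only [T_add2, T_smul2, T_add3, T_smul3, z4, C.T_swap23 _ Ω (cst k R f3)] at d4
      linear_combination -v2 * v * d4 - α * hv - γ * α * v * hv2
    have hb : ∃ A, β = t * A := by
      refine ⟨v2 * v * 3 * (2 * C.T (cst k R q) (cst k R f3) Ω + t * C.T (cst k R q) Ω Ω), ?_⟩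
      simp only [T_add2, T_smul2, T_add3, T_smul3, z5, C.T_swap23 _ Ω (cst k R f3)] at d5
      linear_combination -v2 * v * d5 - β * hv - γ * β * v * hv2
    obtain ⟨A, rfl⟩ := ha
    obtain ⟨B, rfl⟩ := hb
    have y1 : C.T p p (rs ρ Ω) = 0 := by
      have := dvd_cancel (ρ := ρ) ht rt (A := 3 * C.T (cst k R p) (cst k R p) Ω) (B := A ^ 2) (by
        simp only [T_add3, T_smul3, z1] at d1
        linear_combination d1)
      rw [map_mul, s3, ← tr, rs_cst] at this
      exact (mul_eq_zero.1 this).resolve_left h3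
    have y2 : C.T p q (rs ρ Ω) = 0 := by
      have := dvd_cancel (ρ := ρ) ht rt (A := 3 * C.T (cst k R p) (cst k R q) Ω) (B := A * B) (by
        simp only [T_add3, T_smul3, z2] at d2
        linear_combination d2)
      rw [map_mul, s3, ← tr, rs_cst, rs_cst] at this
      exact (mul_eq_zero.1 this).resolve_left h3
    have y3 : C.T q q (rs ρ Ω) = 0 := by
      have := dvd_cancel (ρ := ρ) ht rt (A := 3 * C.T (cst k R q) (cst k R q) Ω) (B := B ^ 2) (by
        simp only [T_add3, T_smul3, z3] at d3
        linear_combination d3)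
      rw [map_mul, s3, ← tr, rs_cst] at this
      exact (mul_eq_zero.1 this).resolve_left h3
    exact hC.no_tangent_hyperplane hli g1 g2 g3 g4 c1 c2 c3 y1 y2 y3

theorem dbl_const [IsAlgClosed K] (hP : PlaceIn K ρ) (hC : C.SM) {o a b : Vec K}
    (hli : LinIndep K ![o, a, b]) (hn : C.Nrm o a b) (hob : ConstLine k o b) :
    ConstLine k o a := by
  obtain ⟨p, q, hpq, s, t, s', t', hp, hq⟩ := hob
  have hlo : C.OnLine o b := ⟨hn.ooo, hn.oob, hn.obb, hn.bbb⟩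
  obtain ⟨κ, hκ⟩ := IsAlgClosed.exists_pow_nat_eq (3 * C.T a b b) (n := 2) (by norm_num)
  have h30 : (3 : K) ≠ 0 := by rw [← map_ofNat (algMap k K) 3, Ne, map_eq_zero]; norm_num
  have hκ0 : κ ≠ 0 := by
    rintro rfl
    simp [h30, hn.abb] at hκ
  have hd : C.DblE o b a 0 κ 0 := by
    refine ⟨?_, ?_, ?_, ?_, ?_, ?_⟩
    · rw [hn.ooa]; ring
    · rw [C.T_swap23, hn.oab]; ring
    · rw [C.T_swap23, C.T_swap12, hκ]
    · rw [hn.oaa]; ring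
    · rw [C.T_swap12, C.T_swap23, hn.aab]; ring
    · rw [hn.aaa]; ring
  have hlk : C.OnLine (cst k K p) (cst k K q) := by rw [hp, hq]; exact hlo.comb _ _ _ _
  have hl : C.OnLine p q := by
    refine ⟨?_, ?_, ?_, ?_⟩ <;> apply (algMap k K).injective <;> rw [map_zero, ← T_cst]
    exacts [hlk.1, hlk.2.1, hlk.2.2.1, hlk.2.2.2]
  have hpqR : LinIndep k ![rs ρ (cst k R p), rs ρ (cst k R q)] := by
    rw [rs_cst, rs_cst]; exact hpq
  obtain ⟨e3, y, x, hy, he3, hl3⟩ := hP.ext_flag ![cst k R p, cst k R q] (by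
      convert hpqR using 1
      ext i j; fin_cases i <;> rfl) a (by
    intro x hx
    simp only [Fin.sum_univ_two, Matrix.cons_val_zero, Matrix.cons_val_one, up_cst, hp, hq] at hx
    have := li3_iff.1 hli (x 0 * s + x 1 * s') 1 (x 0 * t + x 1 * t') (by rw [← hx]; module)
    exact one_ne_zero this.2.1)
  simp only [Fin.sum_univ_two, Matrix.cons_val_zero, Matrix.cons_val_one, up_cst, rs_cst] at he3 hl3
  have hl3' : LinIndep k ![p, q, rs ρ e3] := by
    rw [li3_iff]
    intro a b c h
    have := hl3 c ![a, b] (by rw [← h]; simp; module)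
    exact ⟨congrFun this.2 0, congrFun this.2 1, this.1⟩
  obtain ⟨f4, hf4⟩ := exists_ext3 hl3'
  obtain ⟨f5, hf⟩ := exists_ext4 hf4
  obtain ⟨f3, hf3⟩ : ∃ f3, f3 = rs ρ e3 := ⟨_, rfl⟩
  rw [← hf3] at hf hl3'
  obtain ⟨X1, X2, X3, X4, X5, hX⟩ := exists_coordR (R := R) hf e3
  obtain ⟨-, -, r3, r4, r5⟩ := residues5 (ρ := ρ) hf (x1 := X1) (x2 := X2) (x3 := X3) (x4 := X4) (x5 := X5)
    (y1 := 0) (y2 := 0) (y3 := 1) (y4 := 0) (y5 := 0) (by rw [← hX, ← hf3]; module)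
  obtain ⟨v, hv⟩ := hP.toIsPlace.inv (a := X3) (by rw [r3]; exact one_ne_zero)
  obtain ⟨E, hE⟩ : ∃ E, E = cst k R f3 + (v * X4) • cst k R f4 + (v * X5) • cst k R f5 := ⟨_, rfl⟩
  have hE1 : E = v • e3 - (v * X1) • cst k R p - (v * X2) • cst k R q := by
    have : v • e3 - (v * X1) • cst k R p - (v * X2) • cst k R q = (X3 * v) • cst k R f3 +
      (v * X4) • cst k R f4 + (v * X5) • cst k R f5 := by rw [hX]; module
    rw [this, hE, hv, one_smul]
  have hv0 : algMap R K v ≠ 0 := by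
    intro h
    have h1 : v = 0 := hP.inj (by rw [h, map_zero])
    rw [h1] at hv; simp at hv
  obtain ⟨σ, hσ⟩ := IsAlgClosed.exists_pow_nat_eq (algMap R K v * y) (n := 2) (by norm_num)
  have hσ0 : σ ≠ 0 := by
    rintro rfl
    have : algMap R K v * y = 0 := by rw [← hσ]; ring
    exact (mul_ne_zero hv0 hy) this
  have hupE : ∃ u w : K, up K E = u • o + w • b + σ ^ 2 • a := by
    refine ⟨algMap R K v * (x 0 * s + x 1 * s') - algMap R K (v * X1) * s - algMap R K (v * X2) * s',
      algMap R K v * (x 0 * t + x 1 * t') - algMap R K (v * X1) * t - algMap R K (v * X2) * t', ?_⟩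
    rw [hE1, hσ]
    simp only [up_sub, up_smul, he3, up_cst, hp, hq]
    module
  obtain ⟨u, w, hup⟩ := hupE
  have hdK := DblE.comb hlo hd s t s' t' u w σ
  rw [← hp, ← hq, ← hup] at hdK
  set α := σ * (0 * s + κ * t) with hα
  set β := σ * (0 * s' + κ * t') with hβ
  set γ := σ * (0 * u + κ * w + 0 * σ ^ 2) with hγ
  have hαβ : α ≠ 0 ∨ β ≠ 0 := by
    by_contra hcon
    push Not at hcon
    have ht : t = 0 := by
      have := hcon.1; rw [hα] at this
      simpa [hσ0, hκ0] using this
    have ht' : t' = 0 := by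
      have := hcon.2; rw [hβ] at this
      simpa [hσ0, hκ0] using this
    have h2 := li2_iff.1 (cst_li2 K hpq)
    rw [hp, hq, ht, ht'] at h2
    have h3 := h2 s' (-s) (by module)
    have h4 := h2 1 0 (by rw [neg_eq_zero.1 h3.2]; module)
    exact one_ne_zero h4.1
  clear_value α β γ
  rw [← up_cst (R := R) p, ← up_cst (R := R) q] at hdK
  obtain ⟨α', rfl⟩ := hP.sq_int (z := α) (s := 3 * C.T (cst k R p) (cst k R p) E) (by
    rw [← hdK.1, T_up, map_mul, map_ofNat])
  obtain ⟨β', rfl⟩ := hP.sq_int (z := β) (s := 3 * C.T (cst k R q) (cst k R q) E) (by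
    rw [← hdK.2.2.1, T_up, map_mul, map_ofNat])
  obtain ⟨γ', rfl⟩ := hP.sq_int (z := γ) (s := C.T E E E) (by
    rw [← hdK.2.2.2.2.2, T_up])
  have hdR : C.DblE (cst k R p) (cst k R q) E α' β' γ' :=
    DblE.of_map C (IsScalarTower.toAlgHom k R K) hP.inj hdK
  have hlR : C.OnLine (cst k R p) (cst k R q) := hl.map (Algebra.ofId k R)
  have hEf : E = cst k R f3 := by
    by_cases h0 : ρ α' = 0 ∧ ρ β' = 0
    · rw [hE] at hdR ⊢
      exact dbl_core hP.toIsPlace hC hf hl (by simp [r4]) (by simp [r5]) hdR (Or.inr h0)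
    · obtain ⟨S, T', hST⟩ : ∃ S T' : k, ρ α' * S + ρ β' * T' = 1 := by
        by_cases h1 : ρ α' = 0
        · have h2 : ρ β' ≠ 0 := fun h => h0 ⟨h1, h⟩
          exact ⟨0, (ρ β')⁻¹, by field_simp; ring⟩
        · exact ⟨(ρ α')⁻¹, 0, by field_simp; ring⟩
      have hd2 := DblE.comb hlR hdR (algMap k R (ρ β')) (algMap k R (-ρ α')) (algMap k R S)
        (algMap k R T') (algMap k R (-ρ γ' * S)) (algMap k R (-ρ γ' * T')) 1
      have e1 : algMap k R (ρ β') • cst k R p + algMap k R (-ρ α') • cst k R q =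
        cst k R (ρ β' • p + (-ρ α') • q) := by rw [cst_add, cst_smul, cst_smul]
      have e2 : algMap k R S • cst k R p + algMap k R T' • cst k R q = cst k R (S • p + T' • q) := by simp
      have e3' : algMap k R (-ρ γ' * S) • cst k R p + algMap k R (-ρ γ' * T') • cst k R q +
          (1 : R) ^ 2 • E = cst k R (f3 + (-ρ γ' * S) • p + (-ρ γ' * T') • q) + (v * X4) • cst k R f4 +
          (v * X5) • cst k R f5 := by
        rw [hE]; simp only [cst_add, cst_smul]; module
      rw [e1, e2, e3'] at hd2
      have := dbl_core hP.toIsPlace hC (p := ρ β' • p + (-ρ α') • q) (q := S • p + T' • q)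
        (f3 := f3 + (-ρ γ' * S) • p + (-ρ γ' * T') • q) (f4 := f4) (f5 := f5) ?_ (hl.comb _ _ _ _)
        (by simp [r4]) (by simp [r5]) hd2 (Or.inl ⟨by simp; ring, ?_, ?_⟩)
      · rw [hE]
        have h6 : (v * X4) • cst k R f4 + (v * X5) • cst k R f5 = 0 := by
          have := sub_eq_zero.2 this
          rw [← this]; module
        rw [add_assoc, h6, add_zero]
      · rw [li5_iff] at hf ⊢
        intro x y z w u h
        have := hf (x * ρ β' + y * S - z * ρ γ' * S) (- x * ρ α' + y * T' - z * ρ γ' * T') z w u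
          (by rw [← h]; module)
        obtain ⟨h1, h2, h3, h4, h5⟩ := this
        rw [h3] at h1 h2
        refine ⟨?_, ?_, h3, h4, h5⟩
        · linear_combination T' * h1 - S * h2 - x * hST
        · linear_combination ρ α' * h1 + ρ β' * h2 - y * hST
      · simp [hST]
      · simp
        linear_combination (- ρ γ') * hST
  -- the constant double line
  have hdk : C.DblE p q f3 (ρ α') (ρ β') (ρ γ') := by
    have := DblE.map C hdR ρ
    have e1 : ρ ∘ cst k R p = p := rs_cst (ρ := ρ) p
    have e2 : ρ ∘ cst k R q = q := rs_cst (ρ := ρ) q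
    have e3 : ρ ∘ E = f3 := by rw [hEf]; exact rs_cst (ρ := ρ) f3
    rwa [e1, e2, e3] at this
  rw [hEf, up_cst] at hup
  have h0 : ¬ (ρ α' = 0 ∧ ρ β' = 0) := by
    rintro ⟨h1, h2⟩
    obtain ⟨d1, -, d3, -⟩ := hdR
    obtain ⟨c1, -, c3, -⟩ := hdk
    rw [h1] at c1
    rw [h2] at c3
    have c1' : C.T p p f3 = 0 := by simpa using c1
    have c3' : C.T q q f3 = 0 := by simpa using c3
    rw [hEf, T_cst, c1', map_zero, mul_zero] at d1
    rw [hEf, T_cst, c3', map_zero, mul_zero] at d3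
    rcases hαβ with h | h
    · exact h (by rw [pow_eq_zero_iff (by norm_num) |>.1 d1.symm, map_zero])
    · exact h (by rw [pow_eq_zero_iff (by norm_num) |>.1 d3.symm, map_zero])
  obtain ⟨S, T', hST⟩ : ∃ S T' : k, ρ α' * S + ρ β' * T' = 1 := by
    by_cases h1 : ρ α' = 0
    · have h2 : ρ β' ≠ 0 := fun h => h0 ⟨h1, h⟩
      exact ⟨0, (ρ β')⁻¹, by field_simp; ring⟩
    · exact ⟨(ρ α')⁻¹, 0, by field_simp; ring⟩
  have hd2 := DblE.comb hl hdk (ρ β') (-ρ α') S T' (-ρ γ' * S) (-ρ γ' * T') 1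
  obtain ⟨P1, hP1⟩ : ∃ P, P = ρ β' • p + (-ρ α') • q := ⟨_, rfl⟩
  obtain ⟨P2, hP2⟩ : ∃ P, P = (-ρ γ' * S) • p + (-ρ γ' * T') • q + (1 : k) ^ 2 • f3 := ⟨_, rfl⟩
  rw [← hP1, ← hP2] at hd2
  obtain ⟨d1, d2, d3, d4, d5, d6⟩ := hd2
  have k3 : (3 : k) ≠ 0 := by norm_num
  have zz1 : 1 * (ρ α' * ρ β' + ρ β' * -ρ α') = 0 := by ring
  have zz2 : 1 * (ρ α' * (-ρ γ' * S) + ρ β' * (-ρ γ' * T') + ρ γ' * 1 ^ 2) = 0 := by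
    linear_combination (- ρ γ') * hST
  rw [zz1] at d1 d2 d4
  rw [zz2] at d4 d5 d6
  have d1' : C.T P1 P1 P2 = 0 := by simpa [k3] using d1
  have d5' : C.T (S • p + T' • q) P2 P2 = 0 := by simpa [k3] using d5
  have d4' : C.T P1 P2 P2 = 0 := by simpa [k3] using d4
  have d6' : C.T P2 P2 P2 = 0 := by simpa using d6
  have hP1o : ∃ x1 z1 : K, cst k K P1 = x1 • o + z1 • b := by
    refine ⟨algMap k K (ρ β') * s - algMap k K (ρ α') * s',
      algMap k K (ρ β') * t - algMap k K (ρ α') * t', ?_⟩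
    rw [hP1]; simp only [cst_add, cst_smul, hp, hq, map_neg]; module
  have hP2o : ∃ x2 z2 : K, cst k K P2 = x2 • o + z2 • b + σ ^ 2 • a := by
    refine ⟨algMap k K (-ρ γ' * S) * s + algMap k K (-ρ γ' * T') * s' + u,
      algMap k K (-ρ γ' * S) * t + algMap k K (-ρ γ' * T') * t' + w, ?_⟩
    rw [hP2]; simp only [cst_add, cst_smul, hp, hq, map_neg, hup, one_pow, map_one]; module
  obtain ⟨x1, z1, hx1⟩ := hP1o
  obtain ⟨x2, z2, hx2⟩ := hP2o
  have hn10 := hn.abb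
  have hz1 : z1 = 0 := by
    have h1 : C.T (cst k K P1) (cst k K P1) (cst k K P2) = 0 := by rw [T_cst, d1', map_zero]
    rw [hx1, hx2] at h1
    obtain ⟨g1, g2, g3, g4, g5, g6, g7, g8, g9, g10⟩ := hn
    simp only [T_lin] at h1
    simp only [C.T_swap] at g1 g2 g3 g4 g5 g6 g7 g8 g9 g10 h1
    simp only [g1, g2, g3, g4, g5, g6, g7, g8, g9] at h1
    have : z1 ^ 2 * (σ ^ 2 * C.T a b b) = 0 := by linear_combination h1
    simpa [hσ0, hn10] using this
  have hz2 : z2 = 0 := by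
    have h1 : C.T (cst k K P2) (cst k K P2) (cst k K P2) = 0 := by rw [T_cst, d6', map_zero]
    rw [hx2] at h1
    obtain ⟨g1, g2, g3, g4, g5, g6, g7, g8, g9, g10⟩ := hn
    simp only [T_lin] at h1
    simp only [C.T_swap] at g1 g2 g3 g4 g5 g6 g7 g8 g9 g10 h1
    simp only [g1, g2, g3, g4, g5, g6, g7, g8, g9] at h1
    have : z2 ^ 2 * (3 * σ ^ 2 * C.T a b b) = 0 := by linear_combination h1
    simpa [hσ0, hn10, h30] using this
  refine ⟨P1, P2, ?_, x1, 0, x2, σ ^ 2, ?_, ?_⟩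
  · rw [li2_iff]
    intro x y h
    rw [hP1, hP2] at h
    have := li3_iff.1 hl3' (x * ρ β' - y * ρ γ' * S) (- x * ρ α' - y * ρ γ' * T') y (by rw [← h]; module)
    obtain ⟨h1, h2, h3⟩ := this
    rw [h3] at h1 h2
    refine ⟨?_, h3⟩
    linear_combination T' * h1 - S * h2 - x * hST
  · rw [hx1, hz1]; module
  · rw [hx2, hz2]; module

end L2
end Cub

/-! ### A moving line of second type -/

namespace Cub

theorem cst_cst {k k0 K : Type} [Field k] [Field k0] [Field K] [Algebra k k0] [Algebra k0 K] [Algebra k K]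
    [IsScalarTower k k0 K] (v : Vec k) : cst k0 K (cst k k0 v) = cst k K v := by
  ext i; simp [cst, ← IsScalarTower.algebraMap_apply]

theorem chA_tower {k k0 K : Type} [Field k] [Field k0] [Field K] [Algebra k k0] [Algebra k0 K] [Algebra k K]
    [IsScalarTower k k0 K] (v : Fin 5 → Vec k) (x : Fin 6 → K) :
    chA (k := k0) K (fun i => cst k k0 (v i)) x = chA K v x := by
  simp only [chA, cst_cst]

theorem chB_tower {k k0 K : Type} [Field k] [Field k0] [Field K] [Algebra k k0] [Algebra k0 K] [Algebra k K]
    [IsScalarTower k k0 K] (v : Fin 5 → Vec k) (x : Fin 6 → K) :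
    chB (k := k0) K (fun i => cst k k0 (v i)) x = chB K v x := by
  simp only [chB, cst_cst]

theorem stepA {k : Type} [Field k] [CharZero k] [IsAlgClosed k] (C : Cub k) (hC : C.SM) :
    ∃ (k0 : Type) (_ : Field k0) (_ : CharZero k0) (_ : IsAlgClosed k0) (C0 : Cub k0), C0.SM ∧
      (C0.Config → C.Config) ∧
      ∃ a b c : Fin 5 → k0, LinIndep k0 ![a, b, c] ∧ C0.OnLine a b ∧ C0.Tan a b c := by
  obtain ⟨a, b, hab, hl⟩ := C.exists_line
  obtain ⟨c, hc⟩ := exists_ext2 hab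
  obtain ⟨d, hd⟩ := exists_ext3 hc
  obtain ⟨e, he⟩ := exists_ext4 hd
  obtain ⟨K, _, _, _, x, hx, i, hi⟩ := C.chart_curve ![a, b, c, d, e] hl
  obtain ⟨k0, _, _, _, _, _, hy, hp⟩ := exists_constants (x i) hi
  have : CharZero k0 := charZero_of_injective_algebraMap (algMap k k0).injective
  refine ⟨k0, inferInstance, this, inferInstance, C.base k0, C.SM_base hC, C.Config_base, ?_⟩
  refine ample hp (fun i => cst k k0 (![a, b, c, d, e] i)) (cst_li5 k0 he) x ?_ ⟨i, hy⟩
  rw [chA_tower, chB_tower]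
  simpa only [OnLine, T_base] using hx

theorem stepB {k : Type} [Field k] [CharZero k] [IsAlgClosed k] (C : Cub k) (hC : C.SM)
    {a b c : Vec k} (hli : LinIndep k ![a, b, c]) (hl : C.OnLine a b) (ht : C.Tan a b c) :
    ∃ (k0 : Type) (_ : Field k0) (_ : CharZero k0) (_ : IsAlgClosed k0) (C0 : Cub k0) (K : Type) (_ : Field K)
      (_ : IsAlgClosed K) (_ : Algebra k0 K) (v : Fin 5 → Fin 5 → k0) (x : Fin 6 → K), C0.SM ∧
      (C0.Config → C.Config) ∧ HasPlaces k0 K ∧ LinIndep k0 ![v 0, v 1, v 2, v 3, v 4] ∧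
      C0.OnLine (chA K v x) (chB K v x) ∧
      C0.G3 (chA K v x) (chB K v x) (cst k0 K (v 2)) (cst k0 K (v 3)) (cst k0 K (v 4)) = 0 ∧
      ∃ i, x i ∉ Set.range (algMap k0 K) := by
  obtain ⟨d, hd⟩ := exists_ext3 hli
  obtain ⟨e, he⟩ := exists_ext4 hd
  have hG : C.G3 a b c d e = 0 := by
    obtain ⟨h1, h2, h3⟩ := ht
    simp only [G3, h1, h2, h3]; ring
  obtain ⟨K, _, _, _, x, hx, hGx, i, hi⟩ := C.chart_curve2 ![a, b, c, d, e] hl hG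
  obtain ⟨k0, _, _, _, _, _, hy, hp⟩ := exists_constants (x i) hi
  have : CharZero k0 := charZero_of_injective_algebraMap (algMap k k0).injective
  refine ⟨k0, inferInstance, this, inferInstance, C.base k0, K, inferInstance, inferInstance, inferInstance,
    (fun i => cst k k0 (![a, b, c, d, e] i)), x, C.SM_base hC, C.Config_base, hp, cst_li5 k0 he, ?_, ?_, i, hy⟩
  · rw [chA_tower, chB_tower]
    simpa only [OnLine, T_base] using hx
  · rw [chA_tower, chB_tower]
    simpa only [G3, T_base, cst_cst] using hGx

section kernel
variable {k K : Type} [Field k] [CharZero k] [Field K] [Algebra k K] {C : Cub k}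

theorem tan_of_G3 {a b u v w : Vec K} (h : C.G3 a b u v w = 0) :
    ∃ x y z : K, (x ≠ 0 ∨ y ≠ 0 ∨ z ≠ 0) ∧ C.Tan a b (x • u + y • v + z • w) := by
  let M : Matrix (Fin 3) (Fin 3) K := !![C.T a a u, C.T a a v, C.T a a w; C.T a b u, C.T a b v, C.T a b w;
    C.T b b u, C.T b b v, C.T b b w]
  have hM : M.det = 0 := by
    rw [← h, Matrix.det_fin_three]
    simp only [M, G3, Matrix.of_apply, Matrix.cons_val', Matrix.cons_val_zero, Matrix.cons_val_one,
      Matrix.cons_val]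
    ring
  obtain ⟨y, hy, hMy⟩ := Matrix.exists_mulVec_eq_zero_iff.2 hM
  refine ⟨y 0, y 1, y 2, ?_, ?_⟩
  · by_contra hcon
    push Not at hcon
    apply hy; ext i; fin_cases i
    exacts [hcon.1, hcon.2.1, hcon.2.2]
  · have h0 := congrFun hMy 0
    have h1 := congrFun hMy 1
    have h2 := congrFun hMy 2
    simp only [Matrix.mulVec, dotProduct, Fin.sum_univ_three, M, Matrix.of_apply, Matrix.cons_val',
      Matrix.cons_val_zero, Matrix.cons_val_one, Matrix.cons_val, Pi.zero_apply] at h0 h1 h2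
    refine ⟨?_, ?_, ?_⟩ <;> simp only [T_add3, T_smul3]
    · linear_combination h0
    · linear_combination h1
    · linear_combination h2

theorem chart_li {v : Fin 5 → Vec k} (hv : LinIndep k ![v 0, v 1, v 2, v 3, v 4])
    (x : Fin 6 → K) {y0 y1 y2 : K} (hy : y0 ≠ 0 ∨ y1 ≠ 0 ∨ y2 ≠ 0) :
    LinIndep K ![chA K v x, chB K v x,
      y0 • cst k K (v 2) + y1 • cst k K (v 3) + y2 • cst k K (v 4)] := by
  have h5 := li5_iff.1 (cst_li5 K hv)
  rw [li3_iff]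
  intro a b c h
  have := h5 a b (a * x 0 + b * x 3 + c * y0) (a * x 1 + b * x 4 + c * y1) (a * x 2 + b * x 5 + c * y2)
    (by rw [← h, chA, chB]; module)
  obtain ⟨h1, h2, h3, h4, h5⟩ := this
  subst h1 h2
  simp only [zero_mul, zero_add, mul_eq_zero] at h3 h4 h5
  refine ⟨rfl, rfl, ?_⟩
  by_contra hc
  rcases hy with h | h | h
  · exact h (h3.resolve_left hc)
  · exact h (h4.resolve_left hc)
  · exact h (h5.resolve_left hc)

theorem chart_nonconst {v : Fin 5 → Vec k} (hv : LinIndep k ![v 0, v 1, v 2, v 3, v 4])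
    {x : Fin 6 → K} (hx : ∃ i, x i ∉ Set.range (algMap k K)) :
    ¬ ConstLine k (chA K v x) (chB K v x) := by
  rintro ⟨p, q, hpq, s, t, s', t', hp, hq⟩
  obtain ⟨p0, p1, p2, p3, p4, rfl⟩ := exists_coord hv p
  obtain ⟨q0, q1, q2, q3, q4, rfl⟩ := exists_coord hv q
  have h5 := li5_iff.1 (cst_li5 K hv)
  have e1 := h5 (algMap k K p0 - s) (algMap k K p1 - t)
    (algMap k K p2 - s * x 0 - t * x 3) (algMap k K p3 - s * x 1 - t * x 4)
    (algMap k K p4 - s * x 2 - t * x 5) (by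
      rw [← sub_eq_zero] at hp
      simp only [cst_add, cst_smul, chA, chB] at hp
      rw [← hp]; module)
  have e2 := h5 (algMap k K q0 - s') (algMap k K q1 - t')
    (algMap k K q2 - s' * x 0 - t' * x 3) (algMap k K q3 - s' * x 1 - t' * x 4)
    (algMap k K q4 - s' * x 2 - t' * x 5) (by
      rw [← sub_eq_zero] at hq
      simp only [cst_add, cst_smul, chA, chB] at hq
      rw [← hq]; module)
  obtain ⟨a0, a1, a2, a3, a4⟩ := e1
  obtain ⟨b0, b1, b2, b3, b4⟩ := e2
  have hdet : p0 * q1 - p1 * q0 ≠ 0 := by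
    intro h0
    have hK : algMap k K p0 * algMap k K q1 - algMap k K p1 * algMap k K q0 = 0 := by
      rw [← map_mul, ← map_mul, ← map_sub, h0, map_zero]
    rw [sub_eq_zero.1 a0, sub_eq_zero.1 a1, sub_eq_zero.1 b0, sub_eq_zero.1 b1] at hK
    have h2 := li2_iff.1 (cst_li2 K hpq)
    rw [hp, hq] at h2
    have z1 := h2 t' (-t) (by
      have : t' * s - t * s' = 0 := by linear_combination hK
      calc _ = (t' * s - t * s') • chA K v x := by module
        _ = 0 := by rw [this, zero_smul])
    have z2 := h2 s' (-s) (by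
      have : s' * t - s * t' = 0 := by linear_combination -hK
      calc _ = (s' * t - s * t') • chB K v x := by module
        _ = 0 := by rw [this, zero_smul])
    have := h2 1 0 (by rw [neg_eq_zero.1 z1.2, neg_eq_zero.1 z2.2]; module)
    exact one_ne_zero this.1
  have hd : algMap k K (p0 * q1 - p1 * q0) ≠ 0 := by rwa [Ne, map_eq_zero]
  have key : ∀ {y z : K} {g h : k}, algMap k K g - s * y - t * z = 0 →
      algMap k K h - s' * y - t' * z = 0 →
      y ∈ Set.range (algMap k K) ∧ z ∈ Set.range (algMap k K) := by
    intro y z g h hg hh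
    rw [← sub_eq_zero.1 a0, ← sub_eq_zero.1 a1] at hg
    rw [← sub_eq_zero.1 b0, ← sub_eq_zero.1 b1] at hh
    constructor
    · refine ⟨(g * q1 - h * p1) / (p0 * q1 - p1 * q0), ?_⟩
      rw [map_div₀, div_eq_iff hd]
      simp only [map_sub, map_mul]
      linear_combination algMap k K q1 * hg - algMap k K p1 * hh
    · refine ⟨(h * p0 - g * q0) / (p0 * q1 - p1 * q0), ?_⟩
      rw [map_div₀, div_eq_iff hd]
      simp only [map_sub, map_mul]
      linear_combination algMap k K p0 * hh - algMap k K q0 * hg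
  obtain ⟨i, hi⟩ := hx
  apply hi
  fin_cases i
  · exact (key a2 b2).1
  · exact (key a3 b3).1
  · exact (key a4 b4).1
  · exact (key a2 b2).2
  · exact (key a3 b3).2
  · exact (key a4 b4).2

theorem ConstLine.of_comb {a b a' b' : Vec K} {x y z w : K} (h : ConstLine k a b)
    (ha : a = x • a' + y • b') (hb : b = z • a' + w • b') : ConstLine k a' b' := by
  obtain ⟨p, q, hpq, s, t, s', t', hp, hq⟩ := h
  refine ⟨p, q, hpq, s * x + t * z, s * y + t * w, s' * x + t' * z, s' * y + t' * w, ?_, ?_⟩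
  · rw [hp, ha, hb]; module
  · rw [hq, ha, hb]; module

theorem nrm_of_tan {a b e : Vec K} (hli : LinIndep K ![a, b, e]) (hl : C.OnLine a b)
    (ht : C.Tan a b e) (hn : C.T a e e ≠ 0) :
    ∃ o c : Vec K, LinIndep K ![o, a, c] ∧ C.Nrm o a c ∧
      ∃ x y : K, o = x • a + y • b := by
  have h30 : (3 : K) ≠ 0 := by rw [← map_ofNat (algMap k K) 3, Ne, map_eq_zero]; norm_num
  obtain ⟨h1, h2, h3, h4⟩ := hl
  obtain ⟨h5, h6, h7⟩ := ht
  obtain ⟨μ, hμ⟩ : ∃ μ, C.T e e e = 3 * μ * C.T a e e := ⟨C.T e e e / (3 * C.T a e e), by field_simp⟩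
  refine ⟨C.T b e e • a - C.T a e e • b, e - μ • a, ?_, ?_, C.T b e e, - C.T a e e, by module⟩
  · rw [li3_iff] at hli ⊢
    intro x y z h
    have := hli (x * C.T b e e + y - μ * z) (- x * C.T a e e) z (by rw [← h]; module)
    obtain ⟨g1, g2, g3⟩ := this
    have hx : x = 0 := by simpa [hn] using g2
    subst hx g3
    refine ⟨rfl, by simpa using g1, rfl⟩
  · generalize hA : C.T a e e = A at *
    generalize hB : C.T b e e = B at *
    try simp only [C.T_swap] at h1 h2 h3 h4 h5 h6 h7 hA hB hμ
    constructor
    all_goals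
      try simp only [T_sub1, T_sub2, T_sub3, T_smul1, T_smul2, T_smul3]
      try simp only [C.T_swap]
      try simp only [h1, h2, h3, h4, h5, h6, h7, hA, hB, hμ]
    any_goals ring1
    intro h; apply hn; linear_combination h

end kernel

theorem HasPlaces.exists {k K : Type} [Field k] [Field K] [Algebra k K] (hp : HasPlaces k K) {z : K}
    (hz : z ∉ Set.range (algMap k K)) :
    ∃ (R : Type) (_ : CommRing R) (_ : IsDomain R) (_ : Algebra k R) (_ : Algebra R K)
      (_ : IsScalarTower k R K) (ρ : R →ₐ[k] k), PlaceIn K ρ := by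
  obtain ⟨R, _, _, _, _, _, ρ, h1, h2, h3, h4⟩ := hp z hz
  exact ⟨R, inferInstance, inferInstance, inferInstance, inferInstance, inferInstance, ρ, h1, h2, h3⟩

/-- a moving line of second type -/
theorem setup {k : Type} [Field k] [CharZero k] [IsAlgClosed k] (C : Cub k) (hC : C.SM) :
    ∃ (k0 : Type) (_ : Field k0) (_ : CharZero k0) (_ : IsAlgClosed k0) (C0 : Cub k0) (K : Type) (_ : Field K)
      (_ : IsAlgClosed K) (_ : Algebra k0 K) (o a b : Vec K), C0.SM ∧
      (C0.Config → C.Config) ∧ HasPlaces k0 K ∧ LinIndep K ![o, a, b] ∧ C0.Nrm o a b ∧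
      ¬ ConstLine k0 o a ∧ ∃ z : K, z ∉ Set.range (algMap k0 K) := by
  obtain ⟨k1, _, _, _, C1, hC1, hc1, a, b, c, hli, hl, ht⟩ := stepA C hC
  obtain ⟨k0, _, _, _, C0, K, _, _, _, v, x, hC0, hc0, hp, hv, hl, hG, hx⟩ := stepB C1 hC1 hli hl ht
  obtain ⟨y0, y1, y2, hy, hT⟩ := tan_of_G3 hG
  have hli := chart_li hv x hy
  have hnc := chart_nonconst hv hx
  set A := chA K v x
  set B := chB K v x
  set E := y0 • cst k0 K (v 2) + y1 • cst k0 K (v 3) + y2 • cst k0 K (v 4)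
  obtain ⟨i, hi⟩ := hx
  obtain ⟨R, _, _, _, _, _, ρ, hP⟩ := HasPlaces.exists hp hi
  have hor : C0.T A E E ≠ 0 ∨ C0.T B E E ≠ 0 := by
    by_contra hcon
    push Not at hcon
    exact hnc (triple_const hP hC0 hli ⟨hl, hT, hcon.1, hcon.2⟩)
  have hli' : LinIndep K ![B, A, E] := by
    rw [li3_iff] at hli ⊢
    intro x y z h
    have := hli y x z (by rw [← h]; module)
    tauto
  rcases hor with h | h
  · obtain ⟨o, c, hoc, hn, X, Y, ho⟩ := nrm_of_tan hli hl hT h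
    refine ⟨k0, inferInstance, inferInstance, inferInstance, C0, K, inferInstance, inferInstance, inferInstance,
      o, A, c, hC0, fun h => hc1 (hc0 h), hp, hoc, hn, fun h => hnc (h.of_comb ho (z := 1) (w := 0) (by module)), _, hi⟩
  · obtain ⟨o, c, hoc, hn, X, Y, ho⟩ := nrm_of_tan hli' ⟨hl.2.2.2, by rw [C0.T_swap23, C0.T_swap12]; exact hl.2.2.1,
      by rw [C0.T_swap12, C0.T_swap23]; exact hl.2.1, hl.1⟩ ⟨hT.2.2, by rw [C0.T_swap12]; exact hT.2.1, hT.1⟩ h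
    refine ⟨k0, inferInstance, inferInstance, inferInstance, C0, K, inferInstance, inferInstance, inferInstance,
      o, B, c, hC0, fun h => hc1 (hc0 h), hp, hoc, hn, fun h => hnc (h.of_comb (x := Y) (y := X) (z := 0) (w := 1) (by rw [ho]; module) (by module)), _, hi⟩

end Cub

/-! ### Discriminants of cubics depending on a parameter -/

section disc

/-- discriminant of a cubic -/
def dsc {R : Type} [CommRing R] (A B C D : R) : R :=
  B ^ 2 * C ^ 2 - 4 * A * C ^ 3 - 4 * B ^ 3 * D - 27 * A ^ 2 * D ^ 2 + 18 * A * B * C * D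

variable {K : Type} [Field K] [CharZero K] [IsAlgClosed K]

theorem exists_sq (a : K) : ∃ z, z ^ 2 = a := IsAlgClosed.exists_pow_nat_eq a (by norm_num)

theorem exists_cubic_root (A B C D : K) (hA : A ≠ 0) : ∃ z, A * z ^ 3 + B * z ^ 2 + C * z + D = 0 := by
  obtain ⟨z, hz⟩ := IsAlgClosed.exists_root (PolyC A * PolyX ^ 3 + PolyC B * PolyX ^ 2 +
    PolyC C * PolyX + PolyC D) (by rw [Polynomial.degree_cubic hA]; norm_num)
  exact ⟨z, by simpa [Polynomial.IsRoot] using hz⟩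

theorem cubic_double {A B C D : K} (hA : A ≠ 0) (h : dsc A B C D = 0) :
    ∃ z, A * z ^ 3 + B * z ^ 2 + C * z + D = 0 ∧ 3 * A * z ^ 2 + 2 * B * z + C = 0 := by
  obtain ⟨w, hw⟩ := exists_cubic_root A B C D hA
  -- divide by `z - w`
  by_cases hd : 3 * A * w ^ 2 + 2 * B * w + C = 0
  · exact ⟨w, hw, hd⟩
  · have hq : (3 * A * w ^ 2 + 2 * B * w + C) ^ 2 * ((B + A * w) ^ 2 - 4 * A * (C + (B + A * w) * w)) = 0 := by
      have hD : D = - (A * w ^ 3 + B * w ^ 2 + C * w) := by linear_combination hw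
      rw [← h, dsc, hD]; ring
    have hq2 : (B + A * w) ^ 2 - 4 * A * (C + (B + A * w) * w) = 0 := by
      rcases mul_eq_zero.1 hq with h1 | h1
      · exact absurd (pow_eq_zero_iff (by norm_num) |>.1 h1) hd
      · exact h1
    have hz : ∃ z, 2 * A * z = - (B + A * w) := ⟨-(B + A * w) / (2 * A), by field_simp⟩
    obtain ⟨z, hz⟩ := hz
    have hq3 : A * z ^ 2 + (B + A * w) * z + (C + (B + A * w) * w) = 0 := by
      have : (4 * A) * (A * z ^ 2 + (B + A * w) * z + (C + (B + A * w) * w)) = 0 := by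
        linear_combination (2 * A * z + (B + A * w)) * hz - hq2
      exact (mul_eq_zero.1 this).resolve_left (by simpa using hA)
    refine ⟨z, ?_, ?_⟩
    · linear_combination (z - w) * hq3 + hw
    · linear_combination hq3 + (z - w) * hz

theorem X_dvd_C {a : K} {Q : Polynomial K} (h : PolyC a = PolyX * Q) : a = 0 := by
  have := congrArg (Polynomial.eval 0) h
  simpa using this

theorem cubic_order {A B C D : Polynomial K} {A0 A1 B0 B1 C0 C1 D0 D1 : K} {A2 B2 C2 D2 Q : Polynomial K}
    (hA : A = PolyC A0 + PolyX * PolyC A1 + PolyX ^ 2 * A2)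
    (hB : B = PolyC B0 + PolyX * PolyC B1 + PolyX ^ 2 * B2)
    (hC : C = PolyC C0 + PolyX * PolyC C1 + PolyX ^ 2 * C2)
    (hD : D = PolyC D0 + PolyX * PolyC D1 + PolyX ^ 2 * D2)
    (h : dsc A B C D = PolyX ^ 3 * Q) (hne : A0 ≠ 0 ∨ A1 ≠ 0) :
    ∃ z, A0 * z ^ 3 + B0 * z ^ 2 + C0 * z + D0 = 0 ∧ 3 * A0 * z ^ 2 + 2 * B0 * z + C0 = 0 ∧
      A1 * z ^ 3 + B1 * z ^ 2 + C1 * z + D1 = 0 := by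
  have X0 : (PolyX : Polynomial K) ≠ 0 := Polynomial.X_ne_zero
  have hds0 : dsc A0 B0 C0 D0 = 0 := by
    have := congrArg (Polynomial.eval 0) h
    simpa [dsc, hA, hB, hC, hD] using this
  -- shifting
  have key : ∀ z, A0 * z ^ 3 + B0 * z ^ 2 + C0 * z + D0 = 0 → 3 * A0 * z ^ 2 + 2 * B0 * z + C0 = 0 →
      (3 * A0 * z + B0 ≠ 0 ∨ A0 ≠ 0) → A1 * z ^ 3 + B1 * z ^ 2 + C1 * z + D1 = 0 := by
    intro z h0 h1 h2
    set b0 := 3 * A0 * z + B0 with hb0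
    set d1 := A1 * z ^ 3 + B1 * z ^ 2 + C1 * z + D1 with hd1
    have hs : dsc A B C D = dsc A (3 * A * PolyC z + B)
        (3 * A * PolyC z ^ 2 + 2 * B * PolyC z + C)
        (A * PolyC z ^ 3 + B * PolyC z ^ 2 + C * PolyC z + D) := by
      simp only [dsc]; ring
    obtain ⟨b2, hb⟩ : ∃ b2, 3 * A * PolyC z + B = PolyC b0 + PolyX * b2 :=
      ⟨3 * (PolyC A1 + PolyX * A2) * PolyC z + (PolyC B1 + PolyX * B2), by
        rw [hA, hB, hb0]; simp only [map_add, map_mul, map_pow, map_ofNat]; ring⟩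
    obtain ⟨c2, hc⟩ : ∃ c2, 3 * A * PolyC z ^ 2 + 2 * B * PolyC z + C = PolyX * c2 :=
      ⟨3 * (PolyC A1 + PolyX * A2) * PolyC z ^ 2 + 2 * (PolyC B1 + PolyX * B2) * PolyC z
        + (PolyC C1 + PolyX * C2), by
        have := congrArg PolyC h1
        simp only [map_add, map_mul, map_pow, map_ofNat, map_zero] at this
        rw [hA, hB, hC]; linear_combination this⟩
    obtain ⟨e2, he⟩ : ∃ e2, A * PolyC z ^ 3 + B * PolyC z ^ 2 + C * PolyC z + D =
        PolyX * (PolyC d1 + PolyX * e2) :=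
      ⟨A2 * PolyC z ^ 3 + B2 * PolyC z ^ 2 + C2 * PolyC z + D2, by
        have := congrArg PolyC h0
        rw [hd1]
        simp only [map_add, map_mul, map_pow, map_ofNat, map_zero] at this ⊢
        rw [hA, hB, hC, hD]; linear_combination this⟩
    rw [hs, hb, hc, he] at h
    by_cases hbz : b0 = 0
    · have hA0 : A0 ≠ 0 := h2.resolve_left (fun h => h hbz)
      rw [hbz, hA] at h
      have : PolyX ^ 2 * PolyC (-27 * A0 ^ 2 * d1 ^ 2) = PolyX ^ 2 * (PolyX * (Q -
          (PolyX * b2 ^ 2 * c2 ^ 2 - 4 * A * c2 ^ 3 - 4 * PolyX * b2 ^ 3 * (PolyC d1 + PolyX * e2)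
          + 18 * A * b2 * c2 * (PolyC d1 + PolyX * e2)
          - 27 * (PolyC A1 + PolyX * A2) * (2 * PolyC A0 + PolyX * (PolyC A1 + PolyX * A2)) * (PolyC d1 + PolyX * e2) ^ 2
          - 27 * PolyC A0 ^ 2 * e2 * (2 * PolyC d1 + PolyX * e2)))) := by
        simp only [map_neg, map_mul, map_pow, map_ofNat, dsc, map_zero, hA] at h ⊢
        linear_combination h
      have := X_dvd_C (mul_left_cancel₀ (pow_ne_zero 2 X0) this)
      simpa [hA0] using this
    · have : PolyX * PolyC (-4 * b0 ^ 3 * d1) = PolyX * (PolyX * (PolyX * Q -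
          ((PolyC b0 + PolyX * b2) ^ 2 * c2 ^ 2 - 4 * A * PolyX * c2 ^ 3
          - 27 * A ^ 2 * (PolyC d1 + PolyX * e2) ^ 2
          + 18 * A * (PolyC b0 + PolyX * b2) * c2 * (PolyC d1 + PolyX * e2)
          - 4 * b2 * (3 * PolyC b0 ^ 2 + 3 * PolyC b0 * PolyX * b2 + PolyX ^ 2 * b2 ^ 2) * (PolyC d1 + PolyX * e2)
          - 4 * PolyC b0 ^ 3 * e2))) := by
        simp only [map_neg, map_mul, map_pow, map_ofNat, dsc, map_zero] at h ⊢
        linear_combination h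
      have := X_dvd_C (mul_left_cancel₀ X0 this)
      simpa [hbz] using this
  by_cases hA0 : A0 = 0
  · have hA1 := hne.resolve_left (fun h => h hA0)
    by_cases hB0 : B0 = 0
    · subst hA0 hB0
      simp only [map_zero, zero_add] at hA hB
      have hC0 : C0 = 0 := by
        rw [hA, hB, hC] at h
        have : PolyX * PolyC (-4 * A1 * C0 ^ 3) = PolyX * (PolyX * (PolyX * Q -
            ((PolyC B1 + PolyX * B2) ^ 2 * C ^ 2 - 4 * PolyX * (PolyC B1 + PolyX * B2) ^ 3 * D
            - 27 * (PolyC A1 + PolyX * A2) ^ 2 * D ^ 2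
            + 18 * (PolyC A1 + PolyX * A2) * (PolyC B1 + PolyX * B2) * C * D
            - 4 * A2 * C ^ 3 - 4 * PolyC A1 * (PolyC C1 + PolyX * C2) *
              (3 * PolyC C0 ^ 2 + 3 * PolyC C0 * (PolyX * (PolyC C1 + PolyX * C2)) +
              (PolyX * (PolyC C1 + PolyX * C2)) ^ 2)))) := by
          simp only [map_neg, map_mul, map_pow, map_ofNat, dsc, map_zero, hC] at h ⊢
          linear_combination h
        have := X_dvd_C (mul_left_cancel₀ X0 this)
        simpa [hA1] using this
      subst hC0
      simp only [map_zero, zero_add] at hC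
      have hD0 : D0 = 0 := by
        rw [hA, hB, hC, hD] at h
        have : PolyX ^ 2 * PolyC (-27 * A1 ^ 2 * D0 ^ 2) = PolyX ^ 2 * (PolyX * (Q -
            (PolyX * (PolyC B1 + PolyX * B2) ^ 2 * (PolyC C1 + PolyX * C2) ^ 2
            - 4 * (PolyC B1 + PolyX * B2) ^ 3 * D
            - 4 * PolyX * (PolyC A1 + PolyX * A2) * (PolyC C1 + PolyX * C2) ^ 3
            + 18 * (PolyC A1 + PolyX * A2) * (PolyC B1 + PolyX * B2) * (PolyC C1 + PolyX * C2) * D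
            - 27 * A2 * (2 * PolyC A1 + PolyX * A2) * D ^ 2
            - 27 * PolyC A1 ^ 2 * (PolyC D1 + PolyX * D2) *
              (2 * PolyC D0 + PolyX * (PolyC D1 + PolyX * D2))))) := by
          simp only [map_neg, map_mul, map_pow, map_ofNat, dsc, map_zero, hD] at h ⊢
          linear_combination h
        have := X_dvd_C (mul_left_cancel₀ (pow_ne_zero 2 X0) this)
        simpa [hA1] using this
      obtain ⟨z, hz⟩ := exists_cubic_root A1 B1 C1 D1 hA1
      exact ⟨z, by rw [hD0]; ring, by ring, hz⟩
    · subst hA0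
      obtain ⟨z, hz⟩ : ∃ z, 2 * B0 * z + C0 = 0 := ⟨-C0 / (2 * B0), by field_simp; ring⟩
      have hq : C0 ^ 2 - 4 * B0 * D0 = 0 := by
        have : B0 ^ 2 * (C0 ^ 2 - 4 * B0 * D0) = 0 := by rw [← hds0, dsc]; ring
        exact (mul_eq_zero.1 this).resolve_left (pow_ne_zero 2 hB0)
      have h0 : B0 * z ^ 2 + C0 * z + D0 = 0 := by
        have : (4 * B0) * (B0 * z ^ 2 + C0 * z + D0) = 0 := by
          linear_combination (2 * B0 * z + C0) * hz - hq
        exact (mul_eq_zero.1 this).resolve_left (by simpa using hB0)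
      refine ⟨z, by linear_combination h0, by linear_combination hz, key z (by linear_combination h0) (by linear_combination hz) (Or.inl ?_)⟩
      simpa using hB0
  · obtain ⟨z, h0, h1⟩ := cubic_double hA0 hds0
    exact ⟨z, h0, h1, key z h0 h1 (Or.inr hA0)⟩

/-- symmetric matrices of rank at most one -/
theorem sym_rank1 {a b c d e f : K} (h1 : a * d = b ^ 2) (h2 : a * f = c ^ 2) (h3 : d * f = e ^ 2)
    (h4 : a * e = b * c) (h5 : d * c = b * e) (h6 : f * b = c * e) :
    ∃ x y z : K, a = x ^ 2 ∧ b = x * y ∧ c = x * z ∧ d = y ^ 2 ∧ e = y * z ∧ f = z ^ 2 := by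
  by_cases ha : a = 0
  · subst ha
    have hb : b = 0 := by simpa using h1.symm
    have hc : c = 0 := by simpa using h2.symm
    subst hb hc
    by_cases hd : d = 0
    · subst hd
      have he : e = 0 := by simpa using h3.symm
      subst he
      obtain ⟨z, hz⟩ := exists_sq f
      exact ⟨0, 0, z, by simp [hz]⟩
    · obtain ⟨y, hy⟩ := exists_sq d
      have hy0 : y ≠ 0 := by rintro rfl; apply hd; rw [← hy]; ring
      refine ⟨0, y, e / y, by ring, by ring, by ring, hy.symm, by field_simp, ?_⟩
      rw [div_pow, hy, eq_div_iff hd, ← h3]; ring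
  · obtain ⟨y, hy⟩ := exists_sq a
    have hy0 : y ≠ 0 := by rintro rfl; apply ha; rw [← hy]; ring
    refine ⟨y, b / y, c / y, hy.symm, by field_simp, by field_simp, ?_, ?_, ?_⟩
    · rw [div_pow, hy, eq_div_iff ha, ← h1]; ring
    · rw [div_mul_div_comm, ← pow_two, hy, eq_div_iff ha, ← h4]; ring
    · rw [div_pow, hy, eq_div_iff ha, ← h2]; ring

/-- singular symmetric matrices -/
theorem sym_sing {a b c d e f : K} (h : a * d * f + 2 * b * c * e - a * e ^ 2 - d * c ^ 2 - f * b ^ 2 = 0) :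
    (∃ x y z : K, a = x ^ 2 ∧ b = x * y ∧ c = x * z ∧ d = y ^ 2 ∧ e = y * z ∧ f = z ^ 2) ∨
    (∃ x y z : K, (x ≠ 0 ∨ y ≠ 0 ∨ z ≠ 0) ∧ a * x + b * y + c * z = 0 ∧ b * x + d * y + e * z = 0 ∧
      c * x + e * y + f * z = 0 ∧ d * f - e ^ 2 = x ^ 2 ∧ c * e - b * f = x * y ∧ b * e - c * d = x * z ∧
      a * f - c ^ 2 = y ^ 2 ∧ b * c - a * e = y * z ∧ a * d - b ^ 2 = z ^ 2) := by
  obtain ⟨x, y, z, h1, h2, h3, h4, h5, h6⟩ := sym_rank1 (a := d * f - e ^ 2) (b := c * e - b * f)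
    (c := b * e - c * d) (d := a * f - c ^ 2) (e := b * c - a * e) (f := a * d - b ^ 2)
    (by linear_combination f * h) (by linear_combination d * h) (by linear_combination a * h)
    (by linear_combination -e * h) (by linear_combination -c * h) (by linear_combination -b * h)
  by_cases h0 : x = 0 ∧ y = 0 ∧ z = 0
  · left
    obtain ⟨rfl, rfl, rfl⟩ := h0
    exact sym_rank1 (by linear_combination h6) (by linear_combination h4) (by linear_combination h1)
      (by linear_combination -h5) (by linear_combination -h3) (by linear_combination -h2)
  · right
    have hx : x ≠ 0 ∨ y ≠ 0 ∨ z ≠ 0 := by tauto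
    have k1 : ∀ t u v w : K, u * x = 0 → u * y = 0 → u * z = 0 → u = 0 := by
      intro t u v w e1 e2 e3
      by_contra hu
      simp only [mul_eq_zero, hu, false_or] at e1 e2 e3
      tauto
    refine ⟨x, y, z, hx, ?_, ?_, ?_, h1, h2, h3, h4, h5, h6⟩
    · refine k1 0 _ 0 0 ?_ ?_ ?_
      · linear_combination (-a) * h1 - b * h2 - c * h3 + h
      · linear_combination (-a) * h2 - b * h4 - c * h5
      · linear_combination (-a) * h3 - b * h5 - c * h6
    · refine k1 0 _ 0 0 ?_ ?_ ?_
      · linear_combination (-b) * h1 - d * h2 - e * h3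
      · linear_combination (-b) * h2 - d * h4 - e * h5 + h
      · linear_combination (-b) * h3 - d * h5 - e * h6
    · refine k1 0 _ 0 0 ?_ ?_ ?_
      · linear_combination (-c) * h1 - e * h2 - f * h3
      · linear_combination (-c) * h2 - e * h4 - f * h5
      · linear_combination (-c) * h3 - e * h5 - f * h6 + h

end disc

/-! ### Singular conics in planes through the line -/

namespace Cub

section gen
variable {k R S : Type} [Field k] [CommRing R] [Algebra k R] [CommRing S] [Algebra k S]

/-- determinant of the residual conic -/
def Fdet (C : Cub k) (o b e : Vec R) : R :=
  (6 * C.T o o e) * (6 * C.T b b e) * (2 * C.T e e e) + 2 * (6 * C.T o b e) * (3 * C.T o e e) * (3 * C.T b e e)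
  - (6 * C.T o o e) * (3 * C.T b e e) ^ 2 - (6 * C.T b b e) * (3 * C.T o e e) ^ 2
  - (2 * C.T e e e) * (6 * C.T o b e) ^ 2

/-- derivative of the determinant -/
def Fder (C : Cub k) (o b e w : Vec R) : R :=
  ((6 * C.T b b e) * (2 * C.T e e e) - (3 * C.T b e e) ^ 2) * (6 * C.T o o w)
  + 2 * ((3 * C.T o e e) * (3 * C.T b e e) - (6 * C.T o b e) * (2 * C.T e e e)) * (6 * C.T o b w)
  + 2 * ((6 * C.T o b e) * (3 * C.T b e e) - (3 * C.T o e e) * (6 * C.T b b e)) * (6 * C.T o e w)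
  + ((6 * C.T o o e) * (2 * C.T e e e) - (3 * C.T o e e) ^ 2) * (6 * C.T b b w)
  + 2 * ((6 * C.T o b e) * (3 * C.T o e e) - (6 * C.T o o e) * (3 * C.T b e e)) * (6 * C.T b e w)
  + ((6 * C.T o o e) * (6 * C.T b b e) - (6 * C.T o b e) ^ 2) * (6 * C.T e e w)

def FA (C : Cub k) (o a b d : Vec R) : R :=
  12 * C.T a b b * (C.T o o d * C.T a a d - C.T o a d ^ 2)

def FB (C : Cub k) (o a b d : Vec R) : R :=
  12 * C.T o o d * C.T a b b * C.T a d d + 12 * C.T o o d * C.T b b d * C.T a a d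
  + 24 * C.T o b d * C.T o a d * C.T a b d - 12 * C.T o o d * C.T a b d ^ 2
  - 12 * C.T a b b * C.T o a d * C.T o d d - 12 * C.T b b d * C.T o a d ^ 2 - 12 * C.T o b d ^ 2 * C.T a a d

def FC (C : Cub k) (o a b d : Vec R) : R :=
  4 * C.T o o d * C.T a b b * C.T d d d + 12 * C.T o o d * C.T b b d * C.T a d d
  + 12 * C.T o b d * (C.T o a d * C.T b d d + C.T a b d * C.T o d d) - 12 * C.T o o d * C.T a b d * C.T b d d
  - 3 * C.T a b b * C.T o d d ^ 2 - 12 * C.T b b d * C.T o a d * C.T o d d - 12 * C.T o b d ^ 2 * C.T a d d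

def FD (C : Cub k) (o a b d : Vec R) : R :=
  4 * C.T o o d * C.T b b d * C.T d d d + 6 * C.T o b d * C.T o d d * C.T b d d
  - 3 * C.T o o d * C.T b d d ^ 2 - 3 * C.T b b d * C.T o d d ^ 2 - 4 * C.T o b d ^ 2 * C.T d d d

/-- discriminant -/
def FDs (C : Cub k) (o a b d : Vec R) : R :=
  dsc (C.FA o a b d) (C.FB o a b d) (C.FC o a b d) (C.FD o a b d)

theorem FA_map (C : Cub k) (φ : R →ₐ[k] S) (o a b d : Vec R) :
    C.FA (φ ∘ o) (φ ∘ a) (φ ∘ b) (φ ∘ d) = φ (C.FA o a b d) := by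
  simp only [FA, T_map, map_mul, map_sub, map_pow, map_ofNat]
theorem FB_map (C : Cub k) (φ : R →ₐ[k] S) (o a b d : Vec R) :
    C.FB (φ ∘ o) (φ ∘ a) (φ ∘ b) (φ ∘ d) = φ (C.FB o a b d) := by
  simp only [FB, T_map, map_mul, map_sub, map_add, map_pow, map_ofNat]
theorem FC_map (C : Cub k) (φ : R →ₐ[k] S) (o a b d : Vec R) :
    C.FC (φ ∘ o) (φ ∘ a) (φ ∘ b) (φ ∘ d) = φ (C.FC o a b d) := by
  simp only [FC, T_map, map_mul, map_sub, map_add, map_pow, map_ofNat]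
theorem FD_map (C : Cub k) (φ : R →ₐ[k] S) (o a b d : Vec R) :
    C.FD (φ ∘ o) (φ ∘ a) (φ ∘ b) (φ ∘ d) = φ (C.FD o a b d) := by
  simp only [FD, T_map, map_mul, map_sub, map_add, map_pow, map_ofNat]

theorem Fdet_map (C : Cub k) (φ : R →ₐ[k] S) (o b d : Vec R) :
    C.Fdet (φ ∘ o) (φ ∘ b) (φ ∘ d) = φ (C.Fdet o b d) := by
  simp only [Fdet, T_map, map_mul, map_sub, map_add, map_pow, map_ofNat]

theorem FDs_map (C : Cub k) (φ : R →ₐ[k] S) (o a b d : Vec R) :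
    C.FDs (φ ∘ o) (φ ∘ a) (φ ∘ b) (φ ∘ d) = φ (C.FDs o a b d) := by
  simp only [FDs, FA_map, FB_map, FC_map, FD_map, dsc, map_mul, map_sub, map_add, map_pow, map_ofNat]

theorem FA_smul (C : Cub k) (o a b d : Vec R) (t : R) : C.FA o a b (t • d) = t ^ 2 * C.FA o a b d := by
  simp only [FA, T_smul1, T_smul2, T_smul3]; ring
theorem FB_smul (C : Cub k) (o a b d : Vec R) (t : R) : C.FB o a b (t • d) = t ^ 3 * C.FB o a b d := by
  simp only [FB, T_smul1, T_smul2, T_smul3]; ring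
theorem FC_smul (C : Cub k) (o a b d : Vec R) (t : R) : C.FC o a b (t • d) = t ^ 4 * C.FC o a b d := by
  simp only [FC, T_smul1, T_smul2, T_smul3]; ring
theorem FD_smul (C : Cub k) (o a b d : Vec R) (t : R) : C.FD o a b (t • d) = t ^ 5 * C.FD o a b d := by
  simp only [FD, T_smul1, T_smul2, T_smul3]; ring

theorem FDs_smul (C : Cub k) (o a b d : Vec R) (t : R) :
    C.FDs o a b (t • d) = t ^ 14 * C.FDs o a b d := by
  rw [FDs, FDs, FA_smul, FB_smul, FC_smul, FD_smul, dsc, dsc]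
  ring

theorem Fdet_eq (C : Cub k) {o a b d : Vec R} (h1 : C.T o o a = 0) (h2 : C.T o a b = 0) (h3 : C.T o a a = 0)
    (h4 : C.T a a b = 0) (h5 : C.T a a a = 0) (z : R) :
    C.Fdet o b (z • a + d) = 18 * (C.FA o a b d * z ^ 3 + C.FB o a b d * z ^ 2 + C.FC o a b d * z + C.FD o a b d) := by
  simp only [Fdet, FA, FB, FC, FD, T_lin]
  simp only [C.T_swap] at *
  simp only [h1, h2, h3, h4, h5]
  ring

end gen

section field
variable {K : Type} [Field K] [CharZero K] [IsAlgClosed K] {C : Cub K}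

theorem conic_sing (hnc : ¬ C.Config) {o a b e : Vec K} (hli : LinIndep K ![o, a, b, e])
    (hn : C.Nrm o a b) (ht : ∀ c, LinIndep K ![o, b, c] → ¬ C.Trip o b c) (h : C.Fdet o b e = 0) :
    ∃ x y u : K, (x ≠ 0 ∨ y ≠ 0 ∨ u ≠ 0) ∧
      C.T (x • o + y • b + u • e) (x • o + y • b + u • e) o = 0 ∧
      C.T (x • o + y • b + u • e) (x • o + y • b + u • e) b = 0 ∧
      C.T (x • o + y • b + u • e) (x • o + y • b + u • e) e = 0 ∧
      36 * (C.T o o e * C.T b b e - C.T o b e ^ 2) = u ^ 2 ∧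
      ∀ w, 6 * C.T (x • o + y • b + u • e) (x • o + y • b + u • e) w = C.Fder o b e w := by
  rcases sym_sing h with ⟨x, y, z, h1, h2, h3, h4, h5, h6⟩ | ⟨x, y, u, h0, h1, h2, h3, h4, h5, h6, h7, h8, h9⟩
  · exfalso
    by_cases hxy : x = 0 ∧ y = 0
    · obtain ⟨rfl, rfl⟩ := hxy
      refine ht e ?_ ⟨⟨hn.ooo, hn.oob, hn.obb, hn.bbb⟩, ⟨?_, ?_, ?_⟩, ?_, ?_⟩
      · rw [li4_iff] at hli
        rw [li3_iff]
        intro x y z h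
        have := hli x 0 y z (by rw [← h]; module)
        tauto
      · simpa using h1
      · simpa using h2
      · simpa using h4
      · simpa using h3
      · simpa using h5
    · obtain ⟨s, hs⟩ := exists_sq (2 : K)
      have hs0 : s ≠ 0 := by rintro rfl; norm_num at hs
      obtain ⟨β, hβ⟩ := exists_sq (3 * C.T a b b)
      apply hnc
      refine ⟨o, b, a, e, ?_, hn.ooo, hn.oob, hn.obb, hn.bbb, ⟨0, β, 0, ?_, ?_, ?_, ?_, ?_, ?_, ?_⟩,
        x / s, y / s, z / s, ?_, ?_, ?_, ?_, ?_, ?_, ?_⟩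
      · rw [li4_iff] at hli ⊢
        intro x y z w h
        have := hli x z y w (by rw [← h]; module)
        tauto
      · right; rintro rfl; apply hn.abb; simpa using hβ
      · rw [hn.ooa]; ring
      · rw [C.T_swap23, hn.oab]; ring
      · rw [C.T_swap23, C.T_swap12, hβ]
      · rw [hn.oaa]; ring
      · rw [C.T_swap12, C.T_swap23, hn.aab]; ring
      · rw [hn.aaa]; ring
      · have : x / s ≠ 0 ∨ y / s ≠ 0 := by
          by_contra hcon; push Not at hcon; simp [hs0] at hcon; exact hxy hcon
        exact this
      · rw [div_pow, hs, ← h1]; ring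
      · rw [div_mul_div_comm, ← pow_two, hs, ← h2]; ring
      · rw [div_pow, hs, ← h4]; ring
      · rw [mul_assoc, div_mul_div_comm, ← pow_two, hs, ← h3]; ring
      · rw [mul_assoc, div_mul_div_comm, ← pow_two, hs, ← h5]; ring
      · rw [div_pow, hs, ← h6]; ring
  · obtain ⟨ooo, ooa, oob, oaa, oab, obb, aaa, aab, bbb, abb⟩ := hn
    have n3 : (3 : K) ≠ 0 := by norm_num
    refine ⟨x, y, u, h0, ?_, ?_, ?_, by linear_combination h9, ?_⟩
    · apply mul_left_cancel₀ n3
      simp only [T_lin]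
      simp only [C.T_swap] at *
      simp only [ooo, oob, obb]
      linear_combination u * h1
    · apply mul_left_cancel₀ n3
      simp only [T_lin]
      simp only [C.T_swap] at *
      simp only [bbb, oob, obb]
      linear_combination u * h2
    · apply mul_left_cancel₀ (two_ne_zero : (2 : K) ≠ 0)
      apply mul_left_cancel₀ n3
      simp only [T_lin]
      simp only [C.T_swap] at *
      linear_combination x * h1 + y * h2 + 3 * u * h3
    · intro w
      rw [Fder]
      rw [h4, h5, h6, h7, h8, h9]
      simp only [T_lin]
      rw [C.T_swap12 b o w, C.T_swap12 e o w, C.T_swap12 e b w]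
      ring

end field
end Cub

open Polynomial in
theorem poly_dec {K : Type} [Field K] (A : K[X]) :
    ∃ A2, A = C (A.eval 0) + X * C ((derivative A).eval 0) + X ^ 2 * A2 := by
  refine ⟨A.divX.divX, ?_⟩
  have h1 := A.divX_mul_X_add
  have h2 := A.divX.divX_mul_X_add
  have e0 : A.coeff 0 = A.eval 0 := coeff_zero_eq_eval_zero A
  have e1 : A.divX.coeff 0 = (derivative A).eval 0 := by
    rw [coeff_divX, ← coeff_zero_eq_eval_zero, coeff_derivative]; simp
  rw [← e0, ← e1]
  linear_combination -h1 - X * h2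

open Polynomial in
/-- a polynomial with few roots at three places has another root -/
theorem exists_other_root {K : Type} [Field K] [CharZero K] [IsAlgClosed K] {P P' : K[X]} {s1 : K} (h0 : ¬ X ^ 3 ∣ P)
    (h1 : ¬ (X - C s1) ^ 3 ∣ P) (h2 : ¬ X ^ 3 ∣ P') (h : ∀ t : K, t ≠ 0 → P'.eval t = t ^ 14 * P.eval t⁻¹) :
    ∃ s, s ≠ 0 ∧ s ≠ s1 ∧ P.eval s = 0 := by
  classical
  by_contra hcon
  push Not at hcon
  have hP : P ≠ 0 := by rintro rfl; simp at h0
  have hdeg : P.natDegree ≤ 4 := by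
    rw [(IsAlgClosed.splits P).natDegree_eq_card_roots, ← Multiset.toFinset_sum_count_eq]
    have hsub : P.roots.toFinset ⊆ {0, s1} := by
      intro s hs
      simp only [Multiset.mem_toFinset, mem_roots hP, IsRoot.def] at hs
      simp only [Finset.mem_insert, Finset.mem_singleton]
      by_contra hc
      push Not at hc
      exact hcon s hc.1 hc.2 hs
    calc _ ≤ ∑ a ∈ P.roots.toFinset, 2 := by
          apply Finset.sum_le_sum
          intro s hs
          have hs' := hsub hs
          rw [count_roots]
          by_contra hlt
          push Not at hlt
          have : (X - C s) ^ 3 ∣ P := (le_rootMultiplicity_iff hP).1 hlt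
          simp only [Finset.mem_insert, Finset.mem_singleton] at hs'
          rcases hs' with rfl | rfl
          · apply h0; simpa using this
          · exact h1 this
      _ ≤ ∑ a ∈ ({0, s1} : Finset K), 2 := Finset.sum_le_sum_of_subset hsub
      _ ≤ 4 := by
          rw [Finset.sum_const, smul_eq_mul]
          have := Finset.card_le_two (a := (0 : K)) (b := s1)
          omega
  apply h2
  have hPe : P' = X ^ 10 * (C (P.coeff 0) * X ^ 4 + C (P.coeff 1) * X ^ 3 + C (P.coeff 2) * X ^ 2 + C (P.coeff 3) * X
      + C (P.coeff 4)) := by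
    apply eq_of_infinite_eval_eq
    apply Set.Infinite.mono (s := ({0}ᶜ : Set K))
    · intro t ht
      have ht : t ≠ 0 := ht
      show eval t P' = _
      rw [h t ht, P.eval_eq_sum_range' (n := 5) (by omega)]
      simp only [Finset.sum_range_succ, Finset.sum_range_zero, eval_mul, eval_add, eval_pow, eval_X, eval_C]
      field_simp
      ring
    · exact (Set.finite_singleton 0).infinite_compl
  rw [hPe]
  exact Dvd.dvd.mul_right (pow_dvd_pow X (by norm_num)) _

/-- zeros of a binary quadratic form -/
theorem bin_quad {K : Type} [Field K] [CharZero K] [IsAlgClosed K] {p q r : K} (h : q ^ 2 - p * r ≠ 0) :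
    ∃ x1 y1 x2 y2 : K, x1 * y2 - x2 * y1 ≠ 0 ∧ p * x1 ^ 2 + 2 * q * (x1 * y1) + r * y1 ^ 2 = 0 ∧
      p * x2 ^ 2 + 2 * q * (x2 * y2) + r * y2 ^ 2 = 0 ∧ p * (x1 * x2) + q * (x1 * y2 + x2 * y1) + r * (y1 * y2) ≠ 0 := by
  by_cases hp : p = 0
  · subst hp
    have hq : q ≠ 0 := by rintro rfl; simp at h
    refine ⟨1, 0, -r, 2 * q, ?_, by ring, by ring, ?_⟩
    · simpa using hq
    · intro h0; apply hq
      have : 2 * q ^ 2 = 0 := by linear_combination h0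
      simpa using this
  · obtain ⟨w, hw⟩ := exists_sq (q ^ 2 - p * r)
    have hw0 : w ≠ 0 := by rintro rfl; apply h; rw [← hw]; ring
    refine ⟨-q + w, p, -q - w, p, ?_, by linear_combination p * hw, by linear_combination p * hw, ?_⟩
    · intro h0
      have : 2 * w * p = 0 := by linear_combination h0
      simp [hw0, hp] at this
    · intro h0
      have : 2 * p * (q ^ 2 - p * r) = 0 := by linear_combination -h0 - p * hw
      simp only [mul_eq_zero] at this
      simp [hp, h] at this

namespace Cub
section field
open Polynomial
variable {K : Type} [Field K] [CharZero K] [IsAlgClosed K] {C : Cub K}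
local notation "cX" => cst K K[X]
local notation "tX" => (X : K[X])

theorem eval_T (s : K) (x y z : Vec K[X]) :
    (C.T x y z).eval s = C.T (fun i => (x i).eval s) (fun i => (y i).eval s) (fun i => (z i).eval s) := by
  have := C.T_map (aeval s) x y z
  simp only [coe_aeval_eq_eval] at this
  rw [← this]; rfl

theorem cst_evalAt (s : K) (v : Vec K) : (aeval s : K[X] →ₐ[K] K) ∘ cX v = v := by
  ext i; simp [cst]

theorem pen_evalAt (s : K) (d1 d2 : Vec K) :
    (aeval s : K[X] →ₐ[K] K) ∘ (tX • cX d1 + cX d2) = s • d1 + d2 := by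
  ext i; simp [cst]; ring

theorem pen_shift (s : K) (d1 d2 : Vec K) :
    (aeval (X + PolyC s) : K[X] →ₐ[K] K[X]) ∘ (tX • cX d1 + cX d2) =
      (tX • cX d1 + cX (s • d1 + d2)) := by
  ext1 i; simp [cst]; ring

theorem cst_shift (s : K) (v : Vec K) :
    (aeval (X + PolyC s) : K[X] →ₐ[K] K[X]) ∘ (cX v) = cX v := by
  ext1 i; simp [cst]

/-- the discriminant along a pencil -/
noncomputable def pD (C : Cub K) (o a b d1 d2 : Vec K) : K[X] :=
  C.FDs (cX o) (cX a) (cX b) (tX • cX d1 + cX d2)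

theorem pD_eval (o a b d1 d2 : Vec K) (s : K) : (C.pD o a b d1 d2).eval s = C.FDs o a b (s • d1 + d2) := by
  have := C.FDs_map (aeval s) (cX o) (cX a) (cX b) (tX • cX d1 + cX d2)
  rw [cst_evalAt, cst_evalAt, cst_evalAt, pen_evalAt] at this
  rw [this, pD]; rfl

theorem pD_shift (o a b d1 d2 : Vec K) (s : K) :
    (aeval (X + PolyC s) : K[X] →ₐ[K] K[X]) (C.pD o a b d1 d2) = C.pD o a b d1 (s • d1 + d2) := by
  rw [pD, pD, ← FDs_map, cst_shift, cst_shift, cst_shift, pen_shift]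

theorem Fdet_deriv (o b e w : Vec K) :
    (derivative (C.Fdet (cX o) (cX b) (cX e + tX • cX w))).eval 0 = C.Fder o b e w := by
  simp only [Fdet, T_lin, T_cst, Fder, algebraMap_eq]
  simp only [derivative_add, derivative_sub, derivative_mul, derivative_pow, derivative_C, derivative_X, derivative_ofNat,
    eval_add, eval_sub, eval_mul, eval_pow, eval_C, eval_X, eval_ofNat, eval_zero, eval_one, map_ofNat, Nat.cast_ofNat]
  simp only [C.T_swap]
  ring

theorem order_lemma (hC : C.SM) (hnc : ¬ C.Config) {o a b d1 d2 : Vec K}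
    (hli : LinIndep K ![o, a, b, d1, d2])
    (hn : C.Nrm o a b) (ht : ∀ c, LinIndep K ![o, b, c] → ¬ C.Trip o b c)
    (hne : C.T o o d2 * C.T a a d2 - C.T o a d2 ^ 2 ≠ 0 ∨
      C.T o o d1 * C.T a a d2 + C.T o o d2 * C.T a a d1 - 2 * (C.T o a d1 * C.T o a d2) ≠ 0) :
    ¬ X ^ 3 ∣ C.pD o a b d1 d2 := by
  rintro ⟨Q, hQ⟩
  rw [pD, FDs] at hQ
  have ev : ∀ s : K, C.FA o a b (s • d1 + d2) = (C.FA (cX o) (cX a) (cX b) (tX • cX d1 + cX d2)).eval s ∧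
      C.FB o a b (s • d1 + d2) = (C.FB (cX o) (cX a) (cX b) (tX • cX d1 + cX d2)).eval s ∧
      C.FC o a b (s • d1 + d2) = (C.FC (cX o) (cX a) (cX b) (tX • cX d1 + cX d2)).eval s ∧
      C.FD o a b (s • d1 + d2) = (C.FD (cX o) (cX a) (cX b) (tX • cX d1 + cX d2)).eval s := by
    intro s
    have h1 := C.FA_map (aeval s) (cX o) (cX a) (cX b) (tX • cX d1 + cX d2)
    have h2 := C.FB_map (aeval s) (cX o) (cX a) (cX b) (tX • cX d1 + cX d2)
    have h3 := C.FC_map (aeval s) (cX o) (cX a) (cX b) (tX • cX d1 + cX d2)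
    have h4 := C.FD_map (aeval s) (cX o) (cX a) (cX b) (tX • cX d1 + cX d2)
    rw [cst_evalAt, cst_evalAt, cst_evalAt, pen_evalAt] at h1 h2 h3 h4
    exact ⟨h1, h2, h3, h4⟩
  have hz := ev 0
  simp only [zero_smul, zero_add] at hz
  have hA1 : (derivative (C.FA (cX o) (cX a) (cX b) (tX • cX d1 + cX d2))).eval 0 =
      12 * C.T a b b * (C.T o o d1 * C.T a a d2 + C.T o o d2 * C.T a a d1 - 2 * (C.T o a d1 * C.T o a d2)) := by
    simp only [FA, T_lin, T_cst, algebraMap_eq]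
    simp only [derivative_add, derivative_sub, derivative_mul, derivative_pow, derivative_C, derivative_X, derivative_ofNat,
      eval_add, eval_sub, eval_mul, eval_pow, eval_C, eval_X, eval_ofNat, eval_zero, eval_one, map_ofNat, Nat.cast_ofNat]
    ring
  have hdet : ∀ z : K, C.Fdet (cX o) (cX b) (cX (z • a + d2) + tX • cX d1) =
      18 * (C.FA (cX o) (cX a) (cX b) (tX • cX d1 + cX d2) * (PolyC z) ^ 3 +
      C.FB (cX o) (cX a) (cX b) (tX • cX d1 + cX d2) * (PolyC z) ^ 2 +
      C.FC (cX o) (cX a) (cX b) (tX • cX d1 + cX d2) * (PolyC z) +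
      C.FD (cX o) (cX a) (cX b) (tX • cX d1 + cX d2)) := by
    intro z
    rw [← Fdet_eq]
    · congr 1
      rw [cst_add, cst_smul, algebraMap_eq]; module
    all_goals rw [T_cst]
    · rw [hn.ooa, map_zero]
    · rw [hn.oab, map_zero]
    · rw [hn.oaa, map_zero]
    · rw [hn.aab, map_zero]
    · rw [hn.aaa, map_zero]
  generalize C.FA (cX o) (cX a) (cX b) (tX • cX d1 + cX d2) = A at *
  generalize C.FB (cX o) (cX a) (cX b) (tX • cX d1 + cX d2) = B at *
  generalize C.FC (cX o) (cX a) (cX b) (tX • cX d1 + cX d2) = C' at *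
  generalize C.FD (cX o) (cX a) (cX b) (tX • cX d1 + cX d2) = D at *
  obtain ⟨A2, hA2⟩ := poly_dec A
  obtain ⟨B2, hB2⟩ := poly_dec B
  obtain ⟨C2, hC2⟩ := poly_dec C'
  obtain ⟨D2, hD2⟩ := poly_dec D
  obtain ⟨z, h0, h1, h2⟩ := cubic_order hA2 hB2 hC2 hD2 hQ (by
    rw [← hz.1, hA1, FA]
    have := hn.abb
    rcases hne with h | h
    · left; simp [this, h]
    · right; simp [this, h])
  rw [← hz.1, ← hz.2.1, ← hz.2.2.1, ← hz.2.2.2] at h0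
  rw [← hz.1, ← hz.2.1, ← hz.2.2.1] at h1
  have hli4 : LinIndep K ![o, a, b, z • a + d2] := by
    rw [li5_iff] at hli
    rw [li4_iff]
    intro x y w t h
    have := hli x (y + t * z) w 0 t (by rw [← h]; module)
    obtain ⟨e1, e2, e3, e4, e5⟩ := this
    subst e5
    exact ⟨e1, by simpa using e2, e3, rfl⟩
  have hF0 : C.Fdet o b (z • a + d2) = 0 := by
    rw [C.Fdet_eq hn.ooa hn.oab hn.oaa hn.aab hn.aaa, h0, mul_zero]
  obtain ⟨x, y, u, hxyu, k1, k2, k3, -, kw⟩ := conic_sing hnc hli4 hn ht hF0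
  set P := x • o + y • b + u • (z • a + d2) with hP
  have ka : C.T P P a = 0 := by
    have h6 := kw a
    have : C.Fder o b (z • a + d2) a = 18 * (3 * C.FA o a b d2 * z ^ 2 + 2 * C.FB o a b d2 * z + C.FC o a b d2) := by
      obtain ⟨ooo, ooa, oob, oaa, oab, obb, aaa, aab, bbb, abb⟩ := hn
      clear * - ooa oab oaa aab aaa
      simp only [Fder, FA, FB, FC, FD, T_lin]
      simp only [C.T_swap] at *
      simp only [ooa, oab, oaa, aab, aaa]
      ring
    rw [this, h1] at h6
    simpa using h6
  have kd : C.T P P d1 = 0 := by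
    have h6 := kw d1
    rw [← Fdet_deriv, hdet] at h6
    simp only [derivative_add, derivative_sub, derivative_mul, derivative_pow, derivative_C, derivative_X, derivative_ofNat,
      eval_add, eval_sub, eval_mul, eval_pow, eval_C, eval_X, eval_ofNat, eval_zero, eval_one, map_ofNat, Nat.cast_ofNat] at h6
    have : 6 * C.T P P d1 = 0 := by rw [h6]; linear_combination 18 * h2
    simpa using this
  have kd2 : C.T P P d2 = 0 := by
    rw [T_add3, T_smul3, ka] at k3
    linear_combination k3
  have hP0 : P = 0 := by
    apply hC
    intro v
    obtain ⟨y0, y1, y2, y3, y4, rfl⟩ := exists_coord hli v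
    simp only [T_add3, T_smul3, k1, k2, ka, kd, kd2]; ring
  have := li5_iff.1 hli x (u * z) y 0 u (by rw [← hP0, hP]; module)
  tauto

theorem exists_c (hC : C.SM) (hnc : ¬ C.Config) {o a b : Vec K}
    (hli : LinIndep K ![o, a, b])
    (hn : C.Nrm o a b) (ht : ∀ c, LinIndep K ![o, b, c] → ¬ C.Trip o b c) :
    ∃ c d : Vec K, LinIndep K ![o, a, b, c, d] ∧ C.T c c o = 0 ∧ C.T c c a = 0 ∧ C.T c c b = 0 ∧
      C.T c c c = 0 ∧ C.T c c d ≠ 0 ∧ C.T o o c * C.T a a c - C.T o a c ^ 2 ≠ 0 ∧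
      C.T o o c * C.T b b c - C.T o b c ^ 2 ≠ 0 := by
  obtain ⟨f1, hf1⟩ := exists_ext3 hli
  obtain ⟨f2, hf2⟩ := exists_ext4 hf1
  have hres := hC.res_ne hf2 ⟨hn.ooo, hn.ooa, hn.oaa, hn.aaa⟩ ⟨hn.oob, hn.oab, hn.aab⟩
  have hpd : ((C.T o o f1 * C.T a a f2 + C.T o o f2 * C.T a a f1 - 2 * (C.T o a f1 * C.T o a f2)) / 2) ^ 2
      - (C.T o o f1 * C.T a a f1 - C.T o a f1 ^ 2) * (C.T o o f2 * C.T a a f2 - C.T o a f2 ^ 2) ≠ 0 := by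
    intro h; apply hres; rw [res2]; linear_combination 4 * h
  obtain ⟨x1, y1, x2, y2, hdet, q1, q2, q3⟩ := bin_quad hpd
  obtain ⟨d1, hd1⟩ : ∃ d, d = x1 • f1 + y1 • f2 := ⟨_, rfl⟩
  obtain ⟨d2, hd2⟩ : ∃ d, d = x2 • f1 + y2 • f2 := ⟨_, rfl⟩
  have hli5 : LinIndep K ![o, a, b, d1, d2] := by
    rw [li5_iff] at hf2 ⊢
    intro x y z u v h
    have := hf2 x y z (u * x1 + v * x2) (u * y1 + v * y2) (by rw [← h, hd1, hd2]; module)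
    obtain ⟨e1, e2, e3, e4, e5⟩ := this
    refine ⟨e1, e2, e3, ?_, ?_⟩
    · have : u * (x1 * y2 - x2 * y1) = 0 := by linear_combination y2 * e4 - x2 * e5
      exact (mul_eq_zero.1 this).resolve_right hdet
    · have : v * (x1 * y2 - x2 * y1) = 0 := by linear_combination x1 * e5 - y1 * e4
      exact (mul_eq_zero.1 this).resolve_right hdet
  have g1 : C.T o o d1 * C.T a a d1 - C.T o a d1 ^ 2 = 0 := by
    rw [hd1]; simp only [T_add3, T_smul3]; linear_combination q1
  have g2 : C.T o o d2 * C.T a a d2 - C.T o a d2 ^ 2 = 0 := by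
    rw [hd2]; simp only [T_add3, T_smul3]; linear_combination q2
  have g3 : C.T o o d1 * C.T a a d2 + C.T o o d2 * C.T a a d1 - 2 * (C.T o a d1 * C.T o a d2) ≠ 0 := by
    intro h; apply q3
    rw [hd1, hd2] at h; simp only [T_add3, T_smul3] at h; linear_combination h / 2
  have hli5' : LinIndep K ![o, a, b, d2, d1] := by
    rw [li5_iff] at hli5 ⊢
    intro x y z u v h
    have := hli5 x y z v u (by rw [← h]; module)
    tauto
  have hli5s : ∀ s : K, LinIndep K ![o, a, b, d1, s • d1 + d2] := by
    intro s
    rw [li5_iff] at hli5 ⊢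
    intro x y z u v h
    obtain ⟨e1, e2, e3, e4, e5⟩ := hli5 x y z (u + v * s) v (by rw [← h]; module)
    subst e5
    exact ⟨e1, e2, e3, by simpa using e4, rfl⟩
  have hδ : ∀ s : K, C.T o o (s • d1 + d2) * C.T a a (s • d1 + d2) - C.T o a (s • d1 + d2) ^ 2 =
      s * (C.T o o d1 * C.T a a d2 + C.T o o d2 * C.T a a d1 - 2 * (C.T o a d1 * C.T o a d2)) := by
    intro s
    simp only [T_add3, T_smul3]; linear_combination s ^ 2 * g1 + g2
  obtain ⟨s1, hs1, hs1'⟩ : ∃ s1 : K, s1 ≠ 0 ∧ ∀ s, s ≠ 0 → s ≠ s1 → C.T o o (s • d1 + d2) ≠ 0 := by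
    by_cases z1 : C.T o o d1 = 0
    · refine ⟨1, one_ne_zero, fun s _ _ h => ?_⟩
      rw [T_add3, T_smul3, z1] at h
      have z2 : C.T o o d2 = 0 := by linear_combination h
      have z3 : C.T o a d1 = 0 := by rw [z1] at g1; simpa using g1
      apply g3; rw [z1, z2, z3]; ring
    · by_cases z2 : C.T o o d2 = 0
      · refine ⟨1, one_ne_zero, fun s hs _ h => ?_⟩
        rw [T_add3, T_smul3, z2] at h
        simp [hs, z1] at h
      · refine ⟨-C.T o o d2 / C.T o o d1, by simp [z1, z2], fun s _ hs h => hs ?_⟩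
        rw [T_add3, T_smul3] at h
        rw [eq_div_iff z1]; linear_combination h
  obtain ⟨s, hs0, hss1, hs⟩ := exists_other_root (P := C.pD o a b d1 d2) (P' := C.pD o a b d2 d1) (s1 := s1)
    (order_lemma hC hnc hli5 hn ht (Or.inr g3))
    (by
      rintro ⟨Q, hQ⟩
      have := congrArg (aeval (X + PolyC s1) : K[X] →ₐ[K] K[X]) hQ
      rw [pD_shift, map_mul, map_pow, map_sub, aeval_X, aeval_C, algebraMap_eq, add_sub_cancel_right] at this
      refine order_lemma hC hnc (hli5s s1) hn ht (Or.inl ?_) ⟨_, this⟩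
      rw [hδ]; exact mul_ne_zero hs1 g3)
    (order_lemma hC hnc hli5' hn ht (Or.inr (by intro h; apply g3; linear_combination h)))
    (by
      intro t ht
      rw [pD_eval, pD_eval, ← FDs_smul]
      congr 1
      rw [smul_add, smul_smul, mul_inv_cancel₀ ht, one_smul, add_comm])
  rw [pD_eval, FDs] at hs
  have hd5 := hli5s s
  have hδs := hδ s
  have hoo := hs1' s hs0 hss1
  obtain ⟨d, hd⟩ : ∃ d, d = s • d1 + d2 := ⟨_, rfl⟩
  rw [← hd] at hs hd5 hδs hoo
  have hδ0 : C.T o o d * C.T a a d - C.T o a d ^ 2 ≠ 0 := by rw [hδs]; exact mul_ne_zero hs0 g3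
  obtain ⟨z, h0, h1⟩ := cubic_double (by rw [FA]; have := hn.abb; simp [this, hδ0]) hs
  have hli4 : LinIndep K ![o, a, b, z • a + d] := by
    rw [li5_iff] at hd5
    rw [li4_iff]
    intro x y w t h
    have := hd5 x (y + t * z) w 0 t (by rw [← h]; module)
    obtain ⟨e1, e2, e3, e4, e5⟩ := this
    subst e5
    exact ⟨e1, by simpa using e2, e3, rfl⟩
  have hF0 : C.Fdet o b (z • a + d) = 0 := by
    rw [C.Fdet_eq hn.ooa hn.oab hn.oaa hn.aab hn.aaa, h0, mul_zero]
  obtain ⟨x, y, u, hxyu, k1, k2, k3, kq, kw⟩ := conic_sing hnc hli4 hn ht hF0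
  obtain ⟨P, hP⟩ : ∃ P, P = x • o + y • b + u • (z • a + d) := ⟨_, rfl⟩
  rw [← hP] at k1 k2 k3 kw
  have ka : C.T P P a = 0 := by
    have h6 := kw a
    have : C.Fder o b (z • a + d) a = 18 * (3 * C.FA o a b d * z ^ 2 + 2 * C.FB o a b d * z + C.FC o a b d) := by
      obtain ⟨ooo, ooa, oob, oaa, oab, obb, aaa, aab, bbb, abb⟩ := hn
      clear * - ooa oab oaa aab aaa
      simp only [Fder, FA, FB, FC, FD, T_lin]
      simp only [C.T_swap] at *
      simp only [ooa, oab, oaa, aab, aaa]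
      ring
    rw [this, h1] at h6
    simpa using h6
  have hu : u ≠ 0 := by
    rintro rfl
    have hyy : y = 0 := by
      have : y ^ 2 * C.T a b b = 0 := by
        rw [← ka, hP]
        obtain ⟨ooo, ooa, oob, oaa, oab, obb, aaa, aab, bbb, abb⟩ := hn
        clear * - ooa oab
        simp only [T_lin]
        simp only [C.T_swap] at *
        simp only [ooa, oab]; ring
      simpa [hn.abb] using this
    subst hyy
    have hxx : x = 0 := by
      have : x ^ 2 * C.T o o d = 0 := by
        rw [← k3, hP]
        obtain ⟨ooo, ooa, oob, oaa, oab, obb, aaa, aab, bbb, abb⟩ := hn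
        clear * - ooa oab
        simp only [T_lin]
        simp only [C.T_swap] at *
        simp only [ooa, oab]; ring
      simpa [hoo] using this
    tauto
  have hc5 : LinIndep K ![o, a, b, P, d1] := by
    rw [li5_iff] at hd5 ⊢
    intro e1 e2 e3 e4 e5 h
    obtain ⟨g1, g2, g3, g4, g5⟩ := hd5 (e1 + e4 * x) (e2 + e4 * u * z) (e3 + e4 * y) e5 (e4 * u)
      (by rw [← h, hP]; module)
    have h4 : e4 = 0 := (mul_eq_zero.1 g5).resolve_right hu
    subst h4
    exact ⟨by simpa using g1, by simpa using g2, by simpa using g3, rfl, g4⟩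
  have kc : C.T P P P = 0 := by
    conv_lhs => rw [C.T_swap23]
    have : C.T P P (x • o + y • b + u • (z • a + d)) = 0 := by
      rw [T_add3, T_add3, T_smul3, T_smul3, T_smul3, k1, k2, k3]; ring
    rw [← hP] at this; exact this
  refine ⟨P, d1, hc5, k1, ka, k2, kc, ?_, ?_, ?_⟩
  · intro h
    have hP0 : P = 0 := by
      apply hC
      intro v
      obtain ⟨y0, y1, y2, y3, y4, rfl⟩ := exists_coord hc5 v
      simp only [T_add3, T_smul3, k1, k2, ka, kc, h]; ring
    have := li5_iff.1 hc5 0 0 0 1 0 (by rw [hP0]; module)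
    exact one_ne_zero this.2.2.2.1
  · have : C.T o o P * C.T a a P - C.T o a P ^ 2 = u ^ 2 * (C.T o o d * C.T a a d - C.T o a d ^ 2) := by
      rw [hP]
      obtain ⟨ooo, ooa, oob, oaa, oab, obb, aaa, aab, bbb, abb⟩ := hn
      clear * - ooo ooa oob oaa oab aaa aab
      simp only [T_lin]
      simp only [C.T_swap] at *
      simp only [ooo, ooa, oob, oaa, oab, aaa, aab]; ring
    rw [this]; exact mul_ne_zero (pow_ne_zero 2 hu) hδ0
  · have : 36 * (C.T o o P * C.T b b P - C.T o b P ^ 2) = u ^ 4 := by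
      have : 36 * (C.T o o P * C.T b b P - C.T o b P ^ 2) = u ^ 2 * (36 * (C.T o o (z • a + d) * C.T b b (z • a + d) - C.T o b (z • a + d) ^ 2)) := by
        rw [hP]
        obtain ⟨ooo, ooa, oob, oaa, oab, obb, aaa, aab, bbb, abb⟩ := hn
        clear * - ooo ooa oob oaa oab aaa aab bbb obb
        simp only [T_lin]
        simp only [C.T_swap] at *
        simp only [ooo, ooa, oob, oaa, oab, aaa, aab, bbb, obb]; ring
      rw [this, kq]; ring
    intro h
    rw [h, mul_zero] at this
    exact hu (pow_eq_zero_iff (by norm_num) |>.1 this.symm)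

end field
end Cub

/-! ### Eckardt points -/

theorem exists_root4 {K : Type} [Field K] [IsAlgClosed K] (c0 c1 c2 c3 c4 : K)
    (h : ¬ (c1 = 0 ∧ c2 = 0 ∧ c3 = 0 ∧ c4 = 0)) :
    ∃ s, c4 * s ^ 4 + c3 * s ^ 3 + c2 * s ^ 2 + c1 * s + c0 = 0 := by
  obtain ⟨P, hP⟩ : ∃ P : Polynomial K, P = PolyC c4 * PolyX ^ 4 + PolyC c3 * PolyX ^ 3
    + PolyC c2 * PolyX ^ 2 + PolyC c1 * PolyX + PolyC c0 := ⟨_, rfl⟩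
  have hdeg : P.degree ≠ 0 := by
    intro h0
    apply h
    have hc := Polynomial.eq_C_of_degree_eq_zero h0
    have hi : ∀ i, i ≠ 0 → P.coeff i = 0 := by intro i hi; rw [hc, Polynomial.coeff_C, if_neg hi]
    have h1 := hi 1 (by norm_num)
    have h2 := hi 2 (by norm_num)
    have h3 := hi 3 (by norm_num)
    have h4 := hi 4 (by norm_num)
    rw [hP] at h1 h2 h3 h4
    simp [Polynomial.coeff_X, Polynomial.coeff_C] at h1 h2 h3 h4
    exact ⟨h1, h2, h3, h4⟩
  obtain ⟨s, hs⟩ := IsAlgClosed.exists_root P hdeg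
  refine ⟨s, ?_⟩
  rw [hP] at hs
  simpa [Polynomial.IsRoot] using hs

namespace Cub
section field
variable {K : Type} [Field K] [CharZero K] [IsAlgClosed K] {C : Cub K}

/-- Eckardt points -/
structure Eck (C : Cub K) (p f e t : Vec K) : Prop where
  ppp : C.T p p p = 0
  ppf : C.T p p f = 0
  ppe : C.T p p e = 0
  ppt : C.T p p t = 0
  pff : C.T p f f = 0
  pfe : C.T p f e = 0
  pft : C.T p f t = 0
  pee : C.T p e e = 0
  pet : C.T p e t = 0
  ptt : C.T p t t = 0

theorem Eck.smooth (hC : C.SM) {p f e t h : Vec K} (hli : LinIndep K ![p, f, e, t, h])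
    (hE : C.Eck p f e t) {x y z : K} (hx : x ≠ 0 ∨ y ≠ 0 ∨ z ≠ 0)
    (h1 : C.T (x • f + y • e + z • t) (x • f + y • e + z • t) f = 0)
    (h2 : C.T (x • f + y • e + z • t) (x • f + y • e + z • t) e = 0)
    (h3 : C.T (x • f + y • e + z • t) (x • f + y • e + z • t) t = 0) : False := by
  obtain ⟨ppp, ppf, ppe, ppt, pff, pfe, pft, pee, pet, ptt⟩ := hE
  have hh : C.T p p h ≠ 0 := by
    intro h0
    have hp : p = 0 := by
      apply hC
      intro v
      obtain ⟨y0, y1, y2, y3, y4, rfl⟩ := exists_coord hli v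
      simp only [T_add3, T_smul3, ppp, ppf, ppe, ppt, h0]; ring
    have := li5_iff.1 hli 1 0 0 0 0 (by rw [hp]; module)
    exact one_ne_zero this.1
  obtain ⟨X, hX⟩ : ∃ X, X = x • f + y • e + z • t := ⟨_, rfl⟩
  rw [← hX] at h1 h2 h3
  obtain ⟨s, hs⟩ := exists_root4 (C.T X X h) (2 * C.T X p h) (C.T p p h) 0 0 (fun h => hh h.2.1)
  have k1 : C.T X p p = 0 := by
    rw [hX]; simp only [T_add1, T_smul1]
    simp only [C.T_swap] at *
    simp only [ppp, ppf, ppe, ppt]; ring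
  have k2 : C.T X p f = 0 := by
    rw [hX]; simp only [T_add1, T_smul1]
    simp only [C.T_swap] at *
    simp only [pff, pfe, pft]; ring
  have k3 : C.T X p e = 0 := by
    rw [hX]; simp only [T_add1, T_smul1]
    simp only [C.T_swap] at *
    simp only [pee, pfe, pet]; ring
  have k4 : C.T X p t = 0 := by
    rw [hX]; simp only [T_add1, T_smul1]
    simp only [C.T_swap] at *
    simp only [ptt, pft, pet]; ring
  have k5 : C.T X X p = 0 := by
    have : C.T X p (x • f + y • e + z • t) = 0 := by simp only [T_add3, T_smul3, k2, k3, k4]; ring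
    rw [← hX] at this; rw [C.T_swap23]; exact this
  have hsing : X + s • p = 0 := by
    apply hC
    intro v
    obtain ⟨y0, y1, y2, y3, y4, rfl⟩ := exists_coord hli v
    simp only [T_lin]
    rw [C.T_swap12 p X p, C.T_swap12 p X f, C.T_swap12 p X e, C.T_swap12 p X t, C.T_swap12 p X h]
    simp only [k1, k2, k3, k4, k5, h1, h2, h3, ppp, ppf, ppe, ppt]
    linear_combination y4 * hs
  obtain ⟨-, h1, h2, h3, -⟩ := li5_iff.1 hli s x y z 0 (by rw [← hsing, hX]; module)
  rcases hx with h | h | h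
  · exact h h1
  · exact h h2
  · exact h h3

theorem eck_config {p f e e' : Vec K} (hli : LinIndep K ![p, f, e, e'])
    (ppp : C.T p p p = 0) (ppf : C.T p p f = 0) (pff : C.T p f f = 0) (fff : C.T f f f = 0)
    (h : ∀ x, x = e ∨ x = e' → C.T p p x = 0 ∧ C.T p f x = 0 ∧ C.T p x x = 0 ∧ C.T f f x = 1 ∧
      3 * C.T f x x ^ 2 = 4 * C.T x x x) : C.Config := by
  have key : ∀ x, x = e ∨ x = e' → C.Dbl p f x := by
    intro x hx
    obtain ⟨h1, h2, h3, h4, h5⟩ := h x hx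
    obtain ⟨β, hβ⟩ := exists_sq (3 : K)
    have hβ0 : β ≠ 0 := by rintro rfl; norm_num at hβ
    refine ⟨0, β, 3 * C.T f x x / (2 * β), Or.inr hβ0, ?_, ?_, ?_, ?_, ?_, ?_⟩
    · rw [h1]; ring
    · rw [h2]; ring
    · rw [h4, hβ]; ring
    · rw [h3]; ring
    · field_simp
    · rw [div_pow, mul_pow, mul_pow, hβ, eq_div_iff (by norm_num)]; linear_combination -3 * h5
  exact ⟨p, f, e, e', hli, ppp, ppf, pff, fff, key e (Or.inl rfl), key e' (Or.inr rfl)⟩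

theorem eck0 (hC : C.SM) {p f e t h : Vec K} (hli : LinIndep K ![p, f, e, t, h])
    (hE : C.Eck p f e t) (fff : C.T f f f = 0) (ffe : C.T f f e = 1) (fft : C.T f f t = 0)
    (fee : C.T f e e = 0) (fet : C.T f e t = 0) (eee : C.T e e e = 0) : C.Config := by
  have heet : C.T e e t ≠ 0 := by
    intro h0
    refine hE.smooth hC hli (x := 0) (y := 1) (z := 0) (by simp) ?_ ?_ ?_ <;>
      simp only [zero_smul, one_smul, zero_add, add_zero]
    · rw [C.T_swap23, C.T_swap12]; exact fee
    · exact eee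
    · exact h0
  by_cases hall : C.T f t t = 0 ∧ C.T t t t = 0 ∧ C.T e t t = 0
  · exfalso
    refine hE.smooth hC hli (x := 0) (y := 0) (z := 1) (by simp) ?_ ?_ ?_ <;>
      simp only [zero_smul, one_smul, zero_add, add_zero]
    · rw [C.T_swap23, C.T_swap12]; exact hall.1
    · rw [C.T_swap23, C.T_swap12]; exact hall.2.2
    · exact hall.2.1
  · obtain ⟨s, hs⟩ := exists_root4 (-12 * C.T e e t) (-12 * C.T e t t) (-4 * C.T t t t) (3 * C.T f t t ^ 2) 0 (by
      intro hcon; apply hall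
      obtain ⟨h1, h2, h3, -⟩ := hcon
      exact ⟨by simpa using h3, by simpa using h2, by simpa using h1⟩)
    have hs0 : s ≠ 0 := by rintro rfl; apply heet; simpa using hs
    obtain ⟨ppp, ppf, ppe, ppt, pff, pfe, pft, pee, pet, ptt⟩ := hE
    apply eck_config (p := p) (f := f) (e := e) (e' := e + s • t) _ ppp ppf pff fff
    · rintro x (rfl | rfl)
      · exact ⟨ppe, pfe, pee, ffe, by rw [fee, eee]; ring⟩
      · simp only [T_lin]
        simp only [C.T_swap] at *
        simp only [ppe, ppt, pfe, pft, pee, pet, ptt, ffe, fft, fee, fet, eee]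
        refine ⟨by ring, by ring, by ring, by ring, by linear_combination s * hs⟩
    · rw [li5_iff] at hli
      rw [li4_iff]
      intro x y z w h
      obtain ⟨h1, h2, h3, h4, h5⟩ := hli x y (z + w) (w * s) 0 (by rw [← h]; module)
      have hw : w = 0 := (mul_eq_zero.1 h4).resolve_right hs0
      subst hw
      exact ⟨h1, h2, by simpa using h3, rfl⟩

theorem eck1 (hC : C.SM) {p f e t h : Vec K} (hli : LinIndep K ![p, f, e, t, h])
    (hE : C.Eck p f e t) (fff : C.T f f f = 0) (ffe : C.T f f e = 1) (fft : C.T f f t = 0)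
    (fee : C.T f e e = 0) (fet : C.T f e t = 0) : C.Config := by
  by_cases hall : C.T f t t = 0 ∧ C.T t t t = 0 ∧ C.T e t t = 0
  · exfalso
    refine hE.smooth hC hli (x := 0) (y := 0) (z := 1) (by simp) ?_ ?_ ?_ <;>
      simp only [zero_smul, one_smul, zero_add, add_zero]
    · rw [C.T_swap23, C.T_swap12]; exact hall.1
    · rw [C.T_swap23, C.T_swap12]; exact hall.2.2
    · exact hall.2.1
  · obtain ⟨s, hs⟩ := exists_root4 (-4 * C.T e e e) (-12 * C.T e e t) (-12 * C.T e t t) (-4 * C.T t t t) (3 * C.T f t t ^ 2) (by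
      intro hcon; apply hall
      obtain ⟨-, h1, h2, h3⟩ := hcon
      exact ⟨by simpa using h3, by simpa using h2, by simpa using h1⟩)
    obtain ⟨ppp, ppf, ppe, ppt, pff, pfe, pft, pee, pet, ptt⟩ := hE
    obtain ⟨q, hq⟩ : ∃ q, C.T f t t = 2 * q := ⟨C.T f t t / 2, by ring⟩
    rw [hq] at hs
    apply eck0 hC (p := p) (f := f) (e := e + s • t - (q * s ^ 2) • f) (t := t - (2 * s * q) • f) (h := h)
    · rw [li5_iff] at hli ⊢
      intro x y z w u h
      obtain ⟨h1, h2, h3, h4, h5⟩ := hli x (y - z * (q * s ^ 2) - w * (2 * s * q)) z (z * s + w) u (by rw [← h]; module)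
      subst h3 h5
      have hw : w = 0 := by simpa using h4
      subst hw
      exact ⟨h1, by simpa using h2, rfl, rfl, rfl⟩
    · constructor
      all_goals
        try simp only [T_lin, T_sub1, T_sub2, T_sub3]
        try simp only [C.T_swap] at *
        try simp only [ppp, ppf, ppe, ppt, pff, pfe, pft, pee, pet, ptt, fff, ffe, fft, fee, fet]
        try ring
    · exact fff
    all_goals
      simp only [T_lin, T_sub1, T_sub2, T_sub3]
      try simp only [C.T_swap] at *
      simp only [ppp, ppf, ppe, ppt, pff, pfe, pft, pee, pet, ptt, fff, ffe, fft, fee, fet, hq]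
    · ring
    · ring
    · ring
    · ring
    · linear_combination -(1/4) * hs

theorem eck2 (hC : C.SM) {p f e t h : Vec K} (hli : LinIndep K ![p, f, e, t, h])
    (hE : C.Eck p f e t) (fff : C.T f f f = 0) (ffe : C.T f f e ≠ 0) : C.Config := by
  obtain ⟨ppp, ppf, ppe, ppt, pff, pfe, pft, pee, pet, ptt⟩ := hE
  obtain ⟨c, hc⟩ : ∃ c, c * C.T f f e = 1 := ⟨(C.T f f e)⁻¹, inv_mul_cancel₀ ffe⟩
  have hc0 : c ≠ 0 := by rintro rfl; simp at hc
  obtain ⟨α, hα⟩ : ∃ α, 2 * α + c ^ 2 * C.T f e e = 0 := ⟨-(c ^ 2 * C.T f e e / 2), by ring⟩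
  obtain ⟨r, hr⟩ : ∃ r, r = c * C.T f f t := ⟨_, rfl⟩
  obtain ⟨β, hβ⟩ : ∃ β, β = - (c * C.T f e t - r * c * C.T f e e + α * C.T f f t - α * r * C.T f f e) := ⟨_, rfl⟩
  apply eck1 hC (p := p) (f := f) (e := c • e + α • f) (t := t - r • e + β • f) (h := h)
  · rw [li5_iff] at hli ⊢
    intro x y z w u h
    obtain ⟨h1, h2, h3, h4, h5⟩ := hli x (y + z * α + w * β) (z * c - w * r) w u (by rw [← h]; module)
    subst h4 h5
    have hz : z = 0 := by simpa [hc0] using h3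
    subst hz
    exact ⟨h1, by simpa using h2, rfl, rfl, rfl⟩
  · constructor
    all_goals
      try simp only [T_lin, T_sub1, T_sub2, T_sub3]
      try simp only [C.T_swap] at *
      try simp only [ppp, ppf, ppe, ppt, pff, pfe, pft, pee, pet, ptt, fff]
      try ring
  · exact fff
  all_goals
    simp only [T_lin, T_sub1, T_sub2, T_sub3]
    try simp only [C.T_swap] at *
    simp only [ppp, ppf, ppe, ppt, pff, pfe, pft, pee, pet, ptt, fff]
  · linear_combination hc
  · rw [hr]; linear_combination - C.T f f t * hc
  · linear_combination hα + 2 * α * hc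
  · rw [hβ]
    linear_combination (-(c * C.T f e t - r * c * C.T f e e + α * C.T f f t - α * r * C.T f f e)) * hc

theorem eck3 (hC : C.SM) {p f e t h : Vec K} (hli : LinIndep K ![p, f, e, t, h])
    (hE : C.Eck p f e t) (fff : C.T f f f = 0) : C.Config := by
  by_cases ffe : C.T f f e = 0
  · have fft : C.T f f t ≠ 0 := by
      intro h0
      refine hE.smooth hC hli (x := 1) (y := 0) (z := 0) (by simp) ?_ ?_ ?_ <;>
        simpa only [zero_smul, one_smul, zero_add, add_zero]
    obtain ⟨ppp, ppf, ppe, ppt, pff, pfe, pft, pee, pet, ptt⟩ := hE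
    apply eck2 hC (p := p) (f := f) (e := t) (t := e) (h := h) _ _ fff fft
    · rw [li5_iff] at hli ⊢
      intro x y z w u h
      obtain ⟨h1, h2, h3, h4, h5⟩ := hli x y w z u (by rw [← h]; module)
      exact ⟨h1, h2, h4, h3, h5⟩
    · exact ⟨ppp, ppf, ppt, ppe, pff, pft, pfe, ptt, by rw [C.T_swap23]; exact pet, pee⟩
  · exact eck2 hC hli hE fff ffe

/-- Eckardt points give configurations -/
theorem eckardt (hC : C.SM) {p f e t h : Vec K} (hli : LinIndep K ![p, f, e, t, h])
    (hE : C.Eck p f e t) : C.Config := by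
  by_cases fff : C.T f f f = 0
  · exact eck3 hC hli hE fff
  · obtain ⟨s, hs⟩ := exists_root4 (C.T e e e) (3 * C.T f e e) (3 * C.T f f e) (C.T f f f) 0 (fun h => fff h.2.2.1)
    obtain ⟨ppp, ppf, ppe, ppt, pff, pfe, pft, pee, pet, ptt⟩ := hE
    apply eck3 hC (p := p) (f := s • f + e) (e := f) (t := t) (h := h)
    · rw [li5_iff] at hli ⊢
      intro x y z w u h
      obtain ⟨h1, h2, h3, h4, h5⟩ := hli x (y * s + z) y w u (by rw [← h]; module)
      subst h3
      exact ⟨h1, rfl, by simpa using h2, h4, h5⟩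
    · constructor
      all_goals
        try simp only [T_lin, T_sub1, T_sub2, T_sub3]
        try simp only [C.T_swap] at *
        try simp only [ppp, ppf, ppe, ppt, pff, pfe, pft, pee, pet, ptt]
        try ring
    · simp only [T_lin, T_sub1, T_sub2, T_sub3]
      try simp only [C.T_swap] at *
      linear_combination hs

end field
end Cub

/-! ### Normal forms -/

theorem adj_form {k R : Type} [Field k] [CommRing R] [Algebra k R] {ρ : R →ₐ[k] k}
    (hP : IsPlace ρ) {a b c d e f x y z : R} (h1 : a * x + b * y + c * z = 0)
    (h2 : b * x + d * y + e * z = 0) (h3 : c * x + e * y + f * z = 0)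
    (hx : ρ x ≠ 0 ∨ ρ y ≠ 0 ∨ ρ z ≠ 0) :
    ∃ t, d * f - e ^ 2 = t * x ^ 2 ∧ c * e - b * f = t * (x * y) ∧ b * e - c * d = t * (x * z) ∧
      a * f - c ^ 2 = t * y ^ 2 ∧ b * c - a * e = t * (y * z) ∧ a * d - b ^ 2 = t * z ^ 2 := by
  have q1 : x * (c * e - b * f) = y * (d * f - e ^ 2) := by linear_combination e * h3 - f * h2
  have q2 : x * (b * e - c * d) = z * (d * f - e ^ 2) := by linear_combination e * h2 - d * h3
  have q3 : x * (a * f - c ^ 2) = y * (c * e - b * f) := by linear_combination f * h1 - c * h3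
  have q4 : x * (b * c - a * e) = y * (b * e - c * d) := by linear_combination c * h2 - e * h1
  have q4' : x * (b * c - a * e) = z * (c * e - b * f) := by linear_combination b * h3 - e * h1
  have q5 : x * (a * d - b ^ 2) = z * (b * e - c * d) := by linear_combination d * h1 - b * h2
  have q6 : y * (b * c - a * e) = z * (a * f - c ^ 2) := by linear_combination c * h1 - a * h3
  have q7 : y * (a * d - b ^ 2) = z * (b * c - a * e) := by linear_combination a * h2 - b * h1
  have inv : ∀ t : R, ρ t ≠ 0 → ∃ v, t * v = 1 := fun t ht => by
    obtain ⟨u, hu⟩ := (hP.unit t ht)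
    exact ⟨(u⁻¹ : Rˣ), by rw [← hu]; simp⟩
  rcases hx with h | h | h
  · obtain ⟨v, hv⟩ := inv x h
    refine ⟨v ^ 2 * (d * f - e ^ 2), ?_, ?_, ?_, ?_, ?_, ?_⟩
    · linear_combination (-(d * f - e ^ 2) * (1 + x * v)) * hv
    · linear_combination (-(c * e - b * f) * (1 + x * v)) * hv + v ^ 2 * (x * q1)
    · linear_combination (-(b * e - c * d) * (1 + x * v)) * hv + v ^ 2 * (x * q2)
    · linear_combination (-(a * f - c ^ 2) * (1 + x * v)) * hv + v ^ 2 * (x * q3 + y * q1)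
    · linear_combination (-(b * c - a * e) * (1 + x * v)) * hv + v ^ 2 * (x * q4 + y * q2)
    · linear_combination (-(a * d - b ^ 2) * (1 + x * v)) * hv + v ^ 2 * (x * q5 + z * q2)
  · obtain ⟨v, hv⟩ := inv y h
    refine ⟨v ^ 2 * (a * f - c ^ 2), ?_, ?_, ?_, ?_, ?_, ?_⟩
    · linear_combination (-(d * f - e ^ 2) * (1 + y * v)) * hv + v ^ 2 * (-(y * q1) - x * q3)
    · linear_combination (-(c * e - b * f) * (1 + y * v)) * hv + v ^ 2 * (-(y * q3))
    · linear_combination (-(b * e - c * d) * (1 + y * v)) * hv + v ^ 2 * (-(y * q4) + x * q6)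
    · linear_combination (-(a * f - c ^ 2) * (1 + y * v)) * hv
    · linear_combination (-(b * c - a * e) * (1 + y * v)) * hv + v ^ 2 * (y * q6)
    · linear_combination (-(a * d - b ^ 2) * (1 + y * v)) * hv + v ^ 2 * (y * q7 + z * q6)
  · obtain ⟨v, hv⟩ := inv z h
    refine ⟨v ^ 2 * (a * d - b ^ 2), ?_, ?_, ?_, ?_, ?_, ?_⟩
    · linear_combination (-(d * f - e ^ 2) * (1 + z * v)) * hv + v ^ 2 * (-(z * q2) - x * q5)
    · linear_combination (-(c * e - b * f) * (1 + z * v)) * hv + v ^ 2 * (-(z * q4') - x * q7)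
    · linear_combination (-(b * e - c * d) * (1 + z * v)) * hv + v ^ 2 * (-(z * q5))
    · linear_combination (-(a * f - c ^ 2) * (1 + z * v)) * hv + v ^ 2 * (-(z * q6) - y * q7)
    · linear_combination (-(b * c - a * e) * (1 + z * v)) * hv + v ^ 2 * (-(z * q7))
    · linear_combination (-(a * d - b ^ 2) * (1 + z * v)) * hv

namespace Cub
section NF
variable {k R : Type} [Field k] [CommRing R] [Algebra k R]

/-- the normal form `u^3 + w b^2 + o u w` -/
structure NF (C : Cub k) (o b w u : Vec R) : Prop where
  uuu : C.T u u u = 1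
  wbb : 3 * C.T b b w = 1
  ouw : 6 * C.T o w u = 1
  ooo : C.T o o o = 0
  oob : C.T o o b = 0
  oow : C.T o o w = 0
  oou : C.T o o u = 0
  obb : C.T o b b = 0
  obw : C.T o b w = 0
  obu : C.T o b u = 0
  oww : C.T o w w = 0
  ouu : C.T o u u = 0
  bbb : C.T b b b = 0
  bbu : C.T b b u = 0
  bww : C.T b w w = 0
  bwu : C.T b w u = 0
  buu : C.T b u u = 0
  www : C.T w w w = 0
  wwu : C.T w w u = 0
  wuu : C.T w u u = 0

/-- general linear combination -/
def cmb (o b w u t : Vec R) (x : Vec R) : Vec R :=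
  x 0 • o + x 1 • b + x 2 • w + x 3 • u + x 4 • t

/-- the coefficients at `t` -/
def nn (C : Cub k) (o b w u t : Vec R) (x y : Vec R) : R :=
  6 * C.T (x 0 • o + x 1 • b + x 2 • w + x 3 • u) (y 0 • o + y 1 • b + y 2 • w + y 3 • u) t +
    3 * (x 4 * C.T (y 0 • o + y 1 • b + y 2 • w + y 3 • u) t t +
      y 4 * C.T (x 0 • o + x 1 • b + x 2 • w + x 3 • u) t t) + 2 * x 4 * y 4 * C.T t t t

variable {C : Cub k} {o b w u : Vec R}

theorem NF.T3 (h : C.NF o b w u) (x y z : Vec R) :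
    6 * C.T (x 0 • o + x 1 • b + x 2 • w + x 3 • u) (y 0 • o + y 1 • b + y 2 • w + y 3 • u)
      (z 0 • o + z 1 • b + z 2 • w + z 3 • u) = 6 * (x 3 * y 3 * z 3) +
      2 * (x 2 * y 1 * z 1 + x 1 * y 2 * z 1 + x 1 * y 1 * z 2) +
      (x 0 * y 2 * z 3 + x 0 * y 3 * z 2 + x 2 * y 0 * z 3 + x 3 * y 0 * z 2 + x 2 * y 3 * z 0
        + x 3 * y 2 * z 0) := by
  obtain ⟨uuu, wbb, ouw, ooo, oob, oow, oou, obb, obw, obu, oww, ouu, bbb, bbu, bww, bwu, buu, www, wwu, wuu⟩ := h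
  simp only [T_lin]
  obtain ⟨e1, e2, f1, f2, f3, f4, f5⟩ := C.T_perm R
  rw [e1 u o] at ouu; rw [e1 b o] at obb; rw [e1 w o] at oww; rw [e1 u b] at buu
  rw [e1 w b] at bww; rw [e1 u w] at wuu
  rw [e1 o b, e1 o w, e1 o u, e1 b o, e1 b w, e1 b u, e1 w o, e1 w b, e1 w u, e1 u o, e1 u b, e1 u w,
    e2 o b, e2 o w, e2 o u, e2 b o, e2 b w, e2 b u, e2 w o, e2 w b, e2 w u, e2 u o, e2 u b, e2 u w,
    f1 o b w, f1 o b u, f1 o w u, f1 b w u, f2 o b w, f2 o b u, f2 o w u, f2 b w u,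
    f3 o b w, f3 o b u, f3 o w u, f3 b w u, f4 o b w, f4 o b u, f4 o w u, f4 b w u,
    f5 o b w, f5 o b u, f5 o w u, f5 b w u]
  rw [uuu, ooo, oob, oow, oou, obb, obw, obu, oww, ouu, bbb, bbu, bww, bwu, buu, www, wwu, wuu]
  linear_combination (2 * (x 2 * y 1 * z 1 + x 1 * y 2 * z 1 + x 1 * y 1 * z 2)) * wbb +
    (x 0 * y 2 * z 3 + x 0 * y 3 * z 2 + x 2 * y 0 * z 3 + x 3 * y 0 * z 2 + x 2 * y 3 * z 0
        + x 3 * y 2 * z 0) * ouw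

theorem NF.T5 (h : C.NF o b w u) (t : Vec R) (x y z : Vec R) :
    6 * C.T (cmb o b w u t x) (cmb o b w u t y) (cmb o b w u t z) = 6 * (x 3 * y 3 * z 3) +
      2 * (x 2 * y 1 * z 1 + x 1 * y 2 * z 1 + x 1 * y 1 * z 2) +
      (x 0 * y 2 * z 3 + x 0 * y 3 * z 2 + x 2 * y 0 * z 3 + x 3 * y 0 * z 2 + x 2 * y 3 * z 0
        + x 3 * y 2 * z 0) + x 4 * C.nn o b w u t y z + y 4 * C.nn o b w u t x z
        + z 4 * C.nn o b w u t x y := by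
  have key := h.T3 x y z
  rw [nn, nn, nn, cmb, cmb, cmb]
  generalize x 0 • o + x 1 • b + x 2 • w + x 3 • u = X at *
  generalize y 0 • o + y 1 • b + y 2 • w + y 3 • u = Y at *
  generalize z 0 • o + z 1 • b + z 2 • w + z 3 • u = Z at *
  simp only [T_lin]
  rw [C.T_swap23 X t Z, C.T_swap12 t Y Z, C.T_swap23 Y t Z, C.T_swap12 t t Z, C.T_swap23 t t Z,
    C.T_swap12 t Z t, C.T_swap12 t Y t, C.T_swap23 Y t t]
  linear_combination key

theorem NF.map (h : C.NF o b w u) {S : Type} [CommRing S] [Algebra k S] (φ : R →ₐ[k] S) :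
    C.NF (φ ∘ o) (φ ∘ b) (φ ∘ w) (φ ∘ u) := by
  obtain ⟨uuu, wbb, ouw, ooo, oob, oow, oou, obb, obw, obu, oww, ouu, bbb, bbu, bww, bwu, buu, www, wwu, wuu⟩ := h
  have m3 : φ 3 = 3 := map_ofNat φ 3
  have m6 : φ 6 = 6 := map_ofNat φ 6
  constructor
  · rw [T_map, uuu, map_one]
  · rw [T_map, ← m3, ← map_mul, wbb, map_one]
  · rw [T_map, ← m6, ← map_mul, ouw, map_one]
  all_goals rw [T_map]
  · rw [ooo, map_zero]
  · rw [oob, map_zero]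
  · rw [oow, map_zero]
  · rw [oou, map_zero]
  · rw [obb, map_zero]
  · rw [obw, map_zero]
  · rw [obu, map_zero]
  · rw [oww, map_zero]
  · rw [ouu, map_zero]
  · rw [bbb, map_zero]
  · rw [bbu, map_zero]
  · rw [bww, map_zero]
  · rw [bwu, map_zero]
  · rw [buu, map_zero]
  · rw [www, map_zero]
  · rw [wwu, map_zero]
  · rw [wuu, map_zero]

end NF
section nf
variable {k : Type} [Field k] [CharZero k] [IsAlgClosed k] {C : Cub k}

theorem nf1 (hC : C.SM) (hnc : ¬ C.Config) {X Y W U : Vec k}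
    (hli : LinIndep k ![X, Y, W, U])
    (XXX : C.T X X X = 0) (XXY : C.T X X Y = 0) (XYY : C.T X Y Y = 0) (YYY : C.T Y Y Y = 0)
    (XXW : C.T X X W = 0) (XYW : C.T X Y W = 0) (YYW : 3 * C.T Y Y W = 1)
    (XWW : C.T X W W = 0) (YWW : C.T Y W W = 0) (WWW : C.T W W W = 0)
    (XXU : C.T X X U = 0) (XYU : C.T X Y U = 0) (YYU : C.T Y Y U = 0)
    (XUU : C.T X U U = 0) (YUU : C.T Y U U = 0) (UUU : C.T U U U = 1) :
    ∃ n s r q : k, n ≠ 0 ∧ C.NF (n • X) (Y + s • X) (W + r • X) (U + q • X) := by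
  obtain ⟨t, ht⟩ := exists_ext4 hli
  have hn : 6 * C.T X W U ≠ 0 := by
    intro h0
    have h0' : C.T X W U = 0 := by simpa using h0
    exact hnc (eckardt hC ht ⟨XXX, XXY, XXW, XXU, XYY, XYW, XYU, XWW, h0', XUU⟩)
  obtain ⟨n, hn1⟩ : ∃ n, n * (6 * C.T X W U) = 1 := ⟨_, inv_mul_cancel₀ hn⟩
  refine ⟨n, -(6 * C.T Y W U) * n, -(3 * C.T W W U) * n, -(3 * C.T W U U) * n, ?_, ?_⟩
  · rintro rfl; simp at hn1
  · clear hn ht hli hnc hC t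
    obtain ⟨e1, e2, f1, f2, f3, f4, f5⟩ := C.T_perm k
    rw [e1 Y X] at XYY; rw [e1 W X] at XWW; rw [e1 U X] at XUU; rw [e1 W Y] at YWW
    rw [e1 U Y] at YUU
    constructor
    all_goals
      simp only [T_lin]
      simp only [e1 X Y, e1 X W, e1 X U, e1 Y W, e1 Y U, e1 W U, e1 Y X, e1 W X, e1 U X, e1 W Y,
        e1 U Y, e1 U W, e2 X Y, e2 X W, e2 X U, e2 Y W, e2 Y U, e2 W U, e2 Y X, e2 W X, e2 U X, e2 W Y,
        e2 U Y, e2 U W, f1 X Y W, f1 X Y U, f1 X W U, f1 Y W U, f2 X Y W, f2 X Y U, f2 X W U, f2 Y W U,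
        f3 X Y W, f3 X Y U, f3 X W U, f3 Y W U, f4 X Y W, f4 X Y U, f4 X W U, f4 Y W U,
        f5 X Y W, f5 X Y U, f5 X W U, f5 Y W U,
        XXX, XXY, XYY, YYY, XXW, XYW, XWW, YWW, WWW, XXU, XYU, YYU, XUU, YUU, UUU]
    · ring
    · linear_combination YYW
    · linear_combination hn1
    all_goals try ring1
    · linear_combination - C.T Y W U * hn1
    · linear_combination - C.T W W U * hn1
    · linear_combination - C.T U U W * hn1

theorem NF.t_ne (hC : C.SM) {o b w u t : Vec k} (h : C.NF o b w u)
    (hli : LinIndep k ![o, b, w, u, t]) : C.T o o t ≠ 0 ∧ C.T w w t ≠ 0 := by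
  constructor
  · intro h0
    refine hli.ne_zero 0 (hC _ fun v => ?_)
    obtain ⟨x1, x2, x3, x4, x5, rfl⟩ := exists_coord hli v
    simp only [Matrix.cons_val_zero, T_add3, T_smul3]
    rw [h.ooo, h.oob, h.oow, h.oou, h0]; ring
  · intro h0
    refine hli.ne_zero 2 (hC _ fun v => ?_)
    obtain ⟨x1, x2, x3, x4, x5, rfl⟩ := exists_coord hli v
    have hb := h.bww; have ho := h.oww
    rw [C.T_swap12, C.T_swap23] at hb ho
    show C.T w w _ = 0
    simp only [T_add3, T_smul3]
    rw [ho, hb, h.www, h.wwu, h0]; ring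

theorem nf_field (hC : C.SM) (hnc : ¬ C.Config) {g1 g2 g3 g4 : Vec k}
    (hli : LinIndep k ![g1, g2, g3, g4]) (hl : C.OnLine g1 g2) {α β γ : k}
    (hαβ : α ≠ 0 ∨ β ≠ 0) (hd : C.DblE g1 g2 g3 α β γ) (ht : C.Tan g1 g2 g4)
    (h144 : C.T g1 g4 g4 = 0) (h244 : C.T g2 g4 g4 = 0) (h444 : C.T g4 g4 g4 ≠ 0) :
    ∃ x y z w a1 a2 b1 b2 s s' : k, ∃ ft, x * w - y * z ≠ 0 ∧ s ≠ 0 ∧ s' ≠ 0 ∧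
      C.NF (x • g1 + y • g2) (z • g1 + w • g2) (a1 • g1 + a2 • g2 + s • g3) (b1 • g1 + b2 • g2 + s' • g4) ∧
      LinIndep k ![x • g1 + y • g2, z • g1 + w • g2, a1 • g1 + a2 • g2 + s • g3,
        b1 • g1 + b2 • g2 + s' • g4, ft] ∧
      C.T (x • g1 + y • g2) (x • g1 + y • g2) ft ≠ 0 ∧
      C.T (a1 • g1 + a2 • g2 + s • g3) (a1 • g1 + a2 • g2 + s • g3) ft ≠ 0 := by
  obtain ⟨y1, y2, hy⟩ : ∃ y1 y2, α * y1 + β * y2 = 1 := by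
    rcases hαβ with h | h
    · exact ⟨α⁻¹, 0, by field_simp; ring⟩
    · exact ⟨0, β⁻¹, by field_simp; ring⟩
  obtain ⟨κ, hκ⟩ := exists_cubic_root (C.T g4 g4 g4) 0 0 (-1) h444
  have hκ0 : κ ≠ 0 := by rintro rfl; simp at hκ
  obtain ⟨d1, d2, d3, d4, d5, d6⟩ := hd.comb hl β (-α) y1 y2 (-(γ * y1)) (-(γ * y2)) 1
  have i1 : (1:k) * (α * β + β * -α) = 0 := by ring
  have i2 : (1:k) * (α * y1 + β * y2) = 1 := by rw [hy, one_mul]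
  have i3 : (1:k) * (α * -(γ * y1) + β * -(γ * y2) + γ * 1 ^ 2) = 0 := by linear_combination (-γ) * hy
  rw [i1] at d1 d2 d4; rw [i2] at d2 d3 d5; rw [i3] at d4 d5 d6
  have hX := hl.comb β (-α) y1 y2
  obtain ⟨u1, u2, u3⟩ : C.Tan (β • g1 + (-α) • g2) (y1 • g1 + y2 • g2) (κ • g4) := by
    obtain ⟨t1, t2, t3⟩ := ht
    have t2' := t2
    rw [C.T_swap12] at t2'
    refine ⟨?_, ?_, ?_⟩ <;> simp only [T_add1, T_add2, T_smul1, T_smul2, T_smul3, t1, t2, t2', t3] <;> ring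
  have u4 : C.T (β • g1 + (-α) • g2) (κ • g4) (κ • g4) = 0 := by
    simp only [T_add1, T_smul1, T_smul2, T_smul3, h144, h244]; ring
  have u5 : C.T (y1 • g1 + y2 • g2) (κ • g4) (κ • g4) = 0 := by
    simp only [T_add1, T_smul1, T_smul2, T_smul3, h144, h244]; ring
  have u6 : C.T (κ • g4) (κ • g4) (κ • g4) = 1 := by
    simp only [T_smul1, T_smul2, T_smul3]; linear_combination hκ
  have z3 : ∀ t : k, 3 * t = 0 → t = 0 := fun t h => by simpa using h
  obtain ⟨n, s, r, q, hn, hnf⟩ := nf1 hC hnc (X := β • g1 + (-α) • g2) (Y := y1 • g1 + y2 • g2)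
    (W := (-(γ * y1)) • g1 + (-(γ * y2)) • g2 + (1:k) ^ 2 • g3) (U := κ • g4) (by
      rw [li4_iff] at hli ⊢
      intro x y z w h
      obtain ⟨h1, h2, h3, h4⟩ := hli (x * β + y * y1 - z * (γ * y1)) (- x * α + y * y2 - z * (γ * y2)) z (w * κ) (by
        rw [← h]; module)
      have hw : w = 0 := by simpa [hκ0] using h4
      subst h3 hw
      refine ⟨by linear_combination y2 * h1 - y1 * h2 - x * hy, by linear_combination α * h1 + β * h2 - y * hy, rfl, rfl⟩)
    hX.1 hX.2.1 hX.2.2.1 hX.2.2.2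
    (z3 _ (by rw [d1]; ring)) (z3 _ (by rw [d2]; ring)) (by rw [d3]; ring) (z3 _ (by rw [d4]; ring))
    (z3 _ (by rw [d5]; ring)) (by rw [d6]; ring) u1 u2 u3 u4 u5 u6
  have j1 : n • (β • g1 + (-α) • g2) = (n * β) • g1 + (-(n * α)) • g2 := by module
  have j2 : (y1 • g1 + y2 • g2) + s • (β • g1 + (-α) • g2) = (y1 + s * β) • g1 + (y2 - s * α) • g2 := by module
  have j3 : ((-(γ * y1)) • g1 + (-(γ * y2)) • g2 + (1:k) ^ 2 • g3) + r • (β • g1 + (-α) • g2) =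
    (-(γ * y1) + r * β) • g1 + (-(γ * y2) - r * α) • g2 + (1:k) • g3 := by module
  have j4 : κ • g4 + q • (β • g1 + (-α) • g2) = (q * β) • g1 + (-(q * α)) • g2 + κ • g4 := by module
  rw [j1, j2, j3, j4] at hnf
  have hdet : (n * β) * (y2 - s * α) - (-(n * α)) * (y1 + s * β) ≠ 0 := by
    have : (n * β) * (y2 - s * α) - (-(n * α)) * (y1 + s * β) = n := by linear_combination n * hy
    rwa [this]
  have hli' : LinIndep k ![(n * β) • g1 + (-(n * α)) • g2, (y1 + s * β) • g1 + (y2 - s * α) • g2,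
      (-(γ * y1) + r * β) • g1 + (-(γ * y2) - r * α) • g2 + (1:k) • g3,
      (q * β) • g1 + (-(q * α)) • g2 + κ • g4] := by
    generalize n * β = x at *
    generalize -(n * α) = y at *
    generalize y1 + s * β = z at *
    generalize y2 - s * α = w at *
    clear hnf j1 j2 j3 j4
    rw [li4_iff] at hli ⊢
    intro x1 x2 x3 x4 h
    obtain ⟨h1, h2, h3, h4⟩ := hli (x1 * x + x2 * z + x3 * (-(γ * y1) + r * β) + x4 * (q * β))
      (x1 * y + x2 * w + x3 * (-(γ * y2) - r * α) + x4 * (-(q * α))) x3 (x4 * κ) (by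
        rw [← h]; module)
    have hw : x4 = 0 := by simpa [hκ0] using h4
    subst h3 hw
    have k1 : (x * w - y * z) * x1 = 0 := by linear_combination w * h1 - z * h2
    have k2 : (x * w - y * z) * x2 = 0 := by linear_combination x * h2 - y * h1
    refine ⟨by simpa [hdet] using k1, by simpa [hdet] using k2, rfl, rfl⟩
  obtain ⟨ft, hft⟩ := exists_ext4 hli'
  refine ⟨_, _, _, _, _, _, _, _, _, _, ft, hdet, one_ne_zero, hκ0, hnf, hft, ?_, ?_⟩
  · exact (NF.t_ne hC hnf hft).1
  · exact (NF.t_ne hC hnf hft).2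

end nf
section polar
variable {k R : Type} [Field k] [CommRing R] [Algebra k R] {C : Cub k} {p q e : Vec R}

/-- polarized form of a cubic on a plane containing a line -/
theorem OnLine.T3 (hl : C.OnLine p q) (x y w x' y' w' x'' y'' w'' : R) :
    6 * C.T (x • p + y • q + w • e) (x' • p + y' • q + w' • e) (x'' • p + y'' • q + w'' • e) =
      3 * C.T p p e * (2 * (w * (x' * x'') + w' * (x * x'') + w'' * (x * x'))) +
      6 * C.T p q e * (w * (x' * y'' + y' * x'') + w' * (x * y'' + y * x'') + w'' * (x * y' + y * x')) +
      3 * C.T q q e * (2 * (w * (y' * y'') + w' * (y * y'') + w'' * (y * y'))) +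
      3 * C.T p e e * (2 * (x * w' * w'' + w * x' * w'' + w * w' * x'')) +
      3 * C.T q e e * (2 * (y * w' * w'' + w * y' * w'' + w * w' * y'')) +
      6 * C.T e e e * (w * w' * w'') := by
  obtain ⟨g1, g2, g3, g4⟩ := hl
  have e1 : ∀ p q : Vec R, C.T q p p = C.T p p q := fun p q => by rw [C.T_swap12, C.T_swap23]
  have e2 : ∀ p q : Vec R, C.T p q p = C.T p p q := fun p q => by rw [C.T_swap23]
  have f1 : C.T p e q = C.T p q e := by rw [C.T_swap23]
  have f2 : C.T q p e = C.T p q e := by rw [C.T_swap12]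
  have f3 : C.T q e p = C.T p q e := by rw [C.T_swap23, C.T_swap12]
  have f4 : C.T e p q = C.T p q e := by rw [C.T_swap12, C.T_swap23]
  have f5 : C.T e q p = C.T p q e := by rw [C.T_swap12, C.T_swap23, C.T_swap12]
  rw [e1 q p] at g3
  rw [e1 e p, e1 e q]
  simp only [T_lin]
  simp only [e1 p q, e1 q p, e1 p e, e1 e p, e1 q e, e1 e q, e2 p q, e2 q p, e2 p e, e2 e p, e2 q e, e2 e q,
    f1, f2, f3, f4, f5, g1, g2, g3, g4]
  ring

theorem DblE.T3 (hl : C.OnLine p q) {α β γ : R} (h : C.DblE p q e α β γ)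
    (x y w x' y' w' x'' y'' w'' : R) :
    6 * C.T (x • p + y • q + w • e) (x' • p + y' • q + w' • e) (x'' • p + y'' • q + w'' • e) =
      2 * (w * ((α * x' + β * y' + γ * w') * (α * x'' + β * y'' + γ * w'')) +
        w' * ((α * x + β * y + γ * w) * (α * x'' + β * y'' + γ * w'')) +
        w'' * ((α * x + β * y + γ * w) * (α * x' + β * y' + γ * w'))) := by
  obtain ⟨h1, h2, h3, h4, h5, h6⟩ := h
  rw [hl.T3]
  linear_combination (2 * (w * (x' * x'') + w' * (x * x'') + w'' * (x * x'))) * h1 +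
    2 * (w * (x' * y'' + y' * x'') + w' * (x * y'' + y * x'') + w'' * (x * y' + y * x')) * h2 +
    (2 * (w * (y' * y'') + w' * (y * y'') + w'' * (y * y'))) * h3 +
    (2 * (x * w' * w'' + w * x' * w'' + w * w' * x'')) * h4 +
    (2 * (y * w' * w'' + w * y' * w'' + w * w' * y'')) * h5 + 6 * (w * w' * w'') * h6

theorem half_exists (k : Type) {R : Type} [Field k] [CharZero k] [CommRing R] [Algebra k R] : ∃ h : R, 2 * h = 1 ∧ ∃ h6 : R, 6 * h6 = 1 := by
  have e2 : algMap k R 2 = 2 := map_ofNat _ 2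
  have e6 : algMap k R 6 = 6 := map_ofNat _ 6
  refine ⟨algMap k R 2⁻¹, ?_, algMap k R 6⁻¹, ?_⟩
  · rw [← e2, ← map_mul]; simp
  · rw [← e6, ← map_mul]; simp

variable [CharZero k] {ρ : R →ₐ[k] k} {o b w u t : Vec R}

/-- the cubic on the plane `E_m` -/
structure EmEq (C : Cub k) (ρ : R →ₐ[k] k) (o w t Po Pb Pw : Vec R) (p q z t0 t1 t2 noo nob nbb now nbw nww : R) : Prop where
  roo : ρ noo = 3 * ρ (C.T o o t)
  rww : ρ nww = 3 * ρ (C.T w w t)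
  E1 : C.T Po Po Po = -p ^ 3 + t0 * noo
  E2 : 3 * C.T Po Po Pb = -3 * p ^ 2 * q + (t0 * nob + t1 * noo)
  E3 : 3 * C.T Po Pb Pb = -3 * p * q ^ 2 + (t0 * nbb + t1 * nob)
  E4 : C.T Pb Pb Pb = -q ^ 3 + t1 * nbb
  E5 : 3 * C.T Po Po Pw = -p - 3 * p ^ 2 * z + (t0 * now + t2 * noo)
  E6 : 6 * C.T Po Pb Pw = -q - 6 * p * q * z + (t0 * nbw + t1 * now + t2 * nob)
  E7 : 3 * C.T Pb Pb Pw = 1 - 3 * q ^ 2 * z + (t1 * nbw + t2 * nbb)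
  E8 : 3 * C.T Po Pw Pw = -z - 3 * p * z ^ 2 + (t0 * nww + t2 * now)
  E9 : 3 * C.T Pb Pw Pw = -3 * q * z ^ 2 + (t1 * nww + t2 * nbw)
  E10 : C.T Pw Pw Pw = -z ^ 3 + t2 * nww

structure EnEq (C : Cub k) (ρ : R →ₐ[k] k) (o t Qo Qb Pu : Vec R) (c0 c1 c3 t0 t1 t3 noo nob nbb nuo nub nuu : R) : Prop where
  roo : ρ noo = 3 * ρ (C.T o o t)
  U1 : C.T Pu Pu Pu = 1 + t3 * nuu
  U2 : 3 * C.T Pu Pu Qo = -c3 + (t3 * nuo + t0 * nuu)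
  U3 : 3 * C.T Pu Pu Qb = t3 * nub + t1 * nuu
  U4 : 3 * C.T Pu Qo Qo = -c0 + (t0 * nuo + t3 * noo)
  U5 : 6 * C.T Pu Qo Qb = -c1 + (t0 * nub + t1 * nuo + t3 * nob)
  U6 : 3 * C.T Pu Qb Qb = -c3 + (t1 * nub + t3 * nbb)
  U7 : C.T Qo Qo Qo = t0 * noo
  U8 : 3 * C.T Qo Qo Qb = t0 * nob + t1 * noo
  U9 : 3 * C.T Qo Qb Qb = -c0 + (t0 * nbb + t1 * nob)
  U10 : C.T Qb Qb Qb = -c1 + t1 * nbb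

theorem NF.Em (h : C.NF o b w u) {Po Pb Pw : Vec R} {p q z t0 t1 t2 : R}
    (hPo : Po = o - p • u + t0 • t) (hPb : Pb = b - q • u + t1 • t) (hPw : Pw = w - z • u + t2 • t)
    (hp : ρ p = 0) (hz : ρ z = 0) (ht0 : ρ t0 = 0) (ht2 : ρ t2 = 0) :
    ∃ noo nob nbb now nbw nww : R, C.EmEq ρ o w t Po Pb Pw p q z t0 t1 t2 noo nob nbb now nbw nww := by
  obtain ⟨h2, hh2, h6, hh6⟩ := half_exists k (R := R)
  have c6 : ∀ a b : R, 6 * a = 6 * b → a = b := fun a b hab => by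
    linear_combination h6 * hab + (b - a) * hh6
  have T5 := h.T5 t
  obtain ⟨vo, hvo⟩ : ∃ v : Vec R, v = ![1, 0, 0, -p, t0] := ⟨_, rfl⟩
  obtain ⟨vb, hvb⟩ : ∃ v : Vec R, v = ![0, 1, 0, -q, t1] := ⟨_, rfl⟩
  obtain ⟨vw, hvw⟩ : ∃ v : Vec R, v = ![0, 0, 1, -z, t2] := ⟨_, rfl⟩
  have ho : cmb o b w u t vo = Po := by rw [hPo, hvo]; simp [cmb, sub_eq_add_neg]
  have ao : vo 0 = 1 ∧ vo 1 = 0 ∧ vo 2 = 0 ∧ vo 3 = -p ∧ vo 4 = t0 := by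
    rw [hvo]; exact ⟨rfl, rfl, rfl, rfl, rfl⟩
  have hb : cmb o b w u t vb = Pb := by rw [hPb, hvb]; simp [cmb, sub_eq_add_neg]
  have ab : vb 0 = 0 ∧ vb 1 = 1 ∧ vb 2 = 0 ∧ vb 3 = -q ∧ vb 4 = t1 := by
    rw [hvb]; exact ⟨rfl, rfl, rfl, rfl, rfl⟩
  have hw : cmb o b w u t vw = Pw := by rw [hPw, hvw]; simp [cmb, sub_eq_add_neg]
  have aw : vw 0 = 0 ∧ vw 1 = 0 ∧ vw 2 = 1 ∧ vw 3 = -z ∧ vw 4 = t2 := by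
    rw [hvw]; exact ⟨rfl, rfl, rfl, rfl, rfl⟩
  obtain ⟨noo, goo⟩ : ∃ x, C.nn o b w u t vo vo = 2 * x := ⟨h2 * C.nn o b w u t vo vo, by linear_combination (-C.nn o b w u t vo vo) * hh2⟩
  obtain ⟨nbb, gbb⟩ : ∃ x, C.nn o b w u t vb vb = 2 * x := ⟨h2 * C.nn o b w u t vb vb, by linear_combination (-C.nn o b w u t vb vb) * hh2⟩
  obtain ⟨nww, gww⟩ : ∃ x, C.nn o b w u t vw vw = 2 * x := ⟨h2 * C.nn o b w u t vw vw, by linear_combination (-C.nn o b w u t vw vw) * hh2⟩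
  have roo : noo = 3 * C.T (o - p • u) (o - p • u) t + t0 * (3 * C.T (o - p • u) t t + t0 * C.T t t t) := by
    have : vo 0 • o + vo 1 • b + vo 2 • w + vo 3 • u = o - p • u := by rw [hvo]; simp [sub_eq_add_neg]
    rw [nn, this, ao.2.2.2.2] at goo
    linear_combination (-h2) * goo + (-noo + 3 * C.T (o - p • u) (o - p • u) t + t0 * (3 * C.T (o - p • u) t t + t0 * C.T t t t)) * hh2
  have rww : nww = 3 * C.T (w - z • u) (w - z • u) t + t2 * (3 * C.T (w - z • u) t t + t2 * C.T t t t) := by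
    have : vw 0 • o + vw 1 • b + vw 2 • w + vw 3 • u = w - z • u := by rw [hvw]; simp [sub_eq_add_neg]
    rw [nn, this, aw.2.2.2.2] at gww
    linear_combination (-h2) * gww + (-nww + 3 * C.T (w - z • u) (w - z • u) t + t2 * (3 * C.T (w - z • u) t t + t2 * C.T t t t)) * hh2
  obtain ⟨nob, gob⟩ : ∃ x, C.nn o b w u t vo vb = x := ⟨_, rfl⟩
  obtain ⟨now, gow⟩ : ∃ x, C.nn o b w u t vo vw = x := ⟨_, rfl⟩
  obtain ⟨nbw, gbw⟩ : ∃ x, C.nn o b w u t vb vw = x := ⟨_, rfl⟩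
  refine ⟨noo, nob, nbb, now, nbw, nww, ?_, ?_, ?_, ?_, ?_, ?_, ?_, ?_, ?_, ?_, ?_, ?_⟩
  · rw [roo]
    simp only [T_sub1, T_sub2, T_smul1, T_smul2, map_add, map_mul, map_sub, hp, ht0, map_ofNat]
    ring
  · rw [rww]
    simp only [T_sub1, T_sub2, T_smul1, T_smul2, map_add, map_mul, map_sub, hz, ht2, map_ofNat]
    ring
  · have := T5 vo vo vo
    simp only [ho, ao, goo] at this
    apply c6; linear_combination 1 * this
  · have := T5 vo vo vb
    simp only [ho, hb, ao, ab, gob, goo] at this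
    apply c6; linear_combination 3 * this
  · have := T5 vo vb vb
    simp only [ho, hb, ao, ab, gbb, gob] at this
    apply c6; linear_combination 3 * this
  · have := T5 vb vb vb
    simp only [hb, ab, gbb] at this
    apply c6; linear_combination 1 * this
  · have := T5 vo vo vw
    simp only [ho, hw, ao, aw, gow, goo] at this
    apply c6; linear_combination 3 * this
  · have := T5 vo vb vw
    simp only [ho, hb, hw, ao, ab, aw, gbw, gow, gob] at this
    linear_combination this
  · have := T5 vb vb vw
    simp only [hb, hw, ab, aw, gbw, gbb] at this
    apply c6; linear_combination 3 * this
  · have := T5 vo vw vw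
    simp only [ho, hw, ao, aw, gww, gow] at this
    apply c6; linear_combination 3 * this
  · have := T5 vb vw vw
    simp only [hb, hw, ab, aw, gww, gbw] at this
    apply c6; linear_combination 3 * this
  · have := T5 vw vw vw
    simp only [hw, aw, gww] at this
    apply c6; linear_combination 1 * this

theorem NF.En (h : C.NF o b w u) {Qo Qb Pu : Vec R} {c0 c1 c3 t0 t1 t3 : R}
    (hQo : Qo = o - c0 • w + t0 • t) (hQb : Qb = b - c1 • w + t1 • t) (hPu : Pu = u - c3 • w + t3 • t)
    (hc0 : ρ c0 = 0) (ht0 : ρ t0 = 0) :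
    ∃ noo nob nbb nuo nub nuu : R, C.EnEq ρ o t Qo Qb Pu c0 c1 c3 t0 t1 t3 noo nob nbb nuo nub nuu := by
  obtain ⟨h2, hh2, h6, hh6⟩ := half_exists k (R := R)
  have c6 : ∀ a b : R, 6 * a = 6 * b → a = b := fun a b hab => by
    linear_combination h6 * hab + (b - a) * hh6
  have T5 := h.T5 t
  obtain ⟨vu, hvu⟩ : ∃ v : Vec R, v = ![0, 0, -c3, 1, t3] := ⟨_, rfl⟩
  obtain ⟨vo, hvo⟩ : ∃ v : Vec R, v = ![1, 0, -c0, 0, t0] := ⟨_, rfl⟩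
  obtain ⟨vb, hvb⟩ : ∃ v : Vec R, v = ![0, 1, -c1, 0, t1] := ⟨_, rfl⟩
  have hu : cmb o b w u t vu = Pu := by rw [hPu, hvu]; simp [cmb, sub_eq_add_neg, add_comm]
  have au : vu 0 = 0 ∧ vu 1 = 0 ∧ vu 2 = -c3 ∧ vu 3 = 1 ∧ vu 4 = t3 := by
    rw [hvu]; exact ⟨rfl, rfl, rfl, rfl, rfl⟩
  have ho : cmb o b w u t vo = Qo := by rw [hQo, hvo]; simp [cmb, sub_eq_add_neg]
  have ao : vo 0 = 1 ∧ vo 1 = 0 ∧ vo 2 = -c0 ∧ vo 3 = 0 ∧ vo 4 = t0 := by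
    rw [hvo]; exact ⟨rfl, rfl, rfl, rfl, rfl⟩
  have hb : cmb o b w u t vb = Qb := by rw [hQb, hvb]; simp [cmb, sub_eq_add_neg]
  have ab : vb 0 = 0 ∧ vb 1 = 1 ∧ vb 2 = -c1 ∧ vb 3 = 0 ∧ vb 4 = t1 := by
    rw [hvb]; exact ⟨rfl, rfl, rfl, rfl, rfl⟩
  obtain ⟨nuu, guu⟩ : ∃ x, C.nn o b w u t vu vu = 2 * x := ⟨h2 * C.nn o b w u t vu vu, by linear_combination (-C.nn o b w u t vu vu) * hh2⟩
  obtain ⟨noo, goo⟩ : ∃ x, C.nn o b w u t vo vo = 2 * x := ⟨h2 * C.nn o b w u t vo vo, by linear_combination (-C.nn o b w u t vo vo) * hh2⟩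
  obtain ⟨nbb, gbb⟩ : ∃ x, C.nn o b w u t vb vb = 2 * x := ⟨h2 * C.nn o b w u t vb vb, by linear_combination (-C.nn o b w u t vb vb) * hh2⟩
  have roo : noo = 3 * C.T (o - c0 • w) (o - c0 • w) t + t0 * (3 * C.T (o - c0 • w) t t + t0 * C.T t t t) := by
    have : vo 0 • o + vo 1 • b + vo 2 • w + vo 3 • u = o - c0 • w := by rw [hvo]; simp [sub_eq_add_neg]
    rw [nn, this, ao.2.2.2.2] at goo
    linear_combination (-h2) * goo + (-noo + 3 * C.T (o - c0 • w) (o - c0 • w) t + t0 * (3 * C.T (o - c0 • w) t t + t0 * C.T t t t)) * hh2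
  obtain ⟨nuo, guo⟩ : ∃ x, C.nn o b w u t vu vo = x := ⟨_, rfl⟩
  obtain ⟨nub, gub⟩ : ∃ x, C.nn o b w u t vu vb = x := ⟨_, rfl⟩
  obtain ⟨nob, gob⟩ : ∃ x, C.nn o b w u t vo vb = x := ⟨_, rfl⟩
  refine ⟨noo, nob, nbb, nuo, nub, nuu, ?_, ?_, ?_, ?_, ?_, ?_, ?_, ?_, ?_, ?_, ?_⟩
  · rw [roo]
    simp only [T_sub1, T_sub2, T_smul1, T_smul2, map_add, map_mul, map_sub, hc0, ht0, map_ofNat]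
    ring
  · have := T5 vu vu vu
    simp only [hu, au, guu] at this
    apply c6; linear_combination 1 * this
  · have := T5 vu vu vo
    simp only [hu, ho, au, ao, guo, guu] at this
    apply c6; linear_combination 3 * this
  · have := T5 vu vu vb
    simp only [hu, hb, au, ab, gub, guu] at this
    apply c6; linear_combination 3 * this
  · have := T5 vu vo vo
    simp only [hu, ho, au, ao, goo, guo] at this
    apply c6; linear_combination 3 * this
  · have := T5 vu vo vb
    simp only [hu, ho, hb, au, ao, ab, gob, gub, guo] at this
    linear_combination this
  · have := T5 vu vb vb
    simp only [hu, hb, au, ab, gbb, gub] at this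
    apply c6; linear_combination 3 * this
  · have := T5 vo vo vo
    simp only [ho, ao, goo] at this
    apply c6; linear_combination 1 * this
  · have := T5 vo vo vb
    simp only [ho, hb, ao, ab, gob, goo] at this
    apply c6; linear_combination 3 * this
  · have := T5 vo vb vb
    simp only [ho, hb, ao, ab, gbb, gob] at this
    apply c6; linear_combination 3 * this
  · have := T5 vb vb vb
    simp only [hb, ab, gbb] at this
    apply c6; linear_combination 1 * this

end polar
section lay
variable {k R : Type} [Field k] [CharZero k] [CommRing R] [IsDomain R] [Algebra k R] {C : Cub k}
  {ρ : R →ₐ[k] k}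

/-- the quantity which controls the multiplicity -/
def EE (C : Cub k) (o b c : Vec R) : R := C.T o o c * C.T b b c - C.T o b c ^ 2

theorem rows (hP : IsPlace ρ) {o b e c : Vec R} {x y η : R} (hl : C.OnLine o b)
    (hc : c = x • o + y • b + η • e) (hη : η ≠ 0) (hprim : ρ x ≠ 0 ∨ ρ y ≠ 0 ∨ ρ η ≠ 0)
    (c1 : C.T c c o = 0) (c2 : C.T c c b = 0) (c3 : C.T c c e = 0) :
    (2 * (3 * C.T o o e) * x + 6 * C.T o b e * y + 3 * C.T o e e * η = 0) ∧
    (6 * C.T o b e * x + 2 * (3 * C.T b b e) * y + 3 * C.T b e e * η = 0) ∧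
    (3 * C.T o e e * x + 3 * C.T b e e * y + 2 * C.T e e e * η = 0) ∧
    ∃ t, 36 * C.EE o b c = η ^ 4 * t ∧
      (2 * (3 * C.T b b e)) * (2 * C.T e e e) - (3 * C.T b e e) ^ 2 = t * x ^ 2 ∧
      (3 * C.T o e e) * (3 * C.T b e e) - (6 * C.T o b e) * (2 * C.T e e e) = t * (x * y) ∧
      (6 * C.T o b e) * (3 * C.T b e e) - (3 * C.T o e e) * (2 * (3 * C.T b b e)) = t * (x * η) ∧
      (2 * (3 * C.T o o e)) * (2 * C.T e e e) - (3 * C.T o e e) ^ 2 = t * y ^ 2 ∧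
      (6 * C.T o b e) * (3 * C.T o e e) - (2 * (3 * C.T o o e)) * (3 * C.T b e e) = t * (y * η) ∧
      (2 * (3 * C.T o o e)) * (2 * (3 * C.T b b e)) - (6 * C.T o b e) ^ 2 = t * η ^ 2 := by
  obtain ⟨h2, hh2, h6, hh6⟩ := half_exists k (R := R)
  have e1 : o = (1:R) • o + (0:R) • b + (0:R) • e := by module
  have e2 : b = (0:R) • o + (1:R) • b + (0:R) • e := by module
  have e3 : e = (0:R) • o + (0:R) • b + (1:R) • e := by module
  have q1 := hl.T3 (e := e) x y η x y η 1 0 0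
  have q2 := hl.T3 (e := e) x y η x y η 0 1 0
  have q3 := hl.T3 (e := e) x y η x y η 0 0 1
  rw [← e1, ← hc, c1] at q1
  rw [← e2, ← hc, c2] at q2
  rw [← e3, ← hc, c3] at q3
  have r1 : 2 * (3 * C.T o o e) * x + 6 * C.T o b e * y + 3 * C.T o e e * η = 0 := by
    apply (mul_eq_zero.1 (show η * _ = 0 from ?_)).resolve_left hη
    linear_combination (-h2) * q1 + (-(2 * (3 * C.T o o e) * x + 6 * C.T o b e * y + 3 * C.T o e e * η) * η) * hh2
  have r2 : 6 * C.T o b e * x + 2 * (3 * C.T b b e) * y + 3 * C.T b e e * η = 0 := by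
    apply (mul_eq_zero.1 (show η * _ = 0 from ?_)).resolve_left hη
    linear_combination (-h2) * q2 + (-(6 * C.T o b e * x + 2 * (3 * C.T b b e) * y + 3 * C.T b e e * η) * η) * hh2
  have r3 : 3 * C.T o e e * x + 3 * C.T b e e * y + 2 * C.T e e e * η = 0 := by
    apply (mul_eq_zero.1 (show η * _ = 0 from ?_)).resolve_left hη
    have : 3 * (η * (3 * C.T o e e * x + 3 * C.T b e e * y + 2 * C.T e e e * η)) = 0 := by
      linear_combination (-1:R) * q3 - x * r1 - y * r2
    linear_combination 2 * h6 * this - (η * (3 * C.T o e e * x + 3 * C.T b e e * y + 2 * C.T e e e * η)) * hh6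
  refine ⟨r1, r2, r3, ?_⟩
  obtain ⟨t, h1, h2', h3, h4, h5, h6'⟩ := adj_form hP r1 r2 r3 hprim
  refine ⟨t, ?_, h1, h2', h3, h4, h5, h6'⟩
  have s1 : C.T o o c = η * C.T o o e := by
    rw [hc]; simp only [T_add3, T_smul3, hl.1, hl.2.1]; ring
  have s2 : C.T b b c = η * C.T b b e := by
    rw [hc]; simp only [T_add3, T_smul3, hl.2.2.2]
    rw [C.T_swap23 b b o, C.T_swap12 b o b, hl.2.2.1]; ring
  have s3 : C.T o b c = η * C.T o b e := by
    rw [hc]; simp only [T_add3, T_smul3, hl.2.2.1]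
    rw [C.T_swap23 o b o, hl.2.1]; ring
  rw [EE, s1, s2, s3]; linear_combination η ^ 2 * h6'

/-- coordinates near a bad plane -/
structure Lay (C : Cub k) (ρ : R →ₐ[k] k) (fo fb fw fu ft Lo Lb Pw Pu : Vec R)
    (y0 f1 a0 y1 g1 a1 z t2 c3 t3 : R) : Prop where
  nf : C.NF fo fb fw fu
  hoo : ρ (C.T fo fo ft) ≠ 0
  hww : ρ (C.T fw fw ft) ≠ 0
  hLo : Lo = fo - y0 • fw + f1 • fu + a0 • ft
  hLb : Lb = fb - y1 • fw + g1 • fu + a1 • ft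
  hPw : Pw = fw - z • fu + t2 • ft
  hPu : Pu = fu - c3 • fw + t3 • ft
  y0' : ρ y0 = 0
  f1' : ρ f1 = 0
  a0' : ρ a0 = 0
  y1' : ρ y1 = 0
  g1' : ρ g1 = 0
  a1' : ρ a1 = 0
  z' : ρ z = 0
  t2' : ρ t2 = 0
  c3' : ρ c3 = 0
  t3' : ρ t3 = 0
  line : C.OnLine Lo Lb

variable {fo fb fw fu ft Lo Lb Pw Pu : Vec R} {y0 f1 a0 y1 g1 a1 z t2 c3 t3 : R}

theorem Lay.Em (h : C.Lay ρ fo fb fw fu ft Lo Lb Pw Pu y0 f1 a0 y1 g1 a1 z t2 c3 t3) :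
    ∃ noo nob nbb now nbw nww : R, C.EmEq ρ fo fw ft (Lo + y0 • Pw) (Lb + y1 • Pw) Pw
      (-f1 + z * y0) (-g1 + z * y1) z (a0 + y0 * t2) (a1 + y1 * t2) t2 noo nob nbb now nbw nww :=
  h.nf.Em (by rw [h.hLo, h.hPw]; module) (by rw [h.hLb, h.hPw]; module) h.hPw
    (by simp [h.f1', h.z']) h.z' (by simp [h.a0', h.t2']) h.t2'

theorem Lay.En (h : C.Lay ρ fo fb fw fu ft Lo Lb Pw Pu y0 f1 a0 y1 g1 a1 z t2 c3 t3) :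
    ∃ noo nob nbb nuo nub nuu : R, C.EnEq ρ fo ft (Lo + (-f1) • Pu) (Lb + (-g1) • Pu) Pu
      (y0 - f1 * c3) (y1 - g1 * c3) c3 (a0 - f1 * t3) (a1 - g1 * t3) t3 noo nob nbb nuo nub nuu :=
  h.nf.En (by rw [h.hLo, h.hPu]; module) (by rw [h.hLb, h.hPu]; module) h.hPu
    (by simp [h.f1', h.y0']) (by simp [h.a0', h.t3'])

/-- values on a plane in a shifted basis -/
theorem shift_T {p q e : Vec R} (hl : C.OnLine p q) (y0 y1 : R) {A B D E G H : R}
    (hA : 3 * C.T p p e = A) (hB : 6 * C.T p q e = B) (hD : 3 * C.T q q e = D)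
    (hE : 3 * C.T p e e = E) (hG : 3 * C.T q e e = G) (hH : C.T e e e = H) :
    C.T (p + y0 • e) (p + y0 • e) (p + y0 • e) = y0 * (A + y0 * E + y0 ^ 2 * H) ∧
    3 * C.T (p + y0 • e) (p + y0 • e) (q + y1 • e) =
      y1 * (A + y0 * E + y0 ^ 2 * H) + y0 * (B + y0 * G + y1 * E + 2 * y0 * y1 * H) ∧
    3 * C.T (p + y0 • e) (q + y1 • e) (q + y1 • e) =
      y0 * (D + y1 * G + y1 ^ 2 * H) + y1 * (B + y0 * G + y1 * E + 2 * y0 * y1 * H) ∧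
    C.T (q + y1 • e) (q + y1 • e) (q + y1 • e) = y1 * (D + y1 * G + y1 ^ 2 * H) ∧
    3 * C.T (p + y0 • e) (p + y0 • e) e =
      (A + y0 * E + y0 ^ 2 * H) + y0 * (E + 2 * y0 * H) ∧
    6 * C.T (p + y0 • e) (q + y1 • e) e =
      (B + y0 * G + y1 * E + 2 * y0 * y1 * H) + y0 * (G + 2 * y1 * H) + y1 * (E + 2 * y0 * H) ∧
    3 * C.T (q + y1 • e) (q + y1 • e) e =
      (D + y1 * G + y1 ^ 2 * H) + y1 * (G + 2 * y1 * H) ∧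
    3 * C.T (p + y0 • e) e e = (E + 2 * y0 * H) + y0 * H ∧
    3 * C.T (q + y1 • e) e e = (G + 2 * y1 * H) + y1 * H := by
  obtain ⟨h2, hh2, h6, hh6⟩ := half_exists k (R := R)
  have c6 : ∀ a b : R, 6 * a = 6 * b → a = b := fun a b hab => by
    linear_combination h6 * hab + (b - a) * hh6
  have e1 : p + y0 • e = (1:R) • p + (0:R) • q + y0 • e := by module
  have e2 : q + y1 • e = (0:R) • p + (1:R) • q + y1 • e := by module
  have e3 : e = (0:R) • p + (0:R) • q + (1:R) • e := by module
  have T3 := fun x y w x' y' w' x'' y'' w'' => hl.T3 (e := e) x y w x' y' w' x'' y'' w''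
  rw [← hH] at *
  have q1 := T3 1 0 y0 1 0 y0 1 0 y0
  have q2 := T3 1 0 y0 1 0 y0 0 1 y1
  have q3 := T3 1 0 y0 0 1 y1 0 1 y1
  have q4 := T3 0 1 y1 0 1 y1 0 1 y1
  have q5 := T3 1 0 y0 1 0 y0 0 0 1
  have q6 := T3 1 0 y0 0 1 y1 0 0 1
  have q7 := T3 0 1 y1 0 1 y1 0 0 1
  have q8 := T3 1 0 y0 0 0 1 0 0 1
  have q9 := T3 0 1 y1 0 0 1 0 0 1
  rw [← e1] at q1 q2 q3 q5 q6 q8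
  rw [← e2] at q2 q3 q4 q6 q7 q9
  rw [← e3] at q5 q6 q7 q8 q9
  rw [hA, hB, hD, hE, hG] at q1 q2 q3 q4 q5 q6 q7 q8 q9
  refine ⟨?_, ?_, ?_, ?_, ?_, ?_, ?_, ?_, ?_⟩ <;> apply c6
  · linear_combination q1
  · linear_combination 3 * q2
  · linear_combination 3 * q3
  · linear_combination q4
  · linear_combination 3 * q5
  · linear_combination 6 * q6
  · linear_combination 3 * q7
  · linear_combination 3 * q8
  · linear_combination 3 * q9

end lay
section bad1
variable {k R : Type} [Field k] [CharZero k] [CommRing R] [IsDomain R] [Algebra k R] {C : Cub k}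
  {ρ : R →ₐ[k] k}
  {fo fb fw fu ft Lo Lb Pw Pu : Vec R} {y0 f1 a0 y1 g1 a1 z t2 c3 t3 : R}

theorem Lay.bad1a (hP : IsPlace ρ)
    (h : C.Lay ρ fo fb fw fu ft Lo Lb Pw Pu y0 f1 a0 y1 g1 a1 z t2 c3 t3)
    {α β γ : R} (hd : C.DblE Lo Lb Pw α β γ) :
    ∃ x φ ψ z' t2' : R, ρ x = 0 ∧ f1 = x ^ 2 * φ ∧ ρ φ = 1 ∧ g1 = x * ψ ∧ ρ ψ = 2 ∧
      z = x ^ 5 * z' ∧ t2 = x ^ 5 * t2' := by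
  obtain ⟨noo, nob, nbb, now, nbw, nww, hE⟩ := h.Em
  obtain ⟨d1, d2, d3, d4, d5, d6⟩ := hd
  obtain ⟨s1, s2, s3, s4, s5, s6, s7, s8, s9⟩ := shift_T h.line y0 y1 d1 (B := 2 * (α * β))
    (by linear_combination 2 * d2) d3 d4 d5 d6
  have E1 := hE.E1; have E2 := hE.E2; have E3 := hE.E3; have E4 := hE.E4; have E5 := hE.E5
  have E6 := hE.E6; have E7 := hE.E7; have E8 := hE.E8; have E9 := hE.E9; have E10 := hE.E10
  rw [s1] at E1; rw [s2] at E2; rw [s3] at E3; rw [s4] at E4; rw [s5] at E5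
  rw [s6] at E6; rw [s7] at E7; rw [s8] at E8; rw [s9] at E9; rw [d6] at E10
  have zf := h.f1'; have zg := h.g1'; have zz := h.z'; have z0 := h.y0'; have z1 := h.y1'
  have za := h.a0'; have zb := h.a1'; have zt := h.t2'
  have rb : ρ (β + γ * y1) ≠ 0 := by
    intro h0
    have := congrArg ρ E7
    have e : β ^ 2 + y1 * (2 * β * γ) + y1 ^ 2 * γ ^ 2 + y1 * (2 * β * γ + 2 * y1 * γ ^ 2) =
      (β + γ * y1) ^ 2 + 2 * y1 * γ * (β + γ * y1) := by ring
    rw [e] at this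
    simp [h0, zg, z1, zz, zb, zt] at this
  have rc : ρ γ = 0 := by
    have := congrArg ρ E10
    simpa [zz, zt] using this
  have ra : ρ (α + γ * y0) = 0 := by
    have := congrArg ρ E5
    simpa [zz, zt, za, zf, z0, rc] using this
  obtain ⟨v, hv⟩ := hP.inv rb
  obtain ⟨ω, σ0, σ1, σ2, h0, h1, h2, hσ⟩ := hP.gcd3 (a0 + y0 * t2) (a1 + y1 * t2) t2
  have hω : ρ ω = 0 := by
    rcases hσ with rfl | rfl | rfl
    · rw [mul_one] at h0; rw [← h0]; simp [za, zt]
    · rw [mul_one] at h1; rw [← h1]; simp [zb, zt]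
    · rw [mul_one] at h2; rw [← h2]; simp [zt]
  have rn : ρ noo ≠ 0 := by rw [hE.roo]; simpa using h.hoo
  have rw' : ρ nww ≠ 0 := by rw [hE.rww]; simpa using h.hww
  rw [h0, h1] at E2 E3 E6
  rw [h0] at E1 E5 E8
  rw [h1] at E4 E7 E9
  rw [h2] at E5 E6 E7 E8 E9 E10
  have j1 : (β + γ * y1) * (v * (α + γ * y0)) = α + γ * y0 := by linear_combination (α + γ * y0) * hv
  have j2 : (β + γ * y1) * (v * γ) = γ := by linear_combination γ * hv
  generalize hx : v * (α + γ * y0) = x at *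
  generalize hx2 : v * γ = x2 at *
  generalize hb : β + γ * y1 = b at *
  have hβ : β = b - b * x2 * y1 := by rw [j2]; linear_combination hb
  have hα : α = b * x - b * x2 * y0 := by rw [j2]; linear_combination -j1
  rw [← j2] at E1 E2 E3 E4 E5 E6 E7 E8 E9
  rw [hα] at E1 E2 E3 E5 E6 E8
  rw [hβ] at E2 E3 E4 E6 E7 E9
  rw [← j2] at E10
  obtain ⟨W, p', q', z', eω, ep, rp, eq, rq, ez⟩ := bad1_Em hP (K := b ^ 2) (y0 := y0) (y1 := y1) (x := x)
    (x2 := x2) (p := -f1 + z * y0) (q := -g1 + z * y1) (z := z) (ω := ω) (s0 := σ0) (s1 := σ1) (s2 := σ2)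
    (a := noo) (a' := noo) (a1 := nww) (A := nob)
    (B3 := σ0 * nbb + σ1 * nob) (B4 := σ1 * nbb) (B5 := σ0 * now + σ2 * noo)
    (B6 := σ0 * nbw + σ1 * now + σ2 * nob) (B7 := σ1 * nbw + σ2 * nbb)
    (B8 := σ0 * nww + σ2 * now) (B9 := σ1 * nww + σ2 * nbw)
    (by simp [zf, zz]) (by simp [zg, zz]) zz (by rw [← hx]; simp [ra]) (by rw [← hx2]; simp [rc])
    z0 z1 hω rn rn rw' (by rcases hσ with rfl | rfl | rfl <;> simp)
    (by linear_combination -E1) (by linear_combination -E2) (by linear_combination -E3)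
    (by linear_combination -E4) (by linear_combination -E5) (by linear_combination -E6)
    (by linear_combination -E7) (by linear_combination -E8) (by linear_combination -E9)
    (by linear_combination -E10)
  have rx : ρ x = 0 := by rw [← hx]; simp [ra]
  refine ⟨x, -p' + x ^ 3 * z' * y0, -q' + x ^ 4 * z' * y1, z', W * σ2, rx, ?_, ?_, ?_, ?_, ez, ?_⟩
  · linear_combination -ep + y0 * ez
  · simp [rp, z0]
  · linear_combination -eq + y1 * ez
  · simp [rq, z1]
  · rw [h2, eω]; ring


theorem Lay.Un (h : C.Lay ρ fo fb fw fu ft Lo Lb Pw Pu y0 f1 a0 y1 g1 a1 z t2 c3 t3)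
    {A B D E G H moo mob mbb muo mub : R}
    (hA : 3 * C.T Lo Lo Pu = A) (hB : 6 * C.T Lo Lb Pu = B) (hD : 3 * C.T Lb Lb Pu = D)
    (hE : 3 * C.T Lo Pu Pu = E) (hG : 3 * C.T Lb Pu Pu = G) (hH : C.T Pu Pu Pu = H)
    (m1 : A + (-f1) * E + (-f1) ^ 2 * H = moo)
    (m2 : B + (-f1) * G + (-g1) * E + 2 * (-f1) * (-g1) * H = mob)
    (m3 : D + (-g1) * G + (-g1) ^ 2 * H = mbb)
    (m4 : E + 2 * (-f1) * H = muo) (m5 : G + 2 * (-g1) * H = mub) :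
    ∃ noo nob nbb nuo nub nuu : R, ρ noo ≠ 0 ∧ 1 + t3 * nuu = H ∧
      -c3 + (t3 * nuo + (a0 - f1 * t3) * nuu) = muo + (-f1) * H ∧
      t3 * nub + (a1 - g1 * t3) * nuu = mub + (-g1) * H ∧
      -(y0 - f1 * c3) + ((a0 - f1 * t3) * nuo + t3 * noo) = moo + (-f1) * muo ∧
      -(y1 - g1 * c3) + ((a0 - f1 * t3) * nub + (a1 - g1 * t3) * nuo + t3 * nob) =
        mob + (-f1) * mub + (-g1) * muo ∧
      -c3 + ((a1 - g1 * t3) * nub + t3 * nbb) = mbb + (-g1) * mub ∧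
      (a0 - f1 * t3) * noo = (-f1) * moo ∧
      (a0 - f1 * t3) * nob + (a1 - g1 * t3) * noo = (-g1) * moo + (-f1) * mob ∧
      -(y0 - f1 * c3) + ((a0 - f1 * t3) * nbb + (a1 - g1 * t3) * nob) =
        (-f1) * mbb + (-g1) * mob ∧
      -(y1 - g1 * c3) + (a1 - g1 * t3) * nbb = (-g1) * mbb := by
  obtain ⟨noo, nob, nbb, nuo, nub, nuu, hU⟩ := h.En
  obtain ⟨s1, s2, s3, s4, s5, s6, s7, s8, s9⟩ := shift_T h.line (-f1) (-g1) hA hB hD hE hG hH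
  rw [m1] at s1 s2 s5
  rw [m2] at s2 s3 s6
  rw [m3] at s3 s4 s7
  rw [m4] at s5 s6 s8
  rw [m5] at s6 s7 s9
  refine ⟨noo, nob, nbb, nuo, nub, nuu, by rw [hU.roo]; simpa using h.hoo, ?_, ?_, ?_, ?_, ?_, ?_,
    ?_, ?_, ?_, ?_⟩
  · rw [← hH]; exact hU.U1.symm
  · rw [← s8, C.T_swap12, C.T_swap23]; exact hU.U2.symm
  · rw [← s9, C.T_swap12, C.T_swap23]; exact hU.U3.symm
  · rw [← s5, C.T_swap23, C.T_swap12]; exact hU.U4.symm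
  · rw [← s6, C.T_swap23, C.T_swap12]; exact hU.U5.symm
  · rw [← s7, C.T_swap23, C.T_swap12]; exact hU.U6.symm
  · rw [← s1]; exact hU.U7.symm
  · rw [← s2]; exact hU.U8.symm
  · rw [← s3]; exact hU.U9.symm
  · rw [← s4]; exact hU.U10.symm

theorem Lay.bad1 (hP : IsPlace ρ)
    (h : C.Lay ρ fo fb fw fu ft Lo Lb Pw Pu y0 f1 a0 y1 g1 a1 z t2 c3 t3)
    {α β γ : R} (hd : C.DblE Lo Lb Pw α β γ) {c : Vec R} {cx cy η : R}
    (hc : c = cx • Lo + cy • Lb + η • Pu) (hη : η ≠ 0) (hprim : ρ cx ≠ 0 ∨ ρ cy ≠ 0 ∨ ρ η ≠ 0)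
    (k1 : C.T c c Lo = 0) (k2 : C.T c c Lb = 0) (k3 : C.T c c Pu = 0) (k4 : C.T c c Pw = 0) :
    C.EE Lo Lb c ∣ η ^ 5 := by
  obtain ⟨h2, hh2, -⟩ := half_exists k (R := R)
  obtain ⟨x, φ, ψ, z', t2', rx, ef, rφ, eg, rψ, ez, et⟩ := h.bad1a hP hd
  obtain ⟨r1, r2, r3, t, hEE, ht, -⟩ := rows hP h.line hc hη hprim k1 k2 k3
  have zf := h.f1'; have zg := h.g1'; have zz := h.z'; have z0 := h.y0'; have z1 := h.y1'
  have za := h.a0'; have zb := h.a1'; have zt := h.t2'; have zc := h.c3'; have zt3 := h.t3'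
  -- the equation from `Pw`
  have V0 : ∃ N1 N2 : R, cy ^ 2 + cx * (η + f1 * cx + g1 * cy) =
      3 * (η + f1 * cx + g1 * cy) ^ 2 * z - cx * (cx * y0 + cy * y1 + η * c3) * z
        - (cx * a0 + cy * a1 + η * t3) * N1 - h2 * t2 * N2 := by
    have e1 : c = cmb fo fb fw fu ft ![cx, cy, -(cx * y0 + cy * y1 + η * c3),
        η + f1 * cx + g1 * cy, cx * a0 + cy * a1 + η * t3] := by
      rw [hc, h.hLo, h.hLb, h.hPu, cmb]; simp; module
    have e2 : Pw = cmb fo fb fw fu ft ![0, 0, 1, -z, t2] := by rw [h.hPw, cmb]; simp; module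
    have := h.nf.T5 ft ![cx, cy, -(cx * y0 + cy * y1 + η * c3), η + f1 * cx + g1 * cy,
      cx * a0 + cy * a1 + η * t3] ![cx, cy, -(cx * y0 + cy * y1 + η * c3), η + f1 * cx + g1 * cy,
      cx * a0 + cy * a1 + η * t3] ![0, 0, 1, -z, t2]
    rw [← e1, ← e2, k4] at this
    generalize C.nn fo fb fw fu ft _ ![0, 0, 1, -z, t2] = N1 at this
    generalize C.nn fo fb fw fu ft _ _ = N2 at this
    simp at this
    refine ⟨N1, N2, ?_⟩
    linear_combination (-h2) * this - (cy ^ 2 + cx * (η + f1 * cx + g1 * cy) - 3 * (η + f1 * cx + g1 * cy) ^ 2 * z + cx * (cx * y0 + cy * y1 + η * c3) * z + (cx * a0 + cy * a1 + η * t3) * N1) * hh2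
  obtain ⟨N1, N2, V0⟩ := V0
  clear k1 k2 k3 k4 hd
  obtain ⟨noo, nob, nbb, nuo, nub, nuu, rn, U1, U2, U3, U4, U5, U6, U7, U8, U9, U10⟩ :=
    h.Un (f1 := f1) (g1 := g1) rfl rfl rfl rfl rfl rfl rfl rfl rfl rfl rfl
  generalize 3 * C.T Lo Lo Pu = A at *
  generalize 6 * C.T Lo Lb Pu = B at *
  generalize 3 * C.T Lb Lb Pu = D at *
  generalize 3 * C.T Lo Pu Pu = E at *
  generalize 3 * C.T Lb Pu Pu = G at *
  generalize C.T Pu Pu Pu = H at *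
  have rH : ρ H = 1 := by rw [← U1]; simp [zt3]
  have rE : ρ E = 0 := by have := congrArg ρ U2; simpa [zc, zt3, za, zf] using this.symm
  have rG : ρ G = 0 := by have := congrArg ρ U3; simpa [zc, zt3, zb, zg] using this.symm
  have rη : ρ η = 0 := by have := congrArg ρ r3; simpa [rH, rE, rG, rho2] using this
  have rcy : ρ cy = 0 := by
    have := congrArg ρ V0; simpa [rη, zf, zg, zz, za, zb, zt3, zt] using this
  have rcx : ρ cx ≠ 0 := by simpa [rη, rcy] using hprim
  obtain ⟨v, hv⟩ := hP.inv rcx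
  obtain ⟨g, s0, s1, s3, e0, e1, e3, hs⟩ := hP.gcd3 (a0 - f1 * t3) (a1 - g1 * t3) t3
  have rg : ρ g = 0 := by
    rcases hs with rfl | rfl | rfl
    · rw [mul_one] at e0; rw [← e0]; simp [za, zf]
    · rw [mul_one] at e1; rw [← e1]; simp [zb, zg]
    · rw [mul_one] at e3; rw [← e3]; simp [zt3]
  have hs' : ρ s0 ≠ 0 ∨ ρ s1 ≠ 0 ∨ ρ s3 ≠ 0 := by rcases hs with rfl | rfl | rfl <;> simp
  obtain ⟨X, hX⟩ : ∃ X, X = cy * v := ⟨_, rfl⟩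
  obtain ⟨u, hu⟩ : ∃ u, u = (η + f1 * cx + g1 * cy) * v := ⟨_, rfl⟩
  obtain ⟨m1, hm1⟩ : ∃ m, A + (-f1) * E + (-f1) ^ 2 * H = m := ⟨_, rfl⟩
  obtain ⟨m2, hm2⟩ : ∃ m, B + (-f1) * G + (-g1) * E + 2 * (-f1) * (-g1) * H = m := ⟨_, rfl⟩
  obtain ⟨m3, hm3⟩ : ∃ m, D + (-g1) * G + (-g1) ^ 2 * H = m := ⟨_, rfl⟩
  obtain ⟨m4, hm4⟩ : ∃ m, E + 2 * (-f1) * H = m := ⟨_, rfl⟩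
  obtain ⟨m5, hm5⟩ : ∃ m, G + 2 * (-g1) * H = m := ⟨_, rfl⟩
  rw [hm4] at U2 U4 U5
  rw [hm5] at U3 U5 U6
  rw [hm1] at U4 U7 U8
  rw [hm2] at U5 U8 U9
  rw [hm3] at U6 U9 U10
  rw [e0] at U2 U4 U5 U7 U8 U9
  rw [e1] at U3 U5 U6 U8 U9 U10
  rw [e3] at U1 U2 U3 U4 U5 U6
  have ru : ρ u = 0 := by rw [hu]; simp [rη, zf, zg]
  have V : X ^ 2 + u = g * (-(s0 + s1 * X + s3 * u) * v * N1) +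
      x ^ 5 * (3 * u ^ 2 * z' - v * (cx * y0 + cy * y1 + η * c3) * z' - h2 * t2' * v ^ 2 * N2) := by
    have q : (s0 + s1 * X + s3 * u) * g = (cx * a0 + cy * a1 + η * t3) * v := by
      rw [hX, hu]
      linear_combination (-1:R) * e0 - cy * v * e1 - (η + f1 * cx + g1 * cy) * v * e3 - (a0 - f1 * t3) * hv
    rw [ez, et] at V0
    have q2 : v ^ 2 * (cy ^ 2 + cx * (η + f1 * cx + g1 * cy)) = X ^ 2 + u := by
      rw [hX, hu]; linear_combination (v * (η + f1 * cx + g1 * cy)) * hv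
    rw [← q2, V0]
    have q3 : u ^ 2 = (η + f1 * cx + g1 * cy) ^ 2 * v ^ 2 := by rw [hu]; ring
    rw [q3]
    linear_combination (v * N1) * q - v * (cx * y0 + cy * y1 + η * c3) * x ^ 5 * z' * hv
  have K1 : 2 * m1 + m2 * X + m4 * u = 0 := by
    rw [← hm1, ← hm2, ← hm4, hX, hu]
    linear_combination v * (r1 - f1 * r3) - 2 * (A - f1 * E + f1 ^ 2 * H) * hv + (E - 2 * f1 * H) * f1 * hv - E * f1 * hv + (2 * f1 ^ 2 * H) * hv
  have K2 : m2 + 2 * m3 * X + m5 * u = 0 := by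
    rw [← hm2, ← hm3, ← hm5, hX, hu]
    linear_combination v * (r2 - g1 * r3) - (B - g1 * E - f1 * G + 2 * f1 * g1 * H) * hv
  have K3 : m4 + m5 * X + 2 * H * u = 0 := by
    rw [← hm4, ← hm5, hX, hu]
    linear_combination v * r3 - E * hv + 2 * H * f1 * hv
  have hη' : η = cx * (u - f1 - g1 * X) := by rw [hu, hX]; linear_combination (-η - f1 * cx) * hv
  generalize -(s0 + s1 * X + s3 * u) * v * N1 = BV at V
  generalize 3 * u ^ 2 * z' - v * (cx * y0 + cy * y1 + η * c3) * z' - h2 * t2' * v ^ 2 * N2 = BW at V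
  obtain ⟨y, ξ, Ξ, ex, eX, hξ⟩ := hP.gcd2 x X
  by_cases hy : y = 0
  · exfalso
    rw [hy, zero_mul] at ex eX
    have f0 : f1 = 0 := by rw [ef, ex]; ring
    have g0 : g1 = 0 := by rw [eg, ex]; ring
    rw [f0, g0, eX] at hη'
    rw [eX, ex] at V
    rw [eX] at K1 K3
    rw [f0] at U4 U7 U8 U9
    rw [g0] at U8 U9
    have hu0 : u ≠ 0 := by rintro rfl; apply hη; rw [hη']; ring
    have hg0 : g ≠ 0 := by rintro rfl; apply hu0; linear_combination V
    have hn0 : noo ≠ 0 := by rintro rfl; simp at rn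
    have w0 : s0 = 0 := by
      have : g * s0 * noo = 0 := by rw [U7]; ring
      simpa [hg0, hn0] using this
    have w1 : s1 = 0 := by
      have : g * s1 * noo = 0 := by linear_combination U8 - g * nob * w0
      simpa [hg0, hn0] using this
    have w : s3 * noo = H * g * BV ^ 2 := by
      apply mul_left_cancel₀ hg0
      have hm : (2:R) * (g * (s3 * noo)) = 2 * (g * (H * g * BV ^ 2)) := by
        linear_combination 2 * U4 - 2 * U9 - 2 * g * nuo * w0 + 2 * g * nbb * w0 + 2 * g * nob * w1 + K1 - u * K3 + 2 * H * (u + g * BV) * V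
      linear_combination h2 * hm - (g * (s3 * noo) - g * (H * g * BV ^ 2)) * hh2
    have := congrArg ρ w
    simp [rg, rn] at this
    rw [w0, w1, this] at hs'
    simp at hs'
  · have ry : ρ y = 0 := by
      rcases hξ with rfl | rfl
      · rw [mul_one] at ex; rw [← ex, rx]
      · rw [mul_one] at eX; rw [← eX, hX]; simp [rcy]
    obtain ⟨w1, w2⟩ := bad1_En hP (muu := H) (muo := m4) (mub := m5) (moo := m1) (mob := m2) (mbb := m3)
      (a := noo) (a4 := noo) (a8 := noo) (A4 := nuo) (B4 := 0) (A8 := nob) (A9 := nbb) (B9 := nob)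
      (B1 := s3 * nuu) (B2 := s3 * nuo + s0 * nuu) (B3 := s3 * nub + s1 * nuu)
      (B5 := s0 * nub + s1 * nuo + s3 * nob) (B6 := s1 * nub + s3 * nbb) (B10 := s1 * nbb)
      (c0 := y0 - f1 * c3) (c1 := y1 - g1 * c3) (c3 := c3)
      hy ry ex eX (by rcases hξ with rfl | rfl <;> simp) ef rφ eg rψ rg ru rn rn rn hs'
      (by linear_combination U1) (by linear_combination U2) (by linear_combination U3)
      (by linear_combination U4) (by linear_combination U5) (by linear_combination U6)
      (by linear_combination U7) (by linear_combination U8) (by linear_combination U9)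
      (by linear_combination U10) K1 K2 K3 V
    have q1 : 4 * m3 * H - m5 ^ 2 = t * cx ^ 2 := by rw [← hm3, ← hm5]; linear_combination ht
    rw [q1] at w1
    have q2 : y ^ 2 ∣ u - f1 - g1 * X := by
      refine dvd_sub (dvd_sub w2 ?_) ?_
      · exact ⟨ξ ^ 2 * φ, by rw [ef, ex]; ring⟩
      · exact ⟨ξ * ψ * Ξ, by rw [eg, ex, eX]; ring⟩
    have q3 : t ∣ η := by
      rw [hη']
      exact ((Dvd.intro _ rfl).trans (w1.trans q2)).trans (dvd_mul_left _ _)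
    calc C.EE Lo Lb c ∣ 36 * C.EE Lo Lb c := dvd_mul_left _ _
      _ = η ^ 4 * t := hEE
      _ ∣ η ^ 4 * η := mul_dvd_mul_left _ q3
      _ = η ^ 5 := by ring


theorem Lay.bad2_delta (h : C.Lay ρ fo fb fw fu ft Lo Lb Pw Pu y0 f1 a0 y1 g1 a1 z t2 c3 t3)
    {α β γ A B ι : R} (hA : α = γ * A) (hB : β = γ * B) (d1 : ι ∣ f1 - A) (d2 : ι ∣ (g1 - B) ^ 2)
    (d3 : ι ∣ y0 - f1 * c3) (d4 : ι ∣ y1 - g1 * c3) (d5 : ι ∣ c3) (d6 : ι ∣ a0 - f1 * t3)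
    (d7 : ι ∣ a1 - g1 * t3) (d8 : ι ∣ t3) (d9 : ι ∣ t2) :
    ι ∣ C.EE (γ • Lo - α • Pu) (γ • Lb - β • Pu) Pw := by
  obtain ⟨h2, hh2, h6, hh6⟩ := half_exists k (R := R)
  have e1 : γ • Lo - α • Pu = γ • cmb fo fb fw fu ft ![1, 0, -(y0 - A * c3), f1 - A, a0 - A * t3] := by
    rw [h.hLo, h.hPu, cmb, hA]; simp; module
  have e2 : γ • Lb - β • Pu = γ • cmb fo fb fw fu ft ![0, 1, -(y1 - B * c3), g1 - B, a1 - B * t3] := by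
    rw [h.hLb, h.hPu, cmb, hB]; simp; module
  have e3 : Pw = cmb fo fb fw fu ft ![0, 0, 1, -z, t2] := by rw [h.hPw, cmb]; simp; module
  have q1 := h.nf.T5 ft ![1, 0, -(y0 - A * c3), f1 - A, a0 - A * t3]
    ![1, 0, -(y0 - A * c3), f1 - A, a0 - A * t3] ![0, 0, 1, -z, t2]
  have q2 := h.nf.T5 ft ![1, 0, -(y0 - A * c3), f1 - A, a0 - A * t3]
    ![0, 1, -(y1 - B * c3), g1 - B, a1 - B * t3] ![0, 0, 1, -z, t2]
  rw [EE, e1, e2, e3]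
  simp only [T_smul1, T_smul2]
  generalize C.T (cmb fo fb fw fu ft ![1, 0, -(y0 - A * c3), f1 - A, a0 - A * t3])
    (cmb fo fb fw fu ft ![1, 0, -(y0 - A * c3), f1 - A, a0 - A * t3])
    (cmb fo fb fw fu ft ![0, 0, 1, -z, t2]) = T1 at *
  generalize C.T (cmb fo fb fw fu ft ![1, 0, -(y0 - A * c3), f1 - A, a0 - A * t3])
    (cmb fo fb fw fu ft ![0, 1, -(y1 - B * c3), g1 - B, a1 - B * t3])
    (cmb fo fb fw fu ft ![0, 0, 1, -z, t2]) = T2 at *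
  generalize C.T (cmb fo fb fw fu ft ![0, 1, -(y1 - B * c3), g1 - B, a1 - B * t3]) _ _ = T3
  generalize C.nn fo fb fw fu ft _ _ = N1 at q1
  generalize C.nn fo fb fw fu ft _ _ = N2 at q1
  generalize C.nn fo fb fw fu ft _ _ = N3 at q1
  generalize C.nn fo fb fw fu ft _ _ = N4 at q2
  generalize C.nn fo fb fw fu ft _ _ = N5 at q2
  generalize C.nn fo fb fw fu ft _ _ = N6 at q2
  simp at q1 q2
  obtain ⟨d1, w1⟩ := d1
  obtain ⟨d2, w2⟩ := d2
  obtain ⟨d3, w3⟩ := d3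
  obtain ⟨d4, w4⟩ := d4
  obtain ⟨d5, w5⟩ := d5
  obtain ⟨d6, w6⟩ := d6
  obtain ⟨d7, w7⟩ := d7
  obtain ⟨d8, w8⟩ := d8
  obtain ⟨d9, w9⟩ := d9
  have x1 : y0 - A * c3 = ι * (d3 + d1 * c3) := by linear_combination w3 + c3 * w1
  have x2 : y1 - B * c3 = ι * (d4 + d5 * (g1 - B)) := by linear_combination w4 + (g1 - B) * w5
  have x3 : a0 - A * t3 = ι * (d6 + d1 * t3) := by linear_combination w6 + t3 * w1
  have x4 : a1 - B * t3 = ι * (d7 + d8 * (g1 - B)) := by linear_combination w7 + (g1 - B) * w8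
  have r1 : ι ∣ T1 := by
    refine ⟨h6 * (-6 * d1 * (f1 - A) * z + 2 * (d3 + d1 * c3) * z + 2 * d1 + (d6 + d1 * t3) * (N1 + N1) +
      d9 * N2), ?_⟩
    linear_combination h6 * q1 - T1 * hh6 + h6 * (-6 * (f1 - A) * z * w1 + 2 * z * x1 + 2 * w1 + 2 * N1 * x3 + N2 * w9)
  have r2 : ι ∣ T2 ^ 2 := by
    obtain ⟨M, hM⟩ : ∃ M, T2 = h6 * (ι * M + (g1 - B)) := by
      refine ⟨-6 * d1 * (g1 - B) * z + (d4 + d5 * (g1 - B)) * z + (d6 + d1 * t3) * N4 +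
        (d7 + d8 * (g1 - B)) * N5 + d9 * N6, ?_⟩
      linear_combination h6 * q2 - T2 * hh6 + h6 * (-6 * (g1 - B) * z * w1 + z * x2 + N4 * x3 + N5 * x4 + N6 * w9)
    refine ⟨h6 ^ 2 * (ι * M ^ 2 + 2 * M * (g1 - B) + d2), ?_⟩
    rw [hM]; linear_combination h6 ^ 2 * w2
  have : γ * (γ * T1) * (γ * (γ * T3)) - (γ * (γ * T2)) ^ 2 = T1 * (γ ^ 4 * T3) - T2 ^ 2 * γ ^ 4 := by ring
  rw [this]
  exact dvd_sub (r1.mul_right _) (r2.mul_right _)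

theorem Lay.bad2 (hP : IsPlace ρ)
    (h : C.Lay ρ fo fb fw fu ft Lo Lb Pw Pu y0 f1 a0 y1 g1 a1 z t2 c3 t3)
    {α β γ : R} (hd : C.DblE Lo Lb Pu α β γ) {c : Vec R} {co cb η : R}
    (hc : c = co • Lo + cb • Lb + η • Pw) (hη : η ≠ 0) (hprim : ρ co ≠ 0 ∨ ρ cb ≠ 0 ∨ ρ η ≠ 0)
    (k1 : C.T c c Lo = 0) (k2 : C.T c c Lb = 0) (k3 : C.T c c Pw = 0) :
    C.EE Lo Lb c ∣ η ^ 5 * C.EE (γ • Lo - α • Pu) (γ • Lb - β • Pu) Pw := by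
  obtain ⟨r1, r2, r3, t, hEE, i1, i2, i3, i4, i5, i6⟩ := rows hP h.line hc hη hprim k1 k2 k3
  have zf := h.f1'; have zg := h.g1'; have zz := h.z'; have z0 := h.y0'; have z1 := h.y1'
  have za := h.a0'; have zb := h.a1'; have zt := h.t2'; have zc := h.c3'; have zt3 := h.t3'
  have hdel := fun A B ι => h.bad2_delta (α := α) (β := β) (γ := γ) (A := A) (B := B) (ι := ι)
  obtain ⟨noo, nob, nbb, now, nbw, nww, hE⟩ := h.Em
  have rn : ρ noo ≠ 0 := by rw [hE.roo]; simpa using h.hoo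
  have rn' : ρ nww ≠ 0 := by rw [hE.rww]; simpa using h.hww
  have E5 := hE.E5; have E6 := hE.E6; have E7 := hE.E7; have E8 := hE.E8; have E9 := hE.E9
  have E10 := hE.E10
  obtain ⟨-, -, -, -, s5, s6, s7, s8, s9⟩ := shift_T h.line (e := Pw) y0 y1 rfl rfl rfl rfl rfl rfl
  rw [s5] at E5; rw [s6] at E6; rw [s7] at E7; rw [s8] at E8; rw [s9] at E9
  obtain ⟨d1, d2, d3, d4, d5, d6⟩ := hd
  obtain ⟨loo, lob, lbb, luo, lub, luu, rl, U1, U2, U3, U4, U5, U6, U7, U8, U9, U10⟩ :=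
    h.Un (f1 := f1) (g1 := g1) d1 (B := 2 * (α * β)) (by linear_combination 2 * d2)
      d3 d4 d5 d6 rfl rfl rfl rfl rfl
  clear s5 s6 s7 s8 s9 d1 d2 d3 d4 d5 d6 k1 k2 k3 hE
  generalize 3 * C.T Lo Lo Pw = A at *
  generalize 6 * C.T Lo Lb Pw = B at *
  generalize 3 * C.T Lb Lb Pw = D at *
  generalize 3 * C.T Lo Pw Pw = E at *
  generalize 3 * C.T Lb Pw Pw = G at *
  generalize C.T Pw Pw Pw = H at *
  have rK : ρ γ ≠ 0 := by
    intro h0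
    have := congrArg ρ U1
    simp [h0, zt3] at this
  obtain ⟨v, hv⟩ := hP.inv rK
  obtain ⟨f2, hf2⟩ : ∃ f2, f2 = f1 - α * v := ⟨_, rfl⟩
  obtain ⟨g2, hg2⟩ : ∃ g2, g2 = g1 - β * v := ⟨_, rfl⟩
  have hα : α = γ * (f1 - f2) := by rw [hf2]; linear_combination (-α) * hv
  have hβ : β = γ * (g1 - g2) := by rw [hg2]; linear_combination (-β) * hv
  obtain ⟨g, s0, s1, s3, e0, e1, e3, hs⟩ := hP.gcd3 (a0 - f1 * t3) (a1 - g1 * t3) t3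
  have rg : ρ g = 0 := by
    rcases hs with rfl | rfl | rfl
    · rw [mul_one] at e0; rw [← e0]; simp [za, zf]
    · rw [mul_one] at e1; rw [← e1]; simp [zb, zg]
    · rw [mul_one] at e3; rw [← e3]; simp [zt3]
  have hs' : ρ s0 ≠ 0 ∨ ρ s1 ≠ 0 ∨ ρ s3 ≠ 0 := by rcases hs with rfl | rfl | rfl <;> simp
  specialize hdel (f1 - f2) (g1 - g2)
  rw [hα, hβ] at hdel
  rw [hα] at U2 U4 U5 U7 U8 U9
  rw [hβ] at U3 U5 U6 U8 U9 U10
  rw [e0] at U2 U4 U5 U7 U8 U9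
  rw [e1] at U3 U5 U6 U8 U9 U10
  rw [e3] at U1 U2 U3 U4 U5 U6
  obtain ⟨c0, hc0⟩ : ∃ c0, y0 - f1 * c3 = c0 := ⟨_, rfl⟩
  obtain ⟨c1, hc1⟩ : ∃ c1, y1 - g1 * c3 = c1 := ⟨_, rfl⟩
  rw [hc0] at U4 U9
  rw [hc1] at U5 U10
  have V1 : 1 + g * (s3 * luu) = γ ^ 2 := by linear_combination U1
  have V2 : -c3 + g * (s3 * luo + s0 * luu) = -γ ^ 2 * (2 * f2 + f1) := by linear_combination U2
  have V3 : g * (s3 * lub + s1 * luu) = -γ ^ 2 * (2 * g2 + g1) := by linear_combination U3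
  have V4 : -c0 + g * (s0 * luo + s1 * 0 + s3 * loo) = γ ^ 2 * (f2 ^ 2 + 2 * f1 * f2) := by
    linear_combination U4
  have V5 : -c1 + g * (s0 * lub + s1 * luo + s3 * lob) = γ ^ 2 * (2 * f2 * g2 + 2 * f1 * g2 + 2 * g1 * f2) := by
    linear_combination U5
  have V6 : -c3 + g * (s1 * lub + s3 * lbb) = γ ^ 2 * (g2 ^ 2 + 2 * g1 * g2) := by linear_combination U6
  have V7 : g * s0 * loo = - γ ^ 2 * (f1 * f2 ^ 2) := by linear_combination U7
  have V8 : g * (s0 * lob + s1 * loo) = - γ ^ 2 * (2 * f1 * f2 * g2 + g1 * f2 ^ 2) := by linear_combination U8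
  have V9 : -c0 + g * (s0 * lbb + s1 * lob) = - γ ^ 2 * (f1 * g2 ^ 2 + 2 * g1 * f2 * g2) := by
    linear_combination U9
  have V10 : -c1 + g * (s1 * lbb) = - γ ^ 2 * (g1 * g2 ^ 2) := by linear_combination U10
  clear U1 U2 U3 U4 U5 U6 U7 U8 U9 U10
  have rf2 : ρ f2 = 0 := by have := congrArg ρ V2; simpa [zc, rg, zf, rK, rho2] using this
  have rg2 : ρ g2 = 0 := by have := congrArg ρ V3; simpa [zc, rg, zg, rK, rho2] using this
  obtain ⟨n, hn⟩ := hP.inv (a := 1 - z * c3) (by simp [zz])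
  obtain ⟨tw, htw⟩ : ∃ tw, tw = (t2 + z * t3) * n := ⟨_, rfl⟩
  have ht2 : t2 = tw - z * (g * s3 + c3 * tw) := by
    rw [htw, ← e3]; linear_combination (-(t2 + z * t3)) * hn
  obtain ⟨ι, X, Y, Tt, x1, x2, x3, hX⟩ := hP.gcd3 f2 (g2 ^ 2) tw
  have rι : ρ ι = 0 := by
    rcases hX with rfl | rfl | rfl
    · rw [mul_one] at x1; rw [← x1, rf2]
    · rw [mul_one] at x2; rw [← x2]; simp [rg2]
    · rw [mul_one] at x3; rw [← x3, htw]; simp [zt, zz]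
  by_cases hι : ι = 0
  · have rl0 : loo ≠ 0 := by rintro rfl; simp at rl
    rw [hι, zero_mul] at x1 x2 x3
    have x2 : g2 = 0 := by simpa using x2
    rw [x1] at V4 V7 V8 V9
    rw [x2] at V6 V8 V9 V10
    have g0 : g * s0 = 0 := by
      have : g * s0 * loo = 0 := by linear_combination V7
      exact (mul_eq_zero.1 this).resolve_right rl0
    have g1' : g * s1 = 0 := by
      have : g * s1 * loo = 0 := by linear_combination V8 - lob * g0
      exact (mul_eq_zero.1 this).resolve_right rl0
    have w0 : c0 = 0 := by linear_combination -V9 + lbb * g0 + lob * g1'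
    have g3 : g * s3 = 0 := by
      have : g * s3 * loo = 0 := by linear_combination V4 - luo * g0 + w0
      exact (mul_eq_zero.1 this).resolve_right rl0
    have w3 : c3 = 0 := by linear_combination -V6 + lub * g1' + lbb * g3
    have w1 : c1 = 0 := by linear_combination -V10 + lbb * g1'
    have := hdel 0 rfl rfl (by simp [x1]) (by simp [x2]) (by rw [hc0, w0]) (by rw [hc1, w1]) (by rw [w3])
      (by rw [e0, g0]) (by rw [e1, g1']) (by rw [e3, g3]) (by rw [ht2, x3, g3]; simp)
    rw [hα, hβ, zero_dvd_iff.1 this, mul_zero]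
    exact dvd_zero _
  · obtain ⟨G', F1, G1, C0, C1, C3, w1, w2, w3, w4, w5, w6, w7⟩ := bad2_En hP hι rι x1 x2 rg rg2 rl rl rl hs'
      V1 V2 V3 V4 V5 V6 V7 V8 V9 V10
    have hdvd : ι ∣ C.EE (γ • Lo - (γ * (f1 - f2)) • Pu) (γ • Lb - (γ * (g1 - g2)) • Pu) Pw := by
      have j3 : ι ∣ c3 := ⟨3 * Y + ι * C3, by rw [w6]; linear_combination 3 * x2⟩
      have jw : ι ∣ tw := ⟨Tt, x3⟩
      have jg : ι ∣ g := ⟨ι * G', by rw [w1]; ring⟩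
      refine hdel ι rfl rfl ⟨X, by rw [← x1]; ring⟩ ⟨Y, by rw [← x2]; ring⟩ ?_ ?_ j3 ?_ ?_ ?_ ?_
      · rw [hc0, w4]; exact ⟨ι * C0, by ring⟩
      · rw [hc1, w5]; exact ⟨-2 * g2 * Y + ι * C1, by linear_combination -2 * g2 * x2⟩
      · rw [e0]; exact jg.mul_right _
      · rw [e1]; exact jg.mul_right _
      · rw [e3]; exact jg.mul_right _
      · rw [ht2]; exact dvd_sub jw (Dvd.dvd.mul_left (dvd_add (jg.mul_right _) (jw.mul_left _)) _)
    have K3 : (G + 2 * y1 * H) * (η - y0 * co - y1 * cb) + (B + y0 * G + y1 * E + 2 * y0 * y1 * H) * co +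
        2 * (D + y1 * G + y1 ^ 2 * H) * cb = 0 := by linear_combination r2 + y1 * r3
    have hcc : ρ co ≠ 0 ∨ ρ (η - y0 * co - y1 * cb) ≠ 0 := by
      by_contra hcon
      push Not at hcon
      have m := congrArg ρ E7
      have m' := congrArg ρ K3
      have rη : ρ η = 0 := by simpa [z0, z1] using hcon.2
      simp [zg, zz, z1, zb, zt] at m
      simp [hcon.1, rη, z1, z0, rho2] at m'
      rw [m] at m'
      simp at m'
      simp [hcon.1, rη, m'] at hprim
    have ht := bad2_Em hP (noo := noo) (nob := nob) (nbb := nbb) (now := now) (nbw := nbw) (nww := nww)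
      (moo := A + y0 * E + y0 ^ 2 * H) (mob := B + y0 * G + y1 * E + 2 * y0 * y1 * H)
      (mbb := D + y1 * G + y1 ^ 2 * H) (mwo := E + 2 * y0 * H) (mwb := G + 2 * y1 * H) (mww := H)
      (e := t) (co := co) (cb := cb) (cw := η - y0 * co - y1 * cb) (p := -f1 + z * y0) (q := -g1 + z * y1)
      (z := z) (y0 := y0) (y1 := y1) (s0 := s0) (s1 := s1) (s3 := s3)
      (t0 := a0 + y0 * t2) (t1 := a1 + y1 * t2) (t2 := t2)
      rι x1 x2 x3 (by rcases hX with rfl | rfl | rfl <;> simp) rg2 zz w1 w2 w3 w4 w5 w6 w7 rfl rfl rfl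
      (by rw [← hc0]; ring) (by rw [← hc1]; ring) rfl rfl
      (by linear_combination e0 + f1 * e3 + y0 * ht2 + tw * hc0)
      (by linear_combination e1 + g1 * e3 + y1 * ht2 + tw * hc1) ht2 rn rn'
      (by linear_combination -E5) (by linear_combination -E6)
      (by linear_combination -E7) (by linear_combination -E8) (by linear_combination -E9)
      (by linear_combination -E10)
      (by linear_combination r3) (by linear_combination r1 + y0 * r3) K3
      (by linear_combination i6 + y0 ^ 2 * i1 + y1 ^ 2 * i4 - 2 * y0 * i3 - 2 * y1 * i5 + 2 * y0 * y1 * i2)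
      (by linear_combination i1) hcc
    rw [hα, hβ]
    calc C.EE Lo Lb c ∣ 36 * C.EE Lo Lb c := dvd_mul_left _ _
      _ = η ^ 4 * t := hEE
      _ ∣ η ^ 4 * C.EE (γ • Lo - (γ * (f1 - f2)) • Pu) (γ • Lb - (γ * (g1 - g2)) • Pu) Pw :=
        mul_dvd_mul_left _ (ht.trans hdvd)
      _ ∣ _ := mul_dvd_mul_right ⟨η, by ring⟩ _

theorem elim1 (hP : IsPlace ρ) {f1 f2 f3 f4 f5 Lo Lb e : Vec R} {c3 c4 c5 d3 d4 d5 x1 x2 x3 x4 x5 : R}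
    (hLo : Lo = f1 + c3 • f3 + c4 • f4 + c5 • f5) (hLb : Lb = f2 + d3 • f3 + d4 • f4 + d5 • f5)
    (he : e = x1 • f1 + x2 • f2 + x3 • f3 + x4 • f4 + x5 • f5)
    (h3 : ρ c3 = 0) (h4 : ρ c4 = 0) (h5 : ρ c5 = 0) (g3 : ρ d3 = 0) (g4 : ρ d4 = 0) (g5 : ρ d5 = 0)
    (r3 : ρ x3 = 1) (r4 : ρ x4 = 0) (r5 : ρ x5 = 0) :
    ∃ v p q z t : R, ρ v ≠ 0 ∧ ρ z = 0 ∧ ρ t = 0 ∧ p • Lo + q • Lb + v • e = f3 + z • f4 + t • f5 := by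
  obtain ⟨v, hv, hv1⟩ := hP.inv_one (a := x3 - x1 * c3 - x2 * d3) (by simp [h3, g3, r3])
  refine ⟨v, -(v * x1), -(v * x2), v * (x4 - x1 * c4 - x2 * d4), v * (x5 - x1 * c5 - x2 * d5),
    by rw [hv1]; exact one_ne_zero, by simp [h4, g4, r4], by simp [h5, g5, r5], ?_⟩
  rw [hLo, hLb, he]
  calc _ = ((x3 - x1 * c3 - x2 * d3) * v) • f3 + (v * (x4 - x1 * c4 - x2 * d4)) • f4 +
      (v * (x5 - x1 * c5 - x2 * d5)) • f5 := by module
    _ = _ := by rw [hv, one_smul]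

theorem lay_exists (hP : IsPlace ρ) {o b e3 e4 : Vec R} (hl : C.OnLine o b)
    {x y z w a1 a2 b1 b2 s s' : k} {ft : Vec k} (hdet : x * w - y * z ≠ 0) (hs : s ≠ 0) (hs' : s' ≠ 0)
    (hn : C.NF (x • rs ρ o + y • rs ρ b) (z • rs ρ o + w • rs ρ b) (a1 • rs ρ o + a2 • rs ρ b + s • rs ρ e3)
      (b1 • rs ρ o + b2 • rs ρ b + s' • rs ρ e4))
    (hli : LinIndep k ![x • rs ρ o + y • rs ρ b, z • rs ρ o + w • rs ρ b,
      a1 • rs ρ o + a2 • rs ρ b + s • rs ρ e3, b1 • rs ρ o + b2 • rs ρ b + s' • rs ρ e4, ft])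
    (hoo : C.T (x • rs ρ o + y • rs ρ b) (x • rs ρ o + y • rs ρ b) ft ≠ 0)
    (hww : C.T (a1 • rs ρ o + a2 • rs ρ b + s • rs ρ e3) (a1 • rs ρ o + a2 • rs ρ b + s • rs ρ e3) ft ≠ 0) :
    ∃ X Y Z W U V S U' V' S' : R, ρ (X * W - Y * Z) ≠ 0 ∧ ρ S ≠ 0 ∧ ρ S' ≠ 0 ∧
      ∃ fo fb fw fu ft y0 f1 a0 y1 g1 a1 z t2 c3 t3, C.Lay ρ fo fb fw fu ft (X • o + Y • b) (Z • o + W • b)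
        (U • o + V • b + S • e3) (U' • o + V' • b + S' • e4) y0 f1 a0 y1 g1 a1 z t2 c3 t3 := by
  have hA : ∀ t : k, ρ (algMap k R t) = t := fun t => by simp
  generalize ho : x • rs ρ o + y • rs ρ b = fo at *
  generalize hb : z • rs ρ o + w • rs ρ b = fb at *
  generalize hw : a1 • rs ρ o + a2 • rs ρ b + s • rs ρ e3 = fw at *
  generalize hu : b1 • rs ρ o + b2 • rs ρ b + s' • rs ρ e4 = fu at *
  let m := algMap k R
  obtain ⟨n11, n12, n21, n22, c3, c4, c5, d3, d4, d5, r1, r2, r3, r4, r5, r6, q1, q2, q3, q4, E1, E2⟩ :=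
    ech2 hP hli (e1 := m x • o + m y • b) (e2 := m z • o + m w • b) (by simp only [rs_add, rs_smul, m, hA, ho])
    (by simp only [rs_add, rs_smul, m, hA, hb])
  obtain ⟨u1, u2, u3, u4, u5, hx⟩ := exists_coordR (R := R) hli (m a1 • o + m a2 • b + m s • e3)
  obtain ⟨-, -, i3, i4, i5⟩ := residues5 (ρ := ρ) (y1 := 0) (y2 := 0) (y3 := 1) (y4 := 0) (y5 := 0) hli
    (by rw [← hx]; simp only [rs_add, rs_smul, m, hA, hw]; module)
  obtain ⟨v1, v2, v3, v4, v5, hy⟩ := exists_coordR (R := R) hli (m b1 • o + m b2 • b + m s' • e4)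
  obtain ⟨-, -, j3, j4, j5⟩ := residues5 (ρ := ρ) (y1 := 0) (y2 := 0) (y3 := 0) (y4 := 1) (y5 := 0) hli
    (by rw [← hy]; simp only [rs_add, rs_smul, m, hA, hu]; module)
  obtain ⟨v, p, q, ζ, τ, hv, hζ, hτ, E3⟩ := elim1 hP E1 E2 hx r1 r2 r3 r4 r5 r6 i3 i4 i5
  obtain ⟨v', p', q', ζ', τ', hv', hζ', hτ', E4⟩ := elim1 hP (E1.trans (by module : _ = cst k R fo +
    c4 • cst k R fu + c3 • cst k R fw + c5 • cst k R ft)) (E2.trans (by module : _ = cst k R fb +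
    d4 • cst k R fu + d3 • cst k R fw + d5 • cst k R ft)) (hy.trans (by module : _ = v1 • cst k R fo +
    v2 • cst k R fb + v4 • cst k R fu + v3 • cst k R fw + v5 • cst k R ft)) r2 r1 r3 r5 r4 r6 j4 j3 j5
  have F1 : (n11 * m x + n12 * m z) • o + (n11 * m y + n12 * m w) • b =
    n11 • (m x • o + m y • b) + n12 • (m z • o + m w • b) := by module
  have F2 : (n21 * m x + n22 * m z) • o + (n21 * m y + n22 * m w) • b =
    n21 • (m x • o + m y • b) + n22 • (m z • o + m w • b) := by module
  refine ⟨n11 * m x + n12 * m z, n11 * m y + n12 * m w, n21 * m x + n22 * m z, n21 * m y + n22 * m w,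
    p * (n11 * m x + n12 * m z) + q * (n21 * m x + n22 * m z) + v * m a1,
    p * (n11 * m y + n12 * m w) + q * (n21 * m y + n22 * m w) + v * m a2, v * m s,
    p' * (n11 * m x + n12 * m z) + q' * (n21 * m x + n22 * m z) + v' * m b1,
    p' * (n11 * m y + n12 * m w) + q' * (n21 * m y + n22 * m w) + v' * m b2, v' * m s', ?_, ?_, ?_,
    cst k R fo, cst k R fb, cst k R fw, cst k R fu, cst k R ft, -c3, c4, c5, -d3, d4, d5, -ζ, τ, -ζ', τ', ?_⟩
  · simpa [m, q1, q2, q3, q4] using hdet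
  · simpa [m, hs] using hv
  · simpa [m, hs'] using hv'
  constructor
  · exact hn.map (Algebra.ofId k R)
  · rw [T_cst]; simpa using hoo
  · rw [T_cst]; simpa using hww
  · rw [F1, E1]; module
  · rw [F2, E2]; module
  · rw [neg_smul, sub_neg_eq_add, ← E3, ← F1, ← F2]; module
  · rw [neg_smul, sub_neg_eq_add, ← E4, ← F1, ← F2]; module
  · simp [r1]
  · exact r2
  · exact r3
  · simp [r4]
  · exact r5
  · exact r6
  · simp [hζ]
  · exact hτ
  · simp [hζ']
  · exact hτ'
  · exact hl.comb _ _ _ _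


theorem rebase (hP : IsPlace ρ) {o b e c : Vec R} {x y η X Y Z W U V S : R}
    (hc : c = x • o + y • b + η • e) (hη : η ≠ 0) (hp : ρ x ≠ 0 ∨ ρ y ≠ 0 ∨ ρ η ≠ 0)
    (hdet : ρ (X * W - Y * Z) ≠ 0) (hS : ρ S ≠ 0) :
    C.EE o b c ∣ C.EE (X • o + Y • b) (Z • o + W • b) c ∧ ∃ x' y' η', c = x' • (X • o + Y • b) +
      y' • (Z • o + W • b) + η' • (U • o + V • b + S • e) ∧ η' ≠ 0 ∧
      (ρ x' ≠ 0 ∨ ρ y' ≠ 0 ∨ ρ η' ≠ 0) ∧ η' ∣ η := by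
  obtain ⟨D, hD⟩ := hP.inv hdet
  obtain ⟨σ, hσ⟩ := hP.inv hS
  refine ⟨⟨(X * W - Y * Z) ^ 2, ?_⟩, D * (W * (x - η * σ * U) - Z * (y - η * σ * V)),
    D * (X * (y - η * σ * V) - Y * (x - η * σ * U)), η * σ, ?_, ?_, ?_, ?_⟩
  · simp only [EE, T_add1, T_smul1, T_add2, T_smul2, C.T_swap12 b o c]; ring
  · rw [hc]
    ext i
    simp only [Pi.add_apply, Pi.smul_apply, smul_eq_mul]
    linear_combination (-((x - η * σ * U) * o i + (y - η * σ * V) * b i)) * hD - (η * e i) * hσ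
  · intro h0
    exact hη (by linear_combination S * h0 - η * hσ)
  · by_contra! h
    obtain ⟨h1, h2, h3⟩ := h
    have e1 : η = S * (η * σ) := by linear_combination -η * hσ
    have e2 : x = X * (D * (W * (x - η * σ * U) - Z * (y - η * σ * V))) +
      Z * (D * (X * (y - η * σ * V) - Y * (x - η * σ * U))) + (η * σ) * U := by
      linear_combination (-(x - η * σ * U)) * hD
    have e3 : y = Y * (D * (W * (x - η * σ * U) - Z * (y - η * σ * V))) +
      W * (D * (X * (y - η * σ * V) - Y * (x - η * σ * U))) + (η * σ) * V := by
      linear_combination (-(y - η * σ * V)) * hD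
    rcases hp with h | h | h
    · exact h (by rw [e2, map_add, map_add, map_mul _ X, map_mul _ Z, map_mul _ (η * σ), h1, h2, h3]; ring)
    · exact h (by rw [e3, map_add, map_add, map_mul _ Y, map_mul _ W, map_mul _ (η * σ), h1, h2, h3]; ring)
    · exact h (by rw [e1, map_mul, h3]; ring)
  · exact ⟨S, by linear_combination -η * hσ⟩

variable [IsAlgClosed k]

theorem caseI (hC : C.SM) (hnc : ¬ C.Config) (hP : IsPlace ρ) (hsq : ∀ a : R, ∃ s, a = s ^ 2)
    {o b v e c : Vec R} (hli : LinIndep k ![rs ρ o, rs ρ b, rs ρ v, rs ρ e])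
    (hl : C.OnLine o b) {μ ν : R} (hd : C.DblE o b v 0 μ ν) (hμν : ρ μ ≠ 0 ∨ ρ ν ≠ 0) {x y η : R}
    (hc : c = x • o + y • b + η • e) (hη : η ≠ 0) (hp : ρ x ≠ 0 ∨ ρ y ≠ 0 ∨ ρ η ≠ 0)
    (c1 : C.T c c o = 0) (c2 : C.T c c b = 0) (c3 : C.T c c v = 0) (c4 : C.T c c e = 0) :
    C.EE o b c ∣ η ^ 5 * C.EE o (ν • b - μ • v) e := by
  obtain ⟨-, -, -, t, ht, A1, A2, A3, A4, A5, A6⟩ := rows hP hl hc hη hp c1 c2 c4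
  by_cases htu : ρ t ≠ 0
  · obtain ⟨τ, hτ⟩ := hP.inv htu
    exact Dvd.dvd.mul_right ⟨36 * τ * η, by linear_combination (-η * τ) * ht - η ^ 5 * hτ⟩ _
  have htz : ρ t = 0 := not_not.1 htu
  have hl' : C.OnLine (rs ρ o) (rs ρ b) := hl.map ρ
  have hd' : C.DblE (rs ρ o) (rs ρ b) (rs ρ v) 0 (ρ μ) (ρ ν) := by
    have := DblE.map C hd ρ; rw [map_zero] at this; exact this
  have three : (3:R) ≠ 0 := fun h => by
    have := congrArg ρ h; rw [rho3, map_zero] at this; exact three_ne_zero this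
  have D1 : C.T o o v = 0 := (mul_eq_zero.1 (by linear_combination hd.1 : 3 * C.T o o v = 0)).resolve_left three
  have D2 : C.T o b v = 0 := (mul_eq_zero.1 (by linear_combination hd.2.1 : 3 * C.T o b v = 0)).resolve_left three
  have D4 : C.T o v v = 0 := (mul_eq_zero.1 (by linear_combination hd.2.2.2.1 : 3 * C.T o v v = 0)).resolve_left three
  replace A1 := congrArg ρ A1
  replace A2 := congrArg ρ A2
  replace A3 := congrArg ρ A3
  replace A4 := congrArg ρ A4
  replace A5 := congrArg ρ A5
  replace A6 := congrArg ρ A6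
  have m6 : ρ 6 = 6 := map_ofNat ρ 6
  simp only [map_sub, map_mul, map_pow, htz, zero_mul, ← T_rs, rho2, rho3, m6] at A1 A2 A3 A4 A5 A6
  generalize ho : rs ρ o = o' at *
  generalize hb : rs ρ b = b' at *
  generalize hv : rs ρ v = v' at *
  generalize he : rs ρ e = e' at *
  obtain ⟨α, β, γ, B1, B2, B3, B4, B5, B6⟩ := sym_rank1 (a := 3 * C.T o' o' e') (b := 3 * C.T o' b' e')
    (c := 3 * C.T o' e' e' / 2) (d := 3 * C.T b' b' e') (e := 3 * C.T b' e' e' / 2) (f := C.T e' e' e')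
    (by linear_combination A6 / 4) (by linear_combination A4 / 4) (by linear_combination A1 / 4)
    (by linear_combination -A5 / 4) (by linear_combination -A3 / 4) (by linear_combination -A2 / 4)
  have hde : C.DblE o' b' e' α β γ := ⟨B1, B2, B4, by linear_combination 2 * B3,
    by linear_combination 2 * B5, B6⟩
  clear A1 A2 A3 A4 A5 A6
  have d1 : C.T o' o' v' = 0 := by linear_combination hd'.1 / 3
  have d2 : C.T o' b' v' = 0 := by linear_combination hd'.2.1 / 3
  have d3 : C.T b' b' v' = ρ μ ^ 2 / 3 := by linear_combination hd'.2.2.1 / 3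
  have d4 : C.T o' v' v' = 0 := by linear_combination hd'.2.2.2.1 / 3
  have d5 : C.T b' v' v' = 2 * ρ μ * ρ ν / 3 := by linear_combination hd'.2.2.2.2.1 / 3
  have d6 : C.T v' v' v' = ρ ν ^ 2 := hd'.2.2.2.2.2
  have lin : ∀ p q r : R, ∀ e, C.T c c e = 0 → C.T c c (p • o + q • b + r • e) = 0 := by
    intro p q r e he; simp only [T_add3, T_smul3, c1, c2, he]; ring
  have lin2 : ∀ p q : R, C.T c c (p • o + q • b) = 0 := by
    intro p q; simp only [T_add3, T_smul3, c1, c2]; ring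
  by_cases hαβ : α ≠ 0 ∨ β ≠ 0
  · by_cases hμ : ρ μ = 0
    · have hν := hμν.resolve_left (not_not.2 hμ)
      have hli2 : LinIndep k ![o', b', e', v'] := by
        refine li4_iff.2 fun p q r s h => ?_
        obtain ⟨h1, h2, h3, h4⟩ := li4_iff.1 hli p q s r (by rw [← h]; module)
        exact ⟨h1, h2, h4, h3⟩
      subst ho hb hv he
      obtain ⟨_, _, _, _, _, _, _, _, _, _, ft, h1, h2, h3, h4, h5, h6, h7⟩ := nf_field hC hnc hli2 hl' hαβ hde
        ⟨d1, d2, by rw [d3, hμ]; ring⟩ d4 (by rw [d5, hμ]; ring) (by rw [d6]; exact pow_ne_zero _ hν)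
      obtain ⟨X, Y, Z, W, U, V, S, U', V', S', i1, i2, i3, _, _, _, _, _, _, _, _, _, _, _, _, _, _, _, L⟩ :=
        lay_exists hP hl h1 h2 h3 h4 h5 h6 h7
      obtain ⟨s, rfl⟩ := hsq S'
      obtain ⟨j1, x', y', η', hc', hη', hp', j2⟩ := rebase (C := C) (U := U) (V := V) hP hc hη hp i1 i2
      have key := L.bad2 hP (hd.comb hl X Y Z W U' V' s) hc' hη' hp' (lin2 _ _) (lin2 _ _) (lin _ _ _ _ c4)
      refine j1.trans (key.trans (mul_dvd_mul (pow_dvd_pow_of_dvd j2 5) ?_))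
      have g5 : ∀ p q p' q' : R, C.EE (p • o + q • (ν • b - μ • v)) (p' • o + q' • (ν • b - μ • v))
          (U • o + V • b + S • e) = ((p * q' - q * p') * S) ^ 2 * C.EE o (ν • b - μ • v) e := by
        intro p q p' q'
        have g1 : C.T o o (U • o + V • b + S • e) = S * C.T o o e := by
          simp only [T_add3, T_smul3, hl.1, hl.2.1]; ring
        have g2 : C.T o (ν • b - μ • v) (U • o + V • b + S • e) = S * C.T o (ν • b - μ • v) e := by
          rw [T_add3, T_add3, T_smul3, T_smul3, T_smul3, C.T_swap23 o _ o, C.T_swap23 o _ b]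
          simp only [T_sub3, T_smul3, hl.2.1, hl.2.2.1, D1, D2]; ring
        have g3 : C.T (ν • b - μ • v) (ν • b - μ • v) (U • o + V • b + S • e) =
            S * C.T (ν • b - μ • v) (ν • b - μ • v) e := by
          have k1 : C.T (ν • b - μ • v) (ν • b - μ • v) o = 0 := by
            rw [T_swap23, T_swap12]
            simp only [T_sub2, T_sub3, T_smul2, T_smul3, hl.2.2.1, D2, D4, C.T_swap23 o v b]; ring
          have k2 : 3 * C.T (ν • b - μ • v) (ν • b - μ • v) b = 0 := by
            rw [T_swap23, T_swap12]
            simp only [T_sub2, T_sub3, T_smul2, T_smul3, hl.2.2.2, C.T_swap23 b v b]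
            linear_combination (-2 * ν * μ) * hd.2.2.1 + μ ^ 2 * hd.2.2.2.2.1
          have k3 := (mul_eq_zero.1 k2).resolve_left three
          rw [T_add3, T_add3, T_smul3, T_smul3, T_smul3, k1, k3]; ring
        generalize ν • b - μ • v = r at *
        simp only [EE, T_add1 C (_ • _), T_add2 C _ (_ • _), T_smul1, T_smul2, g1, g2, g3,
          C.T_swap12 r o]; ring
      have m1 : (s * (0 * U' + μ * V' + ν * s ^ 2)) • (X • o + Y • b) - (s * (0 * X + μ * Y)) •
          (U' • o + V' • b + s ^ 2 • v) = (s * ((μ * V' + ν * s ^ 2) * X - μ * Y * U')) • o +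
          (s * Y * s ^ 2) • (ν • b - μ • v) := by module
      have m2 : (s * (0 * U' + μ * V' + ν * s ^ 2)) • (Z • o + W • b) - (s * (0 * Z + μ * W)) •
          (U' • o + V' • b + s ^ 2 • v) = (s * ((μ * V' + ν * s ^ 2) * Z - μ * W * U')) • o +
          (s * W * s ^ 2) • (ν • b - μ • v) := by module
      rw [m1, m2, g5]
      have hs : ρ s ≠ 0 := fun h => i3 (by rw [map_pow, h]; ring)
      obtain ⟨τ, hτ⟩ := hP.inv (a := (s ^ 4 * (μ * V' + ν * s ^ 2) * (X * W - Y * Z) * S) ^ 2)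
        (by simpa [hμ, hs, hν, i2] using i1)
      exact ⟨τ, by linear_combination (-C.EE o (ν • b - μ • v) e) * hτ⟩
    · exact absurd ⟨o', b', v', e', hli, hl'.1, hl'.2.1, hl'.2.2.1, hl'.2.2.2,
        ⟨_, _, _, Or.inr hμ, hd'⟩, ⟨α, β, γ, hαβ, hde⟩⟩ hnc
  · push Not at hαβ
    obtain ⟨rfl, rfl⟩ := hαβ
    have b1 : C.T o' o' e' = 0 := by linear_combination hde.1 / 3
    have b2 : C.T o' b' e' = 0 := by linear_combination hde.2.1 / 3
    have b3 : C.T b' b' e' = 0 := by linear_combination hde.2.2.1 / 3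
    have b4 : C.T o' e' e' = 0 := by linear_combination hde.2.2.2.1 / 3
    have b5 : C.T b' e' e' = 0 := by linear_combination hde.2.2.2.2.1 / 3
    by_cases hμ : ρ μ = 0
    · exact (hC.no_tangent_hyperplane hli hl'.1 hl'.2.1 hl'.2.2.1 hl'.2.2.2 d1 d2 (by rw [d3, hμ]; ring)
        b1 b2 b3).elim
    · have b6 : C.T e' e' e' ≠ 0 := fun h0 => hC.no_plane (a := o') (b := b') (c := e')
        (li3_iff.2 fun p q r h => by
          obtain ⟨h1, h2, h3, h4⟩ := li4_iff.1 hli p q 0 r (by rw [← h]; module)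
          exact ⟨h1, h2, h4⟩)
        hl'.1 hl'.2.1 b1 hl'.2.2.1 b2 b4 hl'.2.2.2 b3 b5 h0
      subst ho hb hv he
      obtain ⟨_, _, _, _, _, _, _, _, _, _, ft, h1, h2, h3, h4, h5, h6, h7⟩ := nf_field hC hnc hli hl' (Or.inr hμ) hd'
        ⟨b1, b2, b3⟩ b4 b5 b6
      obtain ⟨X, Y, Z, W, U, V, S, U', V', S', i1, i2, i3, _, _, _, _, _, _, _, _, _, _, _, _, _, _, _, L⟩ :=
        lay_exists hP hl h1 h2 h3 h4 h5 h6 h7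
      obtain ⟨s, rfl⟩ := hsq S
      obtain ⟨j1, x', y', η', hc', hη', hp', j2⟩ := rebase (C := C) (U := U') (V := V') hP hc hη hp i1 i3
      have key := L.bad1 hP (hd.comb hl X Y Z W U V s) hc' hη' hp' (lin2 _ _) (lin2 _ _) (lin _ _ _ _ c4)
        (lin _ _ _ _ c3)
      exact j1.trans (key.trans (Dvd.dvd.mul_right (pow_dvd_pow_of_dvd j2 5) _))

end bad1
section core
variable {k R : Type} [Field k] [CharZero k] [CommRing R] [IsDomain R] [Algebra k R] {C : Cub k}
  {ρ : R →ₐ[k] k}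

/-- a plane with `F = x3^2 (l1 x2 + l2 x3)` on it -/
structure Pl (C : Cub k) (e1 e2 e3 : Vec R) (l1 l2 : R) : Prop where
  t111 : C.T e1 e1 e1 = 0
  t112 : C.T e1 e1 e2 = 0
  t113 : C.T e1 e1 e3 = 0
  t122 : C.T e1 e2 e2 = 0
  t123 : C.T e1 e2 e3 = 0
  t133 : C.T e1 e3 e3 = 0
  t222 : C.T e2 e2 e2 = 0
  t223 : C.T e2 e2 e3 = 0
  t233 : 3 * C.T e2 e3 e3 = l1
  t333 : C.T e3 e3 e3 = l2

theorem caseII (hP : IsPlace ρ) {e1 e2 e3 e4 c : Vec R} {l1 l2 p1 p2 p3 η' : R}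
    (hpl : C.Pl e1 e2 e3 l1 l2) (hc : c = p1 • e1 + p2 • e2 + p3 • e3 + ((l1 * p2 + l2 * p3) * η') • e4)
    (hlam : l1 * p2 + l2 * p3 ≠ 0) (hη : ρ η' = 0) (hp : ρ p1 ≠ 0 ∨ ρ p2 ≠ 0 ∨ ρ p3 ≠ 0)
    (q1 : C.T c c e1 = 0) (q2 : C.T c c e2 = 0) (q3 : C.T c c e3 = 0) (q4 : C.T c c e4 = 0)
    (hu : ρ (C.T e1 e1 e4) ≠ 0 ∨ ρ (C.T e1 e2 e4) ≠ 0 ∨ ρ (C.T e2 e2 e4) ≠ 0) :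
    C.EE e1 (l2 • e2 - l1 • e3) c ∣ (l1 * p2 + l2 * p3) ^ 4 * η' := by
  obtain ⟨t111, t112, t113, t122, t123, t133, t222, t223, t233, t333⟩ := hpl
  have cancel : ∀ x : R, (l1 * p2 + l2 * p3) * x = 0 → x = 0 := fun x hx =>
    (mul_eq_zero.1 hx).resolve_left hlam
  obtain ⟨E, hE⟩ : ∃ E, E = C.EE e1 (l2 • e2 - l1 • e3) c := ⟨_, rfl⟩
  rw [← hE]
  subst hc
  have s12 := C.T_swap12 (R := R)
  have s23 := C.T_swap23 (R := R)
  simp only [EE, T_add1, T_add2, T_add3, T_sub1, T_sub2, T_smul1, T_smul2, T_smul3] at hE q1 q2 q3 q4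
  simp only [C.T_swap] at *
  simp only [t111, t112, t113, t122, t123, t133, t222, t223, t333, mul_zero, add_zero, zero_add] at hE q1 q2 q3 q4
  generalize C.T e1 e1 e4 = t114 at *
  generalize C.T e1 e2 e4 = t124 at *
  generalize C.T e1 e3 e4 = t134 at *
  generalize C.T e1 e4 e4 = t144 at *
  generalize C.T e2 e2 e4 = t224 at *
  generalize C.T e2 e3 e4 = t234 at *
  generalize C.T e2 e4 e4 = t244 at *
  generalize C.T e3 e3 e4 = t334 at *
  generalize C.T e3 e4 e4 = t344 at *
  generalize C.T e4 e4 e4 = t444 at *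
  generalize C.T e2 e3 e3 = t at *
  have M0 := cancel (p3 ^ 2 + 3 * η' * (p1 ^ 2 * t114 + p2 ^ 2 * t224 + p3 ^ 2 * t334 +
    2 * p1 * p2 * t124 + 2 * p1 * p3 * t134 + 2 * p2 * p3 * t234) + 3 * η' ^ 2 * (l1 * p2 + l2 * p3) *
    (p1 * t144 + p2 * t244 + p3 * t344) + η' ^ 3 * (l1 * p2 + l2 * p3) ^ 2 * t444) (by
      linear_combination p1 * q1 + p2 * q2 + p3 * q3 + (l1 * p2 + l2 * p3) * η' * q4 - p2 * p3 ^ 2 * t233)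
  obtain ⟨A, hA⟩ : ∃ A, A = 3 * l1 * t244 + η' * l1 ^ 2 * t444 := ⟨_, rfl⟩
  obtain ⟨B, hB⟩ : ∃ A, A = 3 * t334 + 3 * η' * l2 * t344 + η' ^ 2 * l2 ^ 2 * t444 := ⟨_, rfl⟩
  obtain ⟨D, hD⟩ : ∃ A, A = 6 * t234 + 3 * η' * (l1 * t344 + l2 * t244) + 2 * η' ^ 2 * l1 * l2 * t444 := ⟨_, rfl⟩
  obtain ⟨F, hF⟩ : ∃ A, A = 3 * l1 * t144 := ⟨_, rfl⟩
  obtain ⟨G, hG⟩ : ∃ A, A = 6 * t134 + 3 * η' * l2 * t144 := ⟨_, rfl⟩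
  have r1 : (6 * η' * t114) * p1 + (η' * (6 * t124 + η' * F)) * p2 + (η' * G) * p3 = 0 := cancel _ (by
    rw [hF, hG]; linear_combination 3 * q1)
  have r2 : (η' * (6 * t124 + η' * F)) * p1 + (2 * η' * (3 * t224 + η' * A)) * p2 + (η' * D) * p3 = 0 := cancel _ (by
    rw [hF, hA, hD]; linear_combination 3 * q2 + 3 * η' * l1 * q4 - l1 * M0 - p3 ^ 2 * t233)
  have r3 : (η' * G) * p1 + (η' * D) * p2 + (2 * (1 + η' * B)) * p3 = 0 := cancel _ (by
    rw [hG, hD, hB]; linear_combination 3 * q3 + 3 * η' * l2 * q4 - l2 * M0 - 2 * p2 * p3 * t233)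
  obtain ⟨e, a1, a2, a3, a4, a5, a6⟩ := adj_form hP r1 r2 r3 hp
  have hEe : 36 * E = (l1 * p2 + l2 * p3) ^ 4 * e := by
    rw [hA, hB, hD, hF, hG] at *
    linear_combination 36 * hE + (l1 * p2 + l2 * p3) ^ 2 * (l2 ^ 2 * a6 + 2 * l1 * l2 * a5 + l1 ^ 2 * a4) +
      12 * (l1 * p2 + l2 * p3) * η' * t114 * (l1 ^ 2 * p2 - 2 * l1 * l2 * p3) * t233
  have he : e ∣ η' := by
    have fin : ∀ u w : R, ρ u ≠ 0 → η' * u = e * w → e ∣ η' := fun u w hu h => by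
      obtain ⟨v, hv⟩ := hP.inv hu
      exact ⟨w * v, by linear_combination v * h - η' * hv⟩
    have m12 : ρ 12 = 12 := map_ofNat ρ 12
    have k12 : (12:k) ≠ 0 := by norm_num
    rcases hu with h | h | h
    · exact fin (12 * t114 * (1 + η' * B) - η' * G ^ 2) (p2 ^ 2) (by simp [hη, m12, k12, h])
        (by linear_combination a4)
    · exact fin ((6 * t124 + η' * F) * 2 * (1 + η' * B) - η' * G * D) (- (p1 * p2))
        (by simp [hη, h, rho2, (map_ofNat ρ 6 : ρ 6 = 6)]) (by linear_combination -a2)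
    · exact fin (4 * (3 * t224 + η' * A) * (1 + η' * B) - η' * D ^ 2) (p1 ^ 2)
        (by simp [hη, h, rho3, rho4]) (by linear_combination a1)
  obtain ⟨w, hw⟩ := he
  exact ⟨36 * w, by rw [hw]; linear_combination (-w) * hEe⟩

variable [IsAlgClosed k]

theorem core (hC : C.SM) (hnc : ¬ C.Config) (hP : IsPlace ρ) (hsq : ∀ a : R, ∃ s, a = s ^ 2)
    {e1 e2 e3 e4 c : Vec R} (hli : LinIndep k ![rs ρ e1, rs ρ e2, rs ρ e3, rs ρ e4])
    {l1 l2 p1 p2 p3 η : R} (hpl : C.Pl e1 e2 e3 l1 l2) (hc : c = p1 • e1 + p2 • e2 + p3 • e3 + η • e4)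
    (hη : η ≠ 0) (hp : ρ p1 ≠ 0 ∨ ρ p2 ≠ 0 ∨ ρ p3 ≠ 0 ∨ ρ η ≠ 0)
    (q1 : C.T c c e1 = 0) (q2 : C.T c c e2 = 0) (q3 : C.T c c e3 = 0) (q4 : C.T c c e4 = 0) :
    C.EE e1 (l2 • e2 - l1 • e3) c ∣ η ^ 5 * C.EE e1 e2 e4 := by
  obtain ⟨t111, t112, t113, t122, t123, t133, t222, t223, t233, t333⟩ := id hpl
  have z : ∀ {u v w : Vec R}, C.T u v w = 0 → C.T (rs ρ u) (rs ρ v) (rs ρ w) = 0 := fun h => by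
    rw [T_rs, h, map_zero]
  have hl : ρ l1 ≠ 0 ∨ ρ l2 ≠ 0 := by
    by_contra! h
    refine hC.no_plane (li3_iff.2 fun p q r h => ?_) (z t111) (z t112) (z t113) (z t122) (z t123) (z t133)
      (z t222) (z t223) ?_ ?_
    · obtain ⟨h1, h2, h3, h4⟩ := li4_iff.1 hli p q r 0 (by rw [← h]; module)
      exact ⟨h1, h2, h3⟩
    · rw [T_rs]
      have := congrArg ρ t233
      rw [map_mul, rho3, h.1] at this
      exact (mul_eq_zero.1 this).resolve_left three_ne_zero
    · rw [T_rs, t333, h.2]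
  have main : η ∣ l1 * p2 + l2 * p3 → C.EE e1 (l2 • e2 - l1 • e3) c ∣ η ^ 5 * C.EE e1 e2 e4 := by
    rintro ⟨m, hm⟩
    obtain ⟨v1, v2, hv⟩ : ∃ v1 v2, l1 * v1 + l2 * v2 = 1 := by
      rcases hl with h | h
      · obtain ⟨v, hv⟩ := hP.inv h
        exact ⟨v, 0, by rw [hv]; ring⟩
      · obtain ⟨v, hv⟩ := hP.inv h
        exact ⟨0, v, by rw [hv]; ring⟩
    have f2 : v2 • (l2 • e2 - l1 • e3) - (-l1) • (v1 • e2 + v2 • e3) = e2 := by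
      trans (l1 * v1 + l2 * v2) • e2
      · module
      · rw [hv, one_smul]
    have hv' := congrArg ρ hv
    simp only [map_add, map_mul, map_one] at hv'
    have key := caseI (o := e1) (b := l2 • e2 - l1 • e3) (v := v1 • e2 + v2 • e3) (c := c) (x := p1)
      (e := e4 + m • (v1 • e2 + v2 • e3)) (μ := -l1) (ν := v2) (y := v2 * (p2 - η * m * v1) - v1 * (p3 - η * m * v2))
      (η := η) hC hnc hP hsq ?_ ?_ ?_ ?_ ?_ hη ?_ q1 ?_ ?_ ?_
    · rw [f2] at key
      convert key using 2
      have s12 := C.T_swap12 (R := R)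
      have s23 := C.T_swap23 (R := R)
      simp only [EE, T_add3, T_smul3]
      rw [t112, t113, t122, t123, t222, t223]; ring
    · refine li4_iff.2 fun x y z w h => ?_
      simp only [rs_add, rs_sub, rs_smul] at h
      obtain ⟨h1, h2, h3, h4⟩ := li4_iff.1 hli x (y * ρ l2 + z * ρ v1 + w * ρ m * ρ v1)
        (-y * ρ l1 + z * ρ v2 + w * ρ m * ρ v2) w (by rw [← h]; module)
      subst h4
      refine ⟨h1, ?_, ?_, rfl⟩
      · linear_combination (-y) * hv' + ρ v2 * h2 - ρ v1 * h3
      · linear_combination (-z) * hv' + ρ l1 * h2 + ρ l2 * h3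
    · refine ⟨?_, ?_, ?_, ?_⟩ <;>
      (try simp only [T_sub1, T_sub2, T_sub3, T_lin]) <;>
      (try simp only [C.T_swap] at t111 t112 t113 t122 t123 t133 t222 t223 t233 t333 ⊢) <;>
      (try simp only [t111, t112, t113, t122, t123, t133, t222, t223, t333, mul_zero, sub_zero, add_zero, zero_mul, zero_sub])
      linear_combination l2 * l1 ^ 2 * t233
    · refine ⟨?_, ?_, ?_, ?_, ?_, ?_⟩ <;>
      (try simp only [T_sub1, T_sub2, T_sub3, T_lin]) <;>
      (try simp only [C.T_swap] at t111 t112 t113 t122 t123 t133 t222 t223 t233 t333 ⊢) <;>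
      (try simp only [t111, t112, t113, t122, t123, t133, t222, t223, t333, mul_zero, sub_zero, add_zero, zero_mul, zero_sub])
      · ring
      · linear_combination (l1 ^ 2 * v1 - 2 * l1 * l2 * v2) * t233 + l1 ^ 2 * hv
      · linear_combination (l2 * v2 ^ 2 - 2 * l1 * v1 * v2) * t233 - 2 * l1 * v2 * hv
      · linear_combination v1 * v2 ^ 2 * t233 + v2 ^ 2 * hv
    · by_contra! h
      have e1 : ρ l1 = 0 := by simpa using h.1
      rw [e1, h.2] at hv'
      simp at hv'
    · rw [hc]; ext i
      simp only [Pi.add_apply, Pi.sub_apply, Pi.smul_apply, smul_eq_mul]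
      linear_combination (-(p2 * e2 i + p3 * e3 i)) * hv + (v1 * e2 i + v2 * e3 i) * hm
    · by_contra! h
      obtain ⟨h1, h2, h3⟩ := h
      have h4 := congrArg ρ hm
      simp only [map_add, map_sub, map_mul, h3] at h2 h4
      rcases hp with h | h | h | h
      · exact h h1
      · exact h (by linear_combination (-ρ p2) * hv' + ρ v1 * h4 + ρ l2 * h2)
      · exact h (by linear_combination (-ρ p3) * hv' + ρ v2 * h4 - ρ l1 * h2)
      · exact h h3
    · rw [T_sub3, T_smul3, T_smul3, q2, q3]; ring
    · rw [T_add3, T_smul3, T_smul3, q2, q3]; ring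
    · rw [T_add3, T_smul3, T_add3, T_smul3, T_smul3, q2, q3, q4]; ring
  rcases hP.total η (l1 * p2 + l2 * p3) with h | ⟨η', rfl⟩
  · exact main h
  by_cases hη' : ρ η' = 0
  · have hlam : l1 * p2 + l2 * p3 ≠ 0 := fun h => hη (by rw [h, zero_mul])
    refine (caseII hP hpl hc hlam hη' ?_ q1 q2 q3 q4 ?_).trans (Dvd.dvd.mul_right
      ⟨(l1 * p2 + l2 * p3) * η' ^ 4, by ring⟩ _)
    · rcases hp with h | h | h | h
      · exact Or.inl h
      · exact Or.inr (Or.inl h)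
      · exact Or.inr (Or.inr h)
      · exact absurd (by rw [map_mul, hη', mul_zero]) h
    · by_contra! h
      exact hC.no_tangent_hyperplane hli (z t111) (z t112) (z t122) (z t222) (z t113) (z t123) (z t223)
        ((T_rs C _ _ _).trans h.1) ((T_rs C _ _ _).trans h.2.1) ((T_rs C _ _ _).trans h.2.2)
  · obtain ⟨v, hv⟩ := hP.inv hη'
    exact main ⟨v, by linear_combination (-(l1 * p2 + l2 * p3)) * hv⟩

end core
end Cub

/-! ### Constancy of the vertex and of the nodes -/

namespace Cub

theorem theta_alg {K : Type} [Field K] [CharZero K] {a1 a2 a3 a4 b5 y κ e' Ξ γ D δ' δ E r ri g gi U x η ci wi : K}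
    (ha1 : a1 ≠ 0) (ha2 : a2 ≠ 0) (ha3 : a3 ≠ 0) (ha4 : a4 ≠ 0) (hy : y ≠ 0) (hκ : κ ≠ 0) (he : e' ≠ 0)
    (h1 : δ = (a1 * a2 * a4) ^ 2 * δ') (h2 : E = 9 * (a1 * a2 * a3 ^ 3 * κ) ^ 2 * y ^ 2 * e')
    (h3 : r = (a1 * a2) ^ 4 * (a4 * b5) ^ 2 * Ξ) (h3' : r * ri = 1) (h4 : g = y ^ 2 * b5 * γ) (h4' : g * gi = 1)
    (h5 : U = a1 * a2 * a3 * a4 * b5 * D) (h6 : η * a4 = y) (h7 : η ^ 5 * δ = E * x)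
    (h8 : wi = y * ci) :
    wi ^ 6 * x ^ 2 * 81 * U ^ 12 * ri ^ 3 * gi ^ 6 =
      ci ^ 6 * (δ' ^ 2 * D ^ 12 / (κ ^ 4 * e' ^ 2 * Ξ ^ 3 * γ ^ 6)) := by
  obtain ⟨hb, hX⟩ : b5 ≠ 0 ∧ Ξ ≠ 0 := by constructor <;> (rintro rfl; simp [h3] at h3')
  have hγ : γ ≠ 0 := by rintro rfl; simp [h4] at h4'
  obtain rfl : η = y / a4 := by rw [← h6]; field_simp
  obtain rfl : ri = r⁻¹ := (inv_eq_of_mul_eq_one_right h3').symm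
  obtain rfl : gi = g⁻¹ := (inv_eq_of_mul_eq_one_right h4').symm
  obtain rfl : x = y ^ 3 * δ' / (9 * a4 ^ 3 * a3 ^ 6 * κ ^ 2 * e') := by
    have hE : E ≠ 0 := by rw [h2]; simp [*]
    apply mul_left_cancel₀ hE
    rw [← h7, h2, h1]; field_simp
  rw [h3, h4, h5, h8]
  field_simp
  ring

section theta
variable {k R K : Type} [Field k] [CharZero k] [IsAlgClosed k] [CommRing R] [IsDomain R] [Field K] [Algebra k R]
  [Algebra k K] [Algebra R K] [IsScalarTower k R K] {ρ : R →ₐ[k] k} {C : Cub k}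

theorem det_flag {o a b c d : Vec K} {e1 e2 e3 e4 e5 : Vec R}
    {a11 a21 a22 a31 a32 a33 a41 a42 a43 a44 a51 a52 a53 a54 a55 : K} (he1 : up K e1 = a11 • o)
    (he2 : up K e2 = a21 • o + a22 • a) (he3 : up K e3 = a31 • o + a32 • a + a33 • b)
    (he4 : up K e4 = a41 • o + a42 • a + a43 • b + a44 • c)
    (he5 : up K e5 = a51 • o + a52 • a + a53 • b + a54 • c + a55 • d) :
    algMap R K (Matrix.of ![e1, e2, e3, e4, e5]).det =
      a11 * a22 * a33 * a44 * a55 * (Matrix.of ![o, a, b, c, d]).det := by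
  let L : Matrix (Fin 5) (Fin 5) K := !![a11, 0, 0, 0, 0; a21, a22, 0, 0, 0; a31, a32, a33, 0, 0;
    a41, a42, a43, a44, 0; a51, a52, a53, a54, a55]
  have hL : L.det = a11 * a22 * a33 * a44 * a55 := by
    rw [Matrix.det_of_isLowerTriangular]
    · simp [Fin.prod_univ_succ, L]; ring
    · intro i j h
      replace h : i < j := h
      fin_cases i <;> fin_cases j <;> simp [L] at h ⊢
  rw [← hL, ← Matrix.det_mul, RingHom.map_det]
  congr 1
  have h : ∀ (u : Vec R) j, algMap R K (u j) = up K u j := fun _ _ => rfl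
  ext i j
  fin_cases i <;> simp [L, Matrix.mul_apply, Fin.sum_univ_succ, h, he1, he2, he3, he4, he5] <;> ring

end theta

theorem vec_const {k K : Type} [Field k] [IsAlgClosed k] [Field K] [Algebra k K] {c : Vec K} {θ : K} (hc : c ≠ 0)
    (hθ : θ ≠ 0) (h : ∀ i, c i ^ 6 * θ ∈ Set.range (algMap k K)) :
    ∃ (c0 : Vec k) (y : K), y ≠ 0 ∧ c = y • cst k K c0 := by
  obtain ⟨j, hj⟩ : ∃ j, c j ≠ 0 := by by_contra! h; exact hc (funext h)
  have : ∀ i, c i / c j ∈ Set.range (algMap k K) := by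
    intro i
    obtain ⟨s, hs⟩ := h i
    obtain ⟨t, ht⟩ := h j
    apply mem_range_of_isAlgebraic
    apply IsAlgebraic.of_pow (n := 6) (by norm_num)
    have e : (c i / c j) ^ 6 = algMap k K (s / t) := by rw [map_div₀, hs, ht]; field_simp
    rw [e]; exact isAlgebraic_algebraMap _
  choose c0 h0 using this
  exact ⟨c0, c j, hj, by ext i; simp [cst, h0]; field_simp⟩

/-- a node with constant tangent hyperplane is constant -/
theorem node_const {k K : Type} [Field k] [CharZero k] [Field K] [Algebra k K] {C : Cub k} (hp : HasPlaces k K) (hC : C.SM)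
    {c0 : Vec k} (hc0 : c0 ≠ 0) {ν : Vec K} {κ : K} (hν : ν ≠ 0)
    (h : ∀ w, C.T ν ν w = κ * C.T (cst k K c0) (cst k K c0) w) :
    ∃ (ν0 : Vec k) (y : K), y ≠ 0 ∧ cst k K ν0 = y • ν := by
  obtain ⟨i, hi⟩ : ∃ i, ν i ≠ 0 := by by_contra! h; exact hν (funext h)
  obtain ⟨w, hw⟩ : ∃ w, C.T c0 c0 w ≠ 0 := by by_contra! h; exact hc0 (hC _ h)
  set m := C.T c0 c0 w
  -- the local statement
  have loc : ∀ (R : Type) [CommRing R] [IsDomain R] [Algebra k R] [Algebra R K] [IsScalarTower k R K]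
      (ρ : R →ₐ[k] k), PlaceIn K ρ → ∃ (v : Vec R) (s t : R), (∀ j, algMap R K (v j) * ν i = algMap R K (v i) * ν j) ∧
        algMap R K s * ν i ^ 2 = algMap R K (v i) ^ 2 * κ ∧ s * t = 1 := by
    intro R _ _ _ _ _ ρ hP
    obtain ⟨y, v, hy, hv, j, hj⟩ := hP.exists_prim ν hν
    have hvj : ∀ j, algMap R K (v j) = y * ν j := fun j => congrFun hv j
    obtain ⟨u, hu⟩ : ∃ u, C.T (rs ρ v) (rs ρ v) u ≠ 0 := by
      by_contra! h
      have := congrFun (hC _ h) j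
      simp [rs, hj] at this
    have key : ∀ u, algMap R K (C.T v v (cst k R u)) = y ^ 2 * κ * algMap k K (C.T c0 c0 u) := by
      intro u
      rw [← T_up, hv, up_cst, T_smul1, T_smul2, h, T_cst]; ring
    have hm : algMap k R m⁻¹ * algMap k R m = 1 := by rw [← map_mul, inv_mul_cancel₀ hw, map_one]
    obtain ⟨z, hz⟩ := hP.toIsPlace.inv (a := C.T v v (cst k R u)) (by rwa [← T_rs, rs_cst])
    refine ⟨v, algMap k R m⁻¹ * C.T v v (cst k R w), z * algMap k R (C.T c0 c0 u), ?_, ?_, ?_⟩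
    · intro j; rw [hvj, hvj]; ring
    · have hm' : algMap k K m⁻¹ * algMap k K m = 1 := by rw [← map_mul, inv_mul_cancel₀ hw, map_one]
      rw [map_mul, key, hvj, ← IsScalarTower.algebraMap_apply]
      linear_combination (y ^ 2 * κ * ν i ^ 2) * hm'
    · apply hP.inj
      have h1 := key w
      have h2 := key u
      have hz' := congrArg (algMap R K) hz
      have hm' : algMap k K m⁻¹ * algMap k K m = 1 := by rw [← map_mul, inv_mul_cancel₀ hw, map_one]
      rw [map_mul, h2] at hz'
      simp only [map_mul, h1, ← IsScalarTower.algebraMap_apply]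
      rw [map_one] at hz' ⊢
      linear_combination hz' + (y ^ 2 * κ * algMap R K z * algMap k K (C.T c0 c0 u)) * hm'
  obtain ⟨g, hg⟩ : ν i ^ 2 * κ⁻¹ ∈ Set.range (algMap k K) := by
    refine const_of_places hp _ fun R _ _ _ _ _ ρ hP => ?_
    obtain ⟨v, s, t, -, h2, h3⟩ := loc R ρ hP
    refine ⟨v i ^ 2 * t, ?_⟩
    have h3' := congrArg (algMap R K) h3
    rw [map_mul, map_one] at h3'
    have hκ : κ ≠ 0 := by
      rintro rfl
      have : algMap R K s = 0 := by simpa [hi] using h2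
      rw [this, zero_mul] at h3'; exact zero_ne_one h3'
    rw [map_mul, map_pow]
    field_simp
    linear_combination ν i ^ 2 * h3' - algMap R K t * h2
  have : ∀ j, ν j / ν i ∈ Set.range (algMap k K) := fun j => by
    refine const_of_places hp _ fun R _ _ _ _ _ ρ hP => ?_
    obtain ⟨v, s, t, h1, h2, h3⟩ := loc R ρ hP
    have h3' := congrArg (algMap R K) h3
    rw [map_mul, map_one] at h3'
    have hκ : κ ≠ 0 := by
      rintro rfl
      have : algMap R K s = 0 := by simpa [hi] using h2
      rw [this, zero_mul] at h3'; exact zero_ne_one h3'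
    have hg0 : g ≠ 0 := by rintro rfl; simp [hi, hκ] at hg
    have hgg : algMap k K g * algMap k K g⁻¹ = 1 := by rw [← map_mul, mul_inv_cancel₀ hg0, map_one]
    refine ⟨v j * v i * t * algMap k R g⁻¹, ?_⟩
    simp only [map_mul, ← IsScalarTower.algebraMap_apply]
    have hvv : algMap R K (v i) ^ 2 * algMap R K t = algMap k K g := by
      rw [hg]; field_simp; linear_combination ν i ^ 2 * h3' - algMap R K t * h2
    rw [eq_div_iff hi]
    linear_combination algMap R K (v i) * algMap R K t * algMap k K g⁻¹ * h1 j +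
      ν j * algMap k K g⁻¹ * hvv + ν j * hgg
  choose ν0 h0 using this
  exact ⟨ν0, (ν i)⁻¹, inv_ne_zero hi, by ext j; simp [cst, h0]; field_simp⟩

section theta
variable {k R K : Type} [Field k] [CharZero k] [IsAlgClosed k] [CommRing R] [IsDomain R] [Field K] [Algebra k R]
  [Algebra k K] [Algebra R K] [IsScalarTower k R K] {ρ : R →ₐ[k] k} {C : Cub k}

theorem theta_T {o a b c d e1 e2 e3 e4 e5 : Vec K} (hn : C.Nrm o a b)
    {a11 a21 a22 a31 a32 a33 a41 a42 a43 a44 a51 a52 a53 a54 a55 : K} (he1 : e1 = a11 • o)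
    (he2 : e2 = a21 • o + a22 • a) (he3 : e3 = a31 • o + a32 • a + a33 • b)
    (he4 : e4 = a41 • o + a42 • a + a43 • b + a44 • c)
    (he5 : e5 = a51 • o + a52 • a + a53 • b + a54 • c + a55 • d) :
    C.EE e1 e2 e4 = (a11 * a22 * a44) ^ 2 * C.EE o a c ∧
    res2 (C.T e1 e1 e4) (C.T e1 e2 e4) (C.T e2 e2 e4) (C.T e1 e1 e5) (C.T e1 e2 e5) (C.T e2 e2 e5) =
      (a11 * a22) ^ 4 * (a44 * a55) ^ 2 *
        res2 (C.T o o c) (C.T o a c) (C.T a a c) (C.T o o d) (C.T o a d) (C.T a a d) ∧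
    C.Pl e1 e2 e3 (3 * (a22 * a33 ^ 2 * C.T a b b)) (3 * (a32 * a33 ^ 2 * C.T a b b)) ∧
    (3 * (a32 * a33 ^ 2 * C.T a b b)) • e2 - (3 * (a22 * a33 ^ 2 * C.T a b b)) • e3 =
      (3 * (a33 ^ 2 * C.T a b b) * (a32 * a21 - a22 * a31)) • o + (-(3 * (a22 * a33 ^ 3 * C.T a b b))) • b := by
  obtain ⟨ooo, ooa, oob, oaa, oab, obb, aaa, aab, bbb, abb⟩ := hn
  have E : ∀ {u : Vec K} {x1 x2 x3 x4 x5 : K}, u = x1 • o + x2 • a + x3 • b + x4 • c + x5 • d →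
      C.T e1 e1 u = a11 ^ 2 * (x4 * C.T o o c + x5 * C.T o o d) ∧
      C.T e1 e2 u = a11 * (a21 * (x4 * C.T o o c + x5 * C.T o o d) + a22 * (x4 * C.T o a c + x5 * C.T o a d)) ∧
      C.T e2 e2 u = a21 ^ 2 * (x4 * C.T o o c + x5 * C.T o o d) + 2 * a21 * a22 * (x4 * C.T o a c + x5 * C.T o a d)
        + a22 ^ 2 * (x4 * C.T a a c + x5 * C.T a a d) := by
    intro u x1 x2 x3 x4 x5 hu
    rw [hu, he1, he2]
    refine ⟨?_, ?_, ?_⟩ <;> simp only [T_lin] <;>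
      (try simp only [C.T_swap] at ooo ooa oob oaa oab obb aaa aab bbb ⊢) <;> (try simp only [ooo, ooa, oob, oaa, oab, obb, aaa, aab]) <;> try ring
  obtain ⟨f1, f2, f3⟩ := E (x5 := 0) (u := e4) (by rw [he4]; module)
  obtain ⟨g1, g2, g3⟩ := E he5
  refine ⟨?_, ?_, ?_, ?_⟩
  · rw [EE, EE, f1, f2, f3]; ring
  · rw [f1, f2, f3, g1, g2, g3, res2, res2]; ring
  · clear E f1 f2 f3 g1 g2 g3
    rw [he1, he2, he3]
    constructor <;> simp only [T_lin] <;>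
      (try simp only [C.T_swap] at ooo ooa oob oaa oab obb aaa aab bbb ⊢) <;>
      (try simp only [ooo, ooa, oob, oaa, oab, obb, aaa, aab, bbb]) <;> try ring
  · rw [he2, he3]; module

theorem theta_place [IsAlgClosed K] (hP : PlaceIn K ρ) (hC : C.SM) (hnc : ¬ C.Config) {o a b c d : Vec K}
    (hli : LinIndep K ![o, a, b, c, d]) (hn : C.Nrm o a b) (co : C.T c c o = 0) (ca : C.T c c a = 0)
    (cb : C.T c c b = 0) (cc : C.T c c c = 0) (he : C.EE o b c ≠ 0) (i : Fin 5) :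
    c i ^ 6 * (C.EE o a c ^ 2 * (Matrix.of ![o, a, b, c, d]).det ^ 12 / (C.T a b b ^ 4 * C.EE o b c ^ 2 *
      res2 (C.T o o c) (C.T o a c) (C.T a a c) (C.T o o d) (C.T o a d) (C.T a a d) ^ 3 * C.T c c d ^ 6)) ∈
      Set.range (algMap R K) := by
  have hcz : CharZero K := charZero_of_injective_algebraMap (algMap k K).injective
  have hi : ∀ {z : R}, algMap R K z = 0 → z = 0 := fun h => hP.inj (by rw [h, map_zero])
  have hl5 := li5_iff.1 hli
  have hli4 : LinIndep K ![o, a, b, c] := li4_iff.2 fun x y z w h => by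
    obtain ⟨h1, h2, h3, h4, -⟩ := hl5 x y z w 0 (by rw [← h]; module)
    exact ⟨h1, h2, h3, h4⟩
  obtain ⟨e1, e2, e3, e4, a11, a21, a22, a31, a32, a33, a41, a42, a43, a44, h11, h22, h33, h44, he1, he2, he3, he4,
    hr4⟩ := hP.flag4 hli4
  obtain ⟨f5, hf5⟩ := exists_ext4 hr4
  obtain ⟨e5, rfl⟩ : ∃ e5 : Vec R, rs ρ e5 = f5 := ⟨cst k R f5, rs_cst _⟩
  obtain ⟨a51, a52, a53, a54, a55, he5⟩ := exists_coord hli (up K e5)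
  obtain ⟨k1, k2, k3, k4⟩ := theta_T hn he1 he2 he3 he4 he5
  have hc0 : c ≠ 0 := by
    rintro rfl
    exact one_ne_zero (hl5 0 0 0 1 0 (by simp)).2.2.2.1
  obtain ⟨y, w, hy, hw, j, hj⟩ := hP.exists_prim c hc0
  -- coordinates of the primitive vector
  have hx : ∃ x : Fin 4 → K, ∑ i, x i • up K (![e1, e2, e3, e4] i) = up K w ∧ x 3 * a44 = y := by
    refine ⟨![-(y / a44 * a41 + -(y / a44 * a43) / a33 * a31 + (-(y / a44 * a42) - -(y / a44 * a43) / a33 * a32) / a22 * a21) / a11,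
      (-(y / a44 * a42) - -(y / a44 * a43) / a33 * a32) / a22, -(y / a44 * a43) / a33, y / a44], ?_, ?_⟩
    · simp [Fin.sum_univ_succ, he1, he2, he3, he4, hw]
      ext i
      simp only [Pi.add_apply, Pi.smul_apply, smul_eq_mul]
      field_simp
      ring
    · simp; field_simp
  obtain ⟨x, hx, hx3⟩ := hx
  have hxi := hP.coord_int ![e1, e2, e3, e4] (by convert hr4 using 1; ext i j; fin_cases i <;> rfl) x w hx
  choose p hp using hxi
  have hwp : w = p 0 • e1 + p 1 • e2 + p 2 • e3 + p 3 • e4 := by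
    apply hP.up_inj
    rw [← hx]
    simp only [up_add, up_smul, hp, Fin.sum_univ_four]; rfl
  have hη : p 3 ≠ 0 := by
    intro h
    rw [← hp, h, map_zero, zero_mul] at hx3
    exact hy hx3.symm
  have hprim : ρ (p 0) ≠ 0 ∨ ρ (p 1) ≠ 0 ∨ ρ (p 2) ≠ 0 ∨ ρ (p 3) ≠ 0 := by
    by_contra! h
    obtain ⟨q1, q2, q3, q4⟩ := h
    have := congrArg (fun v => rs ρ v j) hwp
    simp only [rs_add, rs_smul, q1, q2, q3, q4, zero_smul, add_zero] at this
    simp [rs, hj] at this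
  -- the plane
  have hpl : C.Pl e1 e2 e3 (3 * C.T e2 e3 e3) (C.T e3 e3 e3) := by
    obtain ⟨t111, t112, t113, t122, t123, t133, t222, t223, t233, t333⟩ := k3
    exact ⟨hP.T_eq_zero C t111, hP.T_eq_zero C t112, hP.T_eq_zero C t113, hP.T_eq_zero C t122,
      hP.T_eq_zero C t123, hP.T_eq_zero C t133, hP.T_eq_zero C t222, hP.T_eq_zero C t223, rfl, rfl⟩
  have cT : ∀ u, C.T (up K w) (up K w) u = y ^ 2 * C.T c c u := fun u => by
    rw [hw, T_smul1, T_smul2]; ring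
  have q : ∀ {u : Vec R}, C.T c c (up K u) = 0 → C.T w w u = 0 := fun h => hP.T_eq_zero C (by rw [cT, h, mul_zero])
  have q1 : C.T w w e1 = 0 := q (by rw [he1, T_smul3, co, mul_zero])
  have q2 : C.T w w e2 = 0 := q (by simp only [he2, T_add3, T_smul3, co, ca]; ring)
  have q3 : C.T w w e3 = 0 := q (by simp only [he3, T_add3, T_smul3, co, ca, cb]; ring)
  have q4 : C.T w w e4 = 0 := q (by simp only [he4, T_add3, T_smul3, co, ca, cb, cc]; ring)
  obtain ⟨X, hX⟩ := core hC hnc hP.toIsPlace (fun z => by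
      obtain ⟨s, hs⟩ := IsAlgClosed.exists_pow_nat_eq (algMap R K z) (n := 2) (by norm_num)
      obtain ⟨t, ht⟩ := hP.sq_int hs.symm
      exact ⟨t, hP.inj (by rw [map_pow, ht, hs])⟩) hr4 hpl hwp hη hprim q1 q2 q3 q4
  -- units
  have on : C.OnLine e1 e2 := ⟨hpl.t111, hpl.t112, hpl.t122, hpl.t222⟩
  have tn : C.Tan e1 e2 e3 := ⟨hpl.t113, hpl.t123, hpl.t223⟩
  have hres := hC.res_ne hf5 (on.rs (ρ := ρ)) (tn.rs (ρ := ρ))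
  obtain ⟨ri, hri⟩ := hP.toIsPlace.inv (a := res2 (C.T e1 e1 e4) (C.T e1 e2 e4) (C.T e2 e2 e4) (C.T e1 e1 e5)
    (C.T e1 e2 e5) (C.T e2 e2 e5)) (by
      intro h; apply hres; rw [← h]
      simp only [T_rs, res2, map_sub, map_mul, map_pow, map_ofNat])
  obtain ⟨gi, hgi⟩ := hP.toIsPlace.inv (a := C.T w w e5) (by
    intro h
    have hz : rs ρ w = 0 := by
      apply hC
      intro u
      obtain ⟨u1, u2, u3, u4, u5, rfl⟩ := exists_coord hf5 u
      simp only [T_add3, T_smul3, T_rs, q1, q2, q3, q4, h, map_zero, mul_zero, add_zero]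
    have := congrFun hz j
    simp [rs, hj] at this)
  refine ⟨w i ^ 6 * X ^ 2 * 81 * (Matrix.of ![e1, e2, e3, e4, e5]).det ^ 12 * ri ^ 3 * gi ^ 6, ?_⟩
  simp only [map_mul, map_pow, map_ofNat]
  have hri' := congrArg (algMap R K) hri
  have hgi' := congrArg (algMap R K) hgi
  have hX' := congrArg (algMap R K) hX
  rw [map_mul, map_one] at hri' hgi'
  rw [map_mul, map_mul, map_pow, hp] at hX'
  refine theta_alg h11 h22 h33 h44 hy hn.abb he ?_ ?_ ?_ hri' ?_ hgi' (det_flag he1 he2 he3 he4 he5) hx3 hX' (congrFun hw i)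
  · rw [← k1]; simp only [EE, T_up, map_sub, map_mul, map_pow]
  · have hb : up K (C.T e3 e3 e3 • e2 - (3 * C.T e2 e3 e3) • e3) =
        (3 * (a33 ^ 2 * C.T a b b) * (a32 * a21 - a22 * a31)) • o + (-(3 * (a22 * a33 ^ 3 * C.T a b b))) • b := by
      rw [← k4, up_sub, up_smul, up_smul, ← k3.t233, ← k3.t333, T_up, T_up, map_mul, map_ofNat]
    have : algMap R K (C.EE e1 (C.T e3 e3 e3 • e2 - (3 * C.T e2 e3 e3) • e3) w) =
        C.EE (up K e1) (up K (C.T e3 e3 e3 • e2 - (3 * C.T e2 e3 e3) • e3)) (up K w) := by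
      simp only [EE, T_up, map_sub, map_mul, map_pow]
    rw [this, hb, he1, hw]
    simp only [EE, T_add1, T_add2, T_smul1, T_smul2, T_smul3]
    rw [C.T_swap12 b o]
    ring
  · rw [← k2]; simp only [T_up, res2, map_sub, map_mul, map_pow, map_ofNat]
  · rw [← T_up, cT, he5]; simp only [T_add3, T_smul3, co, ca, cb, cc]; ring

end theta

theorem const_line {k K : Type} [Field k] [CharZero k] [IsAlgClosed k] [Field K] [IsAlgClosed K] [Algebra k K]
    {C : Cub k} (hp : HasPlaces k K) (hC : C.SM) (hnc : ¬ C.Config) {o a b c d : Vec K}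
    (hli : LinIndep K ![o, a, b, c, d]) (hn : C.Nrm o a b) (co : C.T c c o = 0) (ca : C.T c c a = 0)
    (cb : C.T c c b = 0) (cc : C.T c c c = 0) (cd : C.T c c d ≠ 0) (hδ : C.EE o a c ≠ 0) (he : C.EE o b c ≠ 0) :
    ConstLine k o a := by
  have hcz : CharZero K := charZero_of_injective_algebraMap (algMap k K).injective
  have hl5 := li5_iff.1 hli
  have hc0 : c ≠ 0 := by
    rintro rfl
    exact one_ne_zero (hl5 0 0 0 1 0 (by simp)).2.2.2.1
  have hres := (C.SM_base (K := K) hC).res_ne hli (by simpa only [OnLine, T_base] using ⟨hn.ooo, hn.ooa, hn.oaa, hn.aaa⟩)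
    (by simpa only [Tan, T_base] using ⟨hn.oob, hn.oab, hn.aab⟩)
  simp only [T_base] at hres
  have hD : (Matrix.of ![o, a, b, c, d]).det ≠ 0 := by
    rw [← isUnit_iff_ne_zero, ← Matrix.isUnit_iff_isUnit_det, ← Matrix.linearIndependent_rows_iff_isUnit]
    exact hli
  have hθ := fun i => const_of_places hp _ fun R _ _ _ _ _ ρ hP =>
    theta_place (R := R) (ρ := ρ) hP hC hnc hli hn co ca cb cc he i
  have habb := hn.abb
  obtain ⟨c0, y, hy, rfl⟩ := vec_const hc0 (by positivity) hθ
  have hc00 : c0 ≠ 0 := by rintro rfl; apply hc0; ext i; simp [cst]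
  simp only [T_smul1, T_smul2] at co ca cb cc cd
  obtain ⟨x1, y1, x2, y2, hdet, r1, r2, -⟩ := bin_quad (p := C.T o o (y • cst k K c0)) (q := C.T o a (y • cst k K c0))
    (r := C.T a a (y • cst k K c0)) (by intro h; apply hδ; rw [EE]; linear_combination -h)
  simp only [ne_eq, mul_eq_zero, hy, false_or] at co ca cb cc cd
  -- both nodes are constant
  have node : ∀ {s t : K}, (s ≠ 0 ∨ t ≠ 0) → C.T o o (y • cst k K c0) * s ^ 2 + 2 * C.T o a (y • cst k K c0) * (s * t) +
      C.T a a (y • cst k K c0) * t ^ 2 = 0 → ∃ (ν0 : Vec k) (z : K), z ≠ 0 ∧ cst k K ν0 = z • (s • o + t • a) := by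
    intro s t hst hq
    have hT : ∀ u, C.T (s • o + t • a) (s • o + t • a) u = s ^ 2 * C.T o o u + 2 * s * t * C.T o a u + t ^ 2 * C.T a a u := by
      intro u
      simp only [T_add1, T_add2, T_smul1, T_smul2, C.T_swap12 a o]; ring
    refine node_const hp hC hc00 (κ := C.T (s • o + t • a) (s • o + t • a) d / C.T (cst k K c0) (cst k K c0) d) ?_ ?_
    · intro h
      have := hl5 s t 0 0 0 (by rw [← h]; module)
      rcases hst with h | h
      exacts [h this.1, h this.2.1]
    · intro u
      have hN : ∀ {v}, C.T o o v = 0 → C.T o a v = 0 → C.T a a v = 0 → C.T (s • o + t • a) (s • o + t • a) v = 0 := by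
        intro v h1 h2 h3; rw [hT, h1, h2, h3]; ring
      have n1 := hN hn.ooo (by rw [C.T_swap23]; exact hn.ooa) (by rw [C.T_swap23, C.T_swap12]; exact hn.oaa)
      have n2 := hN hn.ooa hn.oaa hn.aaa
      have n3 := hN hn.oob hn.oab hn.aab
      have n4 : C.T (s • o + t • a) (s • o + t • a) (cst k K c0) = 0 := by
        simp only [T_smul3] at hq
        apply mul_left_cancel₀ hy
        rw [hT]; linear_combination hq
      obtain ⟨u1, u2, u3, u4, u5, rfl⟩ := exists_coord hli u
      generalize s • o + t • a = ν at *
      simp only [T_add3, T_smul3, n1, n2, n3, n4, co, ca, cb, cc]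
      rw [div_mul_eq_mul_div, eq_div_iff cd]; ring
  obtain ⟨p, z, hz, hpz⟩ := node (by
    by_contra! h; apply hdet; rw [h.1, h.2]; ring) r1
  obtain ⟨q, z', hz', hqz⟩ := node (by
    by_contra! h; apply hdet; rw [h.1, h.2]; ring) r2
  refine ⟨p, q, li2_iff.2 fun s t h => ?_, z * x1, z * y1, z' * x2, z' * y2, by rw [hpz]; module, by rw [hqz]; module⟩
  have h1 : algMap k K s • cst k K p + algMap k K t • cst k K q = 0 := by
    rw [← cst_smul, ← cst_smul, ← cst_add, h]; ext i; simp [cst]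
  rw [hpz, hqz] at h1
  obtain ⟨g1, g2, -⟩ := hl5 (algMap k K s * z * x1 + algMap k K t * z' * x2)
    (algMap k K s * z * y1 + algMap k K t * z' * y2) 0 0 0 (by rw [← h1]; module)
  have s0 : algMap k K s * z * (x1 * y2 - x2 * y1) = 0 := by linear_combination y2 * g1 - x2 * g2
  have t0 : algMap k K t * z' * (x1 * y2 - x2 * y1) = 0 := by linear_combination x1 * g2 - y1 * g1
  simp only [mul_eq_zero, hz, hz', hdet, or_false, map_eq_zero] at s0 t0
  exact ⟨s0, t0⟩

theorem main {k : Type} [Field k] [CharZero k] [IsAlgClosed k] (C : Cub k) (hC : C.SM) : C.Config := by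
  by_contra hnc
  obtain ⟨k0, _, _, _, C0, K, _, _, _, o, a, b, hC0, h0, hp, hli, hn, hnl, z, hz⟩ := setup C hC
  have hnc0 : ¬ C0.Config := fun h => hnc (h0 h)
  have hcz : CharZero K := charZero_of_injective_algebraMap (algMap k0 K).injective
  obtain ⟨R, _, _, _, _, _, ρ, hP⟩ := HasPlaces.exists hp hz
  obtain ⟨c, d, h5, co, ca, cb, cc, cd, h1, h2⟩ := exists_c (C := C0.base K) (C0.SM_base hC0)
    (fun h => hnc0 (C0.Config_base h)) hli (by
      obtain ⟨ooo, ooa, oob, oaa, oab, obb, aaa, aab, bbb, abb⟩ := hn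
      constructor <;> simpa only [T_base])
    (fun c hobc ht => hnl (dbl_const hP hC0 hli hn (triple_const hP hC0 hobc (by
      simpa only [Trip, OnLine, Tan, T_base] using ht))))
  simp only [T_base] at co ca cb cc cd h1 h2
  exact hnl (const_line hp hC0 hnc0 h5 hn co ca cb cc cd h1 h2)

end Cub

noncomputable section
open MvPolynomial

/-! ### Translation between polynomials and symmetric arrays -/

theorem pderiv_pderiv_comm (i j : Fin 5) (F : MvPolynomial (Fin 5) ℂ) :
    pderiv i (pderiv j F) = pderiv j (pderiv i F) := by
  have h : ⁅(pderiv i : Derivation ℂ (MvPolynomial (Fin 5) ℂ) (MvPolynomial (Fin 5) ℂ)),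
      (pderiv j : Derivation ℂ (MvPolynomial (Fin 5) ℂ) (MvPolynomial (Fin 5) ℂ))⁆ = 0 := by
    ext l
    rw [Derivation.commutator_apply]
    simp [pderiv_X, Pi.single_apply]
    split_ifs <;> simp
  have h2 := congrArg (fun D => D F) h
  rw [Derivation.commutator_apply] at h2
  exact sub_eq_zero.1 h2

/-- the symmetric array of a cubic polynomial -/
def toCub (F : MvPolynomial (Fin 5) ℂ) : Cub ℂ where
  τ i j l := (1/6) * eval 0 (pderiv l (pderiv j (pderiv i F)))
  s12 i j l := by rw [pderiv_pderiv_comm j i]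
  s23 i j l := by rw [pderiv_pderiv_comm l j]

theorem eval_const (F : MvPolynomial (Fin 5) ℂ) (hF : F.IsHomogeneous 0) (p q : Fin 5 → ℂ) :
    eval p F = eval q F := by
  have := (totalDegree_eq_zero_iff_eq_C (p := F)).1 (Nat.le_zero.1 hF.totalDegree_le)
  rw [this]; simp

theorem euler_eval (F : MvPolynomial (Fin 5) ℂ) {n : ℕ} (hF : F.IsHomogeneous n)
    (p : Fin 5 → ℂ) : ∑ i, p i * eval p (pderiv i F) = n * eval p F := by
  have := congrArg (eval p) hF.sum_X_mul_pderiv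
  simpa [map_sum] using this

theorem toCub_pderiv (F : MvPolynomial (Fin 5) ℂ) (hF : F.IsHomogeneous 3) (p w : Fin 5 → ℂ) :
    (toCub F).T p p w = (1/3) * ∑ i, w i * eval p (pderiv i F) := by
  rw [Cub.T_swap23, Cub.T_swap12]
  unfold Cub.T
  rw [Finset.mul_sum]
  refine Finset.sum_congr rfl fun i _ => ?_
  have h1 := euler_eval _ (hF.pderiv (i := i)) p
  have h2 : ∀ j, ∑ l, p l * eval 0 (pderiv l (pderiv j (pderiv i F)))
      = eval p (pderiv j (pderiv i F)) := by
    intro j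
    have := euler_eval _ ((hF.pderiv (i := i)).pderiv (i := j)) p
    have h3 : ((3 - 1 - 1 : ℕ) : ℂ) = 1 := by norm_num
    rw [h3, one_mul] at this
    rw [← this]
    refine Finset.sum_congr rfl fun l _ => ?_
    rw [eval_const _ (((hF.pderiv (i := i)).pderiv (i := j)).pderiv (i := l)) p 0]
  have h3 : ((3 - 1 : ℕ) : ℂ) = 2 := by norm_num
  rw [h3] at h1
  have h4 : eval p (pderiv i F) = (1/2) * ∑ j, p j * eval p (pderiv j (pderiv i F)) := by
    rw [h1]; ring
  rw [h4]
  simp only [← h2, Finset.mul_sum]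
  refine Finset.sum_congr rfl fun j _ => Finset.sum_congr rfl fun l _ => ?_
  simp [toCub]; ring

theorem toCub_eval (F : MvPolynomial (Fin 5) ℂ) (hF : F.IsHomogeneous 3) (p : Fin 5 → ℂ) :
    (toCub F).T p p p = eval p F := by
  rw [toCub_pderiv F hF, euler_eval F hF]
  push_cast; ring

theorem toCub_SM (F : MvPolynomial (Fin 5) ℂ) (hF : F.IsHomogeneous 3) (h : IsSmoothCubic F) :
    (toCub F).SM := by
  intro p hp
  apply h
  intro i
  have := hp (Pi.single i 1)
  rw [toCub_pderiv F hF] at this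
  simpa [Pi.single_apply] using this

theorem finrank_inf_ker (Pl : Submodule ℂ (Fin 5 → ℂ)) (R : (Fin 5 → ℂ) →ₗ[ℂ] ℂ)
    (h : ∃ p ∈ Pl, R p ≠ 0) (h3 : Module.finrank ℂ Pl = 3) :
    Module.finrank ℂ (Pl ⊓ LinearMap.ker R : Submodule ℂ (Fin 5 → ℂ)) = 2 := by
  have h1 := LinearMap.finrank_range_add_finrank_ker (R.domRestrict Pl)
  have h2 : LinearMap.range (R.domRestrict Pl) = ⊤ := by
    rw [LinearMap.range_eq_top]
    apply LinearMap.surjective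
    obtain ⟨p, hp, hR⟩ := h
    intro h0
    exact hR (by simpa using congrArg (fun f => f ⟨p, hp⟩) h0)
  rw [h2, finrank_top, Module.finrank_self, h3] at h1
  have h4 : (Pl ⊓ LinearMap.ker R : Submodule ℂ (Fin 5 → ℂ)) =
      (LinearMap.ker (R.domRestrict Pl)).map Pl.subtype := by
    ext x
    simp only [Submodule.mem_inf, LinearMap.mem_ker, Submodule.mem_map, Submodule.subtype_apply,
      LinearMap.domRestrict_apply]
    constructor
    · rintro ⟨a, b⟩; exact ⟨⟨x, a⟩, b, rfl⟩
    · rintro ⟨y, hy, rfl⟩; exact ⟨y.2, hy⟩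
  rw [h4, (Submodule.equivMapOfInjective Pl.subtype Pl.injective_subtype _).symm.finrank_eq]
  omega

theorem config_cycle (F : MvPolynomial (Fin 5) ℂ) (hF : F.IsHomogeneous 3)
    (p q e : Fin 5 → ℂ) (g0 g1 g2 : (Fin 5 → ℂ) →ₗ[ℂ] ℂ)
    (h00 : g0 p = 1) (h01 : g0 q = 0) (h02 : g0 e = 0)
    (h10 : g1 p = 0) (h11 : g1 q = 1) (h12 : g1 e = 0)
    (h20 : g2 p = 0) (h21 : g2 q = 0) (h22 : g2 e = 1)
    (t1 : (toCub F).T p p p = 0) (t2 : (toCub F).T p p q = 0) (t3 : (toCub F).T p q q = 0)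
    (t4 : (toCub F).T q q q = 0) (hD : (toCub F).Dbl p q e) :
    ∃ r, LiesOn F r ∧ CycleLplus2R F (Submodule.span ℂ {p, q}) r (Submodule.span ℂ {p, q, e}) := by
  obtain ⟨α, β, γ, hab, a1, a2, a3, a4, a5, a6⟩ := hD
  set C := toCub F with hC
  set R : (Fin 5 → ℂ) →ₗ[ℂ] ℂ := α • g0 + β • g1 + γ • g2 with hR
  set Pl := Submodule.span ℂ {p, q, e} with hPl
  set l := Submodule.span ℂ {p, q} with hl
  have mem : ∀ v, v ∈ Pl ↔ ∃ x y z : ℂ, x • p + y • q + z • e = v := by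
    intro v; rw [hPl, Submodule.mem_span_triple]
  have meml : ∀ v, v ∈ l ↔ ∃ x y : ℂ, x • p + y • q = v := by
    intro v; rw [hl, Submodule.mem_span_pair]
  have hlPl : l ≤ Pl := Submodule.span_mono (by intro x; simp; tauto)
  have hev : ∀ v ∈ Pl, eval v F = 1 * g2 v * (R v) ^ 2 := by
    intro v hv
    obtain ⟨x, y, z, rfl⟩ := (mem v).1 hv
    rw [← toCub_eval F hF]
    simp only [← hC, hR, LinearMap.add_apply, LinearMap.smul_apply, map_add, map_smul, h00, h01, h02,
      h10, h11, h12, h20, h21, h22, smul_eq_mul, Cub.T_add1, Cub.T_add2, Cub.T_add3,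
      Cub.T_smul1, Cub.T_smul2, Cub.T_smul3]
    simp only [C.T_swap12, C.T_swap23] at t1 t2 t3 t4 a1 a2 a3 a4 a5 a6 ⊢
    rw [t1, t2, t3, t4]
    linear_combination x^2*z*a1 + 2*x*y*z*a2+y^2*z*a3+x*z^2*a4+y*z^2*a5+z^3*a6
  have hker : Pl ⊓ LinearMap.ker g2 = l := by
    ext v
    simp only [Submodule.mem_inf, LinearMap.mem_ker, meml]
    constructor
    · rintro ⟨hv, h0⟩
      obtain ⟨x, y, z, rfl⟩ := (mem v).1 hv
      simp [h20, h21, h22] at h0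
      exact ⟨x, y, by simp [h0]⟩
    · rintro ⟨x, y, rfl⟩
      exact ⟨(mem _).2 ⟨x, y, 0, by simp⟩, by simp [h20, h21]⟩
  have hp : p ∈ l := (meml _).2 ⟨1, 0, by simp⟩
  have hq : q ∈ l := (meml _).2 ⟨0, 1, by simp⟩
  have he : e ∈ Pl := (mem _).2 ⟨0, 0, 1, by simp⟩
  have hRp : R p = α := by simp [hR, h00, h10, h20]
  have hRq : R q = β := by simp [hR, h01, h11, h21]
  have hRne : ∃ v ∈ l, R v ≠ 0 := by
    rcases hab with h | h
    · exact ⟨p, hp, by rw [hRp]; exact h⟩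
    · exact ⟨q, hq, by rw [hRq]; exact h⟩
  have hRne' : ∃ v ∈ Pl, R v ≠ 0 := by obtain ⟨v, hv, h⟩ := hRne; exact ⟨v, hlPl hv, h⟩
  have hgne : ∃ v ∈ Pl, g2 v ≠ 0 := ⟨e, he, by simp [h22]⟩
  have hP3 : Module.finrank ℂ Pl = 3 := by
    have hli : LinearIndependent ℂ ![p, q, e] := by
      rw [Fintype.linearIndependent_iff]
      intro c hc
      simp only [Fin.sum_univ_three, Matrix.cons_val_zero, Matrix.cons_val_one,
        Matrix.cons_val_two, Matrix.head_cons, Matrix.tail_cons] at hc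
      have e0 := congrArg g0 hc
      have e1 := congrArg g1 hc
      have e2 := congrArg g2 hc
      simp [h00, h01, h02] at e0
      simp [h10, h11, h12] at e1
      simp [h20, h21, h22] at e2
      intro i; fin_cases i <;> simp [e0, e1, e2]
    have := finrank_span_eq_card hli
    have hr : Set.range ![p, q, e] = {p, q, e} := by
      simp only [Matrix.range_cons, Matrix.range_empty, Set.union_empty]; rfl
    rw [hr] at this
    simpa using this
  refine ⟨Pl ⊓ LinearMap.ker R, ?_, ?_, finrank_inf_ker Pl R hRne' hP3, hP3, hlPl,
    inf_le_left, ?_, 1, g2, R, one_ne_zero, hgne, hRne', hker, rfl, hev⟩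
  · intro v hv
    rw [hev v hv.1, LinearMap.mem_ker.1 hv.2]; simp
  · rw [← hker]; exact finrank_inf_ker Pl g2 hgne hP3
  · intro h
    obtain ⟨v, hv, h0⟩ := hRne
    rw [← h] at hv
    exact h0 (LinearMap.mem_ker.1 hv.2)

theorem config_to_statement (F : MvPolynomial (Fin 5) ℂ) (hF : F.IsHomogeneous 3)
    (hc : (toCub F).Config) :
    ∃ l r₁ r₂ Pl₁ Pl₂ : Submodule ℂ (Fin 5 → ℂ),
      LiesOn F l ∧ LiesOn F r₁ ∧ LiesOn F r₂ ∧
      Pl₁ ≠ Pl₂ ∧ r₁ ≠ r₂ ∧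
      CycleLplus2R F l r₁ Pl₁ ∧ CycleLplus2R F l r₂ Pl₂ := by
  obtain ⟨p, q, e, f, hli, t1, t2, t3, t4, hD1, hD2⟩ := hc
  obtain ⟨G, hG⟩ := Cub.li_dual _ hli
  let g : Fin 4 → ((Fin 5 → ℂ) →ₗ[ℂ] ℂ) := fun i =>
    { toFun := fun v => ∑ l, G i l * v l
      map_add' := fun x y => by simp [mul_add, Finset.sum_add_distrib]
      map_smul' := fun c x => by
        simp only [Pi.smul_apply, smul_eq_mul, RingHom.id_apply, Finset.mul_sum]
        exact Finset.sum_congr rfl fun l _ => by ring }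
  have hp : ∀ i, g i p = if i = 0 then 1 else 0 := fun i => hG i 0
  have hq : ∀ i, g i q = if i = 1 then 1 else 0 := fun i => hG i 1
  have he : ∀ i, g i e = if i = 2 then 1 else 0 := fun i => hG i 2
  have hf : ∀ i, g i f = if i = 3 then 1 else 0 := fun i => hG i 3
  obtain ⟨r1, hr1, hc1⟩ := config_cycle F hF p q e (g 0) (g 1) (g 2) (by simp [hp]) (by simp [hq])
    (by simp [he]) (by simp [hp]) (by simp [hq])
    (by simp [he]) (by simp [hp]) (by simp [hq])
    (by simp [he]) t1 t2 t3 t4 hD1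
  obtain ⟨r2, hr2, hc2⟩ := config_cycle F hF p q f (g 0) (g 1) (g 3) (by simp [hp]) (by simp [hq])
    (by simp [hf]) (by simp [hp]) (by simp [hq])
    (by simp [hf]) (by simp [hp]) (by simp [hq])
    (by simp [hf]) t1 t2 t3 t4 hD2
  have key : Submodule.span ℂ {p, q, e} ⊓ Submodule.span ℂ {p, q, f} ≤ Submodule.span ℂ {p, q} := by
    rintro v ⟨hv1, hv2⟩
    obtain ⟨x, y, z, rfl⟩ := Submodule.mem_span_triple.1 hv1
    obtain ⟨x', y', z', h⟩ := Submodule.mem_span_triple.1 hv2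
    have := congrArg (g 2) h
    simp [hp, hq, he, hf] at this
    exact Submodule.mem_span_pair.2 ⟨x, y, by simp [← this]⟩
  refine ⟨Submodule.span ℂ {p, q}, r1, r2, Submodule.span ℂ {p, q, e}, Submodule.span ℂ {p, q, f},
    ?_, hr1, hr2, ?_, ?_, hc1, hc2⟩
  · intro v hv
    obtain ⟨x, y, rfl⟩ := Submodule.mem_span_pair.1 hv
    rw [← toCub_eval F hF]
    set C := toCub F
    simp only [Cub.T_add1, Cub.T_add2, Cub.T_add3,
      Cub.T_smul1, Cub.T_smul2, Cub.T_smul3]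
    rw [C.T_swap12 q p p, C.T_swap23 p q p, C.T_swap12 q p q, C.T_swap23 q q p,
      C.T_swap12 q p q, t1, t2, t3, t4]
    ring
  · intro h
    have : e ∈ Submodule.span ℂ {p, q, f} := by rw [← h]; exact Submodule.subset_span (by simp)
    obtain ⟨x', y', z', h⟩ := Submodule.mem_span_triple.1 this
    have := congrArg (g 2) h
    simp [hp, hq, he, hf] at this
  · intro h
    have h1 : r1 ≤ Submodule.span ℂ {p, q} :=
      (le_inf hc1.2.2.2.2.1 (h ▸ hc2.2.2.2.2.1)).trans key
    exact hc1.2.2.2.2.2.1 (Submodule.eq_of_le_of_finrank_eq h1 (hc1.2.1.trans hc1.1.symm))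
end

/-- Every smooth cubic threefold `V = V(F) ⊂ ℙ⁴` contains a line `l`, two distinct
2-planes `π₁ ≠ π₂` containing `l`, and two distinct lines `r₁ ≠ r₂` on `V` with
`rᵢ ⊆ πᵢ`, such that `V·π₁ = l + 2r₁` and `V·π₂ = l + 2r₂`. -/
theorem exists_line_with_two_residual_double_lines
    (F : MvPolynomial (Fin 5) ℂ) (hF : F.IsHomogeneous 3) (hsm : IsSmoothCubic F) :
    ∃ l r₁ r₂ Pl₁ Pl₂ : Submodule ℂ (Fin 5 → ℂ),
      LiesOn F l ∧ LiesOn F r₁ ∧ LiesOn F r₂ ∧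
      Pl₁ ≠ Pl₂ ∧ r₁ ≠ r₂ ∧
      CycleLplus2R F l r₁ Pl₁ ∧ CycleLplus2R F l r₂ Pl₂ :=
  config_to_statement F hF (Cub.main _ (toCub_SM F hF hsm))
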